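/- (Hölder stability for the inverse source problem.) Assume Assumptions A.1, A.2, A.3, let T > T₀ = D₀/√β, and let u = (u^s,u^f) solve Biot's system with source F_ℓ(x,t) = p_ℓ(x)R_ℓ(x,t) (ℓ = 1,2), zero initial conditions at t = 0, and boundary conditions u^s = 0, u^f·ν = 0 on ∂Ω×(−T,T). Suppose Φ_j(x) := R_j(x,0) satisfies Φ_j(x)·(x−x₀) ≠ 0 for all x ∈ Ω̄ (j = 1,2). Let M > 0. Then there exist constants C > 0 and κ ∈ (0,1) such that ‖p₁‖²_{H₀¹(Ω)} + ‖p₂‖²_{H₀¹(Ω)} ≤ C·(Σ_{j=2}^{3} ‖∂ₜʲu‖²_{H²(ω×(−T,T))})^κ for all p₁, p₂ ∈ H²(Ω) with ‖p_ℓ‖_{H²(Ω)} ≤ M and p_ℓ = 0, ∇p_ℓ = 0 on ∂Ω. -/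

import Mathlib

noncomputable section

open MeasureTheory Real Set

/-- Spatial points of `ℝ³`. -/
abbrev V3 := Fin 3 → ℝ

/-- Space-time points `z = (t, x)` with `z.1` the time and `z.2` the space variable. -/
abbrev P4 := ℝ × V3

/-- The unit time direction in space-time. -/
def et : P4 := (1, 0)

/-- The `i`-th unit spatial direction in space-time. -/
def ex (i : Fin 3) : P4 := (0, Pi.single i 1)

/-- Directional derivative of a scalar function on space-time. -/
def pd (f : P4 → ℝ) (d : P4) : P4 → ℝ := fun z => fderiv ℝ f z d

/-- Spatial partial derivative of a scalar function on `ℝ³`. -/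
def pdx (c : V3 → ℝ) (i : Fin 3) : V3 → ℝ := fun x => fderiv ℝ c x (Pi.single i 1)

/-- Time derivative `∂ₜ` of a space-time vector field (componentwise). -/
def Dt (u : P4 → V3) : P4 → V3 := fun z i => pd (fun y => u y i) et z

/-- Second time derivative `∂ₜ²` of a scalar function on space-time. -/
def dtt (f : P4 → ℝ) : P4 → ℝ := pd (pd f et) et

/-- Spatial divergence of a space-time vector field. -/
def sdiv (u : P4 → V3) : P4 → ℝ := fun z => ∑ i, pd (fun y => u y i) (ex i) z

/-- Spatial divergence of a vector field on `ℝ³`. -/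
def sdivX (u : V3 → V3) : V3 → ℝ := fun x => ∑ i, pdx (fun y => u y i) i x

/-- Spatial Laplacian of a scalar function on space-time. -/
def slap (f : P4 → ℝ) : P4 → ℝ := fun z => ∑ i, pd (pd f (ex i)) (ex i) z

/-- The elasticity operator `Δ_{μ,λ}v = μΔv + (μ+λ)∇(div v) + (div v)∇λ + (∇v + (∇v)ᵀ)∇μ`. -/
def lameOp (μ lam : V3 → ℝ) (u : P4 → V3) : P4 → V3 := fun z i =>
  μ z.2 * slap (fun y => u y i) z
    + (μ z.2 + lam z.2) * pd (sdiv u) (ex i) z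
    + sdiv u z * pdx lam i z.2
    + ∑ j, (pd (fun y => u y i) (ex j) z + pd (fun y => u y j) (ex i) z) * pdx μ j z.2

/-- Biot's system of poro-elasticity on the space-time set `Q`, with solid displacement `us`,
fluid displacement `uf` and sources `F1, F2`. -/
def BiotSystem (ρ11 ρ12 ρ22 μ lam q r : V3 → ℝ)
    (us uf F1 F2 : P4 → V3) (Q : Set P4) : Prop :=
  ∀ z ∈ Q, ∀ i : Fin 3,
    (ρ11 z.2 * dtt (fun y => us y i) z + ρ12 z.2 * dtt (fun y => uf y i) z
        - lameOp μ lam us z i - pd (fun y => q y.2 * sdiv uf y) (ex i) z = F1 z i)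
    ∧ (ρ12 z.2 * dtt (fun y => us y i) z + ρ22 z.2 * dtt (fun y => uf y i) z
        - pd (fun y => q y.2 * sdiv us y) (ex i) z
        - pd (fun y => r y.2 * sdiv uf y) (ex i) z = F2 z i)

/-- The squared Euclidean distance `|x - x₀|²`. -/
def sqd (x0 x : V3) : ℝ := ∑ i, (x i - x0 i) ^ 2

/-- The Carleman weight `φ(x,t) = exp(γ(|x-x₀|² - βt²))`. -/
def wphi (x0 : V3) (β γ : ℝ) (z : P4) : ℝ := Real.exp (γ * (sqd x0 z.2 - β * z.1 ^ 2))

/-- The spatial weight `ρ(x) = exp(γ|x-x₀|²)`. -/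
def wrho (x0 : V3) (γ : ℝ) (x : V3) : ℝ := Real.exp (γ * sqd x0 x)

/-- The admissible class `𝒞(m,θ)` of coefficients (with lower bound `cstar`). -/
def CClass (Ω : Set V3) (x0 : V3) (m θ cstar : ℝ) (c : V3 → ℝ) : Prop :=
  ContDiff ℝ 2 c ∧ (0 < cstar) ∧ (∀ x ∈ closure Ω, cstar < c x) ∧
    (∀ x ∈ closure Ω,
      |c x| ≤ m ∧ ‖fderiv ℝ c x‖ ≤ m ∧ ‖iteratedFDeriv ℝ 2 c x‖ ≤ m) ∧
    (∀ x ∈ closure Ω, (∑ i, pdx c i x * (x i - x0 i)) / (2 * c x) ≤ 1 - θ)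

/-- Assumption A.1 on the coefficients of Biot's system. -/
def AssumpA1 (Ω : Set V3) (ρ11 ρ12 ρ22 μ lam q r : V3 → ℝ) : Prop :=
  ContDiff ℝ 2 ρ11 ∧ ContDiff ℝ 2 ρ12 ∧ ContDiff ℝ 2 ρ22 ∧ ContDiff ℝ 2 μ ∧
    ContDiff ℝ 2 lam ∧ ContDiff ℝ 2 q ∧ ContDiff ℝ 2 r ∧
    (∀ x ∈ closure Ω, 0 < ρ11 x ∧ 0 < ρ22 x ∧ 0 < q x ∧ 0 < r x ∧
      0 < μ x ∧ 0 < lam x + μ x) ∧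
    (∀ x ∈ closure Ω, 0 < ρ11 x * ρ22 x - ρ12 x ^ 2) ∧
    (∀ x ∈ closure Ω, 0 < lam x * r x - q x ^ 2)

/-- The matrix `A(x)` of (1.9). -/
def Amat (ρ11 ρ12 ρ22 μ lam q r : V3 → ℝ) (x : V3) : Matrix (Fin 2) (Fin 2) ℝ :=
  (ρ11 x * ρ22 x - ρ12 x ^ 2)⁻¹ •
    (Matrix.of ![![ρ22 x, -ρ12 x], ![-ρ12 x, ρ11 x]] *
      Matrix.of ![![2 * μ x + lam x, q x], ![q x, r x]])

/-- Assumption A.2: `A(x)` has two distinct positive eigenvalues `μ₂(x) ≠ μ₃(x)`, and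
`μ₁ = ϱ⁻¹ϱ₂₂μ`, `μ₂`, `μ₃` all belong to the class `𝒞(m,θ)`. -/
def AssumpA2 (Ω : Set V3) (x0 : V3) (ρ11 ρ12 ρ22 μ lam q r μ2 μ3 : V3 → ℝ)
    (m θ c1 c2 c3 : ℝ) : Prop :=
  (∀ x ∈ closure Ω,
      (Amat ρ11 ρ12 ρ22 μ lam q r x - μ2 x • (1 : Matrix (Fin 2) (Fin 2) ℝ)).det = 0 ∧
      (Amat ρ11 ρ12 ρ22 μ lam q r x - μ3 x • (1 : Matrix (Fin 2) (Fin 2) ℝ)).det = 0 ∧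
      0 < μ2 x ∧ 0 < μ3 x ∧ μ2 x ≠ μ3 x) ∧
    CClass Ω x0 m θ c1 (fun x => (ρ11 x * ρ22 x - ρ12 x ^ 2)⁻¹ * ρ22 x * μ x) ∧
    CClass Ω x0 m θ c2 μ2 ∧ CClass Ω x0 m θ c3 μ3

/-- `d² = min_{Ω̄} |x-x₀|²` and `D² = max_{Ω̄} |x-x₀|²`. -/
def dGeom (Ω : Set V3) (x0 : V3) (d D : ℝ) : Prop :=
  0 ≤ d ∧ 0 ≤ D ∧ IsLeast ((fun x => sqd x0 x) '' closure Ω) (d ^ 2) ∧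
    IsGreatest ((fun x => sqd x0 x) '' closure Ω) (D ^ 2)

/-- Condition (1.16) on the parameter `β` (with `D₀ = √(D² - d²)`). -/
def BetaCond (m θ c0 d D β : ℝ) : Prop :=
  0 < β ∧ β + (m * Real.sqrt (D ^ 2 - d ^ 2) / Real.sqrt c0) * Real.sqrt β < θ * c0 ∧
    0 < c0 * d ^ 2 - β * D ^ 2

/-- Squared Euclidean norm of a vector of `ℝ³`. -/
def n2 (v : V3) : ℝ := ∑ i, (v i) ^ 2

/-- Squared space-time gradient `|∇_{x,t} f|²` of a scalar function. -/
def gradT2 (f : P4 → ℝ) (z : P4) : ℝ := (pd f et z) ^ 2 + ∑ j, (pd f (ex j) z) ^ 2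

/-- Squared spatial gradient `|∇f|²` of a scalar function on space-time. -/
def gradX2 (f : P4 → ℝ) (z : P4) : ℝ := ∑ j, (pd f (ex j) z) ^ 2

/-- Squared space-time gradient of a vector field. -/
def vGradT2 (u : P4 → V3) (z : P4) : ℝ := ∑ i, gradT2 (fun y => u y i) z

/-- Squared spatial gradient of a vector field. -/
def vGradX2 (u : P4 → V3) (z : P4) : ℝ := ∑ i, gradX2 (fun y => u y i) z

/-- The weighted Carleman functional appearing on the left-hand side of the Carleman
estimate for Biot's system (also denoted `N_{τ,φ}(v)`). -/
def CarlemanN (x0 : V3) (β γ τ : ℝ) (us uf : P4 → V3) (Q : Set P4) : ℝ :=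
  ∫ z in Q,
    (τ * (vGradT2 us z + gradT2 (sdiv us) z + gradT2 (sdiv uf) z)
      + τ ^ 3 * (n2 (us z) + (sdiv us z) ^ 2 + (sdiv uf z) ^ 2))
      * Real.exp (2 * τ * wphi x0 β γ z)

/-- The weighted source term `∫_Q (|F|² + |∇F|²) e^{2τφ}`. -/
def srcN (x0 : V3) (β γ τ : ℝ) (F1 F2 : P4 → V3) (Q : Set P4) : ℝ :=
  ∫ z in Q,
    (n2 (F1 z) + n2 (F2 z) + vGradX2 F1 z + vGradX2 F2 z)
      * Real.exp (2 * τ * wphi x0 β γ z)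

/-- Squared `H²`-norm of a space-time vector field over a set. -/
def H2sq (w : P4 → V3) (S : Set P4) : ℝ :=
  ∫ z in S, (‖w z‖ ^ 2 + ‖fderiv ℝ w z‖ ^ 2 + ‖iteratedFDeriv ℝ 2 w z‖ ^ 2)

/-- The observation quantity `E_ω(u) = Σ_{j=2}^3 ‖∂ₜʲu‖²_{H²(ω×(-T,T))}`. -/
def Eobs (us uf : P4 → V3) (S : Set P4) : ℝ :=
  H2sq (Dt (Dt us)) S + H2sq (Dt (Dt uf)) S
    + H2sq (Dt (Dt (Dt us))) S + H2sq (Dt (Dt (Dt uf))) S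

/-- Squared `H₀¹(Ω)`-norm of a scalar function. -/
def H01sq (Ω : Set V3) (p : V3 → ℝ) : ℝ :=
  ∫ x in Ω, ((p x) ^ 2 + ∑ i, (pdx p i x) ^ 2)

theorem pd_add {f g : P4 → ℝ} {z : P4} (d : P4) (hf : DifferentiableAt ℝ f z)
    (hg : DifferentiableAt ℝ g z) :
    pd (fun y => f y + g y) d z = pd f d z + pd g d z := by
  simp only [pd]; rw [fderiv_fun_add hf hg]; rfl

theorem pd_sub {f g : P4 → ℝ} {z : P4} (d : P4) (hf : DifferentiableAt ℝ f z)
    (hg : DifferentiableAt ℝ g z) :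
    pd (fun y => f y - g y) d z = pd f d z - pd g d z := by
  simp only [pd]; rw [fderiv_fun_sub hf hg]; rfl

theorem pd_neg {f : P4 → ℝ} {z : P4} (d : P4) :
    pd (fun y => -f y) d z = -pd f d z := by
  simp only [pd]; rw [fderiv_fun_neg]; rfl

theorem pd_mul {f g : P4 → ℝ} {z : P4} (d : P4) (hf : DifferentiableAt ℝ f z)
    (hg : DifferentiableAt ℝ g z) :
    pd (fun y => f y * g y) d z = pd f d z * g z + f z * pd g d z := by
  simp only [pd]; rw [fderiv_fun_mul hf hg]; simp; ring

theorem pd_const (c : ℝ) (d z : P4) : pd (fun _ => c) d z = 0 := by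
  simp [pd]

theorem pd_sum {ι : Type*} {s : Finset ι} {f : ι → P4 → ℝ} {z : P4} (d : P4)
    (hf : ∀ i ∈ s, DifferentiableAt ℝ (f i) z) :
    pd (fun y => ∑ i ∈ s, f i y) d z = ∑ i ∈ s, pd (f i) d z := by
  simp only [pd]; rw [fderiv_fun_sum hf]; simp

theorem pd_fst (d z : P4) : pd (fun y : P4 => y.1) d z = d.1 := by
  simp only [pd]; rw [fderiv_fst]; rfl

theorem pd_snd_apply (i : Fin 3) (d z : P4) : pd (fun y : P4 => y.2 i) d z = d.2 i := by
  have h : (fun y : P4 => y.2 i) =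
      ((ContinuousLinearMap.proj (R := ℝ) (φ := fun _ : Fin 3 => ℝ) i).comp
        (ContinuousLinearMap.snd ℝ ℝ V3)) := rfl
  simp only [pd]; rw [h, ContinuousLinearMap.fderiv]; rfl

theorem pd_comp_snd {a : V3 → ℝ} {z : P4} (d : P4) (ha : DifferentiableAt ℝ a z.2) :
    pd (fun y : P4 => a y.2) d z = fderiv ℝ a z.2 d.2 := by
  have h : HasFDerivAt (fun y : P4 => a y.2)
      ((fderiv ℝ a z.2).comp (ContinuousLinearMap.snd ℝ ℝ V3)) z :=
    ha.hasFDerivAt.comp z hasFDerivAt_snd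
  simp only [pd]; rw [h.fderiv]; rfl

theorem pd_comp_snd_et {a : V3 → ℝ} {z : P4} (ha : DifferentiableAt ℝ a z.2) :
    pd (fun y : P4 => a y.2) et z = 0 := by
  rw [pd_comp_snd _ ha]; simp [et]

theorem pd_comp_snd_ex {a : V3 → ℝ} {z : P4} (i : Fin 3) (ha : DifferentiableAt ℝ a z.2) :
    pd (fun y : P4 => a y.2) (ex i) z = pdx a i z.2 := by
  rw [pd_comp_snd _ ha]; rfl

theorem pd_comp_fst {a : ℝ → ℝ} {z : P4} (d : P4) (ha : DifferentiableAt ℝ a z.1) :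
    pd (fun y : P4 => a y.1) d z = deriv a z.1 * d.1 := by
  have h : HasFDerivAt (fun y : P4 => a y.1)
      ((fderiv ℝ a z.1).comp (ContinuousLinearMap.fst ℝ ℝ V3)) z :=
    ha.hasFDerivAt.comp z hasFDerivAt_fst
  simp only [pd]; rw [h.fderiv]
  have : fderiv ℝ a z.1 d.1 = fderiv ℝ a z.1 (d.1 • 1) := by simp
  simp only [ContinuousLinearMap.comp_apply, ContinuousLinearMap.coe_fst']
  rw [this, map_smul, fderiv_apply_one_eq_deriv, smul_eq_mul, mul_comm]

theorem pd_exp {f : P4 → ℝ} {z : P4} (d : P4) (hf : DifferentiableAt ℝ f z) :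
    pd (fun y => Real.exp (f y)) d z = Real.exp (f z) * pd f d z := by
  simp only [pd]; rw [fderiv_exp hf]; rfl

theorem pd_congr {f g : P4 → ℝ} {z : P4} (d : P4) (h : f =ᶠ[nhds z] g) :
    pd f d z = pd g d z := by
  simp only [pd]; rw [h.fderiv_eq]

theorem ContDiff.pd {n m : WithTop ℕ∞} {f : P4 → ℝ} (hf : ContDiff ℝ n f) (d : P4)
    (h : m + 1 ≤ n) : ContDiff ℝ m (pd f d) :=
  (hf.fderiv_right h).clm_apply contDiff_const

theorem ContDiff.pdx {n m : WithTop ℕ∞} {f : V3 → ℝ} (hf : ContDiff ℝ n f) (i : Fin 3)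
    (h : m + 1 ≤ n) : ContDiff ℝ m (pdx f i) :=
  (hf.fderiv_right h).clm_apply contDiff_const

theorem pd_pd_eq {f : P4 → ℝ} (hf : ContDiff ℝ 2 f) (d e z : P4) :
    pd (pd f d) e z = fderiv ℝ (fderiv ℝ f) z e d := by
  have h1 : ContDiff ℝ 1 (fderiv ℝ f) := hf.fderiv_right (by norm_num)
  have h : HasFDerivAt (fun y => fderiv ℝ f y d) ((fderiv ℝ (fderiv ℝ f) z).flip d) z := by
    have := ((h1.differentiable (by norm_num)) z).hasFDerivAt.clm_apply (hasFDerivAt_const d z)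
    simpa using this
  show fderiv ℝ (fun y => fderiv ℝ f y d) z e = _
  rw [h.fderiv]; rfl

theorem pd_comm {f : P4 → ℝ} (hf : ContDiff ℝ 2 f) (d e : P4) :
    pd (pd f d) e = pd (pd f e) d := by
  funext z
  rw [pd_pd_eq hf, pd_pd_eq hf]
  exact (hf.contDiffAt.isSymmSndFDerivAt (by simp)) e d

theorem pdx_comm {f : V3 → ℝ} (hf : ContDiff ℝ 2 f) (i j : Fin 3) :
    pdx (pdx f i) j = pdx (pdx f j) i := by
  have key : ∀ (k l : Fin 3) (x : V3), pdx (pdx f k) l x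
      = fderiv ℝ (fderiv ℝ f) x (Pi.single l 1) (Pi.single k 1) := by
    intro k l x
    have h1 : ContDiff ℝ 1 (fderiv ℝ f) := hf.fderiv_right (by norm_num)
    have h : HasFDerivAt (fun y => fderiv ℝ f y (Pi.single k 1))
        ((fderiv ℝ (fderiv ℝ f) x).flip (Pi.single k 1)) x := by
      have := ((h1.differentiable (by norm_num)) x).hasFDerivAt.clm_apply
        (hasFDerivAt_const (Pi.single k 1 : V3) x)
      simpa using this
    show fderiv ℝ (fun y => fderiv ℝ f y (Pi.single k 1)) x (Pi.single l 1) = _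
    rw [h.fderiv]; rfl
  funext x
  rw [key, key]
  exact (hf.contDiffAt.isSymmSndFDerivAt (by simp)) _ _

theorem pdx_add {f g : V3 → ℝ} {x : V3} (i : Fin 3) (hf : DifferentiableAt ℝ f x)
    (hg : DifferentiableAt ℝ g x) :
    pdx (fun y => f y + g y) i x = pdx f i x + pdx g i x := by
  simp only [pdx]; rw [fderiv_fun_add hf hg]; rfl

theorem pdx_sub {f g : V3 → ℝ} {x : V3} (i : Fin 3) (hf : DifferentiableAt ℝ f x)
    (hg : DifferentiableAt ℝ g x) :
    pdx (fun y => f y - g y) i x = pdx f i x - pdx g i x := by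
  simp only [pdx]; rw [fderiv_fun_sub hf hg]; rfl

theorem pdx_mul {f g : V3 → ℝ} {x : V3} (i : Fin 3) (hf : DifferentiableAt ℝ f x)
    (hg : DifferentiableAt ℝ g x) :
    pdx (fun y => f y * g y) i x = pdx f i x * g x + f x * pdx g i x := by
  simp only [pdx]; rw [fderiv_fun_mul hf hg]; simp; ring

theorem pdx_const (c : ℝ) (i : Fin 3) (x : V3) : pdx (fun _ => c) i x = 0 := by
  simp [pdx]

theorem pdx_sum {ι : Type*} {s : Finset ι} {f : ι → V3 → ℝ} {x : V3} (i : Fin 3)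
    (hf : ∀ j ∈ s, DifferentiableAt ℝ (f j) x) :
    pdx (fun y => ∑ j ∈ s, f j y) i x = ∑ j ∈ s, pdx (f j) i x := by
  simp only [pdx]; rw [fderiv_fun_sum hf]; simp

theorem pdx_apply (j i : Fin 3) (x : V3) :
    pdx (fun y : V3 => y j) i x = (Pi.single i 1 : V3) j := by
  have h : (fun y : V3 => y j) =
      (ContinuousLinearMap.proj (R := ℝ) (φ := fun _ : Fin 3 => ℝ) j) := rfl
  simp only [pdx]; rw [h, ContinuousLinearMap.fderiv]; rfl

theorem pdx_exp {f : V3 → ℝ} {x : V3} (i : Fin 3) (hf : DifferentiableAt ℝ f x) :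
    pdx (fun y => Real.exp (f y)) i x = Real.exp (f x) * pdx f i x := by
  simp only [pdx]; rw [fderiv_exp hf]; rfl

theorem pdx_congr {f g : V3 → ℝ} {x : V3} (i : Fin 3) (h : f =ᶠ[nhds x] g) :
    pdx f i x = pdx g i x := by
  simp only [pdx]; rw [h.fderiv_eq]

theorem integral_fderiv_eq_zero {E : Type*} [NormedAddCommGroup E] [NormedSpace ℝ E]
    [FiniteDimensional ℝ E] [MeasurableSpace E] [BorelSpace E] (ν : Measure E)
    [ν.IsAddHaarMeasure] {V : E → ℝ} (hV : ContDiff ℝ 1 V) (hc : HasCompactSupport V) (d : E) :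
    ∫ z, fderiv ℝ V z d ∂ν = 0 := by
  have hcont : Continuous fun z => fderiv ℝ V z d :=
    (hV.continuous_fderiv (by norm_num)).clm_apply continuous_const
  have hi : Integrable (fun z => fderiv ℝ V z d) ν :=
    hcont.integrable_of_hasCompactSupport (hc.fderiv_apply (𝕜 := ℝ) d)
  have := integral_mul_fderiv_eq_neg_fderiv_mul_of_integrable (μ := ν)
    (f := fun _ : E => (1 : ℝ)) (g := V) (v := d) (by simp) (by simpa using hi)
    (by simpa using hV.continuous.integrable_of_hasCompactSupport hc)
    (fun _ _ => by fun_prop) (fun x _ => hV.differentiable (by norm_num) x)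
  simpa using this

theorem integral_pd {V : P4 → ℝ} (hV : ContDiff ℝ 1 V) (hc : HasCompactSupport V) (d : P4) :
    ∫ z, pd V d z = 0 := by
  have : (volume : Measure P4).IsAddHaarMeasure := inferInstanceAs (Measure.prod _ _).IsAddHaarMeasure
  exact integral_fderiv_eq_zero volume hV hc d

theorem integral_pdx {V : V3 → ℝ} (hV : ContDiff ℝ 1 V) (hc : HasCompactSupport V) (i : Fin 3) :
    ∫ z, pdx V i z = 0 :=
  integral_fderiv_eq_zero volume hV hc _

theorem pd_sq {f : P4 → ℝ} {z : P4} (d : P4) (hf : DifferentiableAt ℝ f z) :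
    pd (fun y => f y ^ 2) d z = 2 * f z * pd f d z := by
  simp only [pow_two]; rw [pd_mul d hf hf]; ring

/-- Divergence identity for the product of the principal part of the conjugated wave operator
with the weighted radial field. -/
theorem wave_multiplier_divergence (x0 : V3) (β k τ : ℝ) {a : V3 → ℝ} (ha : ContDiff ℝ 1 a)
    {g : P4 → ℝ} (hg : ContDiff ℝ 2 g) (g0 g1 g2 g3 A p Y κ : P4 → ℝ)
    (h0 : g0 = pd g et) (h1 : g1 = pd g (ex 0)) (h2 : g2 = pd g (ex 1)) (h3 : g3 = pd g (ex 2))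
    (hA : A = fun z => 4 * (a z.2 * β ^ 2 * z.1 ^ 2 -
      ((z.2 0 - x0 0) ^ 2 + (z.2 1 - x0 1) ^ 2 + (z.2 2 - x0 2) ^ 2)))
    (hp : p = fun z => a z.2 * g0 z ^ 2 - (g1 z ^ 2 + g2 z ^ 2 + g3 z ^ 2))
    (hY : Y = fun z => β * z.1 * a z.2 * g0 z + ((z.2 0 - x0 0) * g1 z + (z.2 1 - x0 1) * g2 z
      + (z.2 2 - x0 2) * g3 z))
    (hκ : κ = fun z => 2 + k + 2 * β * a z.2) (z : P4) :
    (a z.2 * pd g0 et z - (pd g1 (ex 0) z + pd g2 (ex 1) z + pd g3 (ex 2) z) + τ ^ 2 * A z * g z)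
        * (4 * Y z + κ z * g z) =
      pd (fun z => 4 * a z.2 * g0 z * Y z - 2 * β * z.1 * a z.2 * p z + κ z * g z * a z.2 * g0 z
          + 2 * τ ^ 2 * β * A z * z.1 * a z.2 * g z ^ 2) et z
      + (pd (fun z => - 4 * g1 z * Y z - 2 * (z.2 0 - x0 0) * p z - κ z * g z * g1 z
          + 2 * τ ^ 2 * A z * (z.2 0 - x0 0) * g z ^ 2) (ex 0) z
      + pd (fun z => - 4 * g2 z * Y z - 2 * (z.2 1 - x0 1) * p z - κ z * g z * g2 z
          + 2 * τ ^ 2 * A z * (z.2 1 - x0 1) * g z ^ 2) (ex 1) z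
      + pd (fun z => - 4 * g3 z * Y z - 2 * (z.2 2 - x0 2) * p z - κ z * g z * g3 z
          + 2 * τ ^ 2 * A z * (z.2 2 - x0 2) * g z ^ 2) (ex 2) z)
      + (k * (g1 z ^ 2 + g2 z ^ 2 + g3 z ^ 2)
          + 4 * β * z.1 * (g1 z * pdx a 0 z.2 + g2 z * pdx a 1 z.2 + g3 z * pdx a 2 z.2) * g0 z
          + ((4 - k) * a z.2 + 2 * ((z.2 0 - x0 0) * pdx a 0 z.2 + (z.2 1 - x0 1) * pdx a 1 z.2
            + (z.2 2 - x0 2) * pdx a 2 z.2) - 4 * β * a z.2 ^ 2) * g0 z ^ 2)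
      + τ ^ 2 * (16 * ((z.2 0 - x0 0) ^ 2 + (z.2 1 - x0 1) ^ 2 + (z.2 2 - x0 2) ^ 2)
          - 8 * β ^ 2 * z.1 ^ 2 * ((z.2 0 - x0 0) * pdx a 0 z.2 + (z.2 1 - x0 1) * pdx a 1 z.2
            + (z.2 2 - x0 2) * pdx a 2 z.2) - 16 * β ^ 3 * a z.2 ^ 2 * z.1 ^ 2
          - (4 - k) * A z) * g z ^ 2
      + 2 * β * (pdx a 0 z.2 * g1 z + pdx a 1 z.2 * g2 z + pdx a 2 z.2 * g3 z) * g z := by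
  have hg0 : Differentiable ℝ g0 := h0 ▸ (hg.pd _ (m := 1) (by norm_num)).differentiable (by norm_num)
  have hg1 : Differentiable ℝ g1 := h1 ▸ (hg.pd _ (m := 1) (by norm_num)).differentiable (by norm_num)
  have hg2 : Differentiable ℝ g2 := h2 ▸ (hg.pd _ (m := 1) (by norm_num)).differentiable (by norm_num)
  have hg3 : Differentiable ℝ g3 := h3 ▸ (hg.pd _ (m := 1) (by norm_num)).differentiable (by norm_num)
  have hgd : Differentiable ℝ g := hg.differentiable (by norm_num)
  have had : Differentiable ℝ a := ha.differentiable (by norm_num)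
  have c1 : pd g1 et z = pd g0 (ex 0) z := by rw [h0, h1, pd_comm hg]
  have c2 : pd g2 et z = pd g0 (ex 1) z := by rw [h0, h2, pd_comm hg]
  have c3 : pd g3 et z = pd g0 (ex 2) z := by rw [h0, h3, pd_comm hg]
  have c4 : pd g2 (ex 0) z = pd g1 (ex 1) z := by rw [h2, h1, pd_comm hg]
  have c5 : pd g3 (ex 0) z = pd g1 (ex 2) z := by rw [h3, h1, pd_comm hg]
  have c6 : pd g3 (ex 1) z = pd g2 (ex 2) z := by rw [h3, h2, pd_comm hg]
  have e0 : pd g et z = g0 z := by rw [h0]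
  have e1 : pd g (ex 0) z = g1 z := by rw [h1]
  have e2 : pd g (ex 1) z = g2 z := by rw [h2]
  have e3 : pd g (ex 2) z = g3 z := by rw [h3]
  clear h0 h1 h2 h3
  subst hA hp hY hκ
  simp (disch := fun_prop) only [pd_mul, pd_add, pd_sub, pd_const, pd_sq, pd_fst, pd_snd_apply,
    pd_comp_snd_et, pd_comp_snd_ex, e0, e1, e2, e3, c1, c2, c3, c4, c5, c6]
  simp only [et, ex, Pi.single_apply, Pi.zero_apply]
  simp only [Fin.isValue, Fin.reduceEq, if_true, if_false]
  ring

theorem pd_eq_zero_of_notMem {f : P4 → ℝ} {z : P4} (d : P4) (h : z ∉ tsupport f) :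
    pd f d z = 0 := by
  have : f =ᶠ[nhds z] fun _ => 0 := notMem_tsupport_iff_eventuallyEq.1 h
  rw [pd_congr d this, pd_const]

theorem tsupport_pd_subset (f : P4 → ℝ) (d : P4) : tsupport (pd f d) ⊆ tsupport f := by
  refine closure_minimal (fun z hz => ?_) (isClosed_tsupport f)
  by_contra h
  exact hz (pd_eq_zero_of_notMem d h)

theorem pd_pd_eq_zero_of_notMem {f : P4 → ℝ} {z : P4} (d e : P4) (h : z ∉ tsupport f) :
    pd (pd f d) e z = 0 :=
  pd_eq_zero_of_notMem e fun h' => h (tsupport_pd_subset f d h')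

theorem HasCompactSupport.of_forall_notMem_tsupport {f V : P4 → ℝ} (hf : HasCompactSupport f)
    (h : ∀ z ∉ tsupport f, V z = 0) : HasCompactSupport V :=
  HasCompactSupport.intro hf h

theorem integral_slice_eq_integral_half {G : P4 → ℝ} (hG : ContDiff ℝ 1 G) {B : Set V3}
    (R : ℝ) (hR : ∀ z : P4, z.1 ≤ R → G z = 0)
    (hi : IntegrableOn (pd G et) (Iic (0 : ℝ) ×ˢ B)) :
    ∫ x in B, G (0, x) = ∫ z in Iic (0 : ℝ) ×ˢ B, pd G et z := by
  have hv : (volume : Measure P4).restrict (Iic (0 : ℝ) ×ˢ B) =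
      ((volume : Measure ℝ).restrict (Iic 0)).prod ((volume : Measure V3).restrict B) := by
    rw [Measure.prod_restrict]; rfl
  rw [IntegrableOn, hv] at hi
  rw [hv, integral_prod_symm _ hi]
  have key : ∀ x : V3, IntegrableOn (fun t => pd G et (t, x)) (Iic 0) →
      ∫ t in Iic (0 : ℝ), pd G et (t, x) = G (0, x) := by
    intro x hx
    have hd : ∀ t ∈ Iic (0 : ℝ), HasDerivAt (fun t => G (t, x)) (pd G et (t, x)) t := by
      intro t _
      have h1 : HasDerivAt (fun t : ℝ => ((t, x) : P4)) ((1, 0) : P4) t :=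
        (hasDerivAt_id t).prodMk (hasDerivAt_const t x)
      exact ((hG.differentiable (by norm_num)) (t, x)).hasFDerivAt.comp_hasDerivAt t h1
    have ht : Filter.Tendsto (fun t => G (t, x)) Filter.atBot (nhds 0) := by
      refine tendsto_const_nhds.congr' ?_
      filter_upwards [Filter.eventually_le_atBot R] with t htR
      exact (hR (t, x) htR).symm
    simpa using integral_Iic_of_hasDerivAt_of_tendsto' hd hx ht
  refine integral_congr_ae ?_
  filter_upwards [hi.prod_left_ae] with x hx
  exact (key x hx).symm

theorem integral_half_pd_ex {V : P4 → ℝ} (hV : ContDiff ℝ 1 V) (hc : HasCompactSupport V)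
    (i : Fin 3) : ∫ z in Iic (0 : ℝ) ×ˢ (univ : Set V3), pd V (ex i) z = 0 := by
  have hi : Integrable (pd V (ex i)) := by
    refine (hV.pd (m := 0) (ex i) (by norm_num)).continuous.integrable_of_hasCompactSupport ?_
    exact hc.of_forall_notMem_tsupport fun z hz => pd_eq_zero_of_notMem _ hz
  have hv : (volume : Measure P4).restrict (Iic (0 : ℝ) ×ˢ (univ : Set V3)) =
      ((volume : Measure ℝ).restrict (Iic 0)).prod (volume : Measure V3) := by
    conv_rhs => rw [← Measure.restrict_univ (μ := (volume : Measure V3))]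
    rw [Measure.prod_restrict]; rfl
  have hi' := hi.integrableOn (s := Iic (0 : ℝ) ×ˢ (univ : Set V3))
  rw [IntegrableOn, hv] at hi'
  rw [hv, integral_prod _ hi']
  refine integral_eq_zero_of_ae (Filter.Eventually.of_forall fun t => ?_)
  have hVt : ContDiff ℝ 1 fun x : V3 => V (t, x) := hV.comp (contDiff_prodMk_right t)
  have hcc : HasCompactSupport fun x : V3 => V (t, x) := by
    refine HasCompactSupport.intro (hc.isCompact.image continuous_snd) (fun x hx => ?_)
    by_contra h
    exact hx ⟨(t, x), subset_tsupport V h, rfl⟩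
  rw [Pi.zero_apply, ← integral_pdx hVt hcc i]
  refine integral_congr_ae (Filter.Eventually.of_forall fun x => ?_)
  have h1 : HasFDerivAt (fun x : V3 => ((t, x) : P4)) (ContinuousLinearMap.inr ℝ ℝ V3) x :=
    hasFDerivAt_prodMk_right t x
  have := ((hV.differentiable (by norm_num)) (t, x)).hasFDerivAt.comp x h1
  show _ = fderiv ℝ (V ∘ fun x : V3 => ((t, x) : P4)) x _
  rw [this.fderiv]; rfl

/-- Quantitative pseudoconvexity of the quadratic weight on `S` for `a ∂ₜ² - Δ`. -/
structure WaveAdm (x0 : V3) (β k δ K : ℝ) (a : V3 → ℝ) (S : Set P4) : Prop where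
  beta_pos : 0 < β
  k_pos : 0 < k
  k_le : k ≤ 4
  delta_pos : 0 < δ
  K_pos : 0 < K
  smooth : ContDiff ℝ 1 a
  lower : ∀ z ∈ S, δ ≤ a z.2
  upper : ∀ z ∈ S, a z.2 ≤ K
  time : ∀ z ∈ S, |z.1| ≤ K
  space : ∀ z ∈ S, ∀ i, |z.2 i - x0 i| ≤ K
  grad : ∀ z ∈ S, ∀ i, |pdx a i z.2| ≤ K
  convex : ∀ z ∈ S, ∀ s0 s1 s2 s3 : ℝ, δ * (s0 ^ 2 + (s1 ^ 2 + s2 ^ 2 + s3 ^ 2)) ≤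
    k * (s1 ^ 2 + s2 ^ 2 + s3 ^ 2)
      + 4 * β * z.1 * (s1 * pdx a 0 z.2 + s2 * pdx a 1 z.2 + s3 * pdx a 2 z.2) * s0
      + ((4 - k) * a z.2 + 2 * ((z.2 0 - x0 0) * pdx a 0 z.2 + (z.2 1 - x0 1) * pdx a 1 z.2
        + (z.2 2 - x0 2) * pdx a 2 z.2) - 4 * β * a z.2 ^ 2) * s0 ^ 2
  noncharacteristic : ∀ z ∈ S, 4 * (a z.2 * β ^ 2 * z.1 ^ 2 -
      ((z.2 0 - x0 0) ^ 2 + (z.2 1 - x0 1) ^ 2 + (z.2 2 - x0 2) ^ 2)) ≤ -δ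

/-- The wave operator `a ∂ₜ² - Δ` conjugated with `exp (τ (|x - x₀|² - β t²))`. -/
def conjOp (x0 : V3) (β τ : ℝ) (a : V3 → ℝ) (g : P4 → ℝ) (z : P4) : ℝ :=
  a z.2 * pd (pd g et) et z -
    (pd (pd g (ex 0)) (ex 0) z + pd (pd g (ex 1)) (ex 1) z + pd (pd g (ex 2)) (ex 2) z)
    + τ ^ 2 * (4 * (a z.2 * β ^ 2 * z.1 ^ 2 -
      ((z.2 0 - x0 0) ^ 2 + (z.2 1 - x0 1) ^ 2 + (z.2 2 - x0 2) ^ 2))) * g z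
    + 4 * τ * (β * z.1 * a z.2 * pd g et z + ((z.2 0 - x0 0) * pd g (ex 0) z
      + (z.2 1 - x0 1) * pd g (ex 1) z + (z.2 2 - x0 2) * pd g (ex 2) z))
    + τ * (2 * β * a z.2 + 6) * g z

theorem bulk_zero_order_le {a β t y0 y1 y2 p0 p1 p2 k δ : ℝ} (hδ : 0 < δ) (hk : k ≤ 4) (ha : δ ≤ a)
    (cv : δ * ((-2 * β * t) ^ 2 + ((2 * y0) ^ 2 + (2 * y1) ^ 2 + (2 * y2) ^ 2)) ≤
      k * ((2 * y0) ^ 2 + (2 * y1) ^ 2 + (2 * y2) ^ 2)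
        + 4 * β * t * (2 * y0 * p0 + 2 * y1 * p1 + 2 * y2 * p2) * (-2 * β * t)
        + ((4 - k) * a + 2 * (y0 * p0 + y1 * p1 + y2 * p2) - 4 * β * a ^ 2) * (-2 * β * t) ^ 2)
    (nc : 4 * (a * β ^ 2 * t ^ 2 - (y0 ^ 2 + y1 ^ 2 + y2 ^ 2)) ≤ -δ) :
    δ ^ 2 ≤ 16 * (y0 ^ 2 + y1 ^ 2 + y2 ^ 2)
      - 8 * β ^ 2 * t ^ 2 * (y0 * p0 + y1 * p1 + y2 * p2) - 16 * β ^ 3 * a ^ 2 * t ^ 2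
      - (4 - k) * (4 * (a * β ^ 2 * t ^ 2 - (y0 ^ 2 + y1 ^ 2 + y2 ^ 2))) := by
  have e1 : 0 ≤ (a * β ^ 2 * t ^ 2) := by have : 0 ≤ a := hδ.le.trans ha; positivity
  have e2 : δ ≤ (-2 * β * t) ^ 2 + ((2 * y0) ^ 2 + (2 * y1) ^ 2 + (2 * y2) ^ 2) := by
    have : 0 ≤ (-2 * β * t) ^ 2 := sq_nonneg _
    linarith
  have e3 := mul_le_mul_of_nonneg_left e2 hδ.le
  have e4 := e3.trans cv
  have e5 : 0 ≤ (4 - k) * (-(4 * (a * β ^ 2 * t ^ 2 - (y0 ^ 2 + y1 ^ 2 + y2 ^ 2)))) :=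
    mul_nonneg (by linarith) (by linarith)
  linarith

theorem neg_cross_le {δ β K b w g : ℝ} (hδ : 0 < δ) (hb : |b| ≤ K) :
    -(4 * β * (b * w) * g) ≤ δ * w ^ 2 + 4 * β ^ 2 * K ^ 2 / δ * g ^ 2 := by
  have hb2 : b ^ 2 ≤ K ^ 2 := sq_le_sq' (abs_le.1 hb).1 (abs_le.1 hb).2
  have e1 : 4 * β ^ 2 * b ^ 2 / δ * g ^ 2 ≤ 4 * β ^ 2 * K ^ 2 / δ * g ^ 2 := by gcongr
  have e2 : 0 ≤ δ * w ^ 2 + 4 * β * (b * w) * g + 4 * β ^ 2 * b ^ 2 / δ * g ^ 2 := by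
    have : δ * w ^ 2 + 4 * β * (b * w) * g + 4 * β ^ 2 * b ^ 2 / δ * g ^ 2
        = (δ * w + 2 * β * b * g) ^ 2 / δ := by field_simp; ring
    rw [this]; positivity
  linarith

theorem bulk_le_sq {τ δ k K β P Q D X N L g g0 g1 g2 g3 b1 b2 b3 : ℝ} (hδ : 0 < δ)
    (hk : 0 < k) (hk4 : k ≤ 4) (hτ : 1 ≤ τ) (hτ2 : 16 + 12 * β ^ 2 * K ^ 2 / δ ≤ τ * δ ^ 2)
    (hL : L = P + τ * Q + τ * (4 - k) * g)
    (hPQ : P * Q = D + X + τ ^ 2 * N * g ^ 2 + 2 * β * (b1 * g1 + b2 * g2 + b3 * g3) * g)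
    (hX : δ * (g0 ^ 2 + (g1 ^ 2 + g2 ^ 2 + g3 ^ 2)) ≤ X) (hN : δ ^ 2 ≤ N)
    (h1 : |b1| ≤ K) (h2 : |b2| ≤ K) (h3 : |b3| ≤ K) :
    τ * δ * ((g0 ^ 2 + (g1 ^ 2 + g2 ^ 2 + g3 ^ 2)) + τ ^ 2 * δ * g ^ 2) + 2 * τ * D ≤ L ^ 2 := by
  have c1 := neg_cross_le (β := β) (w := g1) (g := g) hδ h1
  have c2 := neg_cross_le (β := β) (w := g2) (g := g) hδ h2
  have c3 := neg_cross_le (β := β) (w := g3) (g := g) hδ h3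
  obtain ⟨E, hE⟩ : ∃ E, E = 4 * β ^ 2 * K ^ 2 / δ * g ^ 2 := ⟨_, rfl⟩
  have hE' : 12 * β ^ 2 * K ^ 2 / δ * g ^ 2 = 3 * E := by rw [hE]; ring
  rw [← hE] at c1 c2 c3
  have sq : 4 * τ * (P * Q) ≤ 2 * L ^ 2 + 32 * τ ^ 2 * g ^ 2 := by
    have e1 : P + τ * Q = L - τ * (4 - k) * g := by rw [hL]; ring
    have e2 : 4 * (P * (τ * Q)) ≤ (P + τ * Q) ^ 2 := by linarith [sq_nonneg (P - τ * Q)]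
    have e3 : (4 - k) ^ 2 ≤ 16 := by nlinarith
    have e4 : τ ^ 2 * g ^ 2 * (4 - k) ^ 2 ≤ τ ^ 2 * g ^ 2 * 16 := by gcongr
    rw [e1] at e2
    linarith [sq_nonneg (L + τ * (4 - k) * g)]
  have hNN : τ ^ 2 * δ ^ 2 * g ^ 2 ≤ τ ^ 2 * N * g ^ 2 := by gcongr
  have fin : τ * (16 + 12 * β ^ 2 * K ^ 2 / δ) * g ^ 2 ≤ τ * (τ * δ ^ 2) * g ^ 2 := by gcongr
  have fin' : 16 * τ * g ^ 2 + 3 * E ≤ τ ^ 2 * δ ^ 2 * g ^ 2 := by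
    have : 0 ≤ E := by rw [hE]; positivity
    have h3 : 3 * E ≤ τ * (3 * E) := by nlinarith
    rw [← hE'] at h3 ⊢
    linarith
  have low : δ * (g0 ^ 2 + (g1 ^ 2 + g2 ^ 2 + g3 ^ 2)) + τ ^ 2 * δ ^ 2 * g ^ 2 + 2 * D
      ≤ 2 * (P * Q) - 16 * τ * g ^ 2 := by
    rw [hPQ]
    linarith [mul_nonneg hδ.le (sq_nonneg g0)]
  have low2 := mul_le_mul_of_nonneg_left low (by linarith : 0 ≤ τ)
  linarith

set_option maxHeartbeats 1000000 in
theorem exists_conj_bulk {x0 : V3} {β k δ K : ℝ} {a : V3 → ℝ} {S : Set P4}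
    (h : WaveAdm x0 β k δ K a S) :
    ∃ C : ℝ, 1 ≤ C ∧ ∀ τ : ℝ, C ≤ τ → ∀ g : P4 → ℝ, ContDiff ℝ 2 g → HasCompactSupport g →
      tsupport g ⊆ S →
      τ * δ * ∫ z, gradT2 g z + τ ^ 2 * δ * g z ^ 2 ≤ ∫ z, conjOp x0 β τ a g z ^ 2 := by
  obtain ⟨hβ, hk, hk4, hδ, hK, ha, hlo, hup, ht, hx, hgr, hcv, hnc⟩ := h
  have haC : Continuous fun z : P4 => a z.2 := ha.continuous.comp continuous_snd
  refine ⟨max 1 ((16 + 12 * β ^ 2 * K ^ 2 / δ) / δ ^ 2), le_max_left _ _, fun τ hτ g hg hgc hgS => ?_⟩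
  have hτ1 : 1 ≤ τ := (le_max_left _ _).trans hτ
  have hτ2 : 16 + 12 * β ^ 2 * K ^ 2 / δ ≤ τ * δ ^ 2 := by
    have := (le_max_right _ _).trans hτ
    rwa [div_le_iff₀ (by positivity)] at this
  have hgi : ∀ d, ContDiff ℝ 1 (pd g d) := fun d => hg.pd d (by norm_num)
  have hg1 : ContDiff ℝ 1 g := hg.of_le (by norm_num)
  have hgii : ∀ d e, Continuous (pd (pd g d) e) := fun d e =>
    ((hgi d).pd (m := 0) e (by norm_num)).continuous
  obtain ⟨A, hA⟩ : ∃ A : P4 → ℝ, A = fun z => 4 * (a z.2 * β ^ 2 * z.1 ^ 2 -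
      ((z.2 0 - x0 0) ^ 2 + (z.2 1 - x0 1) ^ 2 + (z.2 2 - x0 2) ^ 2)) := ⟨_, rfl⟩
  obtain ⟨g0, h0⟩ : ∃ g0, g0 = pd g et := ⟨_, rfl⟩
  obtain ⟨g1, h1⟩ : ∃ g1, g1 = pd g (ex 0) := ⟨_, rfl⟩
  obtain ⟨g2, h2⟩ : ∃ g2, g2 = pd g (ex 1) := ⟨_, rfl⟩
  obtain ⟨g3, h3⟩ : ∃ g3, g3 = pd g (ex 2) := ⟨_, rfl⟩
  obtain ⟨p, hp⟩ : ∃ p : P4 → ℝ, p = fun z => a z.2 * g0 z ^ 2 - (g1 z ^ 2 + g2 z ^ 2 + g3 z ^ 2) :=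
    ⟨_, rfl⟩
  obtain ⟨Y, hY⟩ : ∃ Y : P4 → ℝ, Y = fun z => β * z.1 * a z.2 * g0 z + ((z.2 0 - x0 0) * g1 z
    + (z.2 1 - x0 1) * g2 z + (z.2 2 - x0 2) * g3 z) := ⟨_, rfl⟩
  obtain ⟨κ, hκ⟩ : ∃ κ : P4 → ℝ, κ = fun z => 2 + k + 2 * β * a z.2 := ⟨_, rfl⟩
  have key := wave_multiplier_divergence x0 β k τ ha hg g0 g1 g2 g3 A p Y κ h0 h1 h2 h3 hA hp hY hκ
  have r0 : ContDiff ℝ 1 g0 := h0 ▸ hgi _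
  have r1 : ContDiff ℝ 1 g1 := h1 ▸ hgi _
  have r2 : ContDiff ℝ 1 g2 := h2 ▸ hgi _
  have r3 : ContDiff ℝ 1 g3 := h3 ▸ hgi _
  have rA : ContDiff ℝ 1 A := by rw [hA]; fun_prop
  have rp : ContDiff ℝ 1 p := by rw [hp]; fun_prop
  have rY : ContDiff ℝ 1 Y := by rw [hY]; fun_prop
  have rκ : ContDiff ℝ 1 κ := by rw [hκ]; fun_prop
  set V0 : P4 → ℝ := fun z => 4 * a z.2 * g0 z * Y z - 2 * β * z.1 * a z.2 * p z
    + κ z * g z * a z.2 * g0 z + 2 * τ ^ 2 * β * A z * z.1 * a z.2 * g z ^ 2 with hV0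
  set V1 : P4 → ℝ := fun z => - 4 * g1 z * Y z - 2 * (z.2 0 - x0 0) * p z - κ z * g z * g1 z
          + 2 * τ ^ 2 * A z * (z.2 0 - x0 0) * g z ^ 2 with hV1
  set V2 : P4 → ℝ := fun z => - 4 * g2 z * Y z - 2 * (z.2 1 - x0 1) * p z - κ z * g z * g2 z
          + 2 * τ ^ 2 * A z * (z.2 1 - x0 1) * g z ^ 2 with hV2
  set V3' : P4 → ℝ := fun z => - 4 * g3 z * Y z - 2 * (z.2 2 - x0 2) * p z - κ z * g z * g3 z
          + 2 * τ ^ 2 * A z * (z.2 2 - x0 2) * g z ^ 2 with hV3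
  have s0 : ContDiff ℝ 1 V0 := by rw [hV0]; fun_prop
  have s1 : ContDiff ℝ 1 V1 := by rw [hV1]; fun_prop
  have s2 : ContDiff ℝ 1 V2 := by rw [hV2]; fun_prop
  have s3 : ContDiff ℝ 1 V3' := by rw [hV3]; fun_prop
  have zz : ∀ z ∉ tsupport g, g z = 0 ∧ g0 z = 0 ∧ g1 z = 0 ∧ g2 z = 0 ∧ g3 z = 0 := by
    intro z hz
    refine ⟨image_eq_zero_of_notMem_tsupport hz, ?_, ?_, ?_, ?_⟩ <;>
    simp only [h0, h1, h2, h3] <;> exact pd_eq_zero_of_notMem _ hz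
  have zp : ∀ z ∉ tsupport g, p z = 0 := by
    intro z hz
    obtain ⟨q, q0, q1, q2, q3⟩ := zz z hz
    simp [hp, q0, q1, q2, q3]
  have k0 : HasCompactSupport V0 := hgc.of_forall_notMem_tsupport fun z hz => by
    obtain ⟨q, q0, q1, q2, q3⟩ := zz z hz
    simp [hV0, q, q0, zp z hz]
  have k1 : HasCompactSupport V1 := hgc.of_forall_notMem_tsupport fun z hz => by
    obtain ⟨q, q0, q1, q2, q3⟩ := zz z hz
    simp [hV1, q, q1, zp z hz]
  have k2 : HasCompactSupport V2 := hgc.of_forall_notMem_tsupport fun z hz => by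
    obtain ⟨q, q0, q1, q2, q3⟩ := zz z hz
    simp [hV2, q, q2, zp z hz]
  have k3 : HasCompactSupport V3' := hgc.of_forall_notMem_tsupport fun z hz => by
    obtain ⟨q, q0, q1, q2, q3⟩ := zz z hz
    simp [hV3, q, q3, zp z hz]
  have ci : ∀ {V : P4 → ℝ} (d : P4), ContDiff ℝ 1 V → HasCompactSupport V →
      Integrable (pd V d) := fun d hV hc =>
    (hV.pd (m := 0) d (by norm_num)).continuous.integrable_of_hasCompactSupport
      (hc.of_forall_notMem_tsupport fun z hz => pd_eq_zero_of_notMem _ hz)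
  have i12 : Integrable (fun z => pd V1 (ex 0) z + pd V2 (ex 1) z) := (ci _ s1 k1).add (ci _ s2 k2)
  have i123 : Integrable (fun z => pd V1 (ex 0) z + pd V2 (ex 1) z + pd V3' (ex 2) z) :=
    i12.add (ci _ s3 k3)
  have idiv : Integrable
      (fun z => pd V0 et z + (pd V1 (ex 0) z + pd V2 (ex 1) z + pd V3' (ex 2) z)) :=
    (ci _ s0 k0).add i123
  have hdiv : ∫ z, (pd V0 et z + (pd V1 (ex 0) z + pd V2 (ex 1) z + pd V3' (ex 2) z)) = 0 := by
    rw [integral_add (ci _ s0 k0) i123, integral_add i12 (ci _ s3 k3),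
      integral_add (ci _ s1 k1) (ci _ s2 k2), integral_pd s0 k0, integral_pd s1 k1,
      integral_pd s2 k2, integral_pd s3 k3]
    simp
  have hLc : Continuous (conjOp x0 β τ a g) := by
    unfold conjOp
    have := fun d => (hgi d).continuous
    have := hg1.continuous
    fun_prop
  have hLs : HasCompactSupport (fun z => conjOp x0 β τ a g z ^ 2) :=
    hgc.of_forall_notMem_tsupport fun z hz => by
      simp [conjOp, pd_eq_zero_of_notMem _ hz, pd_pd_eq_zero_of_notMem _ _ hz,
        image_eq_zero_of_notMem_tsupport hz]
  have iL : Integrable (fun z => conjOp x0 β τ a g z ^ 2) :=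
    (hLc.pow 2).integrable_of_hasCompactSupport hLs
  have hNc : Continuous (fun z => gradT2 g z + τ ^ 2 * δ * g z ^ 2) := by
    unfold gradT2
    have := fun d => (hgi d).continuous
    have := hg1.continuous
    fun_prop
  have iN : Integrable (fun z => gradT2 g z + τ ^ 2 * δ * g z ^ 2) :=
    hNc.integrable_of_hasCompactSupport <| hgc.of_forall_notMem_tsupport fun z hz => by
      simp [gradT2, pd_eq_zero_of_notMem _ hz, image_eq_zero_of_notMem_tsupport hz]
  have point : ∀ z, τ * δ * (gradT2 g z + τ ^ 2 * δ * g z ^ 2)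
      + 2 * τ * (pd V0 et z + (pd V1 (ex 0) z + pd V2 (ex 1) z + pd V3' (ex 2) z))
      ≤ conjOp x0 β τ a g z ^ 2 := by
    intro z
    have kz := key z
    by_cases hz : z ∈ tsupport g
    · have hzS := hgS hz
      have cv := hcv z hzS (g0 z) (g1 z) (g2 z) (g3 z)
      have cv2 := hcv z hzS (-2 * β * z.1) (2 * (z.2 0 - x0 0)) (2 * (z.2 1 - x0 1))
        (2 * (z.2 2 - x0 2))
      have hgr0 := hgr z hzS 0
      have hgr1 := hgr z hzS 1
      have hgr2 := hgr z hzS 2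
      have haz := hlo z hzS
      have eL : conjOp x0 β τ a g z = (a z.2 * pd g0 et z
          - (pd g1 (ex 0) z + pd g2 (ex 1) z + pd g3 (ex 2) z) + τ ^ 2 * A z * g z)
          + τ * (4 * Y z + κ z * g z) + τ * (4 - k) * g z := by
        simp only [conjOp, h0, h1, h2, h3, hA, hY, hκ]; ring
      have eG : gradT2 g z = g0 z ^ 2 + (g1 z ^ 2 + g2 z ^ 2 + g3 z ^ 2) := by
        simp only [gradT2, h0, h1, h2, h3, Fin.sum_univ_three]
      have eA : A z = 4 * (a z.2 * β ^ 2 * z.1 ^ 2 -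
        ((z.2 0 - x0 0) ^ 2 + (z.2 1 - x0 1) ^ 2 + (z.2 2 - x0 2) ^ 2)) := by rw [hA]
      have hN := bulk_zero_order_le hδ hk4 haz cv2 (hnc z hzS)
      rw [← eA] at hN
      rw [eG]
      refine bulk_le_sq hδ hk hk4 hτ1 hτ2 eL ?_ cv hN hgr0 hgr1 hgr2
      linarith [kz]
    · obtain ⟨q, q0, q1, q2, q3⟩ := zz z hz
      have eG : gradT2 g z = 0 := by
        simp [gradT2, pd_eq_zero_of_notMem _ hz]
      have e00 : pd g0 et z = 0 := by rw [h0]; exact pd_pd_eq_zero_of_notMem _ _ hz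
      have e11 : pd g1 (ex 0) z = 0 := by rw [h1]; exact pd_pd_eq_zero_of_notMem _ _ hz
      have e22 : pd g2 (ex 1) z = 0 := by rw [h2]; exact pd_pd_eq_zero_of_notMem _ _ hz
      have e33 : pd g3 (ex 2) z = 0 := by rw [h3]; exact pd_pd_eq_zero_of_notMem _ _ hz
      rw [q, q0, q1, q2, q3, e00, e11, e22, e33] at kz
      have hD : pd V0 et z + (pd V1 (ex 0) z + pd V2 (ex 1) z + pd V3' (ex 2) z) = 0 := by
        linarith
      rw [hD, eG, q]
      nlinarith [sq_nonneg (conjOp x0 β τ a g z)]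
  have iS : Integrable (fun z => τ * δ * (gradT2 g z + τ ^ 2 * δ * g z ^ 2)
      + 2 * τ * (pd V0 et z + (pd V1 (ex 0) z + pd V2 (ex 1) z + pd V3' (ex 2) z))) :=
    (iN.const_mul (τ * δ)).add (idiv.const_mul (2 * τ))
  have := integral_mono iS iL point
  rw [integral_add (iN.const_mul (τ * δ)) (idiv.const_mul (2 * τ)), integral_const_mul,
    integral_const_mul, hdiv] at this
  linarith

theorem two_mul_le_of_abs_le {c x y M : ℝ} (hc : |c| ≤ M) :
    2 * (c * (x * y)) ≤ M * (x ^ 2 + y ^ 2) := by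
  have hM : 0 ≤ M := (abs_nonneg c).trans hc
  have h1 : c * (x * y) ≤ |c| * (|x| * |y|) := by
    rw [← abs_mul, ← abs_mul]; exact le_abs_self _
  have h2 : 2 * (|x| * |y|) ≤ x ^ 2 + y ^ 2 := by
    have := two_mul_le_add_sq |x| |y|; rw [sq_abs, sq_abs] at this; linarith
  have h3 : |c| * (|x| * |y|) ≤ M * (|x| * |y|) := by gcongr
  nlinarith [abs_nonneg x, abs_nonneg y]

theorem energy_flux_le {τ M A b c y0 y1 y2 L g g0 g1 g2 g3 : ℝ} (hτ : 1 ≤ τ) (hA : |A| ≤ M)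
    (hb : |b| ≤ M) (hc : |c| ≤ M) (h0 : |y0| ≤ M) (h1 : |y1| ≤ M) (h2 : |y2| ≤ M) :
    2 * g0 * (L - τ ^ 2 * A * g - 4 * τ * (b * g0 + (y0 * g1 + y1 * g2 + y2 * g3)) - τ * c * g)
      + 2 * τ ^ 2 * g * g0 ≤
      L ^ 2 + (2 + 22 * M) * (τ * (g0 ^ 2 + (g1 ^ 2 + g2 ^ 2 + g3 ^ 2) + τ ^ 2 * g ^ 2)) := by
  have hM : 0 ≤ M := (abs_nonneg A).trans hA
  have e1 := mul_le_mul_of_nonneg_left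
    (two_mul_le_of_abs_le (x := g0) (y := τ * g) (by rwa [abs_neg] : |-A| ≤ M))
    (by linarith : 0 ≤ τ)
  have e2 := mul_le_mul_of_nonneg_left
    (two_mul_le_of_abs_le (x := g0) (y := g0) (by rwa [abs_neg] : |-b| ≤ M))
    (by linarith : 0 ≤ τ)
  have e3 := mul_le_mul_of_nonneg_left
    (two_mul_le_of_abs_le (x := g0) (y := g) (by rwa [abs_neg] : |-c| ≤ M))
    (by linarith : 0 ≤ τ)
  have f0 := mul_le_mul_of_nonneg_left
    (two_mul_le_of_abs_le (x := g0) (y := g1) (by rwa [abs_neg] : |-y0| ≤ M))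
    (by linarith : 0 ≤ τ)
  have f1 := mul_le_mul_of_nonneg_left
    (two_mul_le_of_abs_le (x := g0) (y := g2) (by rwa [abs_neg] : |-y1| ≤ M))
    (by linarith : 0 ≤ τ)
  have f2 := mul_le_mul_of_nonneg_left
    (two_mul_le_of_abs_le (x := g0) (y := g3) (by rwa [abs_neg] : |-y2| ≤ M))
    (by linarith : 0 ≤ τ)
  have t1 : τ * (M * g ^ 2) ≤ τ * (M * (τ ^ 2 * g ^ 2)) := by
    gcongr
    exact le_mul_of_one_le_left (sq_nonneg g) (one_le_pow₀ hτ)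
  have t2 : g0 ^ 2 ≤ τ * g0 ^ 2 := le_mul_of_one_le_left (sq_nonneg _) hτ
  have t3 := mul_nonneg (by linarith : 0 ≤ τ) (sq_nonneg (g0 - τ * g))
  have t4 := sq_nonneg (g0 - L)
  have p1 : 0 ≤ τ * (M * g1 ^ 2) := by positivity
  have p2 : 0 ≤ τ * (M * g2 ^ 2) := by positivity
  have p3 : 0 ≤ τ * (M * g3 ^ 2) := by positivity
  have p4 : 0 ≤ τ * (M * (τ ^ 2 * g ^ 2)) := by positivity
  have q1 : 0 ≤ τ * (g1 ^ 2) := by positivity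
  have q2 : 0 ≤ τ * (g2 ^ 2) := by positivity
  have q3 : 0 ≤ τ * (g3 ^ 2) := by positivity
  have q4 : 0 ≤ τ * (τ ^ 2 * g ^ 2) := by positivity
  linarith

theorem pd_energy (τ : ℝ) {a : V3 → ℝ} (ha : ContDiff ℝ 1 a) {g : P4 → ℝ} (hg : ContDiff ℝ 2 g)
    (g0 g1 g2 g3 : P4 → ℝ)
    (h0 : g0 = pd g et) (h1 : g1 = pd g (ex 0)) (h2 : g2 = pd g (ex 1)) (h3 : g3 = pd g (ex 2))
    (z : P4) :
    pd (fun z => a z.2 * g0 z ^ 2 + (g1 z ^ 2 + g2 z ^ 2 + g3 z ^ 2) + τ ^ 2 * g z ^ 2) et z =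
      2 * (pd (fun z => g1 z * g0 z) (ex 0) z + pd (fun z => g2 z * g0 z) (ex 1) z
        + pd (fun z => g3 z * g0 z) (ex 2) z)
      + (2 * g0 z * (a z.2 * pd g0 et z
          - (pd g1 (ex 0) z + pd g2 (ex 1) z + pd g3 (ex 2) z)) + 2 * τ ^ 2 * g z * g0 z) := by
  have hg0 : Differentiable ℝ g0 := h0 ▸ (hg.pd _ (m := 1) (by norm_num)).differentiable (by norm_num)
  have hg1 : Differentiable ℝ g1 := h1 ▸ (hg.pd _ (m := 1) (by norm_num)).differentiable (by norm_num)
  have hg2 : Differentiable ℝ g2 := h2 ▸ (hg.pd _ (m := 1) (by norm_num)).differentiable (by norm_num)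
  have hg3 : Differentiable ℝ g3 := h3 ▸ (hg.pd _ (m := 1) (by norm_num)).differentiable (by norm_num)
  have hgd : Differentiable ℝ g := hg.differentiable (by norm_num)
  have had : Differentiable ℝ a := ha.differentiable (by norm_num)
  have c1 : pd g1 et z = pd g0 (ex 0) z := by rw [h0, h1, pd_comm hg]
  have c2 : pd g2 et z = pd g0 (ex 1) z := by rw [h0, h2, pd_comm hg]
  have c3 : pd g3 et z = pd g0 (ex 2) z := by rw [h0, h3, pd_comm hg]
  have e0 : pd g et z = g0 z := by rw [h0]
  clear h0 h1 h2 h3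
  simp (disch := fun_prop) only [pd_mul, pd_add, pd_const, pd_sq, pd_comp_snd_et, e0, c1, c2, c3]
  ring

theorem abs_zero_order_le {a β t K y0 y1 y2 δ : ℝ} (hδ : 0 < δ) (ha : δ ≤ a) (ha' : a ≤ K)
    (ht : |t| ≤ K) (h0 : |y0| ≤ K) (h1 : |y1| ≤ K) (h2 : |y2| ≤ K) :
    |4 * (a * β ^ 2 * t ^ 2 - (y0 ^ 2 + y1 ^ 2 + y2 ^ 2))| ≤ 4 * K ^ 3 * β ^ 2 + 12 * K ^ 2 := by
  have hK : 0 ≤ K := (abs_nonneg _).trans ht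
  have sq : ∀ {x : ℝ}, |x| ≤ K → x ^ 2 ≤ K ^ 2 := fun hx =>
    sq_le_sq' (abs_le.1 hx).1 (abs_le.1 hx).2
  have e0 := sq h0
  have e1 := sq h1
  have e2 := sq h2
  have e3 : a * β ^ 2 * t ^ 2 ≤ K * β ^ 2 * K ^ 2 := by
    have := sq ht
    gcongr
  have e4 : 0 ≤ a * β ^ 2 * t ^ 2 := by have : 0 ≤ a := hδ.le.trans ha; positivity
  have e5 : 0 ≤ K * β ^ 2 * K ^ 2 := by positivity
  have := sq_nonneg y0
  have := sq_nonneg y1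
  have := sq_nonneg y2
  rw [abs_le]; constructor <;> linarith

set_option maxHeartbeats 1000000 in
theorem exists_conj_trace {x0 : V3} {β k δ K : ℝ} {a : V3 → ℝ} {S : Set P4}
    (h : WaveAdm x0 β k δ K a S) :
    ∃ C : ℝ, 1 ≤ C ∧ ∀ τ : ℝ, C ≤ τ → ∀ g : P4 → ℝ, ContDiff ℝ 2 g → HasCompactSupport g →
      tsupport g ⊆ S →
      (τ * ∫ z, gradT2 g z + τ ^ 2 * g z ^ 2) + (∫ x, gradT2 g (0, x) + τ ^ 2 * g (0, x) ^ 2)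
        ≤ C * ∫ z, conjOp x0 β τ a g z ^ 2 := by
  obtain ⟨C0, hC0, hbulk⟩ := exists_conj_bulk h
  obtain ⟨hβ, hk, hk4, hδ, hK, ha, hlo, hup, ht, hx, hgr, hcv, hnc⟩ := h
  have haC : Continuous fun z : P4 => a z.2 := ha.continuous.comp continuous_snd
  obtain ⟨e, he⟩ : ∃ e : ℝ, e = min 1 δ := ⟨_, rfl⟩
  have he0 : 0 < e := by rw [he]; positivity
  have he1 : e ≤ 1 := he ▸ min_le_left _ _
  have heδ : e ≤ δ := he ▸ min_le_right _ _
  obtain ⟨M, hM⟩ : ∃ M : ℝ, M = (4 * K ^ 3 * β ^ 2 + 12 * K ^ 2) + β * K ^ 2 + (2 * β * K + 6) + K :=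
    ⟨_, rfl⟩
  obtain ⟨b, hb⟩ : ∃ b : ℝ, b = 1 / (δ * e) := ⟨_, rfl⟩
  have hb0 : 0 < b := by rw [hb]; positivity
  have hM0 : 0 ≤ M := by rw [hM]; positivity
  refine ⟨C0 + b + (1 / e) * (1 + (2 + 22 * M) * b), ?_, fun τ hτ g hg hgc hgS => ?_⟩
  · have : 0 ≤ (1 / e) * (1 + (2 + 22 * M) * b) := by positivity
    linarith
  have hτ0 : C0 ≤ τ := by
    have : 0 ≤ (1 / e) * (1 + (2 + 22 * M) * b) := by positivity
    linarith
  have hτ1 : 1 ≤ τ := hC0.trans hτ0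
  have bulk := hbulk τ hτ0 g hg hgc hgS
  have hgi : ∀ d, ContDiff ℝ 1 (pd g d) := fun d => hg.pd d (by norm_num)
  have hg1 : ContDiff ℝ 1 g := hg.of_le (by norm_num)
  have hgic : ∀ d, Continuous (pd g d) := fun d => (hgi d).continuous
  have hgc0 : Continuous g := hg.continuous
  have hgii : ∀ d e, Continuous (pd (pd g d) e) := fun d e =>
    ((hgi d).pd (m := 0) e (by norm_num)).continuous
  have hN : ∀ s : ℝ, Continuous fun z => gradT2 g z + s * g z ^ 2 := fun s => by
    unfold gradT2; fun_prop
  have hNs : ∀ s : ℝ, HasCompactSupport fun z => gradT2 g z + s * g z ^ 2 := fun s =>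
    hgc.of_forall_notMem_tsupport fun z hz => by
      simp [gradT2, pd_eq_zero_of_notMem _ hz, image_eq_zero_of_notMem_tsupport hz]
  have iN : ∀ s : ℝ, Integrable (fun z => gradT2 g z + s * g z ^ 2) := fun s =>
    (hN s).integrable_of_hasCompactSupport (hNs s)
  have hG0 : ∀ z, 0 ≤ gradT2 g z := fun z => by unfold gradT2; positivity
  have hLc : Continuous (conjOp x0 β τ a g) := by
    unfold conjOp
    fun_prop
  have iL : Integrable (fun z => conjOp x0 β τ a g z ^ 2) :=
    (hLc.pow 2).integrable_of_hasCompactSupport <| hgc.of_forall_notMem_tsupport fun z hz => by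
      simp [conjOp, pd_eq_zero_of_notMem _ hz, pd_pd_eq_zero_of_notMem _ _ hz,
        image_eq_zero_of_notMem_tsupport hz]
  have B1 : τ * ∫ z, gradT2 g z + τ ^ 2 * g z ^ 2 ≤ b * ∫ z, conjOp x0 β τ a g z ^ 2 := by
    have m : e * ∫ z, gradT2 g z + τ ^ 2 * g z ^ 2 ≤ ∫ z, gradT2 g z + τ ^ 2 * δ * g z ^ 2 := by
      rw [← integral_const_mul]
      refine integral_mono ((iN _).const_mul e) (iN _) fun z => ?_
      have := mul_le_mul_of_nonneg_right he1 (hG0 z)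
      have := mul_le_mul_of_nonneg_right heδ (by positivity : 0 ≤ τ ^ 2 * g z ^ 2)
      show e * (gradT2 g z + τ ^ 2 * g z ^ 2) ≤ gradT2 g z + τ ^ 2 * δ * g z ^ 2
      linarith
    have m2 := (mul_le_mul_of_nonneg_left m (by positivity : 0 ≤ τ * δ)).trans bulk
    rw [hb, one_div, inv_mul_eq_div, le_div_iff₀ (by positivity)]
    linarith
  obtain ⟨g0, h0⟩ : ∃ g0, g0 = pd g et := ⟨_, rfl⟩
  obtain ⟨g1, h1⟩ : ∃ g1, g1 = pd g (ex 0) := ⟨_, rfl⟩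
  obtain ⟨g2, h2⟩ : ∃ g2, g2 = pd g (ex 1) := ⟨_, rfl⟩
  obtain ⟨g3, h3⟩ : ∃ g3, g3 = pd g (ex 2) := ⟨_, rfl⟩
  have key := pd_energy τ ha hg g0 g1 g2 g3 h0 h1 h2 h3
  have r0 : ContDiff ℝ 1 g0 := h0 ▸ hgi _
  have r1 : ContDiff ℝ 1 g1 := h1 ▸ hgi _
  have r2 : ContDiff ℝ 1 g2 := h2 ▸ hgi _
  have r3 : ContDiff ℝ 1 g3 := h3 ▸ hgi _
  have eG : ∀ z, gradT2 g z = g0 z ^ 2 + (g1 z ^ 2 + g2 z ^ 2 + g3 z ^ 2) := fun z => by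
    simp only [gradT2, h0, h1, h2, h3, Fin.sum_univ_three]
  have zz : ∀ z ∉ tsupport g, g z = 0 ∧ g0 z = 0 ∧ g1 z = 0 ∧ g2 z = 0 ∧ g3 z = 0 := by
    intro z hz
    refine ⟨image_eq_zero_of_notMem_tsupport hz, ?_, ?_, ?_, ?_⟩ <;>
    simp only [h0, h1, h2, h3] <;> exact pd_eq_zero_of_notMem _ hz
  obtain ⟨E, hE⟩ : ∃ E : P4 → ℝ, E = fun z =>
    a z.2 * g0 z ^ 2 + (g1 z ^ 2 + g2 z ^ 2 + g3 z ^ 2) + τ ^ 2 * g z ^ 2 := ⟨_, rfl⟩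
  have sE : ContDiff ℝ 1 E := by rw [hE]; fun_prop
  have zE : ∀ z ∉ tsupport g, E z = 0 := fun z hz => by
    obtain ⟨q, q0, q1, q2, q3⟩ := zz z hz
    simp [hE, q, q0, q1, q2, q3]
  have sEc : HasCompactSupport E := hgc.of_forall_notMem_tsupport zE
  obtain ⟨R, hR⟩ : ∃ R : ℝ, ∀ z : P4, z.1 ≤ R → E z = 0 := by
    obtain ⟨R, hR⟩ := (hgc.isCompact.image continuous_fst).bddBelow
    refine ⟨R - 1, fun z hz => zE z fun hz' => ?_⟩
    have := hR (mem_image_of_mem _ hz')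
    linarith
  have ci : ∀ {V : P4 → ℝ} (d : P4), ContDiff ℝ 1 V → HasCompactSupport V →
      Integrable (pd V d) := fun d hV hc =>
    (hV.pd (m := 0) d (by norm_num)).continuous.integrable_of_hasCompactSupport
      (hc.of_forall_notMem_tsupport fun z hz => pd_eq_zero_of_notMem _ hz)
  have tr := integral_slice_eq_integral_half (B := univ) sE R hR (ci _ sE sEc).integrableOn
  have s1 : ContDiff ℝ 1 (fun z => g1 z * g0 z) := by fun_prop
  have s2 : ContDiff ℝ 1 (fun z => g2 z * g0 z) := by fun_prop
  have s3 : ContDiff ℝ 1 (fun z => g3 z * g0 z) := by fun_prop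
  have k1 : HasCompactSupport (fun z => g1 z * g0 z) :=
    hgc.of_forall_notMem_tsupport fun z hz => by simp [(zz z hz).2.1]
  have k2 : HasCompactSupport (fun z => g2 z * g0 z) :=
    hgc.of_forall_notMem_tsupport fun z hz => by simp [(zz z hz).2.1]
  have k3 : HasCompactSupport (fun z => g3 z * g0 z) :=
    hgc.of_forall_notMem_tsupport fun z hz => by simp [(zz z hz).2.1]
  have v1 := integral_half_pd_ex s1 k1 0
  have v2 := integral_half_pd_ex s2 k2 1
  have v3 := integral_half_pd_ex s3 k3 2
  have i1 := (ci (ex 0) s1 k1).integrableOn (s := Iic (0 : ℝ) ×ˢ (univ : Set V3))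
  have i2 := (ci (ex 1) s2 k2).integrableOn (s := Iic (0 : ℝ) ×ˢ (univ : Set V3))
  have i3 := (ci (ex 2) s3 k3).integrableOn (s := Iic (0 : ℝ) ×ˢ (univ : Set V3))
  have i12 : IntegrableOn (fun z => pd (fun z => g1 z * g0 z) (ex 0) z
      + pd (fun z => g2 z * g0 z) (ex 1) z) (Iic (0 : ℝ) ×ˢ (univ : Set V3)) := i1.add i2
  have i123 : IntegrableOn (fun z => pd (fun z => g1 z * g0 z) (ex 0) z
      + pd (fun z => g2 z * g0 z) (ex 1) z + pd (fun z => g3 z * g0 z) (ex 2) z)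
      (Iic (0 : ℝ) ×ˢ (univ : Set V3)) := i12.add i3
  have hflux : ∫ z in Iic (0 : ℝ) ×ˢ (univ : Set V3), (pd (fun z => g1 z * g0 z) (ex 0) z
      + pd (fun z => g2 z * g0 z) (ex 1) z + pd (fun z => g3 z * g0 z) (ex 2) z) = 0 := by
    rw [integral_add i12 i3, integral_add i1 i2, v1, v2, v3]; simp
  obtain ⟨H, hH⟩ : ∃ H : P4 → ℝ, H = fun z => conjOp x0 β τ a g z ^ 2
      + (2 + 22 * M) * (τ * (gradT2 g z + τ ^ 2 * g z ^ 2)) := ⟨_, rfl⟩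
  have iH : Integrable H := by
    rw [hH]; exact iL.add (((iN _).const_mul τ).const_mul _)
  have hH0 : ∀ z, 0 ≤ H z := fun z => by
    have := hG0 z
    rw [hH]
    have : 0 ≤ τ := by linarith
    positivity
  have intH : ∫ z, H z ≤ (1 + (2 + 22 * M) * b) * ∫ z, conjOp x0 β τ a g z ^ 2 := by
    rw [hH, integral_add iL (((iN _).const_mul τ).const_mul _), integral_const_mul,
      integral_const_mul]
    have := mul_le_mul_of_nonneg_left B1 (by positivity : 0 ≤ 2 + 22 * M)
    linarith
  have point : ∀ z, pd E et z ≤ 2 * (pd (fun z => g1 z * g0 z) (ex 0) z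
      + pd (fun z => g2 z * g0 z) (ex 1) z + pd (fun z => g3 z * g0 z) (ex 2) z) + H z := by
    intro z
    rw [hE, key z]
    refine add_le_add_right ?_ _
    by_cases hz : z ∈ tsupport g
    · have hzS := hgS hz
      have eL : a z.2 * pd g0 et z - (pd g1 (ex 0) z + pd g2 (ex 1) z + pd g3 (ex 2) z)
          = conjOp x0 β τ a g z - τ ^ 2 * (4 * (a z.2 * β ^ 2 * z.1 ^ 2 -
      ((z.2 0 - x0 0) ^ 2 + (z.2 1 - x0 1) ^ 2 + (z.2 2 - x0 2) ^ 2))) * g z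
          - 4 * τ * (β * z.1 * a z.2 * g0 z + ((z.2 0 - x0 0) * g1 z + (z.2 1 - x0 1) * g2 z
      + (z.2 2 - x0 2) * g3 z)) - τ * (2 * β * a z.2 + 6) * g z := by
        simp only [conjOp, h0, h1, h2, h3]; ring
      rw [eL, hH]
      simp only [eG]
      have hKM : K ≤ M := by
        rw [hM]
        have : 0 ≤ (4 * K ^ 3 * β ^ 2 + 12 * K ^ 2) + β * K ^ 2 + (2 * β * K + 6) := by positivity
        linarith
      refine energy_flux_le hτ1 ?_ ?_ ?_ ((hx z hzS 0).trans hKM) ((hx z hzS 1).trans hKM)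
        ((hx z hzS 2).trans hKM)
      · refine (abs_zero_order_le hδ (hlo z hzS) (hup z hzS) (ht z hzS) (hx z hzS 0) (hx z hzS 1)
          (hx z hzS 2)).trans ?_
        have : 0 ≤ β * K ^ 2 + (2 * β * K + 6) + K := by positivity
        rw [hM]; linarith
      · have ap : 0 ≤ a z.2 := hδ.le.trans (hlo z hzS)
        have : |β * z.1 * a z.2| ≤ β * K * K := by
          rw [abs_mul, abs_mul, abs_of_pos hβ, abs_of_nonneg ap]
          have := hup z hzS
          have := ht z hzS
          gcongr
        have : 0 ≤ (4 * K ^ 3 * β ^ 2 + 12 * K ^ 2) + (2 * β * K + 6) + K := by positivity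
        rw [hM]; linarith
      · have ap : 0 ≤ a z.2 := hδ.le.trans (hlo z hzS)
        have : β * a z.2 ≤ β * K := mul_le_mul_of_nonneg_left (hup z hzS) hβ.le
        rw [abs_of_nonneg (by positivity)]
        have : 0 ≤ (4 * K ^ 3 * β ^ 2 + 12 * K ^ 2) + β * K ^ 2 + K := by positivity
        rw [hM]; linarith
    · obtain ⟨q, q0, q1, q2, q3⟩ := zz z hz
      rw [q, q0]
      simpa using hH0 z
  have half : ∫ x, E (0, x) ≤ ∫ z, H z := by
    rw [setIntegral_univ] at tr
    rw [tr]
    have iS : IntegrableOn (fun z => 2 * (pd (fun z => g1 z * g0 z) (ex 0) z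
      + pd (fun z => g2 z * g0 z) (ex 1) z + pd (fun z => g3 z * g0 z) (ex 2) z) + H z)
      (Iic (0 : ℝ) ×ˢ (univ : Set V3)) := (i123.const_mul 2).add iH.integrableOn
    have m := setIntegral_mono (ci _ sE sEc).integrableOn iS point
    rw [integral_add (i123.const_mul 2) iH.integrableOn, integral_const_mul, hflux] at m
    have := setIntegral_le_integral (s := Iic (0 : ℝ) ×ˢ (univ : Set V3)) iH
      (Filter.Eventually.of_forall hH0)
    linarith
  have emb : Continuous fun x : V3 => ((0 : ℝ), x) := by fun_prop
  have cc : Topology.IsClosedEmbedding fun x : V3 => ((0 : ℝ), x) := by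
    refine Topology.IsClosedEmbedding.of_continuous_injective_isClosedMap emb ?_ ?_
    · intro x y hxy; simpa using hxy
    · intro s hs
      have : (fun x : V3 => ((0 : ℝ), x)) '' s = {0} ×ˢ s := by ext ⟨t, x⟩; simp [eq_comm, and_comm]
      rw [this]; exact isClosed_singleton.prod hs
  have slice : e * (∫ x, gradT2 g (0, x) + τ ^ 2 * g (0, x) ^ 2) ≤ ∫ x, E (0, x) := by
    rw [← integral_const_mul]
    refine integral_mono (Integrable.const_mul ?_ e) ?_ fun x => ?_
    · exact ((hN _).comp emb).integrable_of_hasCompactSupport ((hNs _).comp_isClosedEmbedding cc)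
    · exact (sE.continuous.comp emb).integrable_of_hasCompactSupport
        (sEc.comp_isClosedEmbedding cc)
    · show e * (gradT2 g (0, x) + τ ^ 2 * g (0, x) ^ 2) ≤ E (0, x)
      rw [eG, hE]
      by_cases hz : ((0 : ℝ), x) ∈ tsupport g
      · have l := heδ.trans (hlo _ (hgS hz))
        have l1 := mul_le_mul_of_nonneg_right l (sq_nonneg (g0 (0, x)))
        have l2 := mul_le_mul_of_nonneg_right he1 (by positivity :
          0 ≤ (g1 (0, x) ^ 2 + g2 (0, x) ^ 2 + g3 (0, x) ^ 2) + τ ^ 2 * g (0, x) ^ 2)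
        simp only at l1 ⊢
        linarith
      · obtain ⟨q, q0, q1, q2, q3⟩ := zz _ hz
        simp [q, q0, q1, q2, q3]
  have B2 : (∫ x, gradT2 g (0, x) + τ ^ 2 * g (0, x) ^ 2)
      ≤ (1 / e) * ((1 + (2 + 22 * M) * b) * ∫ z, conjOp x0 β τ a g z ^ 2) := by
    rw [one_div, inv_mul_eq_div, le_div_iff₀ he0]
    linarith
  have : 0 ≤ C0 * ∫ z, conjOp x0 β τ a g z ^ 2 :=
    mul_nonneg (by linarith) (integral_nonneg fun z => sq_nonneg _)
  linarith

/-- The Carleman weight `exp (2 τ (|x - x₀|² - β t²))`. -/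
def wt (x0 : V3) (β τ : ℝ) (z : P4) : ℝ := Real.exp (2 * τ * (sqd x0 z.2 - β * z.1 ^ 2))

theorem wt_pos (x0 : V3) (β τ : ℝ) (z : P4) : 0 < wt x0 β τ z := Real.exp_pos _

theorem contDiff_sqd (x0 : V3) {n : WithTop ℕ∞} : ContDiff ℝ n (sqd x0) := by
  unfold sqd; fun_prop

theorem contDiff_wt (x0 : V3) (β τ : ℝ) {n : WithTop ℕ∞} : ContDiff ℝ n (wt x0 β τ) := by
  have := (contDiff_sqd x0 (n := n)).comp (contDiff_snd (E := ℝ) (F := V3))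
  have h : ContDiff ℝ n fun z : P4 => sqd x0 z.2 := this
  unfold wt; fun_prop

/-- The exponential factor of the conjugation. -/
def ewt (x0 : V3) (β τ : ℝ) (z : P4) : ℝ := Real.exp (τ * ((z.2 0 - x0 0) ^ 2
  + (z.2 1 - x0 1) ^ 2 + (z.2 2 - x0 2) ^ 2 - β * z.1 ^ 2))

theorem ewt_sq (x0 : V3) (β τ : ℝ) (z : P4) : ewt x0 β τ z ^ 2 = wt x0 β τ z := by
  rw [ewt, wt, ← Real.exp_nat_mul, sqd, Fin.sum_univ_three]
  congr 1; push_cast; ring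

theorem contDiff_ewt (x0 : V3) (β τ : ℝ) {n : WithTop ℕ∞} : ContDiff ℝ n (ewt x0 β τ) := by
  unfold ewt; fun_prop

theorem pd_ewt_et (x0 : V3) (β τ : ℝ) (z : P4) :
    pd (ewt x0 β τ) et z = ewt x0 β τ z * (-2 * τ * β * z.1) := by
  unfold ewt
  simp (disch := fun_prop) only [pd_exp, pd_mul, pd_add, pd_sub, pd_const, pd_sq, pd_fst,
    pd_snd_apply]
  simp only [et, Pi.zero_apply]; ring

theorem pd_ewt_ex (x0 : V3) (β τ : ℝ) (i : Fin 3) (z : P4) :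
    pd (ewt x0 β τ) (ex i) z = ewt x0 β τ z * (2 * τ * (z.2 i - x0 i)) := by
  unfold ewt
  simp (disch := fun_prop) only [pd_exp, pd_mul, pd_add, pd_sub, pd_const, pd_sq, pd_fst,
    pd_snd_apply]
  fin_cases i <;> simp [ex] <;> ring

theorem pd_ewt_mul_et (x0 : V3) (β τ : ℝ) {f : P4 → ℝ} (hf : ContDiff ℝ 2 f) :
    pd (fun z => ewt x0 β τ z * f z) et =
      fun z => ewt x0 β τ z * (pd f et z - 2 * τ * β * z.1 * f z) := by
  funext z
  have h1 : Differentiable ℝ f := hf.differentiable (by norm_num)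
  have h2 : Differentiable ℝ (ewt x0 β τ) := (contDiff_ewt x0 β τ (n := 1)).differentiable (by norm_num)
  rw [pd_mul _ (h2 z) (h1 z), pd_ewt_et]; ring

theorem pd_ewt_mul_ex (x0 : V3) (β τ : ℝ) {f : P4 → ℝ} (hf : ContDiff ℝ 2 f) (i : Fin 3) :
    pd (fun z => ewt x0 β τ z * f z) (ex i) =
      fun z => ewt x0 β τ z * (pd f (ex i) z + 2 * τ * (z.2 i - x0 i) * f z) := by
  funext z
  have h1 : Differentiable ℝ f := hf.differentiable (by norm_num)
  have h2 : Differentiable ℝ (ewt x0 β τ) := (contDiff_ewt x0 β τ (n := 1)).differentiable (by norm_num)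
  rw [pd_mul _ (h2 z) (h1 z), pd_ewt_ex]; ring

theorem pd_pd_ewt_mul_et (x0 : V3) (β τ : ℝ) {f : P4 → ℝ} (hf : ContDiff ℝ 2 f) (z : P4) :
    pd (pd (fun z => ewt x0 β τ z * f z) et) et z = ewt x0 β τ z * (pd (pd f et) et z
      - 4 * τ * β * z.1 * pd f et z + (4 * τ ^ 2 * β ^ 2 * z.1 ^ 2 - 2 * τ * β) * f z) := by
  have h1 : Differentiable ℝ f := hf.differentiable (by norm_num)
  have h2 : Differentiable ℝ (ewt x0 β τ) := (contDiff_ewt x0 β τ (n := 1)).differentiable (by norm_num)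
  have h3 : Differentiable ℝ (pd f et) := (hf.pd et (m := 1) (by norm_num)).differentiable (by norm_num)
  rw [pd_ewt_mul_et x0 β τ hf]
  simp (disch := fun_prop) only [pd_mul, pd_sub, pd_const, pd_fst, pd_ewt_et]
  simp only [et]; ring

theorem pd_pd_ewt_mul_ex (x0 : V3) (β τ : ℝ) {f : P4 → ℝ} (hf : ContDiff ℝ 2 f) (i : Fin 3)
    (z : P4) :
    pd (pd (fun z => ewt x0 β τ z * f z) (ex i)) (ex i) z =
      ewt x0 β τ z * (pd (pd f (ex i)) (ex i) z
      + 4 * τ * (z.2 i - x0 i) * pd f (ex i) z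
      + (4 * τ ^ 2 * (z.2 i - x0 i) ^ 2 + 2 * τ) * f z) := by
  have h1 : Differentiable ℝ f := hf.differentiable (by norm_num)
  have h2 : Differentiable ℝ (ewt x0 β τ) := (contDiff_ewt x0 β τ (n := 1)).differentiable (by norm_num)
  have h3 : Differentiable ℝ (pd f (ex i)) :=
    (hf.pd (ex i) (m := 1) (by norm_num)).differentiable (by norm_num)
  rw [pd_ewt_mul_ex x0 β τ hf]
  simp (disch := fun_prop) only [pd_mul, pd_add, pd_sub, pd_const, pd_snd_apply, pd_ewt_ex]
  simp only [ex, Pi.single_eq_same]; ring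

theorem conjOp_ewt_mul (x0 : V3) (β τ : ℝ) (a : V3 → ℝ) {f : P4 → ℝ} (hf : ContDiff ℝ 2 f)
    (z : P4) : conjOp x0 β τ a (fun z => ewt x0 β τ z * f z) z =
      ewt x0 β τ z * (a z.2 * dtt f z - slap f z) := by
  rw [conjOp]
  simp only [pd_pd_ewt_mul_et x0 β τ hf, pd_pd_ewt_mul_ex x0 β τ hf]
  simp only [pd_ewt_mul_et x0 β τ hf, pd_ewt_mul_ex x0 β τ hf, dtt, slap, Fin.sum_univ_three]
  ring

theorem gradT2_mul_wt_le {x0 : V3} {β τ K : ℝ} {f : P4 → ℝ} (hf : ContDiff ℝ 2 f) {z : P4}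
    (ht : |z.1| ≤ K) (hx : ∀ i, |z.2 i - x0 i| ≤ K) :
    (gradT2 f z + τ ^ 2 * f z ^ 2) * wt x0 β τ z ≤ (3 + 8 * (β ^ 2 + 3) * K ^ 2) *
      (gradT2 (fun z => ewt x0 β τ z * f z) z + τ ^ 2 * (ewt x0 β τ z * f z) ^ 2) := by
  simp only [gradT2, Fin.sum_univ_three, pd_ewt_mul_et x0 β τ hf, pd_ewt_mul_ex x0 β τ hf,
    ← ewt_sq]
  have sq : ∀ {x : ℝ}, |x| ≤ K → x ^ 2 ≤ K ^ 2 := fun hx =>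
    sq_le_sq' (abs_le.1 hx).1 (abs_le.1 hx).2
  obtain ⟨e, he⟩ : ∃ e, e = ewt x0 β τ z := ⟨_, rfl⟩
  rw [← he]
  have gen : ∀ u s : ℝ, s ^ 2 ≤ K ^ 2 → ∀ q : ℝ, u ^ 2 * e ^ 2 ≤ 2 * (e * (u + 2 * τ * q * s * f z)) ^ 2
      + 8 * q ^ 2 * K ^ 2 * (τ ^ 2 * (e * f z) ^ 2) := by
    intro u s hs q
    have := mul_le_mul_of_nonneg_right hs (by positivity : 0 ≤ 8 * q ^ 2 * (τ ^ 2 * (e * f z) ^ 2))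
    have := sq_nonneg (e * (u + 2 * τ * q * s * f z) + e * (2 * τ * q * s * f z))
    linarith
  have a0 := gen (pd f et z) z.1 (sq ht) (-β)
  have a1 := gen (pd f (ex 0) z) _ (sq (hx 0)) 1
  have a2 := gen (pd f (ex 1) z) _ (sq (hx 1)) 1
  have a3 := gen (pd f (ex 2) z) _ (sq (hx 2)) 1
  obtain ⟨r, hr⟩ : ∃ r, r = τ ^ 2 * (e * f z) ^ 2 := ⟨_, rfl⟩
  have hr0 : 0 ≤ r := hr ▸ by positivity
  have hr' : τ ^ 2 * f z ^ 2 * e ^ 2 = r := by rw [hr]; ring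
  rw [← hr] at a0 a1 a2 a3 ⊢
  have e0 : e * (pd f et z + 2 * τ * -β * z.1 * f z) = e * (pd f et z - 2 * τ * β * z.1 * f z) := by
    ring
  simp only [mul_one] at a1 a2 a3
  rw [e0] at a0
  have p0 := sq_nonneg (e * (pd f et z - 2 * τ * β * z.1 * f z))
  have p1 := sq_nonneg (e * (pd f (ex 0) z + 2 * τ * (z.2 0 - x0 0) * f z))
  have p2 := sq_nonneg (e * (pd f (ex 1) z + 2 * τ * (z.2 1 - x0 1) * f z))
  have p3 := sq_nonneg (e * (pd f (ex 2) z + 2 * τ * (z.2 2 - x0 2) * f z))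
  generalize (e * (pd f et z - 2 * τ * β * z.1 * f z)) ^ 2 = X0 at *
  generalize (e * (pd f (ex 0) z + 2 * τ * (z.2 0 - x0 0) * f z)) ^ 2 = X1 at *
  generalize (e * (pd f (ex 1) z + 2 * τ * (z.2 1 - x0 1) * f z)) ^ 2 = X2 at *
  generalize (e * (pd f (ex 2) z + 2 * τ * (z.2 2 - x0 2) * f z)) ^ 2 = X3 at *
  have hc : 0 ≤ (8 * (β ^ 2 + 3) * K ^ 2) * (X0 + (X1 + X2 + X3)) := by positivity
  rw [add_mul _ _ (e ^ 2), hr']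
  linarith

theorem exists_wave_carleman {x0 : V3} {β k δ K : ℝ} {a : V3 → ℝ} {S : Set P4}
    (h : WaveAdm x0 β k δ K a S) :
    ∃ C : ℝ, 1 ≤ C ∧ ∀ τ : ℝ, C ≤ τ → ∀ f : P4 → ℝ, ContDiff ℝ 2 f → HasCompactSupport f →
      tsupport f ⊆ S →
      (τ * ∫ z, (gradT2 f z + τ ^ 2 * f z ^ 2) * wt x0 β τ z)
        + (∫ x, (gradT2 f (0, x) + τ ^ 2 * f (0, x) ^ 2) * wt x0 β τ (0, x))
        ≤ C * ∫ z, (a z.2 * dtt f z - slap f z) ^ 2 * wt x0 β τ z := by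
  obtain ⟨C0, hC0, H⟩ := exists_conj_trace h
  obtain ⟨M, hM⟩ : ∃ M, M = 3 + 8 * (β ^ 2 + 3) * K ^ 2 := ⟨_, rfl⟩
  have hM1 : 1 ≤ M := by
    have : 0 ≤ 8 * (β ^ 2 + 3) * K ^ 2 := by positivity
    linarith
  refine ⟨M * C0, one_le_mul_of_one_le_of_one_le hM1 hC0, fun τ hτ f hf hfc hfS => ?_⟩
  have hτ0 : C0 ≤ τ := (le_mul_of_one_le_left (by linarith) hM1).trans hτ
  obtain ⟨g, hg⟩ : ∃ g, g = fun z => ewt x0 β τ z * f z := ⟨_, rfl⟩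
  have hgC : ContDiff ℝ 2 g := hg ▸ (contDiff_ewt x0 β τ).mul hf
  have hgS : tsupport g ⊆ tsupport f := hg ▸ tsupport_mul_subset_right
  have hgc : HasCompactSupport g := hg ▸ hfc.mul_left
  have key := H τ hτ0 g hgC hgc (hgS.trans hfS)
  have eL : ∀ z, conjOp x0 β τ a g z ^ 2 = (a z.2 * dtt f z - slap f z) ^ 2 * wt x0 β τ z := by
    intro z
    rw [hg, conjOp_ewt_mul x0 β τ a hf, ← ewt_sq]; ring
  simp only [eL] at key
  have point : ∀ z, (gradT2 f z + τ ^ 2 * f z ^ 2) * wt x0 β τ z ≤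
      M * (gradT2 g z + τ ^ 2 * g z ^ 2) := by
    intro z
    by_cases hz : z ∈ tsupport f
    · rw [hg, hM]
      exact gradT2_mul_wt_le hf (h.time z (hfS hz)) (h.space z (hfS hz))
    · have : 0 ≤ gradT2 g z := by unfold gradT2; positivity
      have e : gradT2 f z + τ ^ 2 * f z ^ 2 = 0 := by
        simp [gradT2, pd_eq_zero_of_notMem _ hz, image_eq_zero_of_notMem_tsupport hz]
      rw [e, zero_mul]
      positivity
  have cN : ∀ {f : P4 → ℝ}, ContDiff ℝ 2 f → Continuous fun z => gradT2 f z + τ ^ 2 * f z ^ 2 := by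
    intro f hf
    have : ∀ d, Continuous (pd f d) := fun d => (hf.pd d (m := 1) (by norm_num)).continuous
    have := hf.continuous
    unfold gradT2; fun_prop
  have sN : ∀ {f : P4 → ℝ}, HasCompactSupport f →
      HasCompactSupport fun z => gradT2 f z + τ ^ 2 * f z ^ 2 := fun hfc =>
    hfc.of_forall_notMem_tsupport fun z hz => by
      simp [gradT2, pd_eq_zero_of_notMem _ hz, image_eq_zero_of_notMem_tsupport hz]
  have cw : Continuous (wt x0 β τ) := (contDiff_wt x0 β τ (n := 0)).continuous
  have emb : Continuous fun x : V3 => ((0 : ℝ), x) := by fun_prop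
  have cc : Topology.IsClosedEmbedding fun x : V3 => ((0 : ℝ), x) := by
    refine Topology.IsClosedEmbedding.of_continuous_injective_isClosedMap emb ?_ ?_
    · intro x y hxy; simpa using hxy
    · intro s hs
      have : (fun x : V3 => ((0 : ℝ), x)) '' s = {0} ×ˢ s := by ext ⟨t, x⟩; simp [eq_comm, and_comm]
      rw [this]; exact isClosed_singleton.prod hs
  have i1 : ∫ z, (gradT2 f z + τ ^ 2 * f z ^ 2) * wt x0 β τ z ≤
      M * ∫ z, gradT2 g z + τ ^ 2 * g z ^ 2 := by
    rw [← integral_const_mul]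
    exact integral_mono (((cN hf).mul cw).integrable_of_hasCompactSupport (sN hfc).mul_right)
      (((cN hgC).integrable_of_hasCompactSupport (sN hgc)).const_mul M) point
  have i2 : ∫ x, (gradT2 f (0, x) + τ ^ 2 * f (0, x) ^ 2) * wt x0 β τ (0, x) ≤
      M * ∫ x, gradT2 g (0, x) + τ ^ 2 * g (0, x) ^ 2 := by
    rw [← integral_const_mul]
    exact integral_mono
      ((((cN hf).mul cw).comp emb).integrable_of_hasCompactSupport
        ((sN hfc).mul_right.comp_isClosedEmbedding cc))
      ((((cN hgC).comp emb).integrable_of_hasCompactSupport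
        ((sN hgc).comp_isClosedEmbedding cc)).const_mul M) fun x => point (0, x)
  have hτ' : 0 ≤ τ := by linarith
  have j1 := mul_le_mul_of_nonneg_left i1 hτ'
  have j2 := mul_le_mul_of_nonneg_left key (by linarith : 0 ≤ M)
  linarith

/-- The squared first-order jet of a scalar function on space-time. -/
def jet2 (f : P4 → ℝ) (z : P4) : ℝ := f z ^ 2 + gradT2 f z

theorem gradT2_nonneg (f : P4 → ℝ) (z : P4) : 0 ≤ gradT2 f z := by unfold gradT2; positivity

theorem jet2_nonneg (f : P4 → ℝ) (z : P4) : 0 ≤ jet2 f z :=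
  add_nonneg (sq_nonneg _) (gradT2_nonneg f z)

theorem continuous_gradT2 {f : P4 → ℝ} (hf : ContDiff ℝ 1 f) : Continuous (gradT2 f) := by
  have : ∀ d, Continuous (pd f d) := fun d => (hf.pd d (m := 0) (by norm_num)).continuous
  unfold gradT2; fun_prop

theorem continuous_jet2 {f : P4 → ℝ} (hf : ContDiff ℝ 1 f) : Continuous (jet2 f) := by
  have := continuous_gradT2 hf
  have := hf.continuous
  unfold jet2; fun_prop

theorem sq_pd_et_le_jet2 (f : P4 → ℝ) (z : P4) : pd f et z ^ 2 ≤ jet2 f z := by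
  unfold jet2 gradT2
  have : 0 ≤ ∑ j, pd f (ex j) z ^ 2 := by positivity
  nlinarith [sq_nonneg (f z)]

theorem sq_pd_ex_le_jet2 (f : P4 → ℝ) (i : Fin 3) (z : P4) : pd f (ex i) z ^ 2 ≤ jet2 f z := by
  unfold jet2 gradT2
  have := Finset.single_le_sum (f := fun j => pd f (ex j) z ^ 2) (fun j _ => sq_nonneg _)
    (Finset.mem_univ i)
  nlinarith [sq_nonneg (f z), sq_nonneg (pd f et z)]

theorem sq_le_jet2 (f : P4 → ℝ) (z : P4) : f z ^ 2 ≤ jet2 f z :=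
  le_add_of_nonneg_right (gradT2_nonneg f z)

theorem pd_mul_fun {f g : P4 → ℝ} (d : P4) (hf : ContDiff ℝ 1 f) (hg : ContDiff ℝ 1 g) :
    pd (fun y => f y * g y) d = fun z => pd f d z * g z + f z * pd g d z := by
  funext z
  exact pd_mul d (hf.differentiable (by norm_num) z) (hg.differentiable (by norm_num) z)

theorem pd_pd_mul {f g : P4 → ℝ} (d : P4) (hf : ContDiff ℝ 2 f) (hg : ContDiff ℝ 2 g) (z : P4) :
    pd (pd (fun y => f y * g y) d) d z =
      pd (pd f d) d z * g z + 2 * (pd f d z * pd g d z) + f z * pd (pd g d) d z := by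
  have h1 : Differentiable ℝ f := hf.differentiable (by norm_num)
  have h2 : Differentiable ℝ g := hg.differentiable (by norm_num)
  have h3 : Differentiable ℝ (pd f d) := (hf.pd d (m := 1) (by norm_num)).differentiable (by norm_num)
  have h4 : Differentiable ℝ (pd g d) := (hg.pd d (m := 1) (by norm_num)).differentiable (by norm_num)
  rw [pd_mul_fun d (hf.of_le (by norm_num)) (hg.of_le (by norm_num))]
  simp (disch := fun_prop) only [pd_mul, pd_add]
  ring

theorem gradT2_mul_le {ζ f : P4 → ℝ} (hζ : ContDiff ℝ 1 ζ) (hf : ContDiff ℝ 1 f) (z : P4) :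
    ζ z ^ 2 * gradT2 f z ≤ 2 * gradT2 (fun y => ζ y * f y) z + 2 * (gradT2 ζ z * f z ^ 2) := by
  simp only [gradT2, pd_mul_fun _ hζ hf, Fin.sum_univ_three]
  have gen : ∀ a b : ℝ, (ζ z * b) ^ 2 ≤ 2 * (a * f z + ζ z * b) ^ 2 + 2 * (a ^ 2 * f z ^ 2) := by
    intro a b; nlinarith [sq_nonneg (ζ z * b + 2 * (a * f z))]
  have h0 := gen (pd ζ et z) (pd f et z)
  have h1 := gen (pd ζ (ex 0) z) (pd f (ex 0) z)
  have h2 := gen (pd ζ (ex 1) z) (pd f (ex 1) z)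
  have h3 := gen (pd ζ (ex 2) z) (pd f (ex 2) z)
  simp only [mul_pow] at h0 h1 h2 h3
  linarith

/-- The commutator of the wave operator with a cut-off. -/
def waveComm (c : ℝ) (ζ f : P4 → ℝ) (z : P4) : ℝ :=
  dtt ζ z * f z + 2 * (pd ζ et z * pd f et z)
    - c * (slap ζ z * f z + 2 * ∑ i, pd ζ (ex i) z * pd f (ex i) z)

theorem wave_mul {ζ f : P4 → ℝ} (hζ : ContDiff ℝ 2 ζ) (hf : ContDiff ℝ 2 f) (c : ℝ) (z : P4) :
    dtt (fun y => ζ y * f y) z - c * slap (fun y => ζ y * f y) z =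
      ζ z * (dtt f z - c * slap f z) + waveComm c ζ f z := by
  simp only [dtt, slap, waveComm, pd_pd_mul _ hζ hf, Fin.sum_univ_three]
  ring

theorem waveComm_sq_le {c K : ℝ} {ζ f : P4 → ℝ} {z : P4} (hc : |c| ≤ K) (h0 : |dtt ζ z| ≤ K)
    (h1 : |slap ζ z| ≤ K) (h2 : |pd ζ et z| ≤ K) (h3 : ∀ i, |pd ζ (ex i) z| ≤ K) :
    waveComm c ζ f z ^ 2 ≤ 6 * (K ^ 2 + 4 * K ^ 2 + K ^ 4 + 12 * K ^ 4) * jet2 f z := by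
  have sq : ∀ {x : ℝ}, |x| ≤ K → x ^ 2 ≤ K ^ 2 := fun hx =>
    sq_le_sq' (abs_le.1 hx).1 (abs_le.1 hx).2
  have hJ := jet2_nonneg f z
  have b0 : (dtt ζ z * f z) ^ 2 ≤ K ^ 2 * jet2 f z := by
    rw [mul_pow]; exact mul_le_mul (sq h0) (sq_le_jet2 f z) (sq_nonneg _) (sq_nonneg _)
  have b1 : (pd ζ et z * pd f et z) ^ 2 ≤ K ^ 2 * jet2 f z := by
    rw [mul_pow]; exact mul_le_mul (sq h2) (sq_pd_et_le_jet2 f z) (sq_nonneg _) (sq_nonneg _)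
  have b2 : (c * (slap ζ z * f z)) ^ 2 ≤ K ^ 4 * jet2 f z := by
    have : (c * (slap ζ z * f z)) ^ 2 = c ^ 2 * slap ζ z ^ 2 * f z ^ 2 := by ring
    rw [this, show K ^ 4 = K ^ 2 * K ^ 2 by ring]
    exact mul_le_mul (mul_le_mul (sq hc) (sq h1) (sq_nonneg _) (sq_nonneg _)) (sq_le_jet2 f z)
      (sq_nonneg _) (by positivity)
  have b3 : ∀ i, (c * (pd ζ (ex i) z * pd f (ex i) z)) ^ 2 ≤ K ^ 4 * jet2 f z := fun i => by
    have : (c * (pd ζ (ex i) z * pd f (ex i) z)) ^ 2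
      = c ^ 2 * pd ζ (ex i) z ^ 2 * pd f (ex i) z ^ 2 := by ring
    rw [this, show K ^ 4 = K ^ 2 * K ^ 2 by ring]
    exact mul_le_mul (mul_le_mul (sq hc) (sq (h3 i)) (sq_nonneg _) (sq_nonneg _))
      (sq_pd_ex_le_jet2 f i z) (sq_nonneg _) (by positivity)
  have e : waveComm c ζ f z = dtt ζ z * f z + 2 * (pd ζ et z * pd f et z) - c * (slap ζ z * f z)
      - 2 * (c * (pd ζ (ex 0) z * pd f (ex 0) z)) - 2 * (c * (pd ζ (ex 1) z * pd f (ex 1) z))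
      - 2 * (c * (pd ζ (ex 2) z * pd f (ex 2) z)) := by
    simp only [waveComm, Fin.sum_univ_three]; ring
  rw [e]
  have six : ∀ a b c d e f : ℝ, (a + 2 * b - c - 2 * d - 2 * e - 2 * f) ^ 2 ≤
      6 * (a ^ 2 + 4 * b ^ 2 + c ^ 2 + 4 * d ^ 2 + 4 * e ^ 2 + 4 * f ^ 2) := by
    intro a b c d e f
    nlinarith [sq_nonneg (a - 2 * b), sq_nonneg (a + c), sq_nonneg (a + 2 * d),
      sq_nonneg (a + 2 * e), sq_nonneg (a + 2 * f), sq_nonneg (2 * b + c),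
      sq_nonneg (2 * b + 2 * d), sq_nonneg (2 * b + 2 * e), sq_nonneg (2 * b + 2 * f),
      sq_nonneg (c - 2 * d), sq_nonneg (c - 2 * e), sq_nonneg (c - 2 * f),
      sq_nonneg (2 * d - 2 * e), sq_nonneg (2 * d - 2 * f), sq_nonneg (2 * e - 2 * f)]
  refine (six _ _ _ _ _ _).trans ?_
  have := b3 0
  have := b3 1
  have := b3 2
  linarith

theorem Continuous.exists_abs_le_of_isCompact {X : Type*} [TopologicalSpace X] {f : X → ℝ}
    (hf : Continuous f) {s : Set X} (hs : IsCompact s) : ∃ K, 1 ≤ K ∧ ∀ x ∈ s, |f x| ≤ K := by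
  obtain ⟨C, hC⟩ := hs.exists_bound_of_continuousOn hf.continuousOn
  exact ⟨max 1 C, le_max_left _ _, fun x hx => (hC x hx).trans (le_max_right _ _)⟩

theorem exists_abs_le_of_isCompact {X ι : Type*} [TopologicalSpace X] [Finite ι] {f : ι → X → ℝ}
    (hf : ∀ i, Continuous (f i)) {s : Set X} (hs : IsCompact s) :
    ∃ K, 1 ≤ K ∧ ∀ i, ∀ x ∈ s, |f i x| ≤ K := by
  cases nonempty_fintype ι
  choose K h1 hK using fun i => (hf i).exists_abs_le_of_isCompact hs
  refine ⟨1 + ∑ i, K i, ?_, fun i x hx => (hK i x hx).trans ?_⟩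
  · have := Finset.sum_nonneg (s := Finset.univ) (f := K) fun i _ => by linarith [h1 i]
    linarith
  · have := Finset.single_le_sum (f := K) (fun i _ => by linarith [h1 i]) (Finset.mem_univ i)
    linarith

theorem pd_eq_zero_on_compl {f : P4 → ℝ} {S : Set P4} (h : tsupport f ⊆ S) {z : P4} (hz : z ∉ S) :
    f z = 0 ∧ (∀ d, pd f d z = 0) ∧ ∀ d e, pd (pd f d) e z = 0 :=
  ⟨image_eq_zero_of_notMem_tsupport fun h' => hz (h h'),
    fun d => pd_eq_zero_of_notMem d fun h' => hz (h h'),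
    fun d e => pd_pd_eq_zero_of_notMem d e fun h' => hz (h h')⟩

theorem jet2_eq_zero_of_notMem {f : P4 → ℝ} {S : Set P4} (h : tsupport f ⊆ S) {z : P4}
    (hz : z ∉ S) : jet2 f z = 0 := by
  obtain ⟨h0, h1, -⟩ := pd_eq_zero_on_compl h hz
  simp [jet2, gradT2, h0, h1]

theorem tsupport_mul_subset {X : Type*} [TopologicalSpace X] (f g : X → ℝ) :
    tsupport (fun y => f y * g y) ⊆ tsupport f :=
  closure_mono (Function.support_mul_subset_left f g)

/-- The pointwise estimate behind the localisation of the wave Carleman inequality. -/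
theorem wave_cutoff_sq_le {ι : Type*} [Fintype ι] {f : ι → P4 → ℝ} (hf : ∀ l, ContDiff ℝ 2 (f l))
    {ζ : P4 → ℝ} (hζ : ContDiff ℝ 2 ζ) {a c K K0 s χ : ℝ} {z : P4} (hK : 1 ≤ K) (hK0 : 0 ≤ K0)
    (hs : 0 ≤ s) (hac : a * c = 1) (ha : |a| ≤ K) (hc : |c| ≤ K) (h0 : |dtt ζ z| ≤ K)
    (h1 : |slap ζ z| ≤ K) (h2 : |pd ζ et z| ≤ K) (h3 : ∀ i, |pd ζ (ex i) z| ≤ K)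
    (hχ : χ = 1 ∨ χ = 0 ∧ dtt ζ z = 0 ∧ slap ζ z = 0 ∧ pd ζ et z = 0 ∧ ∀ i, pd ζ (ex i) z = 0)
    (l : ι) (hE : ζ z ≠ 0 → (dtt (f l) z - c * slap (f l) z) ^ 2 ≤ K0 * (∑ m, jet2 (f m) z + s)) :
    (a * dtt (fun y => ζ y * f l y) z - slap (fun y => ζ y * f l y) z) ^ 2 ≤
      (2 * K ^ 2 * K0 * (2 + 8 * K ^ 2) + 12 * K ^ 2 * (K ^ 2 + 4 * K ^ 2 + K ^ 4 + 12 * K ^ 4)) *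
        (∑ m, jet2 (fun y => ζ y * f m y) z + ζ z ^ 2 * s + χ * ∑ m, jet2 (f m) z) := by
  set J := ∑ m, jet2 (f m) z with hJ
  set Jt := ∑ m, jet2 (fun y => ζ y * f m y) z with hJt
  have hJ0 : 0 ≤ J := Finset.sum_nonneg fun m _ => jet2_nonneg _ _
  have hJt0 : 0 ≤ Jt := Finset.sum_nonneg fun m _ => jet2_nonneg _ _
  have hχ0 : 0 ≤ χ := by rcases hχ with h | h <;> simp [h]
  have hlJ : jet2 (f l) z ≤ J := Finset.single_le_sum (f := fun m => jet2 (f m) z)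
    (fun m _ => jet2_nonneg _ _) (Finset.mem_univ l)
  set L := K ^ 2 + 4 * K ^ 2 + K ^ 4 + 12 * K ^ 4 with hL
  have hL0 : 0 ≤ L := by positivity
  have hcomm : waveComm c ζ (f l) z ^ 2 ≤ 6 * L * (χ * J) := by
    rcases hχ with h | ⟨h, e0, e1, e2, e3⟩
    · rw [h, one_mul]
      exact (waveComm_sq_le hc h0 h1 h2 h3).trans (by gcongr)
    · simp [waveComm, h, e0, e1, e2, e3]
  have sq : ∀ {x : ℝ}, |x| ≤ K → x ^ 2 ≤ K ^ 2 := fun hx =>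
    sq_le_sq' (abs_le.1 hx).1 (abs_le.1 hx).2
  have hgrad : gradT2 ζ z ≤ 4 * K ^ 2 * χ := by
    rcases hχ with h | ⟨h, e0, e1, e2, e3⟩
    · simp only [gradT2, Fin.sum_univ_three, h]
      linarith [sq h2, sq (h3 0), sq (h3 1), sq (h3 2)]
    · simp [gradT2, h, e2, e3]
  have hζJ : ζ z ^ 2 * J ≤ 2 * Jt + 8 * K ^ 2 * (χ * J) := by
    rw [hJ, hJt, Finset.mul_sum, Finset.mul_sum, Finset.mul_sum, Finset.mul_sum,
      ← Finset.sum_add_distrib]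
    refine Finset.sum_le_sum fun m _ => ?_
    have := gradT2_mul_le (hζ.of_le (by norm_num)) ((hf m).of_le (by norm_num)) z
    have h4 : gradT2 ζ z * f m z ^ 2 ≤ 4 * K ^ 2 * χ * jet2 (f m) z :=
      mul_le_mul hgrad (sq_le_jet2 _ _) (sq_nonneg _) (by positivity)
    simp only [jet2] at *
    nlinarith [sq_nonneg (ζ z * f m z)]
  have hmain : ζ z ^ 2 * (dtt (f l) z - c * slap (f l) z) ^ 2 ≤
      K0 * (2 * Jt + 8 * K ^ 2 * (χ * J) + ζ z ^ 2 * s) := by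
    by_cases hz : ζ z = 0
    · rw [hz]; simp; positivity
    · calc _ ≤ ζ z ^ 2 * (K0 * (J + s)) := by gcongr; exact hE hz
        _ = K0 * (ζ z ^ 2 * J + ζ z ^ 2 * s) := by ring
        _ ≤ _ := by gcongr
  have e : a * dtt (fun y => ζ y * f l y) z - slap (fun y => ζ y * f l y) z =
      a * (ζ z * (dtt (f l) z - c * slap (f l) z) + waveComm c ζ (f l) z) := by
    rw [← wave_mul hζ (hf l)]
    linear_combination slap (fun y => ζ y * f l y) z * hac
  rw [e, mul_pow]
  have hχJ : 0 ≤ χ * J := by positivity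
  have hζs : 0 ≤ ζ z ^ 2 * s := by positivity
  calc a ^ 2 * (ζ z * (dtt (f l) z - c * slap (f l) z) + waveComm c ζ (f l) z) ^ 2
      ≤ K ^ 2 * (2 * (K0 * (2 * Jt + 8 * K ^ 2 * (χ * J) + ζ z ^ 2 * s)) + 2 * (6 * L * (χ * J))) := by
        refine mul_le_mul (sq ha) ?_ (sq_nonneg _) (sq_nonneg _)
        nlinarith [sq_nonneg (ζ z * (dtt (f l) z - c * slap (f l) z) - waveComm c ζ (f l) z)]
    _ ≤ _ := by
        have A : 2 * Jt + 8 * K ^ 2 * (χ * J) + ζ z ^ 2 * s ≤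
            (2 + 8 * K ^ 2) * (Jt + ζ z ^ 2 * s + χ * J) := by
          have : 0 ≤ K ^ 2 := sq_nonneg _
          nlinarith [mul_nonneg this hJt0, mul_nonneg this hζs]
        have B : χ * J ≤ Jt + ζ z ^ 2 * s + χ * J := by linarith
        calc _ ≤ K ^ 2 * (2 * (K0 * ((2 + 8 * K ^ 2) * (Jt + ζ z ^ 2 * s + χ * J)))
              + 2 * (6 * L * (Jt + ζ z ^ 2 * s + χ * J))) := by gcongr
          _ = _ := by ring

/-- The Carleman inequality, with cut-off and trace at `t = 0`, for a system of wave equations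
which is coupled through terms of first order. -/
theorem exists_system_carleman {ι : Type*} [Fintype ι] {x0 : V3} {β : ℝ} {S B : Set P4}
    {a c : ι → V3 → ℝ} (hS : IsCompact S) (hB : MeasurableSet B)
    (hadm : ∀ l, ∃ k δ K, WaveAdm x0 β k δ K (a l) S)
    (hac : ∀ l, ∀ z ∈ S, a l z.2 * c l z.2 = 1)
    {ζ : P4 → ℝ} (hζ : ContDiff ℝ 2 ζ) (hζS : tsupport ζ ⊆ S)
    (hζB : ∀ z ∈ S, z ∉ B → (∀ d, pd ζ d z = 0) ∧ ∀ d, pd (pd ζ d) d z = 0) {K0 : ℝ}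
    (hK0 : 0 ≤ K0) :
    ∃ C, 1 ≤ C ∧ ∀ τ, C ≤ τ → ∀ f : ι → P4 → ℝ, (∀ l, ContDiff ℝ 2 (f l)) →
      ∀ s : P4 → ℝ, Continuous s → (∀ z, 0 ≤ s z) →
      (∀ z, ζ z ≠ 0 → ∀ l,
        (dtt (f l) z - c l z.2 * slap (f l) z) ^ 2 ≤ K0 * (∑ m, jet2 (f m) z + s z)) →
      ∑ l, ∫ x, jet2 (fun y => ζ y * f l y) (0, x) * wt x0 β τ (0, x) ≤
        C * ((∫ z in S, ζ z ^ 2 * s z * wt x0 β τ z) +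
          ∫ z in S ∩ B, (∑ m, jet2 (f m) z) * wt x0 β τ z) := by
  choose k δ Ka hadm using hadm
  choose C hC1 hC using fun l => exists_wave_carleman (hadm l)
  have cpd : ∀ d, ContDiff ℝ 1 (pd ζ d) := fun d => hζ.pd d (by norm_num)
  have cpdd : ∀ d e, Continuous (pd (pd ζ d) e) := fun d e =>
    ((cpd d).pd e (m := 0) (by norm_num)).continuous
  have cdtt : Continuous (dtt ζ) := cpdd _ _
  have cslap : Continuous (slap ζ) := by
    unfold slap; exact continuous_finsetSum _ fun i _ => cpdd _ _
  obtain ⟨K1, hK1, hK1'⟩ := cdtt.exists_abs_le_of_isCompact hS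
  obtain ⟨K2, hK2, hK2'⟩ := cslap.exists_abs_le_of_isCompact hS
  obtain ⟨K3, hK3, hK3'⟩ := (cpd et).continuous.exists_abs_le_of_isCompact hS
  obtain ⟨K4, hK4, hK4'⟩ := exists_abs_le_of_isCompact (fun i => (cpd (ex i)).continuous) hS
  have hKa0 : ∀ l, 0 ≤ Ka l := fun l => (hadm l).K_pos.le
  have hδ0 : ∀ l, 0 ≤ (δ l)⁻¹ := fun l => (inv_pos.2 (hadm l).delta_pos).le
  obtain ⟨K, hKdef⟩ : ∃ K, K = K1 + K2 + K3 + K4 + ∑ l, Ka l + ∑ l, (δ l)⁻¹ := ⟨_, rfl⟩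
  have hsK : 0 ≤ ∑ l, Ka l := Finset.sum_nonneg fun l _ => hKa0 l
  have hsδ : 0 ≤ ∑ l, (δ l)⁻¹ := Finset.sum_nonneg fun l _ => hδ0 l
  have hKl : ∀ l, Ka l ≤ K := fun l => by
    have := Finset.single_le_sum (f := Ka) (fun i _ => hKa0 i) (Finset.mem_univ l)
    linarith
  have hδl : ∀ l, (δ l)⁻¹ ≤ K := fun l => by
    have := Finset.single_le_sum (f := fun l => (δ l)⁻¹) (fun i _ => hδ0 i) (Finset.mem_univ l)
    linarith
  have hK1le : 1 ≤ K := by linarith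
  obtain ⟨P, hP⟩ : ∃ P, P = 2 * K ^ 2 * K0 * (2 + 8 * K ^ 2) +
    12 * K ^ 2 * (K ^ 2 + 4 * K ^ 2 + K ^ 4 + 12 * K ^ 4) := ⟨_, rfl⟩
  have hP0 : 0 ≤ P := by rw [hP]; positivity
  obtain ⟨CC, hCC⟩ : ∃ CC, CC = ∑ l, C l := ⟨_, rfl⟩
  have hCC0 : 0 ≤ CC := hCC ▸ Finset.sum_nonneg fun l _ => by linarith [hC1 l]
  have hCl : ∀ l, C l ≤ CC := fun l =>
    hCC ▸ Finset.single_le_sum (f := C) (fun i _ => by linarith [hC1 i]) (Finset.mem_univ l)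
  have hCP := mul_nonneg hCC0 hP0
  refine ⟨1 + CC + CC * P, by linarith, fun τ hτ f hf s hs hs0 hE => ?_⟩
  have hτ1 : 1 ≤ τ := by linarith
  have hτ2 : CC * P ≤ τ := by linarith
  have hft : ∀ l, ContDiff ℝ 2 fun y => ζ y * f l y := fun l => hζ.mul (hf l)
  have hftS : ∀ l, tsupport (fun y => ζ y * f l y) ⊆ S := fun l =>
    (tsupport_mul_subset _ _).trans hζS
  have hftc : ∀ l, HasCompactSupport fun y => ζ y * f l y := fun l =>
    HasCompactSupport.of_support_subset_isCompact hS ((subset_tsupport _).trans (hftS l))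
  have cw : Continuous (wt x0 β τ) := (contDiff_wt (n := 0) _ _ _).continuous
  have hw0 : ∀ z, 0 ≤ wt x0 β τ z := fun z => (wt_pos ..).le
  have cj : ∀ m, Continuous (jet2 (f m)) := fun m => continuous_jet2 ((hf m).of_le (by norm_num))
  have cjt : ∀ m, Continuous (jet2 fun y => ζ y * f m y) := fun m =>
    continuous_jet2 ((hft m).of_le (by norm_num))
  have cg : ∀ m, Continuous (gradT2 fun y => ζ y * f m y) := fun m =>
    continuous_gradT2 ((hft m).of_le (by norm_num))
  have cft : ∀ m, Continuous fun y => ζ y * f m y := fun m => (hft m).continuous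
  have int : ∀ {g : P4 → ℝ}, Continuous g → IntegrableOn g S := fun hg =>
    hg.continuousOn.integrableOn_compact hS
  have cdf : ∀ l, Continuous (dtt fun y => ζ y * f l y) := fun l =>
    (((hft l).pd et (m := 1) (by norm_num)).pd et (m := 0) (by norm_num)).continuous
  have csf : ∀ l, Continuous (slap fun y => ζ y * f l y) := fun l => by
    unfold slap
    exact continuous_finsetSum _ fun i _ =>
      (((hft l).pd (ex i) (m := 1) (by norm_num)).pd (ex i) (m := 0) (by norm_num)).continuous
  have ca : ∀ l, Continuous fun z : P4 => a l z.2 := fun l =>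
    (hadm l).smooth.continuous.comp continuous_snd
  set X := ∫ z in S, (∑ m, jet2 (fun y => ζ y * f m y) z) * wt x0 β τ z with hX
  set Y := ∫ z in S, ζ z ^ 2 * s z * wt x0 β τ z with hY
  set Z := ∫ z in S ∩ B, (∑ m, jet2 (f m) z) * wt x0 β τ z with hZ
  have hSm : MeasurableSet S := hS.isClosed.measurableSet
  have hZ' : Z = ∫ z in S, B.indicator (fun z => (∑ m, jet2 (f m) z) * wt x0 β τ z) z := by
    rw [hZ, setIntegral_indicator hB]
  have csum : Continuous fun z => (∑ m, jet2 (f m) z) * wt x0 β τ z :=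
    (continuous_finsetSum _ fun m _ => cj m).mul cw
  have csumt : Continuous fun z => (∑ m, jet2 (fun y => ζ y * f m y) z) * wt x0 β τ z :=
    (continuous_finsetSum _ fun m _ => cjt m).mul cw
  have iX := int csumt
  have iY : IntegrableOn (fun z => ζ z ^ 2 * s z * wt x0 β τ z) S := int (by
    have := hζ.continuous; fun_prop)
  have iZ := (int csum).indicator hB
  have hXYZ : X + Y + Z = ∫ z in S, ((∑ m, jet2 (fun y => ζ y * f m y) z) * wt x0 β τ z +
      ζ z ^ 2 * s z * wt x0 β τ z +
      B.indicator (fun z => (∑ m, jet2 (f m) z) * wt x0 β τ z) z) := by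
    have h1 := integral_add (iX.add iY) iZ
    have h2 := integral_add iX iY
    rw [hZ', hX, hY, ← h2]
    exact h1.symm
  have iXYZ : IntegrableOn (fun z => (∑ m, jet2 (fun y => ζ y * f m y) z) * wt x0 β τ z +
      ζ z ^ 2 * s z * wt x0 β τ z +
      B.indicator (fun z => (∑ m, jet2 (f m) z) * wt x0 β τ z) z) S := (iX.add iY).add iZ
  have hRHS : ∀ l, ∫ z, (a l z.2 * dtt (fun y => ζ y * f l y) z - slap (fun y => ζ y * f l y) z) ^ 2
      * wt x0 β τ z ≤ P * (X + Y + Z) := by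
    intro l
    rw [← setIntegral_eq_integral_of_forall_compl_eq_zero (s := S)]
    swap
    · intro z hz
      obtain ⟨-, -, h⟩ := pd_eq_zero_on_compl (hftS l) hz
      simp [dtt, slap, h]
    rw [hXYZ, ← integral_const_mul]
    refine setIntegral_mono_on (int ?_) (iXYZ.const_mul P) hSm fun z hz => ?_
    · exact ((((ca l).mul (cdf l)).sub (csf l)).pow 2).mul cw
    · have key := wave_cutoff_sq_le (χ := B.indicator (fun _ => (1 : ℝ)) z) hf hζ hK1le hK0 (hs0 z)
        (hac l z hz) (abs_le.2 ⟨by linarith [(hadm l).lower z hz, (hadm l).delta_pos],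
          ((hadm l).upper z hz).trans (hKl l)⟩) (K := K) (z := z) ?_
        ((hK1' z hz).trans (by linarith)) ((hK2' z hz).trans (by linarith))
        ((hK3' z hz).trans (by linarith)) (fun i => (hK4' i z hz).trans (by linarith)) ?_ l
        (fun h => hE z h l)
      · rw [← hP] at key
        refine (mul_le_mul_of_nonneg_right key (hw0 z)).trans_eq ?_
        by_cases hzB : z ∈ B <;> simp [hzB] <;> ring
      · have h1 := (hadm l).lower z hz
        have h2 := hac l z hz
        have h3 := (hadm l).delta_pos
        have : c l z.2 = (a l z.2)⁻¹ := (inv_eq_of_mul_eq_one_right h2).symm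
        rw [this, abs_of_pos (inv_pos.2 (h3.trans_le h1))]
        exact (inv_anti₀ h3 h1).trans (hδl l)
      · by_cases hzB : z ∈ B
        · simp [hzB]
        · obtain ⟨e1, e2⟩ := hζB z hz hzB
          right; simp [hzB, dtt, slap, e1, e2]
  have hτsq : 1 ≤ τ ^ 2 := one_le_pow₀ hτ1
  have hYnn : 0 ≤ Y := setIntegral_nonneg hSm fun z _ => by
    have := hs0 z; have := hw0 z; positivity
  have hZnn : 0 ≤ Z := integral_nonneg fun z =>
    mul_nonneg (Finset.sum_nonneg fun m _ => jet2_nonneg _ _) (hw0 z)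
  have hXnn : 0 ≤ X := integral_nonneg fun z =>
    mul_nonneg (Finset.sum_nonneg fun m _ => jet2_nonneg _ _) (hw0 z)
  have hbulk : τ * X ≤
      ∑ l, τ * ∫ z, (gradT2 (fun y => ζ y * f l y) z + τ ^ 2 * (ζ z * f l z) ^ 2) * wt x0 β τ z := by
    rw [← Finset.mul_sum]
    refine mul_le_mul_of_nonneg_left ?_ (by linarith)
    have : X = ∑ m, ∫ z in S, jet2 (fun y => ζ y * f m y) z * wt x0 β τ z := by
      have := integral_finsetSum (μ := volume.restrict S) Finset.univ
        (f := fun m z => jet2 (fun y => ζ y * f m y) z * wt x0 β τ z)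
        fun m _ => int ((cjt m).mul cw)
      rw [hX, ← this]
      simp only [Finset.sum_mul]
    rw [this]
    refine Finset.sum_le_sum fun m _ => ?_
    rw [← setIntegral_eq_integral_of_forall_compl_eq_zero (s := S) (f := fun z =>
      (gradT2 (fun y => ζ y * f m y) z + τ ^ 2 * (ζ z * f m z) ^ 2) * wt x0 β τ z)]
    swap
    · intro z hz
      obtain ⟨h0, h, -⟩ := pd_eq_zero_on_compl (hftS m) hz
      simp_all [gradT2]
    have h1 := cg m
    have h2 := cft m
    have h3 : Continuous fun z => (gradT2 (fun y => ζ y * f m y) z + τ ^ 2 * (ζ z * f m z) ^ 2) *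
        wt x0 β τ z := by fun_prop
    have h4 : Continuous fun z => jet2 (fun y => ζ y * f m y) z * wt x0 β τ z := (cjt m).mul cw
    refine setIntegral_mono_on (int h4) (int h3) hSm fun z _ => ?_
    refine mul_le_mul_of_nonneg_right ?_ (hw0 z)
    have := mul_le_mul_of_nonneg_right hτsq (sq_nonneg (ζ z * f m z))
    unfold jet2
    linarith
  have htr : ∀ l, ∫ x, jet2 (fun y => ζ y * f l y) (0, x) * wt x0 β τ (0, x) ≤
      ∫ x, (gradT2 (fun y => ζ y * f l y) (0, x) + τ ^ 2 * (ζ (0, x) * f l (0, x)) ^ 2) *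
        wt x0 β τ (0, x) := by
    intro l
    have := cg l; have := cft l; have := cjt l
    have hc0 : Continuous fun x : V3 => ((0 : ℝ), x) := by fun_prop
    have ib : ∀ g : P4 → ℝ, Continuous g → (∀ z, z ∉ S → g z = 0) →
        Integrable fun x : V3 => g (0, x) := by
      intro g hg hgS
      refine (hg.comp hc0).integrable_of_hasCompactSupport
        (HasCompactSupport.intro (hS.image continuous_snd) fun x hx => hgS _ fun h => hx ⟨_, h, rfl⟩)
    refine integral_mono (ib (fun z => jet2 (fun y => ζ y * f l y) z * wt x0 β τ z)
      (by fun_prop) fun z hz => by simp [jet2_eq_zero_of_notMem (hftS l) hz]) (ib (fun z =>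
        (gradT2 (fun y => ζ y * f l y) z + τ ^ 2 * (ζ z * f l z) ^ 2) * wt x0 β τ z)
        (by fun_prop) fun z hz => ?_) fun x => ?_
    · obtain ⟨h0, h, -⟩ := pd_eq_zero_on_compl (hftS l) hz
      simp_all [gradT2]
    · refine mul_le_mul_of_nonneg_right ?_ (hw0 _)
      have := mul_le_mul_of_nonneg_right hτsq (sq_nonneg (ζ (0, x) * f l (0, x)))
      unfold jet2
      linarith
  have hsum := Finset.sum_le_sum (s := Finset.univ) fun l (_ : l ∈ Finset.univ) =>
    (hC l τ (by linarith [hCl l]) _ (hft l) (hftc l) (hftS l)).trans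
      (mul_le_mul_of_nonneg_left (hRHS l) (by linarith [hC1 l]))
  rw [Finset.sum_add_distrib, ← Finset.sum_mul, ← hCC] at hsum
  have h2 := Finset.sum_le_sum (s := Finset.univ) fun l (_ : l ∈ Finset.univ) => htr l
  have h3 : CC * P * X ≤ τ * X := mul_le_mul_of_nonneg_right hτ2 hXnn
  calc _ ≤ CC * P * (Y + Z) := by linarith
    _ ≤ _ := by
      refine mul_le_mul_of_nonneg_right ?_ (by linarith)
      linarith

theorem exists_contDiff_cutoff {E : Type*} [NormedAddCommGroup E] [NormedSpace ℝ E]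
    [FiniteDimensional ℝ E] {t U : Set E} (ht : IsClosed t) (hU : IsOpen U) (h : t ⊆ U) (n : ℕ∞) :
    ∃ χ : E → ℝ, ContDiff ℝ n χ ∧ tsupport χ ⊆ U ∧ ∀ᶠ x in nhdsSet t, χ x = 1 := by
  obtain ⟨f, h0, h1, -⟩ := exists_contMDiffMap_zero_one_nhds_of_isClosed (n := n)
    (modelWithCornersSelf ℝ E) hU.isClosed_compl ht
    (disjoint_compl_left_iff_subset.2 h)
  refine ⟨f, f.contMDiff.contDiff, fun x hx => ?_, h1⟩
  by_contra hxU
  have := h0.filter_mono (nhds_le_nhdsSet hxU)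
  exact (notMem_tsupport_iff_eventuallyEq.2 this) hx

theorem exists_contDiff_mul_eq_one {E : Type*} [NormedAddCommGroup E] [NormedSpace ℝ E]
    [FiniteDimensional ℝ E] {t : Set E} (ht : IsClosed t) {n : ℕ∞} {f : E → ℝ}
    (hf : ContDiff ℝ n f) (h : ∀ x ∈ t, f x ≠ 0) :
    ∃ g : E → ℝ, ContDiff ℝ n g ∧ ∀ᶠ x in nhdsSet t, f x * g x = 1 := by
  have hU : IsOpen {x | f x ≠ 0} := isOpen_ne_fun hf.continuous continuous_const
  obtain ⟨χ, hχ, hχs, hχ1⟩ := exists_contDiff_cutoff ht hU h n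
  refine ⟨fun x => χ x * (f x)⁻¹, contDiff_iff_contDiffAt.2 fun x => ?_, ?_⟩
  · by_cases hx : f x = 0
    · have : (fun x => χ x * (f x)⁻¹) =ᶠ[nhds x] fun _ => 0 := by
        filter_upwards [notMem_tsupport_iff_eventuallyEq.1 fun h' => hχs h' hx] with y hy
        simp [hy]
      exact contDiffAt_const.congr_of_eventuallyEq this
    · exact hχ.contDiffAt.mul (hf.contDiffAt.inv hx)
  · filter_upwards [hχ1, hU.mem_nhdsSet.2 h] with x hx hx'
    rw [hx, one_mul, mul_inv_cancel₀ hx']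

/-- The algebraic inequality behind pseudoconvexity of the weight. -/
theorem pseudoconvex_form_le {a k β t g s0 s1 s2 s3 G e η m w : ℝ} (he : 0 ≤ e) (ha : 0 ≤ a)
    (hae : a ≤ e ^ 2) (hw : w = 4 * β * t * G) (hG : |G| ≤ a ^ 2 * m * √(s1 ^ 2 + s2 ^ 2 + s3 ^ 2))
    (hβt : |β * t| ≤ η) (hm : 0 ≤ m)
    (hk : k * a ≤ g) :
    (k - 2 * η * m * e ^ 3) * (s1 ^ 2 + s2 ^ 2 + s3 ^ 2 + a * s0 ^ 2) ≤
      k * (s1 ^ 2 + s2 ^ 2 + s3 ^ 2) + w * s0 + g * s0 ^ 2 := by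
  set q := √(s1 ^ 2 + s2 ^ 2 + s3 ^ 2) with hq
  have hq0 : 0 ≤ q := Real.sqrt_nonneg _
  have hqq : q ^ 2 = s1 ^ 2 + s2 ^ 2 + s3 ^ 2 := Real.sq_sqrt (by positivity)
  rw [← hqq]
  have hη : 0 ≤ η := (abs_nonneg _).trans hβt
  set σ := √a with hσ
  have hσ0 : 0 ≤ σ := Real.sqrt_nonneg _
  have hσσ : σ ^ 2 = a := Real.sq_sqrt ha
  have hσe : σ ≤ e := Real.sqrt_le_iff.2 ⟨he, hae⟩
  have h1 : |w * s0| ≤ 4 * (η * (a ^ 2 * m * q)) * |s0| := by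
    rw [hw, abs_mul]
    refine mul_le_mul_of_nonneg_right ?_ (abs_nonneg _)
    rw [show 4 * β * t * G = 4 * ((β * t) * G) by ring, abs_mul, abs_mul (β * t), abs_of_pos four_pos]
    gcongr
  have h2 : 4 * (η * (a ^ 2 * m * q)) * |s0| ≤ 2 * η * m * e ^ 3 * (q ^ 2 + a * s0 ^ 2) := by
    have h3 : 2 * (σ ^ 3 * (q * (σ * |s0|))) ≤ e ^ 3 * (q ^ 2 + a * s0 ^ 2) := by
      have h4 : 2 * (q * (σ * |s0|)) ≤ q ^ 2 + a * s0 ^ 2 := by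
        rw [← hσσ, ← sq_abs s0]; nlinarith [sq_nonneg (q - σ * |s0|)]
      calc 2 * (σ ^ 3 * (q * (σ * |s0|))) = σ ^ 3 * (2 * (q * (σ * |s0|))) := by ring
        _ ≤ e ^ 3 * (q ^ 2 + a * s0 ^ 2) := by gcongr
    have := mul_le_mul_of_nonneg_left h3 (mul_nonneg (mul_nonneg zero_le_two hη) hm)
    rw [← hσσ] at this ⊢
    linarith
  have h5 : k * a * s0 ^ 2 ≤ g * s0 ^ 2 := mul_le_mul_of_nonneg_right hk (sq_nonneg _)
  have := (abs_le.1 (h1.trans h2)).1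
  linarith

theorem abs_fderiv_sum_le {c : V3 → ℝ} {x : V3} {m : ℝ} (hm : ‖fderiv ℝ c x‖ ≤ m) (s1 s2 s3 : ℝ) :
    |s1 * pdx c 0 x + s2 * pdx c 1 x + s3 * pdx c 2 x| ≤ m * √(s1 ^ 2 + s2 ^ 2 + s3 ^ 2) := by
  have e : s1 * pdx c 0 x + s2 * pdx c 1 x + s3 * pdx c 2 x = fderiv ℝ c x ![s1, s2, s3] := by
    have : (![s1, s2, s3] : V3) = s1 • Pi.single 0 1 + s2 • Pi.single 1 1 + s3 • Pi.single 2 1 := by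
      ext i; fin_cases i <;> simp
    rw [this, map_add, map_add, map_smul, map_smul, map_smul]
    rfl
  rw [e, ← Real.norm_eq_abs]
  refine (ContinuousLinearMap.le_opNorm _ _).trans ?_
  refine mul_le_mul hm ?_ (norm_nonneg _) ((norm_nonneg _).trans hm)
  refine (pi_norm_le_iff_of_nonneg (Real.sqrt_nonneg _)).2 fun i => ?_
  rw [Real.norm_eq_abs]
  refine Real.abs_le_sqrt ?_
  fin_cases i <;> simp <;> nlinarith [sq_nonneg s1, sq_nonneg s2, sq_nonneg s3]

/-- The speeds of the class `𝒞(m, θ)` are admissible for the wave Carleman estimate. -/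
theorem exists_waveAdm {Ω : Set V3} {x0 : V3} {m θ c0 cs d β T2 : ℝ} {c : V3 → ℝ}
    (hΩ : Bornology.IsBounded Ω) (hc : CClass Ω x0 m θ cs c)
    (hm : 0 < m) (hc0 : 0 < c0)
    (hcs : c0 ≤ cs) (hβ : 0 < β) (hT2 : 0 < T2) (hθ : θ < 1)
    (hd : ∀ x ∈ closure Ω, d ^ 2 ≤ sqd x0 x) (h1 : β + β * T2 * m / √c0 < θ * c0)
    (h2 : β ^ 2 * T2 ^ 2 < c0 * d ^ 2) :
    ∃ a : V3 → ℝ, (∀ x ∈ closure Ω, a x * c x = 1) ∧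
      ∃ k δ K, WaveAdm x0 β k δ K a (Icc (-T2) T2 ×ˢ closure Ω) := by
  obtain ⟨hC2, -, hlow, hup, hconv⟩ := hc
  have hcomp : IsCompact (closure Ω) := hΩ.isCompact_closure
  have hclow : ∀ x ∈ closure Ω, c0 < c x := fun x hx => hcs.trans_lt (hlow x hx)
  have hcpos : ∀ x ∈ closure Ω, 0 < c x := fun x hx => hc0.trans (hclow x hx)
  obtain ⟨a, haC, hac⟩ := exists_contDiff_mul_eq_one (n := 2) isClosed_closure hC2
    fun x hx => (hcpos x hx).ne'
  have hac' : ∀ x ∈ closure Ω, c x * a x = 1 := fun x hx => hac.self_of_nhdsSet x hx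
  have hainv : ∀ x ∈ closure Ω, a x = (c x)⁻¹ := fun x hx =>
    (inv_eq_of_mul_eq_one_right (hac' x hx)).symm
  have hapos : ∀ x ∈ closure Ω, 0 < a x := fun x hx => by
    rw [hainv x hx]; exact inv_pos.2 (hcpos x hx)
  have hgrad : ∀ x ∈ closure Ω, ∀ i, pdx a i x = -(a x ^ 2 * pdx c i x) := by
    intro x hx i
    have e : pdx (fun y => c y * a y) i x = 0 := by
      have : (fun y => c y * a y) =ᶠ[nhds x] fun _ => 1 := hac.filter_mono (nhds_le_nhdsSet hx)
      rw [pdx_congr i this, pdx_const]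
    rw [pdx_mul i (hC2.differentiable (by norm_num) x) (haC.differentiable (by norm_num) x)] at e
    linear_combination a x * e - (pdx a i x) * hac' x hx
  obtain ⟨Kg, hKg, hKg'⟩ := exists_abs_le_of_isCompact
    (fun i => ((haC.pdx i (m := 1) (by norm_num)).continuous)) hcomp
  obtain ⟨Ks, hKs, hKs'⟩ := exists_abs_le_of_isCompact (ι := Fin 3)
    (f := fun i (x : V3) => x i - x0 i) (fun i => by fun_prop) hcomp
  have hs0 : 0 < √c0 := Real.sqrt_pos.2 hc0
  set e := (√c0)⁻¹ with he
  have he0 : 0 < e := inv_pos.2 hs0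
  have he2 : e ^ 2 = c0⁻¹ := by rw [he, inv_pow, Real.sq_sqrt hc0.le]
  have hae : ∀ x ∈ closure Ω, a x ≤ e ^ 2 := fun x hx => by
    rw [he2, hainv x hx]; exact inv_anti₀ hc0 (hclow x hx).le
  have ham : ∀ x ∈ closure Ω, m⁻¹ ≤ a x := fun x hx => by
    rw [hainv x hx]; exact inv_anti₀ (hcpos x hx) ((le_abs_self _).trans (hup x hx).1)
  set k := 2 * (θ - β * c0⁻¹) with hk
  have hδ1 : 0 < k - 2 * (β * T2) * m * e ^ 3 := by
    have : k - 2 * (β * T2) * m * e ^ 3 = 2 * c0⁻¹ * (θ * c0 - β - β * T2 * m / √c0) := by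
      rw [hk, show e ^ 3 = e ^ 2 * e by ring, he2, he, div_eq_mul_inv]
      field_simp
    rw [this]
    have : 0 < θ * c0 - β - β * T2 * m / √c0 := by linarith
    positivity
  set δ1 := k - 2 * (β * T2) * m * e ^ 3 with hδ1def
  have hβc : 0 < β * c0⁻¹ := by positivity
  have hk0 : 0 < k := by
    have : 0 ≤ 2 * (β * T2) * m * e ^ 3 := by positivity
    linarith
  have hδ2 : 0 < 4 * (d ^ 2 - β ^ 2 * T2 ^ 2 * c0⁻¹) := by
    have : β ^ 2 * T2 ^ 2 * c0⁻¹ < d ^ 2 := by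
      rw [← div_eq_mul_inv, div_lt_iff₀ hc0]; linarith
    linarith
  have hm' : 0 < m⁻¹ := inv_pos.2 hm
  refine ⟨a, fun x hx => by rw [mul_comm]; exact hac' x hx, k,
    min (min m⁻¹ (4 * (d ^ 2 - β ^ 2 * T2 ^ 2 * c0⁻¹))) (min δ1 (δ1 * m⁻¹)),
    e ^ 2 + T2 + Kg + Ks, hβ, hk0, by linarith, by positivity, by positivity,
    haC.of_le (by norm_num), ?_, ?_, ?_, ?_, ?_, ?_, ?_⟩
  · exact fun z hz => ((min_le_left _ _).trans (min_le_left _ _)).trans (ham _ hz.2)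
  · exact fun z hz => (hae _ hz.2).trans (by linarith)
  · exact fun z hz => (abs_le.2 hz.1).trans (by linarith [sq_nonneg e])
  · exact fun z hz i => (hKs' i _ hz.2).trans (by linarith [sq_nonneg e])
  · exact fun z hz i => (hKg' i _ hz.2).trans (by linarith [sq_nonneg e])
  · intro z hz s0 s1 s2 s3
    have hx := hz.2
    have ha0 := hapos _ hx
    have hkg : k * a z.2 ≤ (4 - k) * a z.2 + 2 * ((z.2 0 - x0 0) * pdx a 0 z.2 +
        (z.2 1 - x0 1) * pdx a 1 z.2 + (z.2 2 - x0 2) * pdx a 2 z.2) - 4 * β * a z.2 ^ 2 := by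
      have h3 := hconv _ hx
      rw [div_le_iff₀ (by linarith [hcpos _ hx]), Fin.sum_univ_three] at h3
      simp only [hgrad _ hx]
      have h4 := mul_le_mul_of_nonneg_left h3 (sq_nonneg (a z.2))
      have h5 : a z.2 ^ 2 * ((1 - θ) * (2 * c z.2)) = 2 * (1 - θ) * a z.2 := by
        linear_combination 2 * (1 - θ) * a z.2 * hac' _ hx
      have h6 : β * a z.2 ^ 2 ≤ β * c0⁻¹ * a z.2 := by
        have := hae _ hx
        rw [he2] at this
        nlinarith [mul_le_mul_of_nonneg_left this (mul_nonneg hβ.le ha0.le)]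
      rw [hk]
      linarith
    have hG : |s1 * pdx a 0 z.2 + s2 * pdx a 1 z.2 + s3 * pdx a 2 z.2| ≤
        a z.2 ^ 2 * m * √(s1 ^ 2 + s2 ^ 2 + s3 ^ 2) := by
      have := abs_fderiv_sum_le (hup _ hx).2.1 s1 s2 s3
      rw [hgrad _ hx, hgrad _ hx, hgrad _ hx, show s1 * -(a z.2 ^ 2 * pdx c 0 z.2) +
        s2 * -(a z.2 ^ 2 * pdx c 1 z.2) + s3 * -(a z.2 ^ 2 * pdx c 2 z.2) = -(a z.2 ^ 2 *
        (s1 * pdx c 0 z.2 + s2 * pdx c 1 z.2 + s3 * pdx c 2 z.2)) by ring, abs_neg, abs_mul,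
        abs_of_nonneg (sq_nonneg _), mul_assoc]
      gcongr
    have hβt : |β * z.1| ≤ β * T2 := by
      rw [abs_mul, abs_of_pos hβ]; gcongr; exact abs_le.2 hz.1
    have main := pseudoconvex_form_le (s0 := s0) he0.le ha0.le (hae _ hx) rfl hG hβt hm.le hkg
    refine le_trans ?_ main
    rw [← hδ1def]
    have e1 : min (min m⁻¹ (4 * (d ^ 2 - β ^ 2 * T2 ^ 2 * c0⁻¹))) (min δ1 (δ1 * m⁻¹)) ≤ δ1 :=
      (min_le_right _ _).trans (min_le_left _ _)
    have e2 : min (min m⁻¹ (4 * (d ^ 2 - β ^ 2 * T2 ^ 2 * c0⁻¹))) (min δ1 (δ1 * m⁻¹)) ≤ δ1 * m⁻¹ :=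
      (min_le_right _ _).trans (min_le_right _ _)
    have e3 : δ1 * m⁻¹ ≤ δ1 * a z.2 := by gcongr; exact ham _ hx
    have i1 := mul_le_mul_of_nonneg_right e1 (show 0 ≤ s1 ^ 2 + s2 ^ 2 + s3 ^ 2 by positivity)
    have i2 := mul_le_mul_of_nonneg_right (e2.trans e3) (sq_nonneg s0)
    linarith
  · intro z hz
    have hx := hz.2
    have h3 := hd _ hx
    rw [sqd, Fin.sum_univ_three] at h3
    have h4 : a z.2 * β ^ 2 * z.1 ^ 2 ≤ c0⁻¹ * β ^ 2 * T2 ^ 2 := by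
      have := hae _ hx
      rw [he2] at this
      have : z.1 ^ 2 ≤ T2 ^ 2 := sq_le_sq' hz.1.1 hz.1.2
      have := hapos _ hx
      gcongr
    have e1 : min (min m⁻¹ (4 * (d ^ 2 - β ^ 2 * T2 ^ 2 * c0⁻¹))) (min δ1 (δ1 * m⁻¹)) ≤
      (4 * (d ^ 2 - β ^ 2 * T2 ^ 2 * c0⁻¹)) := (min_le_left _ _).trans (min_le_right _ _)
    linarith

theorem ContDiff.pd_differentiable {f : P4 → ℝ} (hf : ContDiff ℝ 2 f) (d : P4) :
    Differentiable ℝ (_root_.pd f d) :=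
  (hf.pd d (m := 1) (by norm_num)).differentiable (by norm_num)

theorem ContDiff.pd_pd_differentiable {f : P4 → ℝ} (hf : ContDiff ℝ 3 f) (d e : P4) :
    Differentiable ℝ (_root_.pd (_root_.pd f d) e) :=
  (hf.pd d (m := 2) (by norm_num)).pd_differentiable e

theorem ContDiff.slap {n : WithTop ℕ∞} {f : P4 → ℝ} (hf : ContDiff ℝ (n + 1 + 1) f) :
    ContDiff ℝ n (_root_.slap f) := by
  unfold _root_.slap
  exact ContDiff.sum fun i _ => (hf.pd (ex i) le_rfl).pd (ex i) le_rfl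

theorem pd_pd_sub {f g : P4 → ℝ} (hf : ContDiff ℝ 2 f) (hg : ContDiff ℝ 2 g) (d e z : P4) :
    pd (pd (fun y => f y - g y) d) e z = pd (pd f d) e z - pd (pd g d) e z := by
  have : pd (fun y => f y - g y) d = fun y => pd f d y - pd g d y := by
    funext y
    exact pd_sub d (hf.differentiable (by norm_num) y) (hg.differentiable (by norm_num) y)
  rw [this]
  exact pd_sub e (hf.pd_differentiable d z) (hg.pd_differentiable d z)

theorem pd_pd_add {f g : P4 → ℝ} (hf : ContDiff ℝ 2 f) (hg : ContDiff ℝ 2 g) (d e z : P4) :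
    pd (pd (fun y => f y + g y) d) e z = pd (pd f d) e z + pd (pd g d) e z := by
  have : pd (fun y => f y + g y) d = fun y => pd f d y + pd g d y := by
    funext y
    exact pd_add d (hf.differentiable (by norm_num) y) (hg.differentiable (by norm_num) y)
  rw [this]
  exact pd_add e (hf.pd_differentiable d z) (hg.pd_differentiable d z)

theorem pd_pd_sum {ι : Type*} {s : Finset ι} {f : ι → P4 → ℝ} (hf : ∀ i, ContDiff ℝ 2 (f i))
    (d e z : P4) :
    pd (pd (fun y => ∑ i ∈ s, f i y) d) e z = ∑ i ∈ s, pd (pd (f i) d) e z := by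
  have : pd (fun y => ∑ i ∈ s, f i y) d = fun y => ∑ i ∈ s, pd (f i) d y := by
    funext y
    exact pd_sum d fun i _ => (hf i).differentiable (by norm_num) y
  rw [this]
  exact pd_sum e fun i _ => (hf i).pd_differentiable d z

theorem dtt_pd {f : P4 → ℝ} (hf : ContDiff ℝ 3 f) (d : P4) (z : P4) :
    dtt (pd f d) z = pd (dtt f) d z := by
  unfold dtt
  rw [pd_comm (hf.of_le (by norm_num)) d et, pd_comm (hf.pd et (by norm_num)) d et]

theorem slap_pd {f : P4 → ℝ} (hf : ContDiff ℝ 3 f) (d : P4) (z : P4) :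
    slap (pd f d) z = pd (slap f) d z := by
  have : pd (slap f) d z = ∑ i, pd (pd (pd f (ex i)) (ex i)) d z :=
    pd_sum d fun i _ => hf.pd_pd_differentiable _ _ z
  rw [this]
  unfold slap
  refine Finset.sum_congr rfl fun i _ => ?_
  rw [pd_comm (hf.of_le (by norm_num)) d (ex i), pd_comm (hf.pd (ex i) (by norm_num)) d (ex i)]

theorem dtt_sub {f g : P4 → ℝ} (hf : ContDiff ℝ 2 f) (hg : ContDiff ℝ 2 g) (z : P4) :
    dtt (fun y => f y - g y) z = dtt f z - dtt g z := pd_pd_sub hf hg _ _ z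

theorem slap_sub {f g : P4 → ℝ} (hf : ContDiff ℝ 2 f) (hg : ContDiff ℝ 2 g) (z : P4) :
    slap (fun y => f y - g y) z = slap f z - slap g z := by
  simp only [slap, pd_pd_sub hf hg, Finset.sum_sub_distrib]

theorem dtt_add {f g : P4 → ℝ} (hf : ContDiff ℝ 2 f) (hg : ContDiff ℝ 2 g) (z : P4) :
    dtt (fun y => f y + g y) z = dtt f z + dtt g z := pd_pd_add hf hg _ _ z

theorem slap_add {f g : P4 → ℝ} (hf : ContDiff ℝ 2 f) (hg : ContDiff ℝ 2 g) (z : P4) :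
    slap (fun y => f y + g y) z = slap f z + slap g z := by
  simp only [slap, pd_pd_add hf hg, Finset.sum_add_distrib]

theorem dtt_sum {ι : Type*} {s : Finset ι} {f : ι → P4 → ℝ} (hf : ∀ i, ContDiff ℝ 2 (f i))
    (z : P4) : dtt (fun y => ∑ i ∈ s, f i y) z = ∑ i ∈ s, dtt (f i) z := pd_pd_sum hf _ _ z

theorem slap_sum {ι : Type*} {s : Finset ι} {f : ι → P4 → ℝ} (hf : ∀ i, ContDiff ℝ 2 (f i))
    (z : P4) : slap (fun y => ∑ i ∈ s, f i y) z = ∑ i ∈ s, slap (f i) z := by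
  simp only [slap, pd_pd_sum hf]
  exact Finset.sum_comm

/-- The divergence of a family of three scalar functions. -/
def dvg (v : Fin 3 → P4 → ℝ) (z : P4) : ℝ := ∑ i, pd (v i) (ex i) z

/-- The components `∂_l v_i - ∂_i v_l` of the curl of a family of three scalar functions. -/
def crl (v : Fin 3 → P4 → ℝ) (l i : Fin 3) (z : P4) : ℝ := pd (v i) (ex l) z - pd (v l) (ex i) z

theorem contDiff_dvg {n : WithTop ℕ∞} {v : Fin 3 → P4 → ℝ} (hv : ∀ i, ContDiff ℝ (n + 1) (v i)) :
    ContDiff ℝ n (dvg v) := ContDiff.sum fun i _ => (hv i).pd (ex i) le_rfl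

theorem contDiff_crl {n : WithTop ℕ∞} {v : Fin 3 → P4 → ℝ} (hv : ∀ i, ContDiff ℝ (n + 1) (v i))
    (l i : Fin 3) : ContDiff ℝ n (crl v l i) := ((hv i).pd _ le_rfl).sub ((hv l).pd _ le_rfl)

theorem slap_eq_crl_add_dvg {v : Fin 3 → P4 → ℝ} (hv : ∀ i, ContDiff ℝ 2 (v i)) (i : Fin 3)
    (z : P4) : slap (v i) z = ∑ j, pd (crl v j i) (ex j) z + pd (dvg v) (ex i) z := by
  have h1 : ∀ j, pd (crl v j i) (ex j) z = pd (pd (v i) (ex j)) (ex j) z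
      - pd (pd (v j) (ex i)) (ex j) z := fun j =>
    pd_sub _ ((hv i).pd_differentiable _ z) ((hv j).pd_differentiable _ z)
  have h2 : pd (dvg v) (ex i) z = ∑ j, pd (pd (v j) (ex j)) (ex i) z :=
    pd_sum _ fun j _ => (hv j).pd_differentiable _ z
  rw [h2, ← Finset.sum_add_distrib]
  refine Finset.sum_congr rfl fun j _ => ?_
  rw [h1, pd_comm (hv j) (ex j) (ex i)]
  ring

/-- The coefficients of a second-order elastic expression. -/
structure ElCoef where
  /-- coefficient of the Laplacian -/
  k : V3 → ℝ
  /-- coefficient of the gradient of the divergence -/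
  a : V3 → ℝ
  /-- coefficient of the gradient of the pressure -/
  a' : V3 → ℝ
  /-- coefficients of the divergence -/
  e : Fin 3 → V3 → ℝ
  /-- coefficients of the pressure -/
  e' : Fin 3 → V3 → ℝ
  /-- coefficients of the symmetrised gradient -/
  m : Fin 3 → V3 → ℝ

/-- The elastic expression with coefficients `c` and source `S`. -/
def ElCoef.op (c : ElCoef) (v : Fin 3 → P4 → ℝ) (W' : P4 → ℝ) (S : Fin 3 → P4 → ℝ) (i : Fin 3)
    (z : P4) : ℝ :=
  c.k z.2 * slap (v i) z + c.a z.2 * pd (dvg v) (ex i) z + c.a' z.2 * pd W' (ex i) z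
    + c.e i z.2 * dvg v z + c.e' i z.2 * W' z
    + (c.m 0 z.2 * (pd (v i) (ex 0) z + pd (v 0) (ex i) z)
      + c.m 1 z.2 * (pd (v i) (ex 1) z + pd (v 1) (ex i) z)
      + c.m 2 z.2 * (pd (v i) (ex 2) z + pd (v 2) (ex i) z)) + S i z

/-- The coefficients are differentiable, and bounded together with their gradients at `x`. -/
structure ElCoef.BoundedAt (c : ElCoef) (K : ℝ) (x : V3) : Prop where
  k : DifferentiableAt ℝ c.k x ∧ |c.k x| ≤ K ∧ ∀ l, |pdx c.k l x| ≤ K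
  a : DifferentiableAt ℝ c.a x ∧ |c.a x| ≤ K ∧ ∀ l, |pdx c.a l x| ≤ K
  a' : DifferentiableAt ℝ c.a' x ∧ |c.a' x| ≤ K ∧ ∀ l, |pdx c.a' l x| ≤ K
  e : ∀ i, DifferentiableAt ℝ (c.e i) x ∧ |c.e i x| ≤ K ∧ ∀ l, |pdx (c.e i) l x| ≤ K
  e' : ∀ i, DifferentiableAt ℝ (c.e' i) x ∧ |c.e' i x| ≤ K ∧ ∀ l, |pdx (c.e' i) l x| ≤ K
  m : ∀ i, DifferentiableAt ℝ (c.m i) x ∧ |c.m i x| ≤ K ∧ ∀ l, |pdx (c.m i) l x| ≤ K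

/-- A bound `N` for all terms of lower order at `z`. -/
structure LowerBound (v : Fin 3 → P4 → ℝ) (W' : P4 → ℝ) (S : Fin 3 → P4 → ℝ) (z : P4) (N : ℝ) :
    Prop where
  grad : ∀ i l, |pd (v i) (ex l) z| ≤ N
  curl : ∀ i j l, |pd (crl v i j) (ex l) z| ≤ N
  div : |dvg v z| ≤ N ∧ ∀ l, |pd (dvg v) (ex l) z| ≤ N
  press : |W' z| ≤ N ∧ ∀ l, |pd W' (ex l) z| ≤ N
  src : ∀ i, |S i z| ≤ N ∧ ∀ l, |pd (S i) (ex l) z| ≤ N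

theorem abs_mul_le_mul {a b K N : ℝ} (ha : |a| ≤ K) (hb : |b| ≤ N) : |a * b| ≤ K * N := by
  rw [abs_mul]
  exact mul_le_mul ha hb (abs_nonneg _) ((abs_nonneg _).trans ha)

section

variable {c : ElCoef} {v : Fin 3 → P4 → ℝ} {W' : P4 → ℝ} {S : Fin 3 → P4 → ℝ} {z : P4} {K N : ℝ}

theorem LowerBound.slap_le (hN : LowerBound v W' S z N) (hv : ∀ i, ContDiff ℝ 2 (v i)) (i : Fin 3) :
    |slap (v i) z| ≤ 4 * N := by
  rw [slap_eq_crl_add_dvg hv, Fin.sum_univ_three]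
  have h0 := abs_le.1 (hN.curl 0 i 0)
  have h1 := abs_le.1 (hN.curl 1 i 1)
  have h2 := abs_le.1 (hN.curl 2 i 2)
  have h3 := abs_le.1 (hN.div.2 i)
  rw [abs_le]
  constructor <;> linarith

theorem ElCoef.abs_op_sub_le (hc : c.BoundedAt K z.2) (hN : LowerBound v W' S z N) (hK : 1 ≤ K)
    (i : Fin 3) : |c.op v W' S i z - c.k z.2 * slap (v i) z| ≤ 66 * (K * N) := by
  have hN0 : 0 ≤ N := (abs_nonneg _).trans hN.press.1
  have t1 := abs_le.1 (abs_mul_le_mul hc.a.2.1 (hN.div.2 i))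
  have t2 := abs_le.1 (abs_mul_le_mul hc.a'.2.1 (hN.press.2 i))
  have t3 := abs_le.1 (abs_mul_le_mul (hc.e i).2.1 hN.div.1)
  have t4 := abs_le.1 (abs_mul_le_mul (hc.e' i).2.1 hN.press.1)
  have t5 := fun j => abs_le.1 (abs_mul_le_mul (hc.m j).2.1 (hN.grad i j))
  have t6 := fun j => abs_le.1 (abs_mul_le_mul (hc.m j).2.1 (hN.grad j i))
  have t7 := abs_le.1 (hN.src i).1
  have t8 : N ≤ K * N := le_mul_of_one_le_left hN0 hK
  have := t5 0; have := t5 1; have := t5 2; have := t6 0; have := t6 1; have := t6 2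
  unfold ElCoef.op
  rw [abs_le]
  constructor <;> linarith

theorem ElCoef.abs_pd_op_sub_le (hc : c.BoundedAt K z.2) (hN : LowerBound v W' S z N) (hK : 1 ≤ K)
    (hv : ∀ i, ContDiff ℝ 3 (v i)) (hW : ContDiff ℝ 2 W') (hS : ∀ i, ContDiff ℝ 1 (S i))
    (i l : Fin 3) :
    |pd (c.op v W' S i) (ex l) z - (c.k z.2 * pd (slap (v i)) (ex l) z
      + c.a z.2 * pd (pd (dvg v) (ex i)) (ex l) z + c.a' z.2 * pd (pd W' (ex i)) (ex l) z
      + (c.m 0 z.2 * (pd (pd (v i) (ex 0)) (ex l) z + pd (pd (v 0) (ex i)) (ex l) z)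
      + c.m 1 z.2 * (pd (pd (v i) (ex 1)) (ex l) z + pd (pd (v 1) (ex i)) (ex l) z)
      + c.m 2 z.2 * (pd (pd (v i) (ex 2)) (ex l) z + pd (pd (v 2) (ex i)) (ex l) z)))|
      ≤ 17 * (K * N) := by
  have hN0 : 0 ≤ N := (abs_nonneg _).trans hN.press.1
  have co : ∀ {g : V3 → ℝ}, DifferentiableAt ℝ g z.2 → DifferentiableAt ℝ (fun y : P4 => g y.2) z :=
    fun h => h.comp z differentiableAt_snd
  have hd : ∀ j d, DifferentiableAt ℝ (pd (v j) d) z := fun j d =>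
    ((hv j).of_le (by norm_num)).pd_differentiable d z
  have hs : DifferentiableAt ℝ (slap (v i)) z :=
    (ContDiff.slap (n := 1) ((hv i).of_le (by norm_num))).differentiable (by norm_num) z
  have hdv : ContDiff ℝ 2 (dvg v) := contDiff_dvg fun i => (hv i).of_le (by norm_num)
  have hdv1 : DifferentiableAt ℝ (dvg v) z := hdv.differentiable (by norm_num) z
  have hdv2 : DifferentiableAt ℝ (pd (dvg v) (ex i)) z := hdv.pd_differentiable _ z
  have hW1 : DifferentiableAt ℝ W' z := hW.differentiable (by norm_num) z
  have hW2 : DifferentiableAt ℝ (pd W' (ex i)) z := hW.pd_differentiable _ z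
  have hS1 : DifferentiableAt ℝ (S i) z := (hS i).differentiable (by norm_num) z
  have k1 := co hc.k.1
  have k2 := co hc.a.1
  have k3 := co hc.a'.1
  have k4 := co (hc.e i).1
  have k5 := co (hc.e' i).1
  have k6 := co (hc.m 0).1
  have k7 := co (hc.m 1).1
  have k8 := co (hc.m 2).1
  have E : pd (c.op v W' S i) (ex l) z = (c.k z.2 * pd (slap (v i)) (ex l) z
      + c.a z.2 * pd (pd (dvg v) (ex i)) (ex l) z + c.a' z.2 * pd (pd W' (ex i)) (ex l) z
      + (c.m 0 z.2 * (pd (pd (v i) (ex 0)) (ex l) z + pd (pd (v 0) (ex i)) (ex l) z)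
      + c.m 1 z.2 * (pd (pd (v i) (ex 1)) (ex l) z + pd (pd (v 1) (ex i)) (ex l) z)
      + c.m 2 z.2 * (pd (pd (v i) (ex 2)) (ex l) z + pd (pd (v 2) (ex i)) (ex l) z)))
      + (pdx c.k l z.2 * slap (v i) z + pdx c.a l z.2 * pd (dvg v) (ex i) z
        + pdx c.a' l z.2 * pd W' (ex i) z
        + (pdx (c.e i) l z.2 * dvg v z + c.e i z.2 * pd (dvg v) (ex l) z)
        + (pdx (c.e' i) l z.2 * W' z + c.e' i z.2 * pd W' (ex l) z)
        + (pdx (c.m 0) l z.2 * pd (v i) (ex 0) z + pdx (c.m 0) l z.2 * pd (v 0) (ex i) z)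
        + (pdx (c.m 1) l z.2 * pd (v i) (ex 1) z + pdx (c.m 1) l z.2 * pd (v 1) (ex i) z)
        + (pdx (c.m 2) l z.2 * pd (v i) (ex 2) z + pdx (c.m 2) l z.2 * pd (v 2) (ex i) z)
        + pd (S i) (ex l) z) := by
    have d0 := fun j => hd j (ex i)
    have d1 := hd i (ex 0)
    have d2 := hd i (ex 1)
    have d3 := hd i (ex 2)
    have d4 := d0 0
    have d5 := d0 1
    have d6 := d0 2
    have n1 := hc.k.1
    have n2 := hc.a.1
    have n3 := hc.a'.1
    have n4 := (hc.e i).1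
    have n5 := (hc.e' i).1
    have n6 := (hc.m 0).1
    have n7 := (hc.m 1).1
    have n8 := (hc.m 2).1
    unfold ElCoef.op
    simp (disch := first | assumption | fun_prop) only [pd_add, pd_mul, pd_comp_snd_ex]
    ring
  rw [E, add_sub_cancel_left]
  have t0 := abs_le.1 (abs_mul_le_mul (hc.k.2.2 l)
    (hN.slap_le (fun i => (hv i).of_le (by norm_num)) i))
  have t1 := abs_le.1 (abs_mul_le_mul (hc.a.2.2 l) (hN.div.2 i))
  have t2 := abs_le.1 (abs_mul_le_mul (hc.a'.2.2 l) (hN.press.2 i))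
  have t3 := abs_le.1 (abs_mul_le_mul ((hc.e i).2.2 l) hN.div.1)
  have t4 := abs_le.1 (abs_mul_le_mul ((hc.e' i).2.2 l) hN.press.1)
  have t3' := abs_le.1 (abs_mul_le_mul (hc.e i).2.1 (hN.div.2 l))
  have t4' := abs_le.1 (abs_mul_le_mul (hc.e' i).2.1 (hN.press.2 l))
  have t5 := fun j => abs_le.1 (abs_mul_le_mul ((hc.m j).2.2 l) (hN.grad i j))
  have t6 := fun j => abs_le.1 (abs_mul_le_mul ((hc.m j).2.2 l) (hN.grad j i))
  have t7 := abs_le.1 ((hN.src i).2 l)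
  have t8 : N ≤ K * N := le_mul_of_one_le_left hN0 hK
  have := t5 0; have := t5 1; have := t5 2; have := t6 0; have := t6 1; have := t6 2
  rw [abs_le]
  constructor <;> linarith

theorem ElCoef.abs_crl_op_sub_le (hc : c.BoundedAt K z.2) (hN : LowerBound v W' S z N) (hK : 1 ≤ K)
    (hv : ∀ i, ContDiff ℝ 3 (v i)) (hW : ContDiff ℝ 2 W') (hS : ∀ i, ContDiff ℝ 1 (S i))
    (l i : Fin 3) :
    |(pd (c.op v W' S i) (ex l) z - pd (c.op v W' S l) (ex i) z) - c.k z.2 * slap (crl v l i) z|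
      ≤ 66 * (K * N) := by
  have h1 := abs_le.1 (c.abs_pd_op_sub_le hc hN hK hv hW hS i l)
  have h2 := abs_le.1 (c.abs_pd_op_sub_le hc hN hK hv hW hS l i)
  have hv2 : ∀ i, ContDiff ℝ 2 (v i) := fun i => (hv i).of_le (by norm_num)
  have e1 : slap (crl v l i) z = pd (slap (v i)) (ex l) z - pd (slap (v l)) (ex i) z := by
    rw [← slap_pd (hv i), ← slap_pd (hv l)]
    exact slap_sub ((hv i).pd _ (by norm_num)) ((hv l).pd _ (by norm_num)) z
  have e2 : ∀ j, pd (crl v l i) (ex j) z =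
      pd (pd (v i) (ex j)) (ex l) z - pd (pd (v l) (ex j)) (ex i) z := fun j => by
    have : pd (crl v l i) (ex j) z = pd (pd (v i) (ex l)) (ex j) z - pd (pd (v l) (ex i)) (ex j) z :=
      pd_sub _ ((hv2 i).pd_differentiable _ z) ((hv2 l).pd_differentiable _ z)
    rw [this, pd_comm (hv2 i) (ex l) (ex j), pd_comm (hv2 l) (ex i) (ex j)]
  have m0 := abs_le.1 (abs_mul_le_mul (hc.m 0).2.1 (hN.curl l i 0))
  have m1 := abs_le.1 (abs_mul_le_mul (hc.m 1).2.1 (hN.curl l i 1))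
  have m2 := abs_le.1 (abs_mul_le_mul (hc.m 2).2.1 (hN.curl l i 2))
  rw [e2] at m0 m1 m2
  have hdv : ContDiff ℝ 2 (dvg v) := contDiff_dvg fun i => (hv i).of_le (by norm_num)
  rw [pd_comm hdv (ex i) (ex l), pd_comm hW (ex i) (ex l), pd_comm (hv2 0) (ex i) (ex l),
    pd_comm (hv2 1) (ex i) (ex l), pd_comm (hv2 2) (ex i) (ex l)] at h1
  have hKN : 0 ≤ K * N := (abs_nonneg _).trans (abs_mul_le_mul hc.k.2.1 hN.press.1)
  rw [e1, abs_le]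
  constructor <;> linarith

theorem ElCoef.abs_dvg_op_sub_le (hc : c.BoundedAt K z.2) (hN : LowerBound v W' S z N) (hK : 1 ≤ K)
    (hv : ∀ i, ContDiff ℝ 3 (v i)) (hW : ContDiff ℝ 2 W') (hS : ∀ i, ContDiff ℝ 1 (S i)) :
    |∑ i, pd (c.op v W' S i) (ex i) z -
      ((c.k z.2 + c.a z.2) * slap (dvg v) z + c.a' z.2 * slap W' z)| ≤ 66 * (K * N) := by
  have h0 := abs_le.1 (c.abs_pd_op_sub_le hc hN hK hv hW hS 0 0)
  have h1 := abs_le.1 (c.abs_pd_op_sub_le hc hN hK hv hW hS 1 1)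
  have h2 := abs_le.1 (c.abs_pd_op_sub_le hc hN hK hv hW hS 2 2)
  have hv2 : ∀ i, ContDiff ℝ 2 (v i) := fun i => (hv i).of_le (by norm_num)
  have e1 : slap (dvg v) z = pd (slap (v 0)) (ex 0) z + pd (slap (v 1)) (ex 1) z
      + pd (slap (v 2)) (ex 2) z := by
    have := slap_sum (s := Finset.univ) (fun i => (hv i).pd (m := 2) (ex i) (by norm_num)) z
    rw [← slap_pd (hv 0), ← slap_pd (hv 1), ← slap_pd (hv 2)]
    rw [Fin.sum_univ_three] at this
    exact this
  have e2 : ∀ g : P4 → ℝ, slap g z = pd (pd g (ex 0)) (ex 0) z + pd (pd g (ex 1)) (ex 1) z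
      + pd (pd g (ex 2)) (ex 2) z := fun g => by rw [slap, Fin.sum_univ_three]
  have e3 : ∀ j, pd (dvg v) (ex j) z = pd (pd (v 0) (ex j)) (ex 0) z
      + pd (pd (v 1) (ex j)) (ex 1) z + pd (pd (v 2) (ex j)) (ex 2) z := fun j => by
    have : pd (dvg v) (ex j) z = ∑ i, pd (pd (v i) (ex i)) (ex j) z :=
      pd_sum _ fun i _ => (hv2 i).pd_differentiable _ z
    rw [this, Fin.sum_univ_three, pd_comm (hv2 0) (ex 0) (ex j), pd_comm (hv2 1) (ex 1) (ex j),
      pd_comm (hv2 2) (ex 2) (ex j)]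
  have m1 := fun j => abs_le.1 (abs_mul_le_mul (hc.m j).2.1 (hN.div.2 j))
  have m2 := fun j => abs_le.1 (abs_mul_le_mul (hc.m j).2.1 (hN.slap_le hv2 j))
  have m10 := m1 0
  have m11 := m1 1
  have m12 := m1 2
  have m20 := m2 0
  have m21 := m2 1
  have m22 := m2 2
  simp only [e3] at m10 m11 m12
  simp only [e2] at m20 m21 m22
  have hKN : 0 ≤ K * N := (abs_nonneg _).trans (abs_mul_le_mul hc.k.2.1 hN.press.1)
  rw [Fin.sum_univ_three, add_mul]
  have a1 : c.k z.2 * slap (dvg v) z = c.k z.2 * pd (slap (v 0)) (ex 0) z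
    + c.k z.2 * pd (slap (v 1)) (ex 1) z + c.k z.2 * pd (slap (v 2)) (ex 2) z := by rw [e1]; ring
  rw [a1, e2 (dvg v), e2 W', abs_le]
  constructor <;> linarith

end

theorem jet2_add_le {f g : P4 → ℝ} {z : P4} (hf : DifferentiableAt ℝ f z)
    (hg : DifferentiableAt ℝ g z) :
    jet2 (fun y => f y + g y) z ≤ 2 * (jet2 f z + jet2 g z) := by
  have gen : ∀ a b : ℝ, (a + b) ^ 2 ≤ 2 * (a ^ 2 + b ^ 2) := fun a b => by
    nlinarith [sq_nonneg (a - b)]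
  simp only [jet2, gradT2, pd_add _ hf hg, Fin.sum_univ_three]
  linarith [gen (f z) (g z), gen (pd f et z) (pd g et z), gen (pd f (ex 0) z) (pd g (ex 0) z),
    gen (pd f (ex 1) z) (pd g (ex 1) z), gen (pd f (ex 2) z) (pd g (ex 2) z)]

theorem jet2_neg (f : P4 → ℝ) (z : P4) : jet2 (fun y => -f y) z = jet2 f z := by
  simp [jet2, gradT2, pd_neg]

theorem jet2_sub_le {f g : P4 → ℝ} {z : P4} (hf : DifferentiableAt ℝ f z)
    (hg : DifferentiableAt ℝ g z) :
    jet2 (fun y => f y - g y) z ≤ 2 * (jet2 f z + jet2 g z) := by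
  have := jet2_add_le hf hg.fun_neg
  rw [jet2_neg] at this
  simpa only [sub_eq_add_neg] using this

theorem jet2_coef_mul_le {h : V3 → ℝ} {f : P4 → ℝ} {z : P4} {K : ℝ}
    (hh : DifferentiableAt ℝ h z.2) (hf : DifferentiableAt ℝ f z) (h0 : |h z.2| ≤ K)
    (h1 : ∀ i, |pdx h i z.2| ≤ K) :
    jet2 (fun y => h y.2 * f y) z ≤ 8 * K ^ 2 * jet2 f z := by
  have hs : DifferentiableAt ℝ (fun y : P4 => h y.2) z := hh.comp z differentiableAt_snd
  have sq : ∀ {x : ℝ}, |x| ≤ K → x ^ 2 ≤ K ^ 2 := fun hx =>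
    sq_le_sq' (abs_le.1 hx).1 (abs_le.1 hx).2
  have e0 : pd (fun y => h y.2 * f y) et z = h z.2 * pd f et z := by
    rw [pd_mul et hs hf, pd_comp_snd_et hh]; ring
  have ei : ∀ i, pd (fun y => h y.2 * f y) (ex i) z =
      pdx h i z.2 * f z + h z.2 * pd f (ex i) z := fun i => by
    rw [pd_mul _ hs hf, pd_comp_snd_ex i hh]
  have gen : ∀ i, (pdx h i z.2 * f z + h z.2 * pd f (ex i) z) ^ 2 ≤
      2 * (K ^ 2 * f z ^ 2 + K ^ 2 * pd f (ex i) z ^ 2) := fun i => by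
    have a := mul_le_mul_of_nonneg_right (sq (h1 i)) (sq_nonneg (f z))
    have b := mul_le_mul_of_nonneg_right (sq h0) (sq_nonneg (pd f (ex i) z))
    nlinarith [sq_nonneg (pdx h i z.2 * f z - h z.2 * pd f (ex i) z)]
  have a := mul_le_mul_of_nonneg_right (sq h0) (sq_nonneg (f z))
  have b := mul_le_mul_of_nonneg_right (sq h0) (sq_nonneg (pd f et z))
  simp only [jet2, gradT2, e0, ei, Fin.sum_univ_three]
  have p : ∀ x : ℝ, 0 ≤ K ^ 2 * x ^ 2 := fun x => by positivity
  linarith [gen 0, gen 1, gen 2, p (f z), p (pd f et z), p (pd f (ex 0) z), p (pd f (ex 1) z),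
    p (pd f (ex 2) z)]

theorem jet2_comb_le {h g : V3 → ℝ} {X Y : P4 → ℝ} {z : P4} {K : ℝ}
    (hh : DifferentiableAt ℝ h z.2) (hg : DifferentiableAt ℝ g z.2) (hX : DifferentiableAt ℝ X z)
    (hY : DifferentiableAt ℝ Y z) (h0 : |h z.2| ≤ K) (h1 : ∀ i, |pdx h i z.2| ≤ K)
    (g0 : |g z.2| ≤ K) (g1 : ∀ i, |pdx g i z.2| ≤ K) :
    jet2 (fun y => h y.2 * X y + g y.2 * Y y) z ≤ 16 * K ^ 2 * (jet2 X z + jet2 Y z) := by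
  have a := jet2_coef_mul_le hh hX h0 h1
  have b := jet2_coef_mul_le hg hY g0 g1
  have := jet2_add_le (f := fun y => h y.2 * X y) (g := fun y => g y.2 * Y y)
    ((hh.comp z differentiableAt_snd).mul hX) ((hg.comp z differentiableAt_snd).mul hY)
  linarith

/-- A `C²` function on `ℝ³`, bounded with its derivatives at a point. -/
structure C2BoundAt (h : V3 → ℝ) (K : ℝ) (x : V3) : Prop where
  smooth : ContDiff ℝ 2 h
  val : |h x| ≤ K
  grad : ∀ i, |pdx h i x| ≤ K
  hess : ∀ i j, |pdx (pdx h i) j x| ≤ K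

theorem exists_c2BoundAt {ι : Type*} [Finite ι] {h : ι → V3 → ℝ} (hh : ∀ i, ContDiff ℝ 2 (h i))
    {s : Set V3} (hs : IsCompact s) : ∃ K, 1 ≤ K ∧ ∀ i, ∀ x ∈ s, C2BoundAt (h i) K x := by
  have h1 : ∀ i j, ContDiff ℝ 1 (pdx (h i) j) := fun i j => (hh i).pdx j (by norm_num)
  obtain ⟨K1, a1, b1⟩ := exists_abs_le_of_isCompact (fun i => (hh i).continuous) hs
  obtain ⟨K2, a2, b2⟩ := exists_abs_le_of_isCompact
    (fun i : ι × Fin 3 => (h1 i.1 i.2).continuous) hs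
  obtain ⟨K3, a3, b3⟩ := exists_abs_le_of_isCompact
    (fun i : ι × Fin 3 × Fin 3 =>
      ((h1 i.1 i.2.1).pdx i.2.2 (m := 0) (by norm_num)).continuous) hs
  refine ⟨K1 + K2 + K3, by linarith, fun i x hx => ⟨hh i, ?_, fun j => ?_, fun j k => ?_⟩⟩
  · linarith [b1 i x hx]
  · linarith [b2 (i, j) x hx]
  · linarith [b3 (i, j, k) x hx]

theorem pd_pd_coef_mul {h : V3 → ℝ} {f : P4 → ℝ} (hh : ContDiff ℝ 2 h) (hf : ContDiff ℝ 2 f)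
    (z : P4) :
    dtt (fun y => h y.2 * f y) z = h z.2 * dtt f z ∧
    ∀ i, pd (pd (fun y => h y.2 * f y) (ex i)) (ex i) z =
      pdx (pdx h i) i z.2 * f z + 2 * (pdx h i z.2 * pd f (ex i) z)
        + h z.2 * pd (pd f (ex i)) (ex i) z := by
  have hd : Differentiable ℝ h := hh.differentiable (by norm_num)
  have hd1 : ∀ i, Differentiable ℝ (pdx h i) := fun i =>
    (hh.pdx i (m := 1) (by norm_num)).differentiable (by norm_num)
  have hs : ContDiff ℝ 2 fun y : P4 => h y.2 := hh.comp contDiff_snd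
  have et0 : pd (fun y : P4 => h y.2) et = fun _ => 0 := by
    funext y; exact pd_comp_snd_et (hd y.2)
  have exi : ∀ i, pd (fun y : P4 => h y.2) (ex i) = fun y => pdx h i y.2 := fun i => by
    funext y; exact pd_comp_snd_ex i (hd y.2)
  constructor
  · rw [dtt, pd_pd_mul et hs hf, et0, pd_const, dtt]
    ring
  · intro i
    rw [pd_pd_mul (ex i) hs hf, exi, pd_comp_snd_ex i (hd1 i z.2)]

/-- If `(h, g)` is a left eigenvector of the principal part, `h X + g Y` solves a scalar wave
equation up to terms of lower order. -/
theorem wave_comb_le {h g : V3 → ℝ} {X Y : P4 → ℝ} {z : P4} {K L N M a11 a12 a21 a22 : ℝ} {c : ℝ}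
    (hh : C2BoundAt h K z.2) (hg : C2BoundAt g K z.2) (hX : ContDiff ℝ 2 X) (hY : ContDiff ℝ 2 Y)
    (hc : |c| ≤ K)
    (e1 : h z.2 * a11 + g z.2 * a21 = c * h z.2) (e2 : h z.2 * a12 + g z.2 * a22 = c * g z.2)
    (dX : |dtt X z - (a11 * slap X z + a12 * slap Y z)| ≤ L)
    (dY : |dtt Y z - (a21 * slap X z + a22 * slap Y z)| ≤ L)
    (X0 : |X z| ≤ N) (X1 : ∀ i, |pd X (ex i) z| ≤ N)
    (Y0 : |Y z| ≤ N) (Y1 : ∀ i, |pd Y (ex i) z| ≤ N) (hM : M = 2 * (K * L) + 18 * (K * (K * N))) :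
    |dtt (fun y => h y.2 * X y + g y.2 * Y y) z
      - c * slap (fun y => h y.2 * X y + g y.2 * Y y) z| ≤ M := by
  have ca : ∀ {h : V3 → ℝ} {f : P4 → ℝ}, C2BoundAt h K z.2 → ContDiff ℝ 2 f →
      ContDiff ℝ 2 fun y : P4 => h y.2 * f y := fun hh hf =>
    (hh.smooth.comp contDiff_snd).mul hf
  have sl : ∀ {h : V3 → ℝ} {f : P4 → ℝ}, C2BoundAt h K z.2 → ContDiff ℝ 2 f → |f z| ≤ N →
      (∀ i, |pd f (ex i) z| ≤ N) → |slap (fun y => h y.2 * f y) z - h z.2 * slap f z| ≤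
        9 * (K * N) := by
    intro h f hh hf f0 f1
    have p := fun i => abs_le.1 (abs_mul_le_mul (hh.hess i i) f0)
    have q := fun i => abs_le.1 (abs_mul_le_mul (hh.grad i) (f1 i))
    have p0 := p 0; have p1 := p 1; have p2 := p 2
    have q0 := q 0; have q1 := q 1; have q2 := q 2
    simp only [slap, Fin.sum_univ_three, (pd_pd_coef_mul hh.smooth hf z).2]
    rw [abs_le]
    constructor <;> linarith
  rw [dtt_add (ca hh hX) (ca hg hY), slap_add (ca hh hX) (ca hg hY),
    (pd_pd_coef_mul hh.smooth hX z).1, (pd_pd_coef_mul hg.smooth hY z).1]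
  have s1 := abs_le.1 (abs_mul_le_mul hc (sl hh hX X0 X1))
  have s2 := abs_le.1 (abs_mul_le_mul hc (sl hg hY Y0 Y1))
  have s3 := abs_le.1 (abs_mul_le_mul hh.val dX)
  have s4 := abs_le.1 (abs_mul_le_mul hg.val dY)
  have e3 : h z.2 * (a11 * slap X z + a12 * slap Y z) + g z.2 * (a21 * slap X z + a22 * slap Y z)
      = c * (h z.2 * slap X z) + c * (g z.2 * slap Y z) := by
    linear_combination slap X z * e1 + slap Y z * e2
  rw [hM, abs_le]
  constructor <;> linarith

/-- The elastic coefficients obtained by combining the two equations of Biot's system with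
weights `p` and `s`. -/
def biotCoef (μ lam q r p s : V3 → ℝ) : ElCoef where
  k x := p x * μ x
  a x := p x * (μ x + lam x) + s x * q x
  a' x := p x * q x + s x * r x
  e i x := p x * pdx lam i x + s x * pdx q i x
  e' i x := p x * pdx q i x + s x * pdx r i x
  m i x := p x * pdx μ i x

theorem biotCoef_op {ρ11 ρ12 ρ22 μ lam q r p s : V3 → ℝ} {us uf F1 F2 : P4 → V3} {Q : Set P4}
    (h : BiotSystem ρ11 ρ12 ρ22 μ lam q r us uf F1 F2 Q) (hq : Differentiable ℝ q)
    (hr : Differentiable ℝ r) (hus : ContDiff ℝ 2 us) (huf : ContDiff ℝ 2 uf) {z : P4}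
    (hz : z ∈ Q) (i : Fin 3) :
    (p z.2 * ρ11 z.2 + s z.2 * ρ12 z.2) * dtt (fun y => us y i) z
        + (p z.2 * ρ12 z.2 + s z.2 * ρ22 z.2) * dtt (fun y => uf y i) z =
      (biotCoef μ lam q r p s).op (fun i y => us y i) (sdiv uf)
        (fun i y => p y.2 * F1 y i + s y.2 * F2 y i) i z := by
  obtain ⟨h1, h2⟩ := h z hz i
  have ds : ∀ {u : P4 → V3}, ContDiff ℝ 2 u → Differentiable ℝ (sdiv u) := fun {u} hu =>
    (contDiff_dvg (n := 1) (v := fun i y => u y i) fun i => contDiff_pi.1 hu i).differentiable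
      (by norm_num)
  have gen : ∀ {c : V3 → ℝ} {u : P4 → V3}, Differentiable ℝ c → ContDiff ℝ 2 u →
      pd (fun y => c y.2 * sdiv u y) (ex i) z =
        pdx c i z.2 * sdiv u z + c z.2 * pd (sdiv u) (ex i) z := by
    intro c u hc hu
    have := pd_mul (f := fun y : P4 => c y.2) (ex i) (hc.comp differentiable_snd z) (ds hu z)
    rw [this, pd_comp_snd_ex i (hc z.2)]
  rw [gen hq huf] at h1
  rw [gen hq hus, gen hr huf] at h2
  simp only [lameOp, Fin.sum_univ_three] at h1
  simp only [biotCoef, ElCoef.op]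
  have e : dvg (fun i y => us y i) = sdiv us := rfl
  rw [e]
  linear_combination p z.2 * h1 + s z.2 * h2

theorem exists_c1Bound {ι : Type*} [Finite ι] {h : ι → V3 → ℝ} (hh : ∀ i, ContDiff ℝ 1 (h i))
    {s : Set V3} (hs : IsCompact s) : ∃ K, 1 ≤ K ∧ ∀ i, ∀ x ∈ s,
      DifferentiableAt ℝ (h i) x ∧ |h i x| ≤ K ∧ ∀ l, |pdx (h i) l x| ≤ K := by
  obtain ⟨K1, a1, b1⟩ := exists_abs_le_of_isCompact (fun i => (hh i).continuous) hs
  obtain ⟨K2, a2, b2⟩ := exists_abs_le_of_isCompact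
    (fun i : ι × Fin 3 => ((hh i.1).pdx i.2 (m := 0) (by norm_num)).continuous) hs
  refine ⟨K1 + K2, by linarith, fun i x hx =>
    ⟨(hh i).differentiable (by norm_num) x, ?_, fun j => ?_⟩⟩
  · linarith [b1 i x hx]
  · linarith [b2 (i, j) x hx]

theorem exists_biotCoef_boundedAt {μ lam q r p s : V3 → ℝ} (hμ : ContDiff ℝ 2 μ)
    (hl : ContDiff ℝ 2 lam) (hq : ContDiff ℝ 2 q) (hr : ContDiff ℝ 2 r) (hp : ContDiff ℝ 2 p)
    (hs : ContDiff ℝ 2 s) {B : Set V3} (hB : IsCompact B) :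
    ∃ K, 1 ≤ K ∧ ∀ x ∈ B, (biotCoef μ lam q r p s).BoundedAt K x := by
  have o : ∀ {f : V3 → ℝ}, ContDiff ℝ 2 f → ContDiff ℝ 1 f := fun h => h.of_le (by norm_num)
  have o' : ∀ {f : V3 → ℝ} (i : Fin 3), ContDiff ℝ 2 f → ContDiff ℝ 1 (pdx f i) := fun i h =>
    h.pdx i (by norm_num)
  obtain ⟨K1, a1, b1⟩ := exists_c1Bound (ι := Unit)
    (h := fun _ => (biotCoef μ lam q r p s).k) (fun _ => (o hp).mul (o hμ)) hB
  obtain ⟨K2, a2, b2⟩ := exists_c1Bound (ι := Unit)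
    (h := fun _ => (biotCoef μ lam q r p s).a)
    (fun _ => ((o hp).mul ((o hμ).add (o hl))).add ((o hs).mul (o hq))) hB
  obtain ⟨K3, a3, b3⟩ := exists_c1Bound (ι := Unit)
    (h := fun _ => (biotCoef μ lam q r p s).a')
    (fun _ => ((o hp).mul (o hq)).add ((o hs).mul (o hr))) hB
  obtain ⟨K4, a4, b4⟩ := exists_c1Bound (h := (biotCoef μ lam q r p s).e)
    (fun i => ((o hp).mul (o' i hl)).add ((o hs).mul (o' i hq))) hB
  obtain ⟨K5, a5, b5⟩ := exists_c1Bound (h := (biotCoef μ lam q r p s).e')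
    (fun i => ((o hp).mul (o' i hq)).add ((o hs).mul (o' i hr))) hB
  obtain ⟨K6, a6, b6⟩ := exists_c1Bound (h := (biotCoef μ lam q r p s).m)
    (fun i => (o hp).mul (o' i hμ)) hB
  have mono : ∀ {K : ℝ} {f : V3 → ℝ} {x : V3}, K ≤ K1 + K2 + K3 + K4 + K5 + K6 →
      (DifferentiableAt ℝ f x ∧ |f x| ≤ K ∧ ∀ l, |pdx f l x| ≤ K) →
      (DifferentiableAt ℝ f x ∧ |f x| ≤ K1 + K2 + K3 + K4 + K5 + K6 ∧
        ∀ l, |pdx f l x| ≤ K1 + K2 + K3 + K4 + K5 + K6) :=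
    fun hK h => ⟨h.1, h.2.1.trans hK, fun l => (h.2.2 l).trans hK⟩
  refine ⟨K1 + K2 + K3 + K4 + K5 + K6, by linarith, fun x hx =>
    ⟨mono (by linarith) (b1 () x hx), mono (by linarith) (b2 () x hx),
      mono (by linarith) (b3 () x hx), fun i => mono (by linarith) (b4 i x hx),
      fun i => mono (by linarith) (b5 i x hx), fun i => mono (by linarith) (b6 i x hx)⟩⟩

/-- The rows of `A - b I` are left eigenvectors of a `2 × 2` matrix with eigenvalues `a ≠ b`. -/
theorem eigen_rows {a11 a12 a21 a22 a b : ℝ} (ha : (a11 - a) * (a22 - a) - a12 * a21 = 0)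
    (hb : (a11 - b) * (a22 - b) - a12 * a21 = 0) (hab : a ≠ b) :
    ((a11 - b) * a11 + a12 * a21 = a * (a11 - b) ∧ (a11 - b) * a12 + a12 * a22 = a * a12) ∧
      (a21 * a11 + (a22 - b) * a21 = a * a21 ∧ a21 * a12 + (a22 - b) * a22 = a * (a22 - b)) := by
  have ht : a11 + a22 = a + b := by
    have : (a - b) * (a11 + a22 - (a + b)) = 0 := by linear_combination hb - ha
    rcases mul_eq_zero.1 this with h | h
    · exact absurd (sub_eq_zero.1 h) hab
    · linarith
  have hd : a11 * a22 - a12 * a21 = a * b := by linear_combination ha + a * ht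
  refine ⟨⟨?_, ?_⟩, ?_, ?_⟩
  · linear_combination a11 * ht - hd
  · linear_combination a12 * ht
  · linear_combination a21 * ht
  · linear_combination a22 * ht - hd

theorem Amat_det_eq {ρ11 ρ12 ρ22 μ lam q r : V3 → ℝ} {x : V3} {κ c : ℝ}
    (hκ : (ρ11 x * ρ22 x - ρ12 x ^ 2) * κ = 1)
    (h : (Amat ρ11 ρ12 ρ22 μ lam q r x - c • (1 : Matrix (Fin 2) (Fin 2) ℝ)).det = 0) :
    ((ρ22 x * κ * (2 * μ x + lam x) + -ρ12 x * κ * q x) - c)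
        * ((-ρ12 x * κ * q x + ρ11 x * κ * r x) - c)
      - (ρ22 x * κ * q x + -ρ12 x * κ * r x)
        * (-ρ12 x * κ * (2 * μ x + lam x) + ρ11 x * κ * q x) = 0 := by
  have hκ' : (ρ11 x * ρ22 x - ρ12 x ^ 2)⁻¹ = κ := by
    have : ρ11 x * ρ22 x - ρ12 x ^ 2 ≠ 0 := left_ne_zero_of_mul_eq_one hκ
    field_simp
    linarith
  rw [Matrix.det_fin_two] at h
  simp [Amat, hκ'] at h
  linear_combination h

theorem dtt_dvg_eq {w : Fin 3 → P4 → ℝ} (hw : ∀ i, ContDiff ℝ 3 (w i)) {g : Fin 3 → P4 → ℝ} {z : P4}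
    (h : ∀ i, ∀ᶠ y in nhds z, dtt (w i) y = g i y) :
    dtt (dvg w) z = ∑ i, pd (g i) (ex i) z := by
  have h1 := dtt_sum (s := Finset.univ) (fun i => (hw i).pd (m := 2) (ex i) (by norm_num)) z
  refine Eq.trans h1 (Finset.sum_congr rfl fun i _ => ?_)
  rw [dtt_pd (hw i), pd_congr _ (h i)]

theorem dtt_crl_eq {w : Fin 3 → P4 → ℝ} (hw : ∀ i, ContDiff ℝ 3 (w i)) {g : Fin 3 → P4 → ℝ} {z : P4}
    (h : ∀ i, ∀ᶠ y in nhds z, dtt (w i) y = g i y) (l i : Fin 3) :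
    dtt (crl w l i) z = pd (g i) (ex l) z - pd (g l) (ex i) z := by
  have h1 : dtt (crl w l i) z = dtt (pd (w i) (ex l)) z - dtt (pd (w l) (ex i)) z :=
    dtt_sub ((hw i).pd (m := 2) (ex l) (by norm_num)) ((hw l).pd (m := 2) (ex i) (by norm_num)) z
  rw [h1, dtt_pd (hw i), dtt_pd (hw l), pd_congr _ (h i), pd_congr _ (h l)]

/-- The index set of the scalar wave system attached to Biot's system. -/
abbrev WIdx := Fin 3 ⊕ (Fin 3 × Fin 3) ⊕ (Fin 2 ⊕ Fin 2)

/-- The matrix `A - c I`. -/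
def shiftMat (A : Fin 2 → Fin 2 → V3 → ℝ) (c : V3 → ℝ) (j k : Fin 2) (x : V3) : ℝ :=
  A j k x - if j = k then c x else 0

/-- The unknowns of the scalar wave system attached to Biot's system: the components and the curl
of the solid displacement, and the spectral components of the pair of divergences. -/
def waveFam (A : Fin 2 → Fin 2 → V3 → ℝ) (μ2 μ3 : V3 → ℝ) (us uf : P4 → V3) : WIdx → P4 → ℝ
  | .inl i => fun y => us y i
  | .inr (.inl li) => crl (fun i y => us y i) li.1 li.2
  | .inr (.inr (.inl j)) => fun y =>
      shiftMat A μ3 j 0 y.2 * sdiv us y + shiftMat A μ3 j 1 y.2 * sdiv uf y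
  | .inr (.inr (.inr j)) => fun y =>
      shiftMat A μ2 j 0 y.2 * sdiv us y + shiftMat A μ2 j 1 y.2 * sdiv uf y

/-- The squared speeds of the scalar wave system attached to Biot's system. -/
def waveSpeed (μ1 μ2 μ3 : V3 → ℝ) : WIdx → V3 → ℝ
  | .inl _ => μ1
  | .inr (.inl _) => μ1
  | .inr (.inr (.inl _)) => μ2
  | .inr (.inr (.inr _)) => μ3

/-- The first-order energy of the solid displacement, its curl and the two divergences. -/
def lowJet (us uf : P4 → V3) (z : P4) : ℝ :=
  ∑ i, jet2 (fun y => us y i) z + ∑ l, ∑ i, jet2 (crl (fun i y => us y i) l i) z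
    + jet2 (sdiv us) z + jet2 (sdiv uf) z

/-- The squared size of the sources and their spatial gradients. -/
def srcSq (F1 F2 : P4 → V3) (z : P4) : ℝ :=
  n2 (F1 z) + n2 (F2 z) + vGradX2 F1 z + vGradX2 F2 z

theorem n2_nonneg (v : V3) : 0 ≤ n2 v := Finset.sum_nonneg fun _ _ => sq_nonneg _

theorem vGradX2_nonneg (u : P4 → V3) (z : P4) : 0 ≤ vGradX2 u z :=
  Finset.sum_nonneg fun _ _ => Finset.sum_nonneg fun _ _ => sq_nonneg _

theorem srcSq_nonneg (F1 F2 : P4 → V3) (z : P4) : 0 ≤ srcSq F1 F2 z := by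
  have := n2_nonneg (F1 z)
  have := n2_nonneg (F2 z)
  have := vGradX2_nonneg F1 z
  have := vGradX2_nonneg F2 z
  unfold srcSq; linarith

theorem lowJet_terms_le (us uf : P4 → V3) (z : P4) :
    (∀ i, jet2 (fun y => us y i) z ≤ lowJet us uf z) ∧
    (∀ l i, jet2 (crl (fun i y => us y i) l i) z ≤ lowJet us uf z) ∧
    jet2 (sdiv us) z ≤ lowJet us uf z ∧ jet2 (sdiv uf) z ≤ lowJet us uf z := by
  have a : 0 ≤ ∑ i, jet2 (fun y => us y i) z := Finset.sum_nonneg fun _ _ => jet2_nonneg _ _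
  have b : 0 ≤ ∑ l, ∑ i, jet2 (crl (fun i y => us y i) l i) z :=
    Finset.sum_nonneg fun _ _ => Finset.sum_nonneg fun _ _ => jet2_nonneg _ _
  have c := jet2_nonneg (sdiv us) z
  have d := jet2_nonneg (sdiv uf) z
  refine ⟨fun i => ?_, fun l i => ?_, ?_, ?_⟩
  · have := Finset.single_le_sum (f := fun i => jet2 (fun y => us y i) z)
      (fun _ _ => jet2_nonneg _ _) (Finset.mem_univ i)
    unfold lowJet; linarith
  · have h1 := Finset.single_le_sum (f := fun i => jet2 (crl (fun i y => us y i) l i) z)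
      (fun _ _ => jet2_nonneg _ _) (Finset.mem_univ i)
    have h2 := Finset.single_le_sum (f := fun l => ∑ i, jet2 (crl (fun i y => us y i) l i) z)
      (fun _ _ => Finset.sum_nonneg fun _ _ => jet2_nonneg _ _) (Finset.mem_univ l)
    unfold lowJet; linarith
  · unfold lowJet; linarith
  · unfold lowJet; linarith

theorem lowJet_nonneg (us uf : P4 → V3) (z : P4) : 0 ≤ lowJet us uf z :=
  (jet2_nonneg _ _).trans (lowJet_terms_le us uf z).2.2.1

theorem srcSq_terms_le (F1 F2 : P4 → V3) (z : P4) (i : Fin 3) :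
    (F1 z i ^ 2 ≤ srcSq F1 F2 z ∧ F2 z i ^ 2 ≤ srcSq F1 F2 z) ∧
    ∀ l, pd (fun y => F1 y i) (ex l) z ^ 2 ≤ srcSq F1 F2 z ∧
      pd (fun y => F2 y i) (ex l) z ^ 2 ≤ srcSq F1 F2 z := by
  have a := n2_nonneg (F1 z)
  have b := n2_nonneg (F2 z)
  have c := vGradX2_nonneg F1 z
  have d := vGradX2_nonneg F2 z
  have g1 : ∀ v : V3, v i ^ 2 ≤ n2 v := fun v =>
    Finset.single_le_sum (f := fun i => v i ^ 2) (fun _ _ => sq_nonneg _) (Finset.mem_univ i)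
  have g2 : ∀ (u : P4 → V3) l, pd (fun y => u y i) (ex l) z ^ 2 ≤ vGradX2 u z := fun u l =>
    (Finset.single_le_sum (f := fun j => pd (fun y => u y i) (ex j) z ^ 2)
      (fun _ _ => sq_nonneg _) (Finset.mem_univ l)).trans
    (Finset.single_le_sum (f := fun i => gradX2 (fun y => u y i) z)
      (fun _ _ => Finset.sum_nonneg fun _ _ => sq_nonneg _) (Finset.mem_univ i))
  have h1 := g1 (F1 z)
  have h2 := g1 (F2 z)
  unfold srcSq
  refine ⟨⟨by linarith, by linarith⟩, fun l => ⟨?_, ?_⟩⟩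
  · linarith [g2 F1 l]
  · linarith [g2 F2 l]

theorem lowerBound_of_sqrt {us uf F1 F2 : P4 → V3} {p s : V3 → ℝ} {z : P4} {K : ℝ} (hK : 1 ≤ K)
    (hF1 : ContDiff ℝ 1 F1) (hF2 : ContDiff ℝ 1 F2)
    (hp : DifferentiableAt ℝ p z.2 ∧ |p z.2| ≤ K ∧ ∀ l, |pdx p l z.2| ≤ K)
    (hs : DifferentiableAt ℝ s z.2 ∧ |s z.2| ≤ K ∧ ∀ l, |pdx s l z.2| ≤ K) :
    LowerBound (fun i y => us y i) (sdiv uf) (fun i y => p y.2 * F1 y i + s y.2 * F2 y i) z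
      (4 * (K * √(lowJet us uf z + srcSq F1 F2 z))) := by
  obtain ⟨J1, J2, J3, J4⟩ := lowJet_terms_le us uf z
  have hJ := lowJet_nonneg us uf z
  have hs0 := srcSq_nonneg F1 F2 z
  have root : ∀ {x : ℝ}, x ^ 2 ≤ lowJet us uf z + srcSq F1 F2 z →
      |x| ≤ √(lowJet us uf z + srcSq F1 F2 z) := fun h => Real.abs_le_sqrt h
  obtain ⟨q, hq⟩ : ∃ q, q = √(lowJet us uf z + srcSq F1 F2 z) := ⟨_, rfl⟩
  rw [← hq] at root ⊢
  have hq0 : 0 ≤ q := hq ▸ Real.sqrt_nonneg _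
  have hKq : q ≤ 4 * (K * q) := by nlinarith
  have sm : ∀ {x : ℝ}, x ^ 2 ≤ lowJet us uf z + srcSq F1 F2 z → |x| ≤ 4 * (K * q) := fun h =>
    (root h).trans hKq
  have d1 : ∀ i, DifferentiableAt ℝ (fun y => F1 y i) z := fun i =>
    (contDiff_pi.1 hF1 i).differentiable (by norm_num) z
  have d2 : ∀ i, DifferentiableAt ℝ (fun y => F2 y i) z := fun i =>
    (contDiff_pi.1 hF2 i).differentiable (by norm_num) z
  have dp : DifferentiableAt ℝ (fun y : P4 => p y.2) z := hp.1.comp z differentiableAt_snd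
  have dsn : DifferentiableAt ℝ (fun y : P4 => s y.2) z := hs.1.comp z differentiableAt_snd
  refine ⟨fun i l => sm ?_, fun i j l => sm ?_, ⟨sm ?_, fun l => sm ?_⟩, ⟨sm ?_, fun l => sm ?_⟩,
    fun i => ⟨?_, fun l => ?_⟩⟩
  · have := sq_pd_ex_le_jet2 (fun y => us y i) l z; linarith [J1 i]
  · have := sq_pd_ex_le_jet2 (crl (fun i y => us y i) i j) l z; linarith [J2 i j]
  · have := sq_le_jet2 (sdiv us) z; change sdiv us z ^ 2 ≤ _; linarith
  · have := sq_pd_ex_le_jet2 (sdiv us) l z; change pd (sdiv us) (ex l) z ^ 2 ≤ _; linarith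
  · have := sq_le_jet2 (sdiv uf) z; linarith
  · have := sq_pd_ex_le_jet2 (sdiv uf) l z; linarith
  · obtain ⟨⟨a, b⟩, -⟩ := srcSq_terms_le F1 F2 z i
    have t1 := abs_mul_le_mul hp.2.1 (root (a.trans (by linarith)))
    have t2 := abs_mul_le_mul hs.2.1 (root (b.trans (by linarith)))
    have := abs_add_le (p z.2 * F1 z i) (s z.2 * F2 z i)
    have : 0 ≤ K * q := by positivity
    linarith
  · obtain ⟨⟨a, b⟩, h⟩ := srcSq_terms_le F1 F2 z i
    obtain ⟨c, d⟩ := h l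
    have t1 := abs_mul_le_mul hp.2.1 (root (c.trans (by linarith)))
    have t2 := abs_mul_le_mul hs.2.1 (root (d.trans (by linarith)))
    have t3 := abs_mul_le_mul (hp.2.2 l) (root (a.trans (by linarith)))
    have t4 := abs_mul_le_mul (hs.2.2 l) (root (b.trans (by linarith)))
    have e : pd (fun y : P4 => p y.2 * F1 y i + s y.2 * F2 y i) (ex l) z =
        (pdx p l z.2 * F1 z i + p z.2 * pd (fun y => F1 y i) (ex l) z)
        + (pdx s l z.2 * F2 z i + s z.2 * pd (fun y => F2 y i) (ex l) z) := by
      rw [pd_add (f := fun y : P4 => p y.2 * F1 y i) (g := fun y : P4 => s y.2 * F2 y i) _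
        (dp.mul (d1 i)) (dsn.mul (d2 i)),
        pd_mul (f := fun y : P4 => p y.2) (g := fun y : P4 => F1 y i) _ dp (d1 i),
        pd_mul (f := fun y : P4 => s y.2) (g := fun y : P4 => F2 y i) _ dsn (d2 i),
        pd_comp_snd_ex l hp.1, pd_comp_snd_ex l hs.1]
    rw [e, abs_le]
    rw [abs_le] at t1 t2 t3 t4
    constructor <;> linarith

/-- The matrix of the principal part of the system satisfied by the two divergences; `κ` stands
for the inverse of the determinant of the density matrix. -/
def biotMat (ρ11 ρ12 ρ22 μ lam q r κ : V3 → ℝ) : Fin 2 → Fin 2 → V3 → ℝ :=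
  ![![fun x => ρ22 x * κ x * (2 * μ x + lam x) + -ρ12 x * κ x * q x,
      fun x => ρ22 x * κ x * q x + -ρ12 x * κ x * r x],
    ![fun x => -ρ12 x * κ x * (2 * μ x + lam x) + ρ11 x * κ x * q x,
      fun x => -ρ12 x * κ x * q x + ρ11 x * κ x * r x]]

theorem shiftMat_apply (A : Fin 2 → Fin 2 → V3 → ℝ) (c : V3 → ℝ) (x : V3) :
    shiftMat A c 0 0 x = A 0 0 x - c x ∧ shiftMat A c 0 1 x = A 0 1 x ∧
      shiftMat A c 1 0 x = A 1 0 x ∧ shiftMat A c 1 1 x = A 1 1 x - c x := by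
  simp [shiftMat]

theorem shiftMat_mul {A : Fin 2 → Fin 2 → V3 → ℝ} {a b : V3 → ℝ} {x : V3}
    (ha : (A 0 0 x - a x) * (A 1 1 x - a x) - A 0 1 x * A 1 0 x = 0)
    (hb : (A 0 0 x - b x) * (A 1 1 x - b x) - A 0 1 x * A 1 0 x = 0) (hab : a x ≠ b x)
    (j k : Fin 2) : shiftMat A b j 0 x * A 0 k x + shiftMat A b j 1 x * A 1 k x
      = a x * shiftMat A b j k x := by
  obtain ⟨s1, s2, s3, s4⟩ := shiftMat_apply A b x
  obtain ⟨⟨p1, p2⟩, p3, p4⟩ := eigen_rows ha hb hab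
  revert j k
  simp only [Fin.forall_fin_two, s1, s2, s3, s4]
  exact ⟨⟨p1, p2⟩, p3, p4⟩

theorem biot_wave_le {ρ11 ρ12 ρ22 μ lam q r κ μ1 μ2 μ3 : V3 → ℝ} {us uf F1 F2 : P4 → V3}
    {Q : Set P4} {z : P4} {K : ℝ} (hK : 1 ≤ K)
    (hq : Differentiable ℝ q) (hr : Differentiable ℝ r)
    (hus : ContDiff ℝ 3 us) (huf : ContDiff ℝ 3 uf) (hF1 : ContDiff ℝ 1 F1)
    (hF2 : ContDiff ℝ 1 F2) (hQ : IsOpen Q) (hz : z ∈ Q)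
    (hκ : ∀ y ∈ Q, (ρ11 y.2 * ρ22 y.2 - ρ12 y.2 ^ 2) * κ y.2 = 1)
    (hμ1 : μ1 z.2 = ρ22 z.2 * κ z.2 * μ z.2)
    (hB : BiotSystem ρ11 ρ12 ρ22 μ lam q r us uf F1 F2 Q)
    (c1 : (biotCoef μ lam q r (fun x => ρ22 x * κ x) (fun x => -ρ12 x * κ x)).BoundedAt K z.2)
    (c2 : (biotCoef μ lam q r (fun x => -ρ12 x * κ x) (fun x => ρ11 x * κ x)).BoundedAt K z.2)
    (b11 : C2BoundAt (fun x => ρ22 x * κ x) K z.2) (b12 : C2BoundAt (fun x => -ρ12 x * κ x) K z.2)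
    (b22 : C2BoundAt (fun x => ρ11 x * κ x) K z.2)
    (s2 : ∀ j k, C2BoundAt (shiftMat (biotMat ρ11 ρ12 ρ22 μ lam q r κ) μ2 j k) K z.2)
    (s3 : ∀ j k, C2BoundAt (shiftMat (biotMat ρ11 ρ12 ρ22 μ lam q r κ) μ3 j k) K z.2)
    (m2 : |μ2 z.2| ≤ K) (m3 : |μ3 z.2| ≤ K) (h23 : μ2 z.2 ≠ μ3 z.2)
    (hd2 : (Amat ρ11 ρ12 ρ22 μ lam q r z.2 - μ2 z.2 • (1 : Matrix (Fin 2) (Fin 2) ℝ)).det = 0)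
    (hd3 : (Amat ρ11 ρ12 ρ22 μ lam q r z.2 - μ3 z.2 • (1 : Matrix (Fin 2) (Fin 2) ℝ)).det = 0)
    (l : WIdx) :
    |dtt (waveFam (biotMat ρ11 ρ12 ρ22 μ lam q r κ) μ2 μ3 us uf l) z
      - waveSpeed μ1 μ2 μ3 l z.2 *
        slap (waveFam (biotMat ρ11 ρ12 ρ22 μ lam q r κ) μ2 μ3 us uf l) z| ≤
      150 * (K * (K * (4 * (K * √(lowJet us uf z + srcSq F1 F2 z))))) := by
  have hus2 : ContDiff ℝ 2 us := hus.of_le (by norm_num)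
  have huf2 : ContDiff ℝ 2 uf := huf.of_le (by norm_num)
  have us3 : ∀ i, ContDiff ℝ 3 fun y => us y i := contDiff_pi.1 hus
  have uf3 : ∀ i, ContDiff ℝ 3 fun y => uf y i := contDiff_pi.1 huf
  have W2 : ContDiff ℝ 2 (sdiv us) := contDiff_dvg (v := fun i y => us y i) us3
  have W2' : ContDiff ℝ 2 (sdiv uf) := contDiff_dvg (v := fun i y => uf y i) uf3
  have toC : ∀ {h : V3 → ℝ}, C2BoundAt h K z.2 →
      DifferentiableAt ℝ h z.2 ∧ |h z.2| ≤ K ∧ ∀ l, |pdx h l z.2| ≤ K := fun h =>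
    ⟨h.smooth.differentiable (by norm_num) _, h.val, h.grad⟩
  have S1 : ∀ {p s : V3 → ℝ}, C2BoundAt p K z.2 → C2BoundAt s K z.2 → ∀ i : Fin 3,
      ContDiff ℝ 1 fun y : P4 => p y.2 * F1 y i + s y.2 * F2 y i := fun hp hs i =>
    ((hp.smooth.comp contDiff_snd).of_le (by norm_num) |>.mul (contDiff_pi.1 hF1 i)).add
      ((hs.smooth.comp contDiff_snd).of_le (by norm_num) |>.mul (contDiff_pi.1 hF2 i))
  have e1 : ∀ i, ∀ᶠ y in nhds z, dtt (fun y => us y i) y =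
      (biotCoef μ lam q r (fun x => ρ22 x * κ x) (fun x => -ρ12 x * κ x)).op
        (fun i y => us y i) (sdiv uf)
        (fun i y => ρ22 y.2 * κ y.2 * F1 y i + -ρ12 y.2 * κ y.2 * F2 y i) i y := fun i => by
    filter_upwards [hQ.mem_nhds hz] with y hy
    have := biotCoef_op (p := fun x => ρ22 x * κ x) (s := fun x => -ρ12 x * κ x) hB hq hr hus2 huf2
      hy i
    rw [← this]
    linear_combination (-dtt (fun y => us y i) y) * hκ y hy
  have e2 : ∀ i, ∀ᶠ y in nhds z, dtt (fun y => uf y i) y =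
      (biotCoef μ lam q r (fun x => -ρ12 x * κ x) (fun x => ρ11 x * κ x)).op
        (fun i y => us y i) (sdiv uf)
        (fun i y => -ρ12 y.2 * κ y.2 * F1 y i + ρ11 y.2 * κ y.2 * F2 y i) i y := fun i => by
    filter_upwards [hQ.mem_nhds hz] with y hy
    have := biotCoef_op (p := fun x => -ρ12 x * κ x) (s := fun x => ρ11 x * κ x) hB hq hr hus2 huf2
      hy i
    rw [← this]
    linear_combination (-dtt (fun y => uf y i) y) * hκ y hy
  have N1 := lowerBound_of_sqrt (us := us) (uf := uf) hK hF1 hF2 (toC b11) (toC b12)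
  have N2 := lowerBound_of_sqrt (us := us) (uf := uf) hK hF1 hF2 (toC b12) (toC b22)
  obtain ⟨N, hN⟩ : ∃ N, N = 4 * (K * √(lowJet us uf z + srcSq F1 F2 z)) := ⟨_, rfl⟩
  rw [← hN] at N1 N2 ⊢
  have hN0 : 0 ≤ N := (abs_nonneg _).trans N1.press.1
  have hKN : 0 ≤ K * N := by positivity
  have hKKN : K * N ≤ K * (K * N) := le_mul_of_one_le_left hKN hK
  have dX : |dtt (sdiv us) z - (biotMat ρ11 ρ12 ρ22 μ lam q r κ 0 0 z.2 * slap (sdiv us) z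
      + biotMat ρ11 ρ12 ρ22 μ lam q r κ 0 1 z.2 * slap (sdiv uf) z)| ≤ 66 * (K * N) := by
    have h1 := ElCoef.abs_dvg_op_sub_le c1 N1 hK us3 W2' (S1 b11 b12)
    have h2 : dtt (sdiv us) z = _ := dtt_dvg_eq us3 e1
    rw [h2]
    refine le_of_eq_of_le ?_ h1
    have e : dvg (fun i y => us y i) = sdiv us := rfl
    rw [e]
    congr 1
    simp only [biotCoef, biotMat, Matrix.cons_val_zero, Matrix.cons_val_one]
    ring
  have dY : |dtt (sdiv uf) z - (biotMat ρ11 ρ12 ρ22 μ lam q r κ 1 0 z.2 * slap (sdiv us) z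
      + biotMat ρ11 ρ12 ρ22 μ lam q r κ 1 1 z.2 * slap (sdiv uf) z)| ≤ 66 * (K * N) := by
    have h1 := ElCoef.abs_dvg_op_sub_le c2 N2 hK us3 W2' (S1 b12 b22)
    have h2 : dtt (sdiv uf) z = _ := dtt_dvg_eq uf3 e2
    rw [h2]
    refine le_of_eq_of_le ?_ h1
    have e : dvg (fun i y => us y i) = sdiv us := rfl
    rw [e]
    congr 1
    simp only [biotCoef, biotMat, Matrix.cons_val_zero, Matrix.cons_val_one]
    ring
  have a2 := Amat_det_eq (hκ z hz) hd2
  have a3 := Amat_det_eq (hκ z hz) hd3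
  have hM : 150 * (K * (K * N)) = 2 * (K * (66 * (K * N))) + 18 * (K * (K * N)) := by ring
  rcases l with i | ⟨l, i⟩ | j | j
  · have h1 := ElCoef.abs_op_sub_le c1 N1 hK i
    rw [← (e1 i).self_of_nhds] at h1
    refine le_trans (le_of_eq_of_le ?_ h1) (by linarith)
    simp only [waveFam, waveSpeed, biotCoef, hμ1]
  · have h1 := ElCoef.abs_crl_op_sub_le c1 N1 hK us3 W2' (S1 b11 b12) l i
    rw [← dtt_crl_eq us3 e1] at h1
    refine le_trans (le_of_eq_of_le ?_ h1) (by linarith)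
    simp only [waveFam, waveSpeed, biotCoef, hμ1]
  · exact wave_comb_le (s3 j 0) (s3 j 1) W2 W2' m2
      (shiftMat_mul (A := biotMat ρ11 ρ12 ρ22 μ lam q r κ) a2 a3 h23 j 0)
      (shiftMat_mul (A := biotMat ρ11 ρ12 ρ22 μ lam q r κ) a2 a3 h23 j 1) dX dY
      N1.div.1 N1.div.2 N1.press.1 N1.press.2 hM
  · exact wave_comb_le (s2 j 0) (s2 j 1) W2 W2' m3
      (shiftMat_mul (A := biotMat ρ11 ρ12 ρ22 μ lam q r κ) a3 a2 h23.symm j 0)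
      (shiftMat_mul (A := biotMat ρ11 ρ12 ρ22 μ lam q r κ) a3 a2 h23.symm j 1) dX dY
      N1.div.1 N1.div.2 N1.press.1 N1.press.2 hM

theorem jet2_congr {f g : P4 → ℝ} {z : P4} (h : f =ᶠ[nhds z] g) : jet2 f z = jet2 g z := by
  simp only [jet2, gradT2, pd_congr _ h, h.self_of_nhds]

theorem sum_waveFam (G : (P4 → ℝ) → ℝ) (A : Fin 2 → Fin 2 → V3 → ℝ) (μ2 μ3 : V3 → ℝ)
    (us uf : P4 → V3) : ∑ m, G (waveFam A μ2 μ3 us uf m) =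
      ∑ i, G (fun y => us y i) + (∑ l, ∑ i, G (crl (fun i y => us y i) l i)
        + (∑ j, G (fun y => shiftMat A μ3 j 0 y.2 * sdiv us y + shiftMat A μ3 j 1 y.2 * sdiv uf y)
        + ∑ j, G (fun y => shiftMat A μ2 j 0 y.2 * sdiv us y
            + shiftMat A μ2 j 1 y.2 * sdiv uf y))) := by
  rw [Fintype.sum_sum_type, Fintype.sum_sum_type, Fintype.sum_sum_type, Fintype.sum_prod_type]
  rfl

theorem contDiff_waveFam {A : Fin 2 → Fin 2 → V3 → ℝ} {μ2 μ3 : V3 → ℝ} {us uf : P4 → V3}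
    (h2 : ∀ j k, ContDiff ℝ 2 (shiftMat A μ2 j k)) (h3 : ∀ j k, ContDiff ℝ 2 (shiftMat A μ3 j k))
    (hus : ContDiff ℝ 3 us) (huf : ContDiff ℝ 3 uf) (l : WIdx) :
    ContDiff ℝ 2 (waveFam A μ2 μ3 us uf l) := by
  have W2 : ContDiff ℝ 2 (sdiv us) := contDiff_dvg (v := fun i y => us y i) (contDiff_pi.1 hus)
  have W2' : ContDiff ℝ 2 (sdiv uf) := contDiff_dvg (v := fun i y => uf y i) (contDiff_pi.1 huf)
  rcases l with i | ⟨l, i⟩ | j | j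
  · exact (contDiff_pi.1 hus i).of_le (by norm_num)
  · exact contDiff_crl (contDiff_pi.1 hus) l i
  · exact (((h3 j 0).comp contDiff_snd).mul W2).add (((h3 j 1).comp contDiff_snd).mul W2')
  · exact (((h2 j 0).comp contDiff_snd).mul W2).add (((h2 j 1).comp contDiff_snd).mul W2')

theorem lowJet_le_waveFam {A : Fin 2 → Fin 2 → V3 → ℝ} {μ2 μ3 h : V3 → ℝ} {us uf : P4 → V3}
    {z : P4} {K : ℝ} (hK : 1 ≤ K)
    (h2 : ∀ j k, ContDiff ℝ 2 (shiftMat A μ2 j k)) (h3 : ∀ j k, ContDiff ℝ 2 (shiftMat A μ3 j k))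
    (hus : ContDiff ℝ 3 us) (huf : ContDiff ℝ 3 uf)
    (hh : C2BoundAt h K z.2) (he : ∀ᶠ x in nhds z.2, (μ2 x - μ3 x) * h x = 1) :
    lowJet us uf z ≤ 32 * K ^ 2 * ∑ m, jet2 (waveFam A μ2 μ3 us uf m) z := by
  have cd := contDiff_waveFam h2 h3 hus huf
  have dd : ∀ l, DifferentiableAt ℝ (waveFam A μ2 μ3 us uf l) z := fun l =>
    (cd l).differentiable (by norm_num) z
  have hd : DifferentiableAt ℝ h z.2 := hh.smooth.differentiable (by norm_num) _
  have hd' : DifferentiableAt ℝ (fun x => -h x) z.2 := hd.neg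
  have n0 : |(fun x => -h x) z.2| ≤ K := by simpa using hh.val
  have n1 : ∀ i, |pdx (fun x => -h x) i z.2| ≤ K := fun i => by
    have : pdx (fun x => -h x) i z.2 = -pdx h i z.2 := by
      simp only [pdx]; rw [fderiv_fun_neg]; rfl
    rw [this, abs_neg]; exact hh.grad i
  have ez : ∀ᶠ y : P4 in nhds z, (μ2 y.2 - μ3 y.2) * h y.2 = 1 :=
    (continuous_snd.tendsto z).eventually he
  have w1 : jet2 (sdiv us) z ≤ 16 * K ^ 2 * (jet2 (waveFam A μ2 μ3 us uf (.inr (.inr (.inl 0)))) z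
      + jet2 (waveFam A μ2 μ3 us uf (.inr (.inr (.inr 0)))) z) := by
    refine le_of_eq_of_le (jet2_congr ?_)
      (jet2_comb_le hd hd' (dd _) (dd _) hh.val hh.grad n0 n1)
    filter_upwards [ez] with y hy
    simp only [waveFam, shiftMat_apply]
    linear_combination (-sdiv us y) * hy
  have w2 : jet2 (sdiv uf) z ≤ 16 * K ^ 2 * (jet2 (waveFam A μ2 μ3 us uf (.inr (.inr (.inl 1)))) z
      + jet2 (waveFam A μ2 μ3 us uf (.inr (.inr (.inr 1)))) z) := by
    refine le_of_eq_of_le (jet2_congr ?_)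
      (jet2_comb_le hd hd' (dd _) (dd _) hh.val hh.grad n0 n1)
    filter_upwards [ez] with y hy
    simp only [waveFam, shiftMat_apply]
    linear_combination (-sdiv uf y) * hy
  have hs := sum_waveFam (fun f => jet2 f z) A μ2 μ3 us uf
  have a : 0 ≤ ∑ i, jet2 (fun y => us y i) z := Finset.sum_nonneg fun _ _ => jet2_nonneg _ _
  have b : 0 ≤ ∑ l, ∑ i, jet2 (crl (fun i y => us y i) l i) z :=
    Finset.sum_nonneg fun _ _ => Finset.sum_nonneg fun _ _ => jet2_nonneg _ _
  have t := fun l => jet2_nonneg (waveFam A μ2 μ3 us uf l) z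
  have t1 := t (.inr (.inr (.inl 0)))
  have t2 := t (.inr (.inr (.inr 0)))
  have t3 := t (.inr (.inr (.inl 1)))
  have t4 := t (.inr (.inr (.inr 1)))
  simp only [Fin.sum_univ_two] at hs
  simp only [waveFam] at w1 w2 t1 t2 t3 t4
  have hK2 : 1 ≤ K ^ 2 := by nlinarith
  rw [hs]
  unfold lowJet
  nlinarith

theorem waveFam_jet2_le {A : Fin 2 → Fin 2 → V3 → ℝ} {μ2 μ3 : V3 → ℝ} {us uf : P4 → V3}
    {z : P4} {K : ℝ} (hK : 1 ≤ K)
    (h2 : ∀ j k, C2BoundAt (shiftMat A μ2 j k) K z.2)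
    (h3 : ∀ j k, C2BoundAt (shiftMat A μ3 j k) K z.2)
    (hus : ContDiff ℝ 2 us) (huf : ContDiff ℝ 2 uf) :
    ∑ m, jet2 (waveFam A μ2 μ3 us uf m) z ≤ 65 * K ^ 2 * lowJet us uf z := by
  have W2 : DifferentiableAt ℝ (sdiv us) z :=
    (contDiff_dvg (n := 1) (v := fun i y => us y i) (contDiff_pi.1 hus)).differentiable
      (by norm_num) z
  have W2' : DifferentiableAt ℝ (sdiv uf) z :=
    (contDiff_dvg (n := 1) (v := fun i y => uf y i) (contDiff_pi.1 huf)).differentiable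
      (by norm_num) z
  have d : ∀ {g : V3 → ℝ}, C2BoundAt g K z.2 → DifferentiableAt ℝ g z.2 := fun h =>
    h.smooth.differentiable (by norm_num) _
  have c2 := fun j => jet2_comb_le (d (h2 j 0)) (d (h2 j 1)) W2 W2' (h2 j 0).val (h2 j 0).grad
    (h2 j 1).val (h2 j 1).grad
  have c3 := fun j => jet2_comb_le (d (h3 j 0)) (d (h3 j 1)) W2 W2' (h3 j 0).val (h3 j 0).grad
    (h3 j 1).val (h3 j 1).grad
  have hs := sum_waveFam (fun f => jet2 f z) A μ2 μ3 us uf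
  simp only [Fin.sum_univ_two] at hs
  have a : 0 ≤ ∑ i, jet2 (fun y => us y i) z := Finset.sum_nonneg fun _ _ => jet2_nonneg _ _
  have b : 0 ≤ ∑ l, ∑ i, jet2 (crl (fun i y => us y i) l i) z :=
    Finset.sum_nonneg fun _ _ => Finset.sum_nonneg fun _ _ => jet2_nonneg _ _
  have := jet2_nonneg (sdiv us) z
  have := jet2_nonneg (sdiv uf) z
  have hK2 : 1 ≤ K ^ 2 := by nlinarith
  have := c2 0; have := c2 1; have := c3 0; have := c3 1
  rw [hs]
  unfold lowJet
  nlinarith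

/-- The first-order jet of a vector field. -/
def vjet (u : P4 → V3) (z : P4) : ℝ := ∑ i, jet2 (fun y => u y i) z

theorem vjet_nonneg (u : P4 → V3) (z : P4) : 0 ≤ vjet u z :=
  Finset.sum_nonneg fun _ _ => jet2_nonneg _ _

theorem sq_pd_ex_le_vjet (u : P4 → V3) (i l : Fin 3) (z : P4) :
    pd (fun y => u y i) (ex l) z ^ 2 ≤ vjet u z :=
  (sq_pd_ex_le_jet2 _ l z).trans
    (Finset.single_le_sum (f := fun i => jet2 (fun y => u y i) z) (fun _ _ => jet2_nonneg _ _)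
      (Finset.mem_univ i))

theorem sq_le_vjet (u : P4 → V3) (i : Fin 3) (z : P4) : u z i ^ 2 ≤ vjet u z :=
  (sq_le_jet2 (fun y => u y i) z).trans
    (Finset.single_le_sum (f := fun i => jet2 (fun y => u y i) z) (fun _ _ => jet2_nonneg _ _)
      (Finset.mem_univ i))

theorem sq_sdiv_le_vjet (u : P4 → V3) (z : P4) : sdiv u z ^ 2 ≤ 9 * vjet u z := by
  have h := fun i => sq_pd_ex_le_vjet u i i z
  have h0 := h 0; have h1 := h 1; have h2 := h 2
  have e : sdiv u z = ∑ i, pd (fun y => u y i) (ex i) z := rfl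
  rw [e, Fin.sum_univ_three]
  nlinarith [sq_nonneg (pd (fun y => u y 0) (ex 0) z - pd (fun y => u y 1) (ex 1) z),
    sq_nonneg (pd (fun y => u y 0) (ex 0) z - pd (fun y => u y 2) (ex 2) z),
    sq_nonneg (pd (fun y => u y 1) (ex 1) z - pd (fun y => u y 2) (ex 2) z)]

theorem sq_waveFam_le {A : Fin 2 → Fin 2 → V3 → ℝ} {μ2 μ3 : V3 → ℝ} {us uf : P4 → V3}
    {z : P4} {K : ℝ} (hK : 1 ≤ K) (h2 : ∀ j k, |shiftMat A μ2 j k z.2| ≤ K)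
    (h3 : ∀ j k, |shiftMat A μ3 j k z.2| ≤ K) (m : WIdx) :
    waveFam A μ2 μ3 us uf m z ^ 2 ≤ 18 * K ^ 2 * (vjet us z + vjet uf z) := by
  have hK2 : 1 ≤ K ^ 2 := by nlinarith
  have a := vjet_nonneg us z
  have b := vjet_nonneg uf z
  have c := sq_sdiv_le_vjet us z
  have d := sq_sdiv_le_vjet uf z
  have sq : ∀ {x y : ℝ}, |x| ≤ K → (x * y) ^ 2 ≤ K ^ 2 * y ^ 2 := fun {x y} h => by
    rw [mul_pow]
    exact mul_le_mul_of_nonneg_right (sq_le_sq' (abs_le.1 h).1 (abs_le.1 h).2) (sq_nonneg _)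
  have comb : ∀ {x y : ℝ}, |x| ≤ K → |y| ≤ K →
      (x * sdiv us z + y * sdiv uf z) ^ 2 ≤ 18 * K ^ 2 * (vjet us z + vjet uf z) := by
    intro x y hx hy
    have e1 := sq (y := sdiv us z) hx
    have e2 := sq (y := sdiv uf z) hy
    have e3 := mul_le_mul_of_nonneg_left c (sq_nonneg K)
    have e4 := mul_le_mul_of_nonneg_left d (sq_nonneg K)
    nlinarith [sq_nonneg (x * sdiv us z - y * sdiv uf z)]
  rcases m with i | ⟨l, i⟩ | j | j
  · have := sq_le_vjet us i z
    simp only [waveFam]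
    nlinarith
  · have h1 := sq_pd_ex_le_vjet us i l z
    have h2 := sq_pd_ex_le_vjet us l i z
    simp only [waveFam, crl]
    nlinarith [sq_nonneg (pd (fun y => us y i) (ex l) z + pd (fun y => us y l) (ex i) z)]
  · exact comb (h3 j 0) (h3 j 1)
  · exact comb (h2 j 0) (h2 j 1)

theorem C2BoundAt.mono {h : V3 → ℝ} {K L : ℝ} {x : V3} (hh : C2BoundAt h K x) (hKL : K ≤ L) :
    C2BoundAt h L x :=
  ⟨hh.smooth, hh.val.trans hKL, fun i => (hh.grad i).trans hKL, fun i j => (hh.hess i j).trans hKL⟩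

theorem ElCoef.BoundedAt.mono {c : ElCoef} {K L : ℝ} {x : V3} (h : c.BoundedAt K x) (hKL : K ≤ L) :
    c.BoundedAt L x := by
  have mono : ∀ {f : V3 → ℝ}, (DifferentiableAt ℝ f x ∧ |f x| ≤ K ∧ ∀ l, |pdx f l x| ≤ K) →
      (DifferentiableAt ℝ f x ∧ |f x| ≤ L ∧ ∀ l, |pdx f l x| ≤ L) :=
    fun h => ⟨h.1, h.2.1.trans hKL, fun l => (h.2.2 l).trans hKL⟩
  exact ⟨mono h.k, mono h.a, mono h.a', fun i => mono (h.e i), fun i => mono (h.e' i),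
    fun i => mono (h.m i)⟩

theorem contDiff_biotMat {ρ11 ρ12 ρ22 μ lam q r κ : V3 → ℝ} (h11 : ContDiff ℝ 2 ρ11)
    (h12 : ContDiff ℝ 2 ρ12) (h22 : ContDiff ℝ 2 ρ22) (hμ : ContDiff ℝ 2 μ) (hl : ContDiff ℝ 2 lam)
    (hq : ContDiff ℝ 2 q) (hr : ContDiff ℝ 2 r) (hκ : ContDiff ℝ 2 κ) (j k : Fin 2) :
    ContDiff ℝ 2 (biotMat ρ11 ρ12 ρ22 μ lam q r κ j k) := by
  revert j k
  simp only [Fin.forall_fin_two, biotMat, Matrix.cons_val_zero, Matrix.cons_val_one]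
  refine ⟨⟨?_, ?_⟩, ?_, ?_⟩ <;> fun_prop

theorem contDiff_shiftMat {A : Fin 2 → Fin 2 → V3 → ℝ} {c : V3 → ℝ}
    (hA : ∀ j k, ContDiff ℝ 2 (A j k)) (hc : ContDiff ℝ 2 c) (j k : Fin 2) :
    ContDiff ℝ 2 (shiftMat A c j k) := by
  have : shiftMat A c j k = fun x => A j k x - if j = k then c x else 0 := rfl
  rw [this]
  by_cases h : j = k
  · simp only [h, if_true]; exact (hA k k).sub hc
  · simp only [h, if_false, sub_zero]; exact hA j k

theorem exists_biot_waveSystem {Ω : Set V3} {x0 : V3} {ρ11 ρ12 ρ22 μ lam q r μ2 μ3 : V3 → ℝ}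
    {m θ c1 c2 c3 : ℝ} (hΩ : Bornology.IsBounded Ω) (hA1 : AssumpA1 Ω ρ11 ρ12 ρ22 μ lam q r)
    (hA2 : AssumpA2 Ω x0 ρ11 ρ12 ρ22 μ lam q r μ2 μ3 m θ c1 c2 c3) :
    ∃ A : Fin 2 → Fin 2 → V3 → ℝ, ∃ K : ℝ, 1 ≤ K ∧
      (∀ us uf : P4 → V3, ContDiff ℝ 3 us → ContDiff ℝ 3 uf →
        (∀ l, ContDiff ℝ 2 (waveFam A μ2 μ3 us uf l)) ∧
        ∀ z : P4, z.2 ∈ closure Ω →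
          lowJet us uf z ≤ K * ∑ l, jet2 (waveFam A μ2 μ3 us uf l) z ∧
          ∑ l, jet2 (waveFam A μ2 μ3 us uf l) z ≤ K * lowJet us uf z ∧
          ∑ l, waveFam A μ2 μ3 us uf l z ^ 2 ≤ K * (vjet us z + vjet uf z)) ∧
      ∀ us uf F1 F2 : P4 → V3, ContDiff ℝ 3 us → ContDiff ℝ 3 uf → ContDiff ℝ 1 F1 →
        ContDiff ℝ 1 F2 → ∀ Q : Set P4, IsOpen Q → (∀ z ∈ Q, z.2 ∈ Ω) →
        BiotSystem ρ11 ρ12 ρ22 μ lam q r us uf F1 F2 Q → ∀ z ∈ Q, ∀ l,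
        (dtt (waveFam A μ2 μ3 us uf l) z
          - waveSpeed (fun x => (ρ11 x * ρ22 x - ρ12 x ^ 2)⁻¹ * ρ22 x * μ x) μ2 μ3 l z.2 *
            slap (waveFam A μ2 μ3 us uf l) z) ^ 2
          ≤ K * (∑ l, jet2 (waveFam A μ2 μ3 us uf l) z + srcSq F1 F2 z) := by
  obtain ⟨h11, h12, h22, hμ, hl, hq, hr, -, hρ, -⟩ := hA1
  obtain ⟨hev, -, hc2, hc3⟩ := hA2
  have hcomp : IsCompact (closure Ω) := hΩ.isCompact_closure
  obtain ⟨κ, hκ, hκ1⟩ := exists_contDiff_mul_eq_one (n := 2) (t := closure Ω)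
    (f := fun x => ρ11 x * ρ22 x - ρ12 x ^ 2) isClosed_closure
    ((h11.mul h22).sub (h12.pow 2)) fun x hx => (hρ x hx).ne'
  have hκ2 : ∀ x ∈ closure Ω, (ρ11 x * ρ22 x - ρ12 x ^ 2) * κ x = 1 := fun x hx =>
    hκ1.self_of_nhdsSet x hx
  have hκC : ContDiff ℝ 2 κ := hκ
  have hμ2 : ContDiff ℝ 2 μ2 := hc2.1
  have hμ3 : ContDiff ℝ 2 μ3 := hc3.1
  obtain ⟨h, hh, hh1⟩ := exists_contDiff_mul_eq_one (n := 2) (t := closure Ω)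
    (f := fun x => μ2 x - μ3 x) isClosed_closure (hμ2.sub hμ3)
    fun x hx => sub_ne_zero.2 (hev x hx).2.2.2.2
  have hA := contDiff_biotMat h11 h12 h22 hμ hl hq hr hκC
  obtain ⟨A, hAe⟩ : ∃ A, A = biotMat ρ11 ρ12 ρ22 μ lam q r κ := ⟨_, rfl⟩
  have hs2 := contDiff_shiftMat hA hμ2
  have hs3 := contDiff_shiftMat hA hμ3
  have hb11 : ContDiff ℝ 2 fun x => ρ22 x * κ x := h22.mul hκC
  have hb12 : ContDiff ℝ 2 fun x => -ρ12 x * κ x := h12.neg.mul hκC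
  have hb22 : ContDiff ℝ 2 fun x => ρ11 x * κ x := h11.mul hκC
  obtain ⟨K1, a1, b1⟩ := exists_biotCoef_boundedAt hμ hl hq hr hb11 hb12 hcomp
  obtain ⟨K2, a2, b2⟩ := exists_biotCoef_boundedAt hμ hl hq hr hb12 hb22 hcomp
  obtain ⟨K3, a3, b3⟩ := exists_c2BoundAt (ι := Fin 2 × Fin 2) (fun i => hs2 i.1 i.2) hcomp
  obtain ⟨K4, a4, b4⟩ := exists_c2BoundAt (ι := Fin 2 × Fin 2) (fun i => hs3 i.1 i.2) hcomp
  obtain ⟨K5, a5, b5⟩ := exists_c2BoundAt (ι := Unit) (fun _ => hb11) hcomp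
  obtain ⟨K6, a6, b6⟩ := exists_c2BoundAt (ι := Unit) (fun _ => hb12) hcomp
  obtain ⟨K7, a7, b7⟩ := exists_c2BoundAt (ι := Unit) (fun _ => hb22) hcomp
  obtain ⟨K8, a8, b8⟩ := exists_c2BoundAt (ι := Unit) (fun _ => hμ2) hcomp
  obtain ⟨K9, a9, b9⟩ := exists_c2BoundAt (ι := Unit) (fun _ => hμ3) hcomp
  obtain ⟨K10, a10, b10⟩ := exists_c2BoundAt (ι := Unit) (h := fun _ => h) (fun _ => hh) hcomp
  obtain ⟨K, hK⟩ : ∃ K, K = K1 + K2 + K3 + K4 + K5 + K6 + K7 + K8 + K9 + K10 := ⟨_, rfl⟩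
  have hK1 : 1 ≤ K := by linarith
  have p1 : K ≤ K ^ 6 := le_self_pow₀ hK1 (by norm_num)
  have p2 : K ^ 2 ≤ K ^ 6 := pow_le_pow_right₀ hK1 (by norm_num)
  have p6 : 0 ≤ K ^ 6 := by positivity
  have low : ∀ us uf : P4 → V3, ContDiff ℝ 3 us → ContDiff ℝ 3 uf → ∀ z : P4, z.2 ∈ closure Ω →
      lowJet us uf z ≤ 32 * K ^ 2 * ∑ l, jet2 (waveFam A μ2 μ3 us uf l) z := by
    intro us uf hus huf z hz
    rw [hAe]
    exact lowJet_le_waveFam hK1 hs2 hs3 hus huf ((b10 () z.2 hz).mono (by linarith))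
      (eventually_nhdsSet_iff_forall.1 hh1 z.2 hz)
  have jn : ∀ (us uf : P4 → V3) z, 0 ≤ ∑ l, jet2 (waveFam A μ2 μ3 us uf l) z := fun us uf z =>
    Finset.sum_nonneg fun _ _ => jet2_nonneg _ _
  refine ⟨A, 16000000 * K ^ 8, ?_, ?_, ?_⟩
  · have : 1 ≤ K ^ 8 := one_le_pow₀ hK1
    linarith
  · intro us uf hus huf
    refine ⟨fun l => hAe ▸ contDiff_waveFam hs2 hs3 hus huf l, fun z hz => ⟨?_, ?_, ?_⟩⟩
    · refine (low us uf hus huf z hz).trans (mul_le_mul_of_nonneg_right ?_ (jn us uf z))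
      have : K ^ 2 ≤ K ^ 8 := pow_le_pow_right₀ hK1 (by norm_num)
      have : 0 ≤ K ^ 8 := by positivity
      linarith
    · have := waveFam_jet2_le (us := us) (uf := uf) hK1
        (fun j k => (b3 (j, k) z.2 hz).mono (L := K) (by linarith))
        (fun j k => (b4 (j, k) z.2 hz).mono (L := K) (by linarith)) (hus.of_le (by norm_num))
        (huf.of_le (by norm_num))
      rw [hAe]
      refine this.trans (mul_le_mul_of_nonneg_right ?_ (lowJet_nonneg us uf z))
      have : K ^ 2 ≤ K ^ 8 := pow_le_pow_right₀ hK1 (by norm_num)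
      have : 0 ≤ K ^ 8 := by positivity
      linarith
    · have := fun l => sq_waveFam_le (us := us) (uf := uf) hK1
        (fun j k => ((b3 (j, k) z.2 hz).mono (L := K) (by linarith)).val)
        (fun j k => ((b4 (j, k) z.2 hz).mono (L := K) (by linarith)).val) l
      rw [hAe]
      refine (Finset.sum_le_card_nsmul _ _ _ fun l _ => this l).trans ?_
      have hc : (Finset.univ : Finset WIdx).card = 16 := by decide
      rw [hc, nsmul_eq_mul, ← mul_assoc]
      refine mul_le_mul_of_nonneg_right ?_ (add_nonneg (vjet_nonneg us z) (vjet_nonneg uf z))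
      have : K ^ 2 ≤ K ^ 8 := pow_le_pow_right₀ hK1 (by norm_num)
      have : 0 ≤ K ^ 8 := by positivity
      push_cast
      linarith
  · intro us uf F1 F2 hus huf hF1 hF2 Q hQ hQΩ hB z hz l
    have hzc : z.2 ∈ closure Ω := subset_closure (hQΩ z hz)
    obtain ⟨d2, d3, -, -, h23⟩ := hev z.2 hzc
    have hμ1 : (ρ11 z.2 * ρ22 z.2 - ρ12 z.2 ^ 2)⁻¹ * ρ22 z.2 * μ z.2 = ρ22 z.2 * κ z.2 * μ z.2 := by
      have : (ρ11 z.2 * ρ22 z.2 - ρ12 z.2 ^ 2)⁻¹ = κ z.2 :=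
        inv_eq_of_mul_eq_one_right (hκ2 z.2 hzc)
      rw [this]; ring
    have key := biot_wave_le
      (μ1 := fun x => (ρ11 x * ρ22 x - ρ12 x ^ 2)⁻¹ * ρ22 x * μ x) hK1
      (hq.differentiable (by norm_num)) (hr.differentiable (by norm_num)) hus huf hF1 hF2 hQ hz
      (fun y hy => hκ2 y.2 (subset_closure (hQΩ y hy))) hμ1 hB
      ((b1 z.2 hzc).mono (by linarith)) ((b2 z.2 hzc).mono (by linarith))
      ((b5 () z.2 hzc).mono (by linarith)) ((b6 () z.2 hzc).mono (by linarith))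
      ((b7 () z.2 hzc).mono (by linarith))
      (fun j k => (b3 (j, k) z.2 hzc).mono (by linarith))
      (fun j k => (b4 (j, k) z.2 hzc).mono (by linarith))
      ((b8 () z.2 hzc).val.trans (by linarith)) ((b9 () z.2 hzc).val.trans (by linarith))
      h23 d2 d3 l
    rw [← hAe] at key
    have s0 := srcSq_nonneg F1 F2 z
    have j0 := lowJet_nonneg us uf z
    have hsq := sq_le_sq' (abs_le.1 key).1 (abs_le.1 key).2
    refine hsq.trans ?_
    have e : (150 * (K * (K * (4 * (K * √(lowJet us uf z + srcSq F1 F2 z)))))) ^ 2 =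
        360000 * K ^ 6 * (lowJet us uf z + srcSq F1 F2 z) := by
      have := Real.sq_sqrt (add_nonneg j0 s0)
      linear_combination 360000 * K ^ 6 * this
    rw [e]
    have hl := low us uf hus huf z hzc
    have hj := jn us uf z
    have t1 := mul_le_mul_of_nonneg_left hl p6
    have t2 : 0 ≤ K ^ 8 * ∑ l, jet2 (waveFam A μ2 μ3 us uf l) z := by positivity
    have t3 : K ^ 6 * srcSq F1 F2 z ≤ K ^ 8 * srcSq F1 F2 z :=
      mul_le_mul_of_nonneg_right (pow_le_pow_right₀ hK1 (by norm_num)) s0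
    have t4 : 0 ≤ K ^ 8 * srcSq F1 F2 z := by positivity
    nlinarith

/-- `f` is differentiable at `z` with time derivative `a`. -/
structure HasDt (f : P4 → ℝ) (z : P4) (a : ℝ) : Prop where
  diff : DifferentiableAt ℝ f z
  eq : pd f et z = a

namespace HasDt

variable {f g : P4 → ℝ} {z : P4} {a b : ℝ}

theorem add (hf : HasDt f z a) (hg : HasDt g z b) : HasDt (fun y => f y + g y) z (a + b) :=
  ⟨hf.diff.add hg.diff, by rw [pd_add et hf.diff hg.diff, hf.eq, hg.eq]⟩

theorem sub (hf : HasDt f z a) (hg : HasDt g z b) : HasDt (fun y => f y - g y) z (a - b) :=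
  ⟨hf.diff.sub hg.diff, by rw [pd_sub et hf.diff hg.diff, hf.eq, hg.eq]⟩

theorem sum {ι : Type*} {s : Finset ι} {f : ι → P4 → ℝ} {a : ι → ℝ}
    (hf : ∀ i, HasDt (f i) z (a i)) : HasDt (fun y => ∑ i ∈ s, f i y) z (∑ i ∈ s, a i) :=
  ⟨DifferentiableAt.fun_sum fun i _ => (hf i).diff, by
    rw [pd_sum et fun i _ => (hf i).diff]
    exact Finset.sum_congr rfl fun i _ => (hf i).eq⟩

theorem coef {c : V3 → ℝ} (hc : DifferentiableAt ℝ c z.2) (hf : HasDt f z a) :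
    HasDt (fun y => c y.2 * f y) z (c z.2 * a) :=
  ⟨(hc.comp z differentiableAt_snd).mul hf.diff, by
    rw [pd_mul (f := fun y : P4 => c y.2) et (hc.comp z differentiableAt_snd) hf.diff,
      pd_comp_snd_et hc, hf.eq]; ring⟩

theorem mul_coef {c : V3 → ℝ} (hc : DifferentiableAt ℝ c z.2) (hf : HasDt f z a) :
    HasDt (fun y => f y * c y.2) z (a * c z.2) := by
  have := coef hc hf
  simpa only [mul_comm] using this

theorem of_pd (hf : ContDiff ℝ 2 f) (d : P4) : HasDt (pd f d) z (pd (pd f et) d z) :=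
  ⟨hf.pd_differentiable d z, by rw [pd_comm hf d et]⟩

end HasDt

theorem contDiff_Dt {n : WithTop ℕ∞} {u : P4 → V3} (hu : ContDiff ℝ (n + 1) u) :
    ContDiff ℝ n (Dt u) :=
  contDiff_pi.2 fun i => (contDiff_pi.1 hu i).pd et le_rfl

theorem contDiff_sdiv {n : WithTop ℕ∞} {u : P4 → V3} (hu : ContDiff ℝ (n + 1) u) :
    ContDiff ℝ n (sdiv u) :=
  contDiff_dvg (v := fun i y => u y i) (contDiff_pi.1 hu)

theorem pd_sdiv_et {u : P4 → V3} (hu : ContDiff ℝ 2 u) : pd (sdiv u) et = sdiv (Dt u) := by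
  funext z
  have h := fun i => contDiff_pi.1 hu i
  have e1 : pd (sdiv u) et z = _ := pd_sum et fun i _ => (h i).pd_differentiable (ex i) z
  rw [e1]
  refine Finset.sum_congr rfl fun i _ => ?_
  rw [pd_comm (h i)]
  rfl

theorem hasDt_lameOp {μ lam : V3 → ℝ} (hμ : ContDiff ℝ 2 μ) (hl : ContDiff ℝ 2 lam) {u : P4 → V3}
    (hu : ContDiff ℝ 3 u) (z : P4) (i : Fin 3) :
    HasDt (fun y => lameOp μ lam u y i) z (lameOp μ lam (Dt u) z i) := by
  have hu2 : ContDiff ℝ 2 u := hu.of_le (by norm_num)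
  have h3 := fun i => contDiff_pi.1 hu i
  have h2 := fun i => contDiff_pi.1 hu2 i
  have dμ : DifferentiableAt ℝ μ z.2 := hμ.differentiable (by norm_num) _
  have dl : DifferentiableAt ℝ lam z.2 := hl.differentiable (by norm_num) _
  have dμ' : ∀ j, DifferentiableAt ℝ (pdx μ j) z.2 := fun j =>
    (hμ.pdx j (m := 1) (by norm_num)).differentiable (by norm_num) _
  have dl' : ∀ j, DifferentiableAt ℝ (pdx lam j) z.2 := fun j =>
    (hl.pdx j (m := 1) (by norm_num)).differentiable (by norm_num) _
  have sdt : HasDt (sdiv u) z (sdiv (Dt u) z) :=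
    ⟨(contDiff_sdiv (n := 1) hu2).differentiable (by norm_num) z, by rw [pd_sdiv_et hu2]⟩
  have t1 : HasDt (slap fun y => u y i) z (slap (fun y => Dt u y i) z) :=
    ⟨((h3 i).slap (n := 1)).differentiable (by norm_num) z, by rw [← slap_pd (h3 i)]; rfl⟩
  have t2 : HasDt (pd (sdiv u) (ex i)) z (pd (sdiv (Dt u)) (ex i) z) := by
    rw [← pd_sdiv_et hu2]
    exact HasDt.of_pd (contDiff_sdiv (n := 2) hu) _
  have t3 : ∀ i j, HasDt (pd (fun y => u y i) (ex j)) z (pd (fun y => Dt u y i) (ex j) z) :=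
    fun i j => HasDt.of_pd (h2 i) _
  exact (((HasDt.coef dμ t1).add (HasDt.coef (dμ.add dl) t2)).add
    (HasDt.mul_coef (dl' i) sdt)).add
    (HasDt.sum fun j => HasDt.mul_coef (dμ' j) ((t3 i j).add (t3 j i)))

/-- Biot's system on an open set may be differentiated in time. -/
theorem BiotSystem.dt {ρ11 ρ12 ρ22 μ lam q r : V3 → ℝ} {us uf F1 F2 : P4 → V3} {Q : Set P4}
    (h : BiotSystem ρ11 ρ12 ρ22 μ lam q r us uf F1 F2 Q) (hQ : IsOpen Q)
    (hρ11 : ContDiff ℝ 2 ρ11) (hρ12 : ContDiff ℝ 2 ρ12) (hρ22 : ContDiff ℝ 2 ρ22)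
    (hμ : ContDiff ℝ 2 μ) (hl : ContDiff ℝ 2 lam) (hq : ContDiff ℝ 2 q) (hr : ContDiff ℝ 2 r)
    (hus : ContDiff ℝ 3 us) (huf : ContDiff ℝ 3 uf) :
    BiotSystem ρ11 ρ12 ρ22 μ lam q r (Dt us) (Dt uf) (Dt F1) (Dt F2) Q := by
  intro z hz i
  have dc : ∀ {c : V3 → ℝ}, ContDiff ℝ 2 c → DifferentiableAt ℝ c z.2 := fun hc =>
    hc.differentiable (by norm_num) _
  have td : ∀ {u : P4 → V3}, ContDiff ℝ 3 u →
      HasDt (dtt fun y => u y i) z (dtt (fun y => Dt u y i) z) := fun {u} hu => by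
    have h3 := contDiff_pi.1 hu i
    exact ⟨h3.pd_pd_differentiable _ _ z, by rw [← dtt_pd h3]; rfl⟩
  have tp : ∀ {c : V3 → ℝ} {u : P4 → V3}, ContDiff ℝ 2 c → ContDiff ℝ 3 u →
      HasDt (pd (fun y => c y.2 * sdiv u y) (ex i)) z
        (pd (fun y => c y.2 * sdiv (Dt u) y) (ex i) z) := by
    intro c u hc hu
    have hs : ContDiff ℝ 2 (sdiv u) := contDiff_sdiv hu
    have e : pd (fun y : P4 => c y.2 * sdiv u y) et = fun y => c y.2 * sdiv (Dt u) y := by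
      funext y
      have : HasDt (sdiv u) y (sdiv (Dt u) y) :=
        ⟨hs.differentiable (by norm_num) y, by rw [pd_sdiv_et (hu.of_le (by norm_num))]⟩
      exact (HasDt.coef (hc.differentiable (by norm_num) _) this).eq
    rw [← e]
    exact HasDt.of_pd ((hc.comp contDiff_snd).mul hs) _
  have k1 := (((HasDt.coef (dc hρ11) (td hus)).add (HasDt.coef (dc hρ12) (td huf))).sub
    (hasDt_lameOp hμ hl hus z i)).sub (tp hq huf)
  have k2 := (((HasDt.coef (dc hρ12) (td hus)).add (HasDt.coef (dc hρ22) (td huf))).sub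
    (tp hq hus)).sub (tp hr huf)
  refine ⟨k1.eq.symm.trans (pd_congr et ?_), k2.eq.symm.trans (pd_congr et ?_)⟩
  · filter_upwards [hQ.mem_nhds hz] with y hy using (h y hy i).1
  · filter_upwards [hQ.mem_nhds hz] with y hy using (h y hy i).2

theorem exists_times {m θ c0 d D β T : ℝ} (hβ : BetaCond m θ c0 d D β) (hd : d ^ 2 ≤ D ^ 2)
    (hT : √(D ^ 2 - d ^ 2) / √β < T) :
    ∃ T1 T2 : ℝ, 0 < T1 ∧ T1 < T2 ∧ T2 < T ∧ β + β * T2 * m / √c0 < θ * c0 ∧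
      β ^ 2 * T2 ^ 2 < c0 * d ^ 2 ∧ D ^ 2 - d ^ 2 < β * T1 ^ 2 := by
  obtain ⟨hβ0, h1, h2⟩ := hβ
  obtain ⟨T0, hT0⟩ : ∃ T0, T0 = √(D ^ 2 - d ^ 2) / √β := ⟨_, rfl⟩
  have hsβ : √β * √β = β := mul_self_sqrt hβ0.le
  have hsβ0 : 0 < √β := sqrt_pos.2 hβ0
  have hD : √(D ^ 2 - d ^ 2) = T0 * √β := by rw [hT0]; field_simp
  have hT00 : 0 ≤ T0 := by rw [hT0]; positivity
  have hD2 : D ^ 2 - d ^ 2 = β * T0 ^ 2 := by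
    have := mul_self_sqrt (sub_nonneg.2 hd)
    rw [hD] at this
    linear_combination (-1 : ℝ) * this + T0 ^ 2 * hsβ
  have e1 : β + β * T0 * m / √c0 < θ * c0 := by
    rw [hD] at h1
    refine lt_of_eq_of_lt ?_ h1
    linear_combination (-(T0 * m / √c0)) * hsβ
  have e2 : β ^ 2 * T0 ^ 2 < c0 * d ^ 2 := by
    nlinarith [mul_nonneg hβ0.le (sq_nonneg d)]
  have hev : ∀ᶠ s in nhdsWithin T0 (Ioi T0), s < T ∧ β + β * s * m / √c0 < θ * c0 ∧
      β ^ 2 * s ^ 2 < c0 * d ^ 2 := by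
    refine Filter.Eventually.filter_mono nhdsWithin_le_nhds ?_
    refine (gt_mem_nhds (hT0 ▸ hT)).and (Filter.Eventually.and ?_ ?_)
    · exact (by fun_prop : ContinuousAt (fun s => β + β * s * m / √c0) T0).eventually
        (gt_mem_nhds e1)
    · exact (by fun_prop : ContinuousAt (fun s => β ^ 2 * s ^ 2) T0).eventually (gt_mem_nhds e2)
  obtain ⟨T2, ⟨h2T, h21, h22⟩, hlt⟩ := (hev.and self_mem_nhdsWithin).exists
  have hlt : T0 < T2 := hlt
  refine ⟨(T0 + T2) / 2, T2, by linarith, by linarith, h2T, h21, h22, ?_⟩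
  rw [hD2]
  have : T0 ^ 2 < ((T0 + T2) / 2) ^ 2 := by nlinarith
  nlinarith

/-- The squared second-order jet of a vector field. -/
def secSq (v : P4 → V3) (z : P4) : ℝ :=
  ‖v z‖ ^ 2 + ‖fderiv ℝ v z‖ ^ 2 + ‖iteratedFDeriv ℝ 2 v z‖ ^ 2

theorem secSq_nonneg (v : P4 → V3) (z : P4) : 0 ≤ secSq v z := by unfold secSq; positivity

theorem norm_et : ‖et‖ = 1 := by simp [et, Prod.norm_def]

theorem norm_ex (i : Fin 3) : ‖ex i‖ = 1 := by simp [ex, Prod.norm_def, Pi.norm_single]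

theorem fderiv_comp_apply {v : P4 → V3} {z : P4} (hv : DifferentiableAt ℝ v z) (i : Fin 3)
    (d : P4) : pd (fun y => v y i) d z = fderiv ℝ v z d i := by
  have := (hasFDerivAt_pi'.1 hv.hasFDerivAt i).fderiv
  rw [pd, this]
  rfl

theorem abs_pd_apply_le {v : P4 → V3} {z : P4} (hv : DifferentiableAt ℝ v z) (i : Fin 3)
    {d : P4} (hd : ‖d‖ = 1) : |pd (fun y => v y i) d z| ≤ ‖fderiv ℝ v z‖ := by
  rw [fderiv_comp_apply hv, ← Real.norm_eq_abs]
  refine (norm_le_pi_norm _ i).trans (((fderiv ℝ v z).le_opNorm d).trans ?_)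
  rw [hd, mul_one]

theorem norm_iteratedFDeriv_fderiv_apply_le {v : P4 → V3} {n : ℕ} (hv : ContDiff ℝ (n + 1) v)
    {d : P4} (hd : ‖d‖ = 1) (z : P4) :
    ‖iteratedFDeriv ℝ n (fun y => fderiv ℝ v y d) z‖ ≤ ‖iteratedFDeriv ℝ (n + 1) v z‖ := by
  have h1 : ContDiff ℝ n (fderiv ℝ v) := hv.fderiv_right le_rfl
  have h2 := (ContinuousLinearMap.apply ℝ V3 d).norm_iteratedFDeriv_comp_left h1.contDiffAt
    (x := z) (n := n) le_rfl
  rw [norm_iteratedFDeriv_fderiv] at h2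
  refine h2.trans ?_
  refine mul_le_of_le_one_left (norm_nonneg _) ?_
  refine ContinuousLinearMap.opNorm_le_bound _ zero_le_one fun L => ?_
  have := L.le_opNorm d
  rw [hd, mul_one] at this
  simpa using this

theorem Dt_eq {v : P4 → V3} (hv : ContDiff ℝ 1 v) : Dt v = fun z => fderiv ℝ v z et := by
  funext z i
  exact fderiv_comp_apply (hv.differentiable one_ne_zero z) i et

theorem norm_iteratedFDeriv_Dt_le {v : P4 → V3} {n : ℕ} (hv : ContDiff ℝ (n + 1) v) (z : P4) :
    ‖iteratedFDeriv ℝ n (Dt v) z‖ ≤ ‖iteratedFDeriv ℝ (n + 1) v z‖ := by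
  rw [Dt_eq (hv.of_le (by simp))]
  exact norm_iteratedFDeriv_fderiv_apply_le hv norm_et z

theorem abs_pd_pd_apply_le {v : P4 → V3} (hv : ContDiff ℝ 2 v) (z : P4) (i : Fin 3)
    {d e : P4} (hd : ‖d‖ = 1) (he : ‖e‖ = 1) :
    |pd (pd (fun y => v y i) d) e z| ≤ ‖iteratedFDeriv ℝ 2 v z‖ := by
  have h : pd (fun y => v y i) d = fun y => (fun y => fderiv ℝ v y d) y i := by
    funext y
    exact fderiv_comp_apply (hv.differentiable two_ne_zero y) i d
  have hd1 : ContDiff ℝ 1 (fun y => fderiv ℝ v y d) :=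
    (hv.fderiv_right (m := 1) (by norm_num)).clm_apply contDiff_const
  rw [h]
  refine (abs_pd_apply_le (hd1.differentiable one_ne_zero z) i he).trans ?_
  rw [← norm_iteratedFDeriv_one]
  exact norm_iteratedFDeriv_fderiv_apply_le (n := 1) (by exact_mod_cast hv) hd z

theorem jet2_apply_le {v : P4 → V3} (hv : ContDiff ℝ 2 v) (i : Fin 3) (z : P4) :
    jet2 (fun y => v y i) z ≤ 4 * secSq v z := by
  have h0 : (v z i) ^ 2 ≤ ‖v z‖ ^ 2 := by
    rw [← sq_abs]; exact pow_le_pow_left₀ (abs_nonneg _) (norm_le_pi_norm (v z) i) 2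
  have h1 : ∀ {d : P4}, ‖d‖ = 1 → pd (fun y => v y i) d z ^ 2 ≤ ‖fderiv ℝ v z‖ ^ 2 := fun hd => by
    rw [← sq_abs]
    exact pow_le_pow_left₀ (abs_nonneg _)
      (abs_pd_apply_le (hv.differentiable two_ne_zero z) i hd) 2
  have a := h1 norm_et
  have b := h1 (norm_ex 0)
  have c := h1 (norm_ex 1)
  have e := h1 (norm_ex 2)
  simp only [jet2, gradT2, secSq, Fin.sum_univ_three]
  nlinarith [sq_nonneg ‖iteratedFDeriv ℝ 2 v z‖, sq_nonneg ‖v z‖]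

theorem jet2_pd_apply_le {v : P4 → V3} (hv : ContDiff ℝ 2 v) (i l : Fin 3) (z : P4) :
    jet2 (pd (fun y => v y i) (ex l)) z ≤ 4 * secSq v z := by
  have h0 : pd (fun y => v y i) (ex l) z ^ 2 ≤ ‖fderiv ℝ v z‖ ^ 2 := by
    rw [← sq_abs]
    exact pow_le_pow_left₀ (abs_nonneg _)
      (abs_pd_apply_le (hv.differentiable two_ne_zero z) i (norm_ex l)) 2
  have h1 : ∀ {d : P4}, ‖d‖ = 1 →
      pd (pd (fun y => v y i) (ex l)) d z ^ 2 ≤ ‖iteratedFDeriv ℝ 2 v z‖ ^ 2 := fun hd => by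
    rw [← sq_abs]
    exact pow_le_pow_left₀ (abs_nonneg _) (abs_pd_pd_apply_le hv z i (norm_ex l) hd) 2
  have a := h1 norm_et
  have b := h1 (norm_ex 0)
  have c := h1 (norm_ex 1)
  have e := h1 (norm_ex 2)
  simp only [jet2, gradT2, secSq, Fin.sum_univ_three]
  nlinarith [sq_nonneg ‖iteratedFDeriv ℝ 2 v z‖, sq_nonneg ‖v z‖, sq_nonneg ‖fderiv ℝ v z‖]

theorem jet2_sdiv_le {v : P4 → V3} (hv : ContDiff ℝ 2 v) (z : P4) :
    jet2 (sdiv v) z ≤ 40 * secSq v z := by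
  have hvi : ∀ i, ContDiff ℝ 2 (fun y => v y i) := fun i => contDiff_pi.1 hv i
  have hd : ∀ i, DifferentiableAt ℝ (pd (fun y => v y i) (ex i)) z := fun i =>
    (hvi i).pd_differentiable (ex i) z
  have e : sdiv v = fun y => pd (fun y => v y 0) (ex 0) y + pd (fun y => v y 1) (ex 1) y
      + pd (fun y => v y 2) (ex 2) y := by
    funext y
    exact Fin.sum_univ_three _
  rw [e]
  have h1 := jet2_add_le ((hd 0).fun_add (hd 1)) (hd 2)
  have h2 := jet2_add_le (hd 0) (hd 1)
  linarith [jet2_pd_apply_le hv 0 0 z, jet2_pd_apply_le hv 1 1 z, jet2_pd_apply_le hv 2 2 z]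

theorem lowJet_le_secSq {us uf : P4 → V3} (hus : ContDiff ℝ 2 us) (huf : ContDiff ℝ 2 uf)
    (z : P4) : lowJet us uf z ≤ 200 * (secSq us z + secSq uf z) := by
  have hi : ∀ i, ContDiff ℝ 2 (fun y => us y i) := fun i => contDiff_pi.1 hus i
  have h1 : ∑ i, jet2 (fun y => us y i) z ≤ 3 * (4 * secSq us z) := by
    refine (Finset.sum_le_card_nsmul _ _ _ fun i _ => jet2_apply_le hus i z).trans ?_
    simp
  have h2 : ∑ l, ∑ i, jet2 (crl (fun i y => us y i) l i) z ≤ 9 * (16 * secSq us z) := by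
    have h : ∀ l i, jet2 (crl (fun i y => us y i) l i) z ≤ 16 * secSq us z := fun l i => by
      have := jet2_sub_le ((hi i).pd_differentiable (ex l) z) ((hi l).pd_differentiable (ex i) z)
      have a := jet2_pd_apply_le hus i l z
      have b := jet2_pd_apply_le hus l i z
      refine le_trans this ?_
      linarith
    refine (Finset.sum_le_card_nsmul _ _ _ fun l _ =>
      Finset.sum_le_card_nsmul _ _ _ fun i _ => h l i).trans ?_
    simp only [Finset.card_univ, Fintype.card_fin, nsmul_eq_mul]
    push_cast
    linarith
  have h3 := jet2_sdiv_le hus z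
  have h4 := jet2_sdiv_le huf z
  have := secSq_nonneg us z
  have := secSq_nonneg uf z
  unfold lowJet
  linarith

theorem secSq_Dt_Dt_le {v : P4 → V3} (hv : ContDiff ℝ 4 v) (z : P4) :
    secSq (Dt (Dt v)) z ≤ ∑ k ∈ Finset.range 6, ‖iteratedFDeriv ℝ k v z‖ ^ 2 := by
  have hD : ContDiff ℝ 3 (Dt v) := contDiff_Dt (by exact_mod_cast hv)
  have key : ∀ n : ℕ, n ≤ 2 →
      ‖iteratedFDeriv ℝ n (Dt (Dt v)) z‖ ^ 2 ≤ ‖iteratedFDeriv ℝ (n + 2) v z‖ ^ 2 := fun n hn => by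
    refine pow_le_pow_left₀ (norm_nonneg _) ?_ 2
    refine (norm_iteratedFDeriv_Dt_le (hD.of_le ?_) z).trans
      (norm_iteratedFDeriv_Dt_le (n := n + 1) (hv.of_le ?_) z)
    · exact_mod_cast (by omega : n + 1 ≤ 3)
    · exact_mod_cast (by omega : n + 1 + 1 ≤ 4)
  have k0 := key 0 (by norm_num)
  have k1 := key 1 (by norm_num)
  have k2 := key 2 (by norm_num)
  rw [norm_iteratedFDeriv_zero] at k0
  rw [norm_iteratedFDeriv_one] at k1
  simp only [Finset.sum_range_succ, Finset.sum_range_zero, secSq]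
  nlinarith [sq_nonneg ‖iteratedFDeriv ℝ 0 v z‖, sq_nonneg ‖iteratedFDeriv ℝ 1 v z‖,
    sq_nonneg ‖iteratedFDeriv ℝ 5 v z‖]

theorem H2sq_eq (v : P4 → V3) (S : Set P4) : H2sq v S = ∫ z in S, secSq v z := rfl

theorem continuous_secSq {v : P4 → V3} (hv : ContDiff ℝ 2 v) : Continuous (secSq v) := by
  unfold secSq
  have h1 := hv.continuous
  have h2 := hv.continuous_fderiv two_ne_zero
  have h3 := hv.continuous_iteratedFDeriv (m := 2) le_rfl
  fun_prop

theorem Continuous.integrableOn_of_isBounded {E : Type*} [MetricSpace E] [ProperSpace E]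
    [MeasurableSpace E] [BorelSpace E] {μ : Measure E} [IsFiniteMeasureOnCompacts μ] {f : E → ℝ}
    (hf : Continuous f) {s : Set E} (hs : Bornology.IsBounded s) : IntegrableOn f s μ :=
  (hf.continuousOn.integrableOn_compact hs.isCompact_closure).mono_set subset_closure

theorem wt_le_exp {x0 : V3} {β τ D : ℝ} (hτ : 0 ≤ τ) {z : P4} {a : ℝ}
    (hD : sqd x0 z.2 ≤ D) (ha : a ≤ β * z.1 ^ 2) : wt x0 β τ z ≤ exp (2 * τ * (D - a)) := by
  refine exp_le_exp.2 (mul_le_mul_of_nonneg_left (by linarith) (by positivity))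

theorem wt_le_wt_zero {x0 : V3} {β τ : ℝ} (hτ : 0 ≤ τ) (hβ : 0 ≤ β) (z : P4) :
    wt x0 β τ z ≤ wt x0 β τ (0, z.2) := by
  refine exp_le_exp.2 (mul_le_mul_of_nonneg_left ?_ (by positivity))
  have := mul_nonneg hβ (sq_nonneg z.1)
  simp
  exact this

theorem integral_le_integral_add_setIntegral {X : Type*} [MeasurableSpace X] {μ : Measure X}
    {f g h : X → ℝ} {s : Set X} (hf : Integrable f μ) (hg : Integrable g μ)
    (hh : IntegrableOn h s μ) (hs : MeasurableSet s) (hle : ∀ x, f x ≤ g x + s.indicator h x) :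
    ∫ x, f x ∂μ ≤ ∫ x, g x ∂μ + ∫ x in s, h x ∂μ := by
  rw [← integral_indicator hs, ← integral_add hg (hh.integrable_indicator hs)]
  exact integral_mono hf (hg.add (hh.integrable_indicator hs)) hle

theorem contDiff_prodCutoff {n : WithTop ℕ∞} {η : ℝ → ℝ} {χ : V3 → ℝ} (hη : ContDiff ℝ n η)
    (hχ : ContDiff ℝ n χ) : ContDiff ℝ n (fun z : P4 => η z.1 * χ z.2) :=
  (hη.comp contDiff_fst).mul (hχ.comp contDiff_snd)

theorem tsupport_prodCutoff_subset {η : ℝ → ℝ} {χ : V3 → ℝ} :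
    tsupport (fun z : P4 => η z.1 * χ z.2) ⊆ tsupport η ×ˢ tsupport χ := by
  refine closure_minimal (fun z hz => ?_) ((isClosed_tsupport η).prod (isClosed_tsupport χ))
  have hz : η z.1 * χ z.2 ≠ 0 := hz
  exact ⟨subset_tsupport _ (left_ne_zero_of_mul hz), subset_tsupport _ (right_ne_zero_of_mul hz)⟩

theorem prodCutoff_eventuallyEq_one {η : ℝ → ℝ} {χ : V3 → ℝ} {z : P4}
    (h1 : ∀ᶠ t in nhds z.1, η t = 1) (h2 : ∀ᶠ x in nhds z.2, χ x = 1) :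
    (fun z : P4 => η z.1 * χ z.2) =ᶠ[nhds z] fun _ => 1 := by
  filter_upwards [(continuous_fst.tendsto z).eventually h1,
    (continuous_snd.tendsto z).eventually h2] with y a b
  rw [a, b, one_mul]

theorem pd_eq_zero_of_eventuallyEq_const {f : P4 → ℝ} {z : P4} {c : ℝ}
    (h : f =ᶠ[nhds z] fun _ => c) (d : P4) : pd f d =ᶠ[nhds z] fun _ => 0 := by
  filter_upwards [h.eventuallyEq_nhds] with y hy
  rw [pd_congr d hy, pd_const]

/-- Passing from the jets of the localized functions back to the localized jets. -/
theorem integral_cutoff_jet2_le {ι : Type*} [Fintype ι] {Ω V : Set V3} {x0 : V3} {β D K : ℝ}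
    (hΩo : IsOpen Ω) (hΩ : Bornology.IsBounded Ω) (hV : IsOpen V)
    (hD : ∀ x ∈ Ω, sqd x0 x ≤ D) {η : ℝ → ℝ} {χ : V3 → ℝ} (hη : ContDiff ℝ 2 η)
    (hχ : ContDiff ℝ 2 χ) (hη0 : ∀ᶠ t in nhds 0, η t = 1) (hχΩ : tsupport χ ⊆ Ω)
    (hχ1 : ∀ x ∈ Ω, x ∉ V → ∀ᶠ y in nhds x, χ y = 1) (hK : 1 ≤ K) :
    ∃ C, 1 ≤ C ∧ ∀ τ, 0 ≤ τ → ∀ f : ι → P4 → ℝ, (∀ l, ContDiff ℝ 2 (f l)) → ∀ Λ g : V3 → ℝ,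
      Continuous Λ → Continuous g → (∀ x, 0 ≤ g x) →
      (∀ x ∈ closure Ω, Λ x ≤ K * ∑ l, jet2 (f l) (0, x)) →
      (∀ x ∈ closure Ω, ∑ l, f l (0, x) ^ 2 ≤ K * g x) →
      ∫ x, χ x ^ 2 * Λ x * wt x0 β τ (0, x) ≤
        C * ((∑ l, ∫ x, jet2 (fun y => η y.1 * χ y.2 * f l y) (0, x) * wt x0 β τ (0, x))
          + exp (2 * τ * D) * ∫ x in Ω ∩ V, g x) := by
  have hζ := contDiff_prodCutoff hη hχ
  have hcχ : HasCompactSupport χ :=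
    Metric.isCompact_of_isClosed_isBounded (isClosed_tsupport χ) (hΩ.subset hχΩ)
  obtain ⟨L, hL1, hL⟩ := (continuous_gradT2 (hζ.of_le one_le_two)).exists_abs_le_of_isCompact
    (isCompact_singleton.prod hcχ : IsCompact ({0} ×ˢ tsupport χ : Set P4))
  have hη00 : η 0 = 1 := hη0.self_of_nhds
  refine ⟨2 * K * L * K, ?_, fun τ hτ f hf Λ g hΛ hg hg0 h1 h2 => ?_⟩
  · have : 1 ≤ K * L := one_le_mul_of_one_le_of_one_le hK hL1
    nlinarith
  have hw : Continuous fun x : V3 => wt x0 β τ (0, x) :=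
    (contDiff_wt (n := 0) x0 β τ).continuous.comp (by fun_prop)
  have hw0 : ∀ x, 0 ≤ wt x0 β τ ((0 : ℝ), x) := fun x => (wt_pos _ _ _ _).le
  have hJ : ∀ l, Continuous fun x : V3 => jet2 (fun y => η y.1 * χ y.2 * f l y) (0, x) := fun l =>
    (continuous_jet2 ((hζ.mul (hf l)).of_le one_le_two)).comp (by fun_prop)
  have hJ0 : ∀ l, ∀ x, x ∉ tsupport χ → jet2 (fun y => η y.1 * χ y.2 * f l y) ((0 : ℝ), x) = 0 :=
    fun l x hx => jet2_eq_zero_of_notMem (S := tsupport η ×ˢ tsupport χ)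
      ((tsupport_mul_subset (fun y : P4 => η y.1 * χ y.2) (f l)).trans tsupport_prodCutoff_subset)
      fun h => hx h.2
  have hJi : ∀ l, Integrable fun x =>
      jet2 (fun y => η y.1 * χ y.2 * f l y) (0, x) * wt x0 β τ (0, x) := fun l =>
    ((hJ l).mul hw).integrable_of_hasCompactSupport
      (HasCompactSupport.intro hcχ fun x hx => by simp only [Pi.mul_apply, hJ0 l x hx, zero_mul])
  have hLi : Integrable fun x => χ x ^ 2 * Λ x * wt x0 β τ (0, x) := by
    refine (((hχ.continuous.pow 2).mul hΛ).mul hw).integrable_of_hasCompactSupport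
      (HasCompactSupport.intro hcχ fun x hx => ?_)
    simp [image_eq_zero_of_notMem_tsupport hx]
  have hgi : IntegrableOn (fun x => 2 * K * L * K * exp (2 * τ * D) * g x) (Ω ∩ V) :=
    Continuous.integrableOn_of_isBounded (by fun_prop) (hΩ.subset inter_subset_left)
  refine (integral_le_integral_add_setIntegral (s := Ω ∩ V) hLi
    ((integrable_finsetSum Finset.univ fun l _ => hJi l).const_mul (2 * K)) hgi
    (hΩo.inter hV).measurableSet fun x => ?_).trans ?_
  rotate_left
  · rw [integral_const_mul, integral_finsetSum _ fun l _ => hJi l, integral_const_mul]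
    have hs : 0 ≤ ∑ l, ∫ x, jet2 (fun y => η y.1 * χ y.2 * f l y) (0, x) * wt x0 β τ (0, x) :=
      Finset.sum_nonneg fun l _ => integral_nonneg fun x => mul_nonneg (jet2_nonneg _ _) (hw0 x)
    have hLK : 1 ≤ L * K := one_le_mul_of_one_le_of_one_le hL1 hK
    have : 2 * K * (∑ l, ∫ x, jet2 (fun y => η y.1 * χ y.2 * f l y) (0, x) * wt x0 β τ (0, x)) ≤
        2 * K * L * K *
          ∑ l, ∫ x, jet2 (fun y => η y.1 * χ y.2 * f l y) (0, x) * wt x0 β τ (0, x) := by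
      refine mul_le_mul_of_nonneg_right ?_ hs
      nlinarith
    rw [mul_add, ← mul_assoc (2 * K * L * K) (exp _)]
    exact add_le_add this le_rfl
  · show χ x ^ 2 * Λ x * wt x0 β τ (0, x) ≤
      2 * K * ∑ l, jet2 (fun y => η y.1 * χ y.2 * f l y) (0, x) * wt x0 β τ (0, x)
        + (Ω ∩ V).indicator (fun x => 2 * K * L * K * exp (2 * τ * D) * g x) x
    by_cases hx : x ∈ tsupport χ
    swap
    · rw [image_eq_zero_of_notMem_tsupport hx]
      have : 0 ≤ (Ω ∩ V).indicator (fun x => 2 * K * L * K * exp (2 * τ * D) * g x) x :=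
        indicator_nonneg (fun x _ => by have := hg0 x; positivity) x
      have h : 0 ≤ ∑ l, jet2 (fun y => η y.1 * χ y.2 * f l y) (0, x) * wt x0 β τ (0, x) :=
        Finset.sum_nonneg fun l _ => mul_nonneg (jet2_nonneg _ _) (hw0 x)
      have : 0 ≤ 2 * K * ∑ l, jet2 (fun y => η y.1 * χ y.2 * f l y) (0, x) * wt x0 β τ (0, x) := by
        positivity
      simp only [ne_eq, OfNat.ofNat_ne_zero, not_false_eq_true, zero_pow, zero_mul]
      linarith
    have hxΩ := hχΩ hx
    have hxc := subset_closure hxΩ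
    have hp : ∀ l, χ x ^ 2 * jet2 (f l) (0, x) ≤
        2 * jet2 (fun y => η y.1 * χ y.2 * f l y) (0, x) +
          2 * (gradT2 (fun z : P4 => η z.1 * χ z.2) (0, x) * f l (0, x) ^ 2) := fun l => by
      have := gradT2_mul_le (hζ.of_le one_le_two) ((hf l).of_le one_le_two) (0, x)
      simp only [hη00, one_mul] at this
      simp only [jet2, hη00, one_mul]
      nlinarith [sq_nonneg (χ x * f l (0, x))]
    have hsum : χ x ^ 2 * Λ x ≤ 2 * K * ∑ l, jet2 (fun y => η y.1 * χ y.2 * f l y) (0, x)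
        + 2 * K * (gradT2 (fun z : P4 => η z.1 * χ z.2) (0, x) * ∑ l, f l (0, x) ^ 2) := by
      have h3 := mul_le_mul_of_nonneg_left (h1 x hxc) (sq_nonneg (χ x))
      have h4 := Finset.sum_le_sum fun l (_ : l ∈ Finset.univ) => hp l
      rw [← Finset.mul_sum, Finset.sum_add_distrib, ← Finset.mul_sum, ← Finset.mul_sum,
        ← Finset.mul_sum] at h4
      have h5 := mul_le_mul_of_nonneg_left h4 (by linarith : 0 ≤ K)
      linarith
    rw [← Finset.sum_mul]
    by_cases hxV : x ∈ V
    · rw [indicator_of_mem (show x ∈ Ω ∩ V from ⟨hxΩ, hxV⟩)]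
      have hwD : wt x0 β τ (0, x) ≤ exp (2 * τ * D) := by
        have := wt_le_exp (x0 := x0) (β := β) (z := ((0 : ℝ), x)) (a := 0) hτ (hD x hxΩ) (by simp)
        rwa [sub_zero] at this
      have hG : gradT2 (fun z : P4 => η z.1 * χ z.2) (0, x) * ∑ l, f l (0, x) ^ 2 ≤
          L * (K * g x) := by
        refine mul_le_mul ((le_abs_self _).trans (hL _ ⟨rfl, hx⟩)) (h2 x hxc)
          (Finset.sum_nonneg fun _ _ => sq_nonneg _) (by linarith)
      have h5 : χ x ^ 2 * Λ x ≤ 2 * K * ∑ l, jet2 (fun y => η y.1 * χ y.2 * f l y) (0, x)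
          + 2 * K * L * K * g x := by
        have := mul_le_mul_of_nonneg_left hG (by linarith : 0 ≤ 2 * K)
        linarith
      have h6 := mul_le_mul_of_nonneg_right h5 (hw0 x)
      have h7 : 2 * K * L * K * g x * wt x0 β τ (0, x) ≤
          2 * K * L * K * g x * exp (2 * τ * D) :=
        mul_le_mul_of_nonneg_left hwD (by have := hg0 x; positivity)
      linarith
    · rw [indicator_of_notMem (fun h : x ∈ Ω ∩ V => hxV h.2)]
      have hz : gradT2 (fun z : P4 => η z.1 * χ z.2) (0, x) = 0 := by
        have := prodCutoff_eventuallyEq_one (z := ((0 : ℝ), x)) hη0 (hχ1 x hxΩ hxV)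
        simp [gradT2, (pd_eq_zero_of_eventuallyEq_const this _).self_of_nhds]
      rw [hz, zero_mul, mul_zero, add_zero] at hsum
      have h6 := mul_le_mul_of_nonneg_right hsum (hw0 x)
      linarith

theorem setIntegral_source_le {x0 : V3} {β τ T2 L : ℝ} (hτ : 0 ≤ τ) (hβ : 0 ≤ β) (hT2 : 0 ≤ T2)
    {η : ℝ → ℝ} {χ σ : V3 → ℝ} (hη : Continuous η) (hχ : Continuous χ)
    (hcχ : HasCompactSupport χ) (hL : ∀ t ∈ Icc (-T2) T2, |η t| ≤ L) (hσ : Continuous σ)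
    (hσ0 : ∀ x, 0 ≤ σ x) :
    ∫ z in Icc (-T2) T2 ×ˢ tsupport χ, (η z.1 * χ z.2) ^ 2 * σ z.2 * wt x0 β τ z ≤
      2 * T2 * L ^ 2 * ∫ x, χ x ^ 2 * σ x * wt x0 β τ (0, x) := by
  have hS : IsCompact (Icc (-T2) T2 ×ˢ tsupport χ) := isCompact_Icc.prod hcχ
  have hw := (contDiff_wt (n := 0) x0 β τ).continuous
  have hw0 : Continuous fun x : V3 => wt x0 β τ (0, x) := hw.comp (by fun_prop)
  have h1 : Continuous fun z : P4 => (η z.1 * χ z.2) ^ 2 * σ z.2 * wt x0 β τ z := by fun_prop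
  have h2 : Continuous fun z : P4 => L ^ 2 * (χ z.2 ^ 2 * σ z.2 * wt x0 β τ (0, z.2)) := by
    have : Continuous fun z : P4 => wt x0 β τ (0, z.2) := hw0.comp continuous_snd
    fun_prop
  have hm : ∫ z in Icc (-T2) T2 ×ˢ tsupport χ, (η z.1 * χ z.2) ^ 2 * σ z.2 * wt x0 β τ z ≤
      ∫ z in Icc (-T2) T2 ×ˢ tsupport χ, L ^ 2 * (χ z.2 ^ 2 * σ z.2 * wt x0 β τ (0, z.2)) := by
    refine setIntegral_mono_on (h1.continuousOn.integrableOn_compact hS)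
      (h2.continuousOn.integrableOn_compact hS) hS.measurableSet fun z hz => ?_
    have hη2 : η z.1 ^ 2 ≤ L ^ 2 := by
      rw [← sq_abs]; exact pow_le_pow_left₀ (abs_nonneg _) (hL _ hz.1) 2
    have hwz := wt_le_wt_zero (x0 := x0) hτ hβ z
    have h3 : 0 ≤ χ z.2 ^ 2 * σ z.2 := mul_nonneg (sq_nonneg _) (hσ0 _)
    calc (η z.1 * χ z.2) ^ 2 * σ z.2 * wt x0 β τ z
        = η z.1 ^ 2 * (χ z.2 ^ 2 * σ z.2 * wt x0 β τ z) := by ring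
      _ ≤ L ^ 2 * (χ z.2 ^ 2 * σ z.2 * wt x0 β τ (0, z.2)) :=
        mul_le_mul hη2 (mul_le_mul_of_nonneg_left hwz h3) (mul_nonneg h3 (wt_pos _ _ _ _).le)
          (sq_nonneg _)
  refine hm.trans (le_of_eq ?_)
  have hp := setIntegral_prod_mul (μ := (volume : Measure ℝ)) (ν := (volume : Measure V3))
    (fun _ => L ^ 2) (fun x => χ x ^ 2 * σ x * wt x0 β τ (0, x)) (Icc (-T2) T2) (tsupport χ)
  refine hp.trans ?_
  rw [setIntegral_eq_integral_of_forall_compl_eq_zero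
    (f := fun x => χ x ^ 2 * σ x * wt x0 β τ (0, x))]
  · simp only [integral_const, measureReal_restrict_apply_univ, Real.volume_real_Icc, smul_eq_mul]
    rw [max_eq_left (by linarith)]
    ring
  · intro x hx
    rw [image_eq_zero_of_notMem_tsupport hx]; ring

theorem setIntegral_mul_wt_le {x0 : V3} {β τ E : ℝ} {A A' : Set P4} {f g : P4 → ℝ} {K : ℝ}
    (hA : MeasurableSet A) (hA' : Bornology.IsBounded A') (hAA' : A ⊆ A') (hf : Continuous f)
    (hg : Continuous g) (hg0 : ∀ z, 0 ≤ g z) (hfg : ∀ z ∈ A, f z ≤ K * g z)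
    (hK : 0 ≤ K) (hw : ∀ z ∈ A, wt x0 β τ z ≤ E) (hE : 0 ≤ E) :
    ∫ z in A, f z * wt x0 β τ z ≤ K * (E * ∫ z in A', g z) := by
  have hwc := (contDiff_wt (n := 0) x0 β τ).continuous
  have i1 : IntegrableOn (fun z => K * (E * g z)) A' :=
    Continuous.integrableOn_of_isBounded (by fun_prop) hA'
  have h1 : Continuous fun z => f z * wt x0 β τ z := hf.mul hwc
  calc ∫ z in A, f z * wt x0 β τ z ≤ ∫ z in A, K * (E * g z) := by
        refine setIntegral_mono_on (h1.integrableOn_of_isBounded (hA'.subset hAA'))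
          (i1.mono_set hAA') hA fun z hz => ?_
        calc f z * wt x0 β τ z ≤ K * g z * E :=
              mul_le_mul (hfg z hz) (hw z hz) (wt_pos _ _ _ _).le (mul_nonneg hK (hg0 z))
          _ = K * (E * g z) := by ring
    _ ≤ ∫ z in A', K * (E * g z) :=
        setIntegral_mono_set i1 (Filter.Eventually.of_forall fun z => by
          have := hg0 z; show 0 ≤ K * (E * g z); positivity) hAA'.eventuallyLE
    _ = K * (E * ∫ z in A', g z) := by rw [integral_const_mul, integral_const_mul]

theorem setIntegral_union_le {X : Type*} [MeasurableSpace X] {μ : Measure X} {f : X → ℝ}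
    {s t : Set X} (hf : ∀ x, 0 ≤ f x) (hs : IntegrableOn f s μ) (ht : IntegrableOn f t μ) :
    ∫ x in s ∪ t, f x ∂μ ≤ ∫ x in s, f x ∂μ + ∫ x in t, f x ∂μ := by
  rw [← integral_add_measure hs ht]
  exact integral_mono_measure (Measure.restrict_union_le s t)
    (Filter.Eventually.of_forall hf) (Integrable.add_measure hs ht)

theorem continuous_vjet {u : P4 → V3} (hu : ContDiff ℝ 1 u) : Continuous (vjet u) :=
  continuous_finsetSum _ fun i _ => continuous_jet2 (contDiff_pi.1 hu i)

theorem continuous_lowJet {us uf : P4 → V3} (hus : ContDiff ℝ 2 us) (huf : ContDiff ℝ 2 uf) :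
    Continuous (lowJet us uf) := by
  have hi : ∀ i, ContDiff ℝ 2 (fun y => us y i) := fun i => contDiff_pi.1 hus i
  have hc : ∀ l i, ContDiff ℝ 1 (crl (fun i y => us y i) l i) := fun l i =>
    contDiff_crl (fun i => by exact_mod_cast hi i) l i
  have h1 : ContDiff ℝ 1 (sdiv us) := contDiff_sdiv (by exact_mod_cast hus)
  have h2 : ContDiff ℝ 1 (sdiv uf) := contDiff_sdiv (by exact_mod_cast huf)
  exact (((continuous_finsetSum _ fun i _ => continuous_jet2 ((hi i).of_le one_le_two)).add
    (continuous_finsetSum _ fun l _ => continuous_finsetSum _ fun i _ =>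
      continuous_jet2 (hc l i))).add (continuous_jet2 h1)).add (continuous_jet2 h2)

theorem exists_biot_carleman {Ω V : Set V3} {x0 : V3}
    {ρ11 ρ12 ρ22 μ lam q r μ2 μ3 : V3 → ℝ} {m θ c1 c2 c3 c0 d D β T T1 T2 : ℝ}
    (hΩo : IsOpen Ω) (hΩ : Bornology.IsBounded Ω) (hV : IsOpen V) (hm : 0 < m) (hθ : θ < 1)
    (hA1 : AssumpA1 Ω ρ11 ρ12 ρ22 μ lam q r)
    (hA2 : AssumpA2 Ω x0 ρ11 ρ12 ρ22 μ lam q r μ2 μ3 m θ c1 c2 c3)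
    (hgeom : dGeom Ω x0 d D) (hc0 : 0 < c0) (hc : c0 ≤ c1 ∧ c0 ≤ c2 ∧ c0 ≤ c3) (hβ : 0 < β)
    (hT1 : 0 < T1) (hT12 : T1 < T2) (hT2 : T2 < T) (h1 : β + β * T2 * m / √c0 < θ * c0)
    (h2 : β ^ 2 * T2 ^ 2 < c0 * d ^ 2) {χ : V3 → ℝ} (hχ : ContDiff ℝ 2 χ)
    (hχΩ : tsupport χ ⊆ Ω) (hχ1 : ∀ x ∈ Ω, x ∉ V → ∀ᶠ y in nhds x, χ y = 1) {L : ℝ}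
    (hL : 0 ≤ L) :
    ∃ C, 1 ≤ C ∧ ∀ τ, C ≤ τ → ∀ us uf F1 F2 : P4 → V3, ContDiff ℝ 3 us → ContDiff ℝ 3 uf →
      ContDiff ℝ 1 F1 → ContDiff ℝ 1 F2 →
      BiotSystem ρ11 ρ12 ρ22 μ lam q r us uf F1 F2 (Ioo (-T) T ×ˢ Ω) →
      ∀ σ : V3 → ℝ, Continuous σ → (∀ x, 0 ≤ σ x) →
      (∀ z ∈ Icc (-T2) T2 ×ˢ tsupport χ, srcSq F1 F2 z ≤ L * σ z.2) →
      ∫ x, χ x ^ 2 * lowJet us uf (0, x) * wt x0 β τ (0, x) ≤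
        C * ((∫ x, χ x ^ 2 * σ x * wt x0 β τ (0, x))
          + exp (2 * τ * D ^ 2) * ((∫ z in Ioo (-T) T ×ˢ (Ω ∩ V), lowJet us uf z)
            + ∫ x in Ω ∩ V, (vjet us (0, x) + vjet uf (0, x)))
          + exp (2 * τ * (D ^ 2 - β * T1 ^ 2)) * ∫ z in Ioo (-T) T ×ˢ Ω, lowJet us uf z) := by
  have hT2p : 0 < T2 := hT1.trans hT12
  have hdD : ∀ x ∈ closure Ω, d ^ 2 ≤ sqd x0 x := fun x hx => hgeom.2.2.1.2 ⟨x, hx, rfl⟩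
  have hD : ∀ x ∈ Ω, sqd x0 x ≤ D ^ 2 := fun x hx => hgeom.2.2.2.2 ⟨x, subset_closure hx, rfl⟩
  obtain ⟨A, K, hK, hfam, hwave⟩ := exists_biot_waveSystem hΩ hA1 hA2
  have hcχ : HasCompactSupport χ :=
    Metric.isCompact_of_isClosed_isBounded (isClosed_tsupport χ) (hΩ.subset hχΩ)
  have hSsub : Icc (-T2) T2 ×ˢ tsupport χ ⊆ Icc (-T2) T2 ×ˢ closure Ω :=
    prod_mono le_rfl (hχΩ.trans subset_closure)
  have hSQ : Icc (-T2) T2 ×ˢ tsupport χ ⊆ Ioo (-T) T ×ˢ Ω :=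
    prod_mono (fun t ht => ⟨by linarith [ht.1], by linarith [ht.2]⟩) hχΩ
  have hS : IsCompact (Icc (-T2) T2 ×ˢ tsupport χ) := isCompact_Icc.prod hcχ
  have hspeed : ∀ l : WIdx, ∃ cs, c0 ≤ cs ∧ CClass Ω x0 m θ cs
      (waveSpeed (fun x => (ρ11 x * ρ22 x - ρ12 x ^ 2)⁻¹ * ρ22 x * μ x) μ2 μ3 l) := by
    obtain ⟨-, k1, k2, k3⟩ := hA2
    rintro (i | i | j | j)
    · exact ⟨c1, hc.1, k1⟩
    · exact ⟨c1, hc.1, k1⟩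
    · exact ⟨c2, hc.2.1, k2⟩
    · exact ⟨c3, hc.2.2, k3⟩
  have hex : ∀ l : WIdx, ∃ a : V3 → ℝ, (∀ x ∈ closure Ω, a x *
      waveSpeed (fun x => (ρ11 x * ρ22 x - ρ12 x ^ 2)⁻¹ * ρ22 x * μ x) μ2 μ3 l x = 1) ∧
      ∃ k δ K, WaveAdm x0 β k δ K a (Icc (-T2) T2 ×ˢ closure Ω) := fun l => by
    obtain ⟨cs, hcs, hcl⟩ := hspeed l
    exact exists_waveAdm hΩ hcl hm hc0 hcs hβ hT2p hθ hdD h1 h2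
  choose a hac hadm using hex
  obtain ⟨η, hη, hηs, hη1⟩ := exists_contDiff_cutoff (E := ℝ) (isClosed_Icc (a := -T1) (b := T1))
    (isOpen_Ioo (a := -T2) (b := T2)) (fun t ht => ⟨by linarith [ht.1], by linarith [ht.2]⟩) 2
  have hη : ContDiff ℝ 2 η := hη
  have hη1' : ∀ t ∈ Icc (-T1) T1, ∀ᶠ s in nhds t, η s = 1 := fun t ht =>
    Filter.Eventually.filter_mono (nhds_le_nhdsSet ht) hη1
  have hζ := contDiff_prodCutoff hη hχ
  have hζS : tsupport (fun z : P4 => η z.1 * χ z.2) ⊆ Icc (-T2) T2 ×ˢ tsupport χ :=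
    tsupport_prodCutoff_subset.trans (prod_mono (hηs.trans Ioo_subset_Icc_self) le_rfl)
  obtain ⟨Lη, hLη1, hLη⟩ := hη.continuous.exists_abs_le_of_isCompact
    (isCompact_Icc (a := -T2) (b := T2))
  have hBm : MeasurableSet ({z : P4 | z.2 ∈ V} ∪ {z : P4 | T1 ≤ |z.1|}) :=
    (hV.measurableSet.preimage measurable_snd).union
      (isClosed_le continuous_const (by fun_prop)).measurableSet
  have hcar := exists_system_carleman (ι := WIdx) (x0 := x0) (β := β) (a := a)
    (B := {z : P4 | z.2 ∈ V} ∪ {z : P4 | T1 ≤ |z.1|})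
    (c := waveSpeed (fun x => (ρ11 x * ρ22 x - ρ12 x ^ 2)⁻¹ * ρ22 x * μ x) μ2 μ3) hS hBm
    (fun l => by
      obtain ⟨k, δ, K, h⟩ := hadm l
      exact ⟨k, δ, K, { h with
        lower := fun z hz => h.lower z (hSsub hz), upper := fun z hz => h.upper z (hSsub hz)
        time := fun z hz => h.time z (hSsub hz), space := fun z hz => h.space z (hSsub hz)
        grad := fun z hz => h.grad z (hSsub hz), convex := fun z hz => h.convex z (hSsub hz)
        noncharacteristic := fun z hz => h.noncharacteristic z (hSsub hz) }⟩)
    (fun l z hz => hac l z.2 (hSsub hz).2) hζ hζS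
    (fun z hz hzB => by
      simp only [mem_union, mem_ofPred_eq, not_or, not_le] at hzB
      have h := prodCutoff_eventuallyEq_one
        (hη1' z.1 ⟨(abs_le.1 hzB.2.le).1, (abs_le.1 hzB.2.le).2⟩)
        (hχ1 z.2 (hχΩ hz.2) hzB.1)
      exact ⟨fun d => (pd_eq_zero_of_eventuallyEq_const h d).self_of_nhds, fun d =>
        (pd_eq_zero_of_eventuallyEq_const (pd_eq_zero_of_eventuallyEq_const h d)
          d).self_of_nhds⟩)
    (K0 := K * (1 + L)) (by positivity)
  obtain ⟨C1, hC1, hcar⟩ := hcar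
  obtain ⟨C2, hC2, hlow⟩ := integral_cutoff_jet2_le (ι := WIdx) (x0 := x0) (β := β) (K := K) hΩo hΩ
    hV hD hη hχ (hη1' 0 ⟨by linarith, by linarith⟩) hχΩ hχ1 hK
  have hLc : 0 ≤ 2 * T2 * Lη ^ 2 := by positivity
  refine ⟨C2 * C1 * (2 * T2 * Lη ^ 2 + K + 1), ?_, fun τ hτ us uf F1 F2 hus huf hF1 hF2 hB σ hσ hσ0
    hsrc => ?_⟩
  · have : 1 ≤ C2 * C1 := one_le_mul_of_one_le_of_one_le hC2 hC1
    nlinarith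
  have hτ1 : C1 ≤ τ := by
    refine le_trans ?_ hτ
    have : C1 ≤ C2 * C1 := le_mul_of_one_le_left (by linarith) hC2
    have h3 : C2 * C1 * 1 ≤ C2 * C1 * (2 * T2 * Lη ^ 2 + K + 1) :=
      mul_le_mul_of_nonneg_left (by linarith) (by linarith)
    linarith
  have hτ0 : 0 ≤ τ := by linarith
  obtain ⟨hfC, hfz⟩ := hfam us uf hus huf
  have hus2 : ContDiff ℝ 2 us := hus.of_le (by norm_num)
  have huf2 : ContDiff ℝ 2 uf := huf.of_le (by norm_num)
  have hcJ : Continuous (lowJet us uf) := continuous_lowJet hus2 huf2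
  have hcv : Continuous fun x : V3 => vjet us (0, x) + vjet uf (0, x) :=
    ((continuous_vjet (hus.of_le (by norm_num))).comp (by fun_prop)).add
      ((continuous_vjet (huf.of_le (by norm_num))).comp (by fun_prop))
  have hA := hlow τ hτ0 (waveFam A μ2 μ3 us uf) hfC (fun x => lowJet us uf (0, x))
    (fun x => vjet us (0, x) + vjet uf (0, x)) (hcJ.comp (by fun_prop)) hcv
    (fun x => add_nonneg (vjet_nonneg _ _) (vjet_nonneg _ _))
    (fun x hx => (hfz (0, x) hx).1) (fun x hx => (hfz (0, x) hx).2.2)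
  have hBd := hcar τ hτ1 (waveFam A μ2 μ3 us uf) hfC (fun z => σ z.2) (hσ.comp continuous_snd)
    (fun z => hσ0 _) (fun z hz l => by
      have hzS := hζS (subset_tsupport _ hz)
      refine (hwave us uf F1 F2 hus huf hF1 hF2 _ (isOpen_Ioo.prod hΩo) (fun z hz => hz.2) hB z
        (hSQ hzS) l).trans ?_
      have := hsrc z hzS
      have hs := hσ0 z.2
      have hj : 0 ≤ ∑ l, jet2 (waveFam A μ2 μ3 us uf l) z :=
        Finset.sum_nonneg fun _ _ => jet2_nonneg _ _
      rw [mul_assoc]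
      refine mul_le_mul_of_nonneg_left ?_ (by linarith)
      nlinarith [mul_nonneg hL hj])
  have hsrcI := setIntegral_source_le (x0 := x0) hτ0 hβ.le hT2p.le hη.continuous hχ.continuous hcχ
    hLη hσ hσ0
  have hcf : Continuous fun z => ∑ l, jet2 (waveFam A μ2 μ3 us uf l) z :=
    continuous_finsetSum _ fun l _ => continuous_jet2 ((hfC l).of_le one_le_two)
  have hf0 : ∀ z, 0 ≤ ∑ l, jet2 (waveFam A μ2 μ3 us uf l) z := fun z =>
    Finset.sum_nonneg fun _ _ => jet2_nonneg _ _
  have hQb : Bornology.IsBounded (Ioo (-T) T ×ˢ Ω) := Metric.isBounded_Ioo _ _ |>.prod hΩ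
  have hJ0 : ∀ z, 0 ≤ lowJet us uf z := lowJet_nonneg us uf
  have hbad1 := setIntegral_mul_wt_le (x0 := x0) (β := β) (τ := τ) (K := K)
    (A := (Icc (-T2) T2 ×ˢ tsupport χ) ∩ {z : P4 | z.2 ∈ V})
    (A' := Ioo (-T) T ×ˢ (Ω ∩ V)) (E := exp (2 * τ * D ^ 2))
    (hS.measurableSet.inter (hV.measurableSet.preimage measurable_snd))
    (hQb.subset (prod_mono le_rfl inter_subset_left))
    (fun z hz => ⟨(hSQ hz.1).1, (hSQ hz.1).2, hz.2⟩) hcf hcJ hJ0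
    (fun z hz => (hfz z (hSsub hz.1).2).2.1) (by linarith)
    (fun z hz => by
      have := wt_le_exp (x0 := x0) (β := β) (z := z) (a := 0) hτ0 (hD z.2 (hSQ hz.1).2)
        (by positivity)
      rwa [sub_zero] at this) (exp_pos _).le
  have hbad2 := setIntegral_mul_wt_le (x0 := x0) (β := β) (τ := τ) (K := K)
    (A := (Icc (-T2) T2 ×ˢ tsupport χ) ∩ {z : P4 | T1 ≤ |z.1|})
    (A' := Ioo (-T) T ×ˢ Ω) (E := exp (2 * τ * (D ^ 2 - β * T1 ^ 2)))
    (hS.measurableSet.inter (isClosed_le continuous_const (by fun_prop)).measurableSet)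
    hQb (fun z hz => hSQ hz.1) hcf hcJ hJ0
    (fun z hz => (hfz z (hSsub hz.1).2).2.1) (by linarith)
    (fun z hz => wt_le_exp hτ0 (hD z.2 (hSQ hz.1).2) (by
      refine mul_le_mul_of_nonneg_left ?_ hβ.le
      rw [← sq_abs z.1]
      exact pow_le_pow_left₀ hT1.le hz.2 2)) (exp_pos _).le
  have hcw : Continuous fun z => (∑ l, jet2 (waveFam A μ2 μ3 us uf l) z) * wt x0 β τ z :=
    hcf.mul (contDiff_wt (n := 0) x0 β τ).continuous
  have hun := setIntegral_union_le (μ := (volume : Measure P4))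
    (f := fun z => (∑ l, jet2 (waveFam A μ2 μ3 us uf l) z) * wt x0 β τ z)
    (s := (Icc (-T2) T2 ×ˢ tsupport χ) ∩ {z : P4 | z.2 ∈ V})
    (t := (Icc (-T2) T2 ×ˢ tsupport χ) ∩ {z : P4 | T1 ≤ |z.1|})
    (fun z => mul_nonneg (hf0 z) (wt_pos _ _ _ _).le)
    (hcw.integrableOn_of_isBounded (hS.isBounded.subset inter_subset_left))
    (hcw.integrableOn_of_isBounded (hS.isBounded.subset inter_subset_left))
  rw [← inter_union_distrib_left] at hun
  obtain ⟨I1, hI1⟩ : ∃ I1, I1 = ∫ x, χ x ^ 2 * σ x * wt x0 β τ (0, x) := ⟨_, rfl⟩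
  obtain ⟨I2, hI2⟩ : ∃ I2, I2 = exp (2 * τ * D ^ 2) *
    ∫ z in Ioo (-T) T ×ˢ (Ω ∩ V), lowJet us uf z := ⟨_, rfl⟩
  obtain ⟨I3, hI3⟩ : ∃ I3, I3 = exp (2 * τ * D ^ 2) *
    ∫ x in Ω ∩ V, (vjet us (0, x) + vjet uf (0, x)) := ⟨_, rfl⟩
  obtain ⟨I4, hI4⟩ : ∃ I4, I4 = exp (2 * τ * (D ^ 2 - β * T1 ^ 2)) *
    ∫ z in Ioo (-T) T ×ˢ Ω, lowJet us uf z := ⟨_, rfl⟩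
  have p1 : 0 ≤ I1 := hI1 ▸ integral_nonneg fun x =>
    mul_nonneg (mul_nonneg (sq_nonneg _) (hσ0 x)) (wt_pos _ _ _ _).le
  have p2 : 0 ≤ I2 := hI2 ▸ mul_nonneg (exp_pos _).le (integral_nonneg hJ0)
  have p3 : 0 ≤ I3 := hI3 ▸ mul_nonneg (exp_pos _).le
    (integral_nonneg fun x => add_nonneg (vjet_nonneg _ _) (vjet_nonneg _ _))
  have p4 : 0 ≤ I4 := hI4 ▸ mul_nonneg (exp_pos _).le (integral_nonneg hJ0)
  rw [mul_add (exp (2 * τ * D ^ 2)), ← hI1, ← hI2, ← hI3, ← hI4]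
  rw [← hI3] at hA
  rw [← hI1] at hsrcI
  rw [← hI2] at hbad1
  rw [← hI4] at hbad2
  refine hA.trans ?_
  have hC12 : 1 ≤ C2 * C1 := one_le_mul_of_one_le_of_one_le hC2 hC1
  have q := hBd.trans (mul_le_mul_of_nonneg_left
    (add_le_add hsrcI (hun.trans (add_le_add hbad1 hbad2))) (by linarith : 0 ≤ C1))
  have q3 := mul_le_mul_of_nonneg_left (add_le_add q (le_refl I3)) (by linarith : 0 ≤ C2)
  refine q3.trans ?_
  obtain ⟨P, hP⟩ : ∃ P, P = 2 * T2 * Lη ^ 2 := ⟨_, rfl⟩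
  rw [← hP] at hLc ⊢
  have e1 : C2 * I3 ≤ C2 * C1 * I3 :=
    mul_le_mul_of_nonneg_right (le_mul_of_one_le_right (by linarith) hC1) p3
  have e2 : P * I1 + K * I2 + K * I4 + I3 ≤ (P + K + 1) * (I1 + (I2 + I3) + I4) := by
    nlinarith [mul_nonneg hLc p2, mul_nonneg hLc p3, mul_nonneg hLc p4,
      mul_nonneg (by linarith : 0 ≤ K) p1, mul_nonneg (by linarith : 0 ≤ K) p3]
  have e3 := mul_le_mul_of_nonneg_left e2 (by linarith : 0 ≤ C2 * C1)
  rw [← mul_assoc] at e3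
  refine le_trans (le_of_eq_of_le ?_ (add_le_add_right e1 (C2 * C1 * (P * I1 + K * I2 + K * I4))))
    (le_trans (le_of_eq ?_) e3) <;> ring

theorem contDiff_wt_zero (x0 : V3) (β τ : ℝ) {n : WithTop ℕ∞} :
    ContDiff ℝ n fun x : V3 => wt x0 β τ (0, x) :=
  (contDiff_wt x0 β τ).comp (contDiff_const.prodMk contDiff_id)

theorem pdx_sqd (x0 : V3) (i : Fin 3) (x : V3) : pdx (sqd x0) i x = 2 * (x i - x0 i) := by
  have e : sqd x0 = fun x => ∑ j, (x j - x0 j) * (x j - x0 j) := by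
    funext x; simp only [sqd, sq]
  rw [e, pdx_sum _ fun j _ => by fun_prop]
  simp (disch := fun_prop) only [pdx_mul, pdx_sub, pdx_apply, pdx_const, Fin.sum_univ_three]
  fin_cases i <;> simp <;> ring

theorem pdx_wt_zero (x0 : V3) (β τ : ℝ) (i : Fin 3) (x : V3) :
    pdx (fun x : V3 => wt x0 β τ (0, x)) i x = wt x0 β τ (0, x) * (4 * τ * (x i - x0 i)) := by
  have hs : Differentiable ℝ (sqd x0) := (contDiff_sqd x0 (n := 1)).differentiable one_ne_zero
  have e : (fun x : V3 => wt x0 β τ (0, x)) = fun x => exp (2 * τ * sqd x0 x) := by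
    funext x; simp [wt]
  rw [e, pdx_exp (f := fun x => 2 * τ * sqd x0 x) i (by fun_prop),
    pdx_mul (f := fun _ => 2 * τ) (g := sqd x0) i (by fun_prop) (hs x), pdx_const, pdx_sqd]
  simp only [wt]
  norm_num
  ring

/-- The directional derivative of `h` along a vector field. -/
def along (Φ : V3 → V3) (h : V3 → ℝ) (x : V3) : ℝ := ∑ i, Φ x i * pdx h i x

theorem continuous_along {Φ : V3 → V3} {h : V3 → ℝ} (hΦ : Continuous Φ) (hh : ContDiff ℝ 1 h) :
    Continuous (along Φ h) :=
  continuous_finsetSum _ fun i _ =>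
    ((continuous_apply i).comp hΦ).mul (hh.pdx i (m := 0) (by simp)).continuous

theorem exists_transport_carleman {Ω : Set V3} {x0 : V3} {β : ℝ} {Φ : V3 → V3}
    (hΩ : Bornology.IsBounded Ω) (hΦ : ContDiff ℝ 1 Φ)
    (hne : ∀ x ∈ closure Ω, ∑ i, Φ x i * (x i - x0 i) ≠ 0) :
    ∃ C, 1 ≤ C ∧ ∀ τ, C ≤ τ → ∀ h : V3 → ℝ, ContDiff ℝ 1 h → tsupport h ⊆ closure Ω →
      τ ^ 2 * ∫ x, h x ^ 2 * wt x0 β τ (0, x) ≤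
        C * ∫ x, along Φ h x ^ 2 * wt x0 β τ (0, x) := by
  have hΦi : ∀ i, ContDiff ℝ 1 fun x => Φ x i := fun i => contDiff_pi.1 hΦ i
  obtain ⟨g, hg⟩ : ∃ g : V3 → ℝ, g = fun x => ∑ i, Φ x i * (x i - x0 i) := ⟨_, rfl⟩
  have hgC : ContDiff ℝ 1 g := by
    rw [hg]
    exact ContDiff.sum fun i _ => (hΦi i).mul ((contDiff_apply ℝ ℝ i).sub contDiff_const)
  obtain ⟨δ, hδ0, hδ⟩ : ∃ δ > 0, ∀ x ∈ closure Ω, δ ≤ g x ^ 2 := by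
    rcases (closure Ω).eq_empty_or_nonempty with he | hn
    · exact ⟨1, one_pos, fun x hx => by rw [he] at hx; exact hx.elim⟩
    · obtain ⟨x, hx, hmin⟩ := hΩ.isCompact_closure.exists_isMinOn hn
        (hgC.continuous.pow 2).continuousOn
      refine ⟨g x ^ 2, ?_, fun y hy => hmin hy⟩
      have := hne x hx
      rw [hg]
      positivity
  have hψ : ∀ i, ContDiff ℝ 1 fun x => Φ x i * g x := fun i => (hΦi i).mul hgC
  have hdv : Continuous fun x => ∑ i, pdx (fun x => Φ x i * g x) i x :=
    continuous_finsetSum _ fun i _ => ((hψ i).pdx i (m := 0) (by simp)).continuous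
  obtain ⟨L, hL1, hL⟩ := hdv.exists_abs_le_of_isCompact hΩ.isCompact_closure
  refine ⟨L / δ + 1 / (2 * δ) + 1, ?_, fun τ hτ h hh hs => ?_⟩
  · have : 0 ≤ L / δ + 1 / (2 * δ) := by positivity
    linarith
  have hτL : L ≤ τ * δ := by
    have h1 : 0 ≤ 1 / (2 * δ) := by positivity
    rw [← div_le_iff₀ hδ0]
    linarith
  have hτ0 : 0 < τ := by
    have : 0 ≤ L / δ + 1 / (2 * δ) := by positivity
    linarith
  obtain ⟨W, hW⟩ : ∃ W : V3 → ℝ, W = fun x => wt x0 β τ (0, x) := ⟨_, rfl⟩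
  have hWC : ContDiff ℝ 1 W := hW ▸ contDiff_wt_zero x0 β τ
  have hWi : ∀ i x, pdx W i x = W x * (4 * τ * (x i - x0 i)) := fun i x => by
    rw [hW]; exact pdx_wt_zero x0 β τ i x
  have hW0 : ∀ x, 0 < W x := fun x => by rw [hW]; exact wt_pos _ _ _ _
  have hch : HasCompactSupport h :=
    hΩ.isCompact_closure.of_isClosed_subset (isClosed_tsupport h) hs
  have hV : ∀ i, ContDiff ℝ 1 fun x => Φ x i * g x * (h x * h x * W x) := fun i =>
    (hψ i).mul ((hh.mul hh).mul hWC)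
  have hcV : ∀ i, HasCompactSupport fun x => Φ x i * g x * (h x * h x * W x) := fun i =>
    HasCompactSupport.intro hch fun x hx => by rw [image_eq_zero_of_notMem_tsupport hx]; ring
  have hdiff : ∀ x, DifferentiableAt ℝ h x := fun x => hh.differentiable one_ne_zero x
  have hWd : ∀ x, DifferentiableAt ℝ W x := fun x => hWC.differentiable one_ne_zero x
  have hVp : ∀ i x, pdx (fun x => Φ x i * g x * (h x * h x * W x)) i x =
      pdx (fun x => Φ x i * g x) i x * (h x * h x * W x)
        + Φ x i * g x * (2 * h x * pdx h i x * W x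
          + h x * h x * (W x * (4 * τ * (x i - x0 i)))) := fun i x => by
    rw [pdx_mul (f := fun x => Φ x i * g x) (g := fun x => h x * h x * W x) i
      ((hψ i).differentiable one_ne_zero x) (((hdiff x).mul (hdiff x)).mul (hWd x)),
      pdx_mul (f := fun x => h x * h x) (g := W) i ((hdiff x).mul (hdiff x)) (hWd x),
      pdx_mul (f := h) (g := h) i (hdiff x) (hdiff x), hWi]
    ring
  have hsum : ∫ x, ∑ i, pdx (fun x => Φ x i * g x * (h x * h x * W x)) i x = 0 := by
    rw [integral_finsetSum]
    · exact Finset.sum_eq_zero fun i _ => integral_pdx (hV i) (hcV i) i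
    · exact fun i _ => ((hV i).pdx i (m := 0) (by simp)).continuous.integrable_of_hasCompactSupport
        (by
          have := (hcV i).fderiv (𝕜 := ℝ)
          exact this.comp_left (g := fun L : V3 →L[ℝ] ℝ => L (Pi.single i 1)) rfl)
  have hdivx : ∀ x, ∑ i, pdx (fun x => Φ x i * g x * (h x * h x * W x)) i x =
      (∑ i, pdx (fun x => Φ x i * g x) i x) * (h x ^ 2 * W x)
        + 2 * h x * g x * along Φ h x * W x + 4 * τ * g x ^ 2 * (h x ^ 2 * W x) := fun x => by
    have hgx : g x = ∑ i, Φ x i * (x i - x0 i) := by rw [hg]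
    simp only [hVp, Fin.sum_univ_three, along] at hgx ⊢
    linear_combination (-4 * τ * g x * h x ^ 2 * W x) * hgx
  have hali := continuous_along (hΦ.continuous) hh
  have hha : ∀ x, x ∉ tsupport h → along Φ h x = 0 := fun x hx => by
    have : h =ᶠ[nhds x] fun _ => 0 := notMem_tsupport_iff_eventuallyEq.1 hx
    simp only [along, pdx_congr _ this, pdx_const, mul_zero, Finset.sum_const_zero]
  have i1 : Integrable fun x => h x ^ 2 * W x :=
    ((hh.continuous.pow 2).mul hWC.continuous).integrable_of_hasCompactSupport
      (HasCompactSupport.intro hch fun x hx => by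
        simp [image_eq_zero_of_notMem_tsupport hx])
  have i2 : Integrable fun x => along Φ h x ^ 2 * W x :=
    ((hali.pow 2).mul hWC.continuous).integrable_of_hasCompactSupport
      (HasCompactSupport.intro hch fun x hx => by simp [hha x hx])
  have i3 : Integrable fun x => ∑ i, pdx (fun x => Φ x i * g x * (h x * h x * W x)) i x :=
    integrable_finsetSum _ fun i _ =>
      ((hV i).pdx i (m := 0) (by simp)).continuous.integrable_of_hasCompactSupport
        (by
          have := (hcV i).fderiv (𝕜 := ℝ)
          exact this.comp_left (g := fun L : V3 →L[ℝ] ℝ => L (Pi.single i 1)) rfl)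
  have hpt : ∀ x, 2 * τ ^ 2 * δ * (h x ^ 2 * W x) - along Φ h x ^ 2 * W x ≤
      τ * ∑ i, pdx (fun x => Φ x i * g x * (h x * h x * W x)) i x := fun x => by
    by_cases hx : x ∈ tsupport h
    · rw [hdivx]
      have hLx := (abs_le.1 (hL x (hs hx))).1
      obtain ⟨d, hd⟩ : ∃ d, d = ∑ i, pdx (fun x => Φ x i * g x) i x := ⟨_, rfl⟩
      rw [← hd] at hLx ⊢
      have hp : 0 ≤ h x ^ 2 * W x := mul_nonneg (sq_nonneg _) (hW0 x).le
      have e1 : -(τ * δ) * (h x ^ 2 * W x) ≤ d * (h x ^ 2 * W x) :=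
        mul_le_mul_of_nonneg_right (by linarith) hp
      have e2 : τ * δ * (h x ^ 2 * W x) ≤ τ * g x ^ 2 * (h x ^ 2 * W x) :=
        mul_le_mul_of_nonneg_right (mul_le_mul_of_nonneg_left (hδ x (hs hx)) hτ0.le) hp
      have e3 : 0 ≤ (τ * g x * h x + along Φ h x) ^ 2 * W x :=
        mul_nonneg (sq_nonneg _) (hW0 x).le
      have e4 := mul_le_mul_of_nonneg_left e1 hτ0.le
      have e5 := mul_le_mul_of_nonneg_left e2 hτ0.le
      nlinarith
    · have h0 := image_eq_zero_of_notMem_tsupport hx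
      rw [hdivx, h0, hha x hx]
      simp
  have hint := integral_mono ((i1.const_mul (2 * τ ^ 2 * δ)).sub i2) (i3.const_mul τ) hpt
  rw [integral_const_mul, hsum, mul_zero] at hint
  have e := integral_sub (i1.const_mul (2 * τ ^ 2 * δ)) i2
  rw [integral_const_mul] at e
  have e' := e.symm.le.trans hint
  have hWe : ∀ x, wt x0 β τ (0, x) = W x := fun x => by rw [hW]
  simp only [hWe]
  obtain ⟨X, hX⟩ : ∃ X, X = ∫ x, h x ^ 2 * W x := ⟨_, rfl⟩
  obtain ⟨Y, hY⟩ : ∃ Y, Y = ∫ x, along Φ h x ^ 2 * W x := ⟨_, rfl⟩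
  have hY0 : 0 ≤ Y := hY ▸ integral_nonneg fun x => mul_nonneg (sq_nonneg _) (hW0 x).le
  rw [← hX, ← hY] at e' ⊢
  have h1 : τ ^ 2 * X ≤ 1 / (2 * δ) * Y := by
    rw [div_mul_eq_mul_div, le_div_iff₀ (by positivity)]
    linarith
  have h2 : 0 ≤ L / δ * Y := by positivity
  linarith

/-- At `x`, the function `f` and its partial derivatives are bounded by `K`. -/
structure JetBound (f : V3 → ℝ) (K : ℝ) (x : V3) : Prop where
  val : |f x| ≤ K
  grad : ∀ k, |pdx f k x| ≤ K

theorem JetBound.mono {f : V3 → ℝ} {K L : ℝ} {x : V3} (h : JetBound f K x) (hKL : K ≤ L) :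
    JetBound f L x := ⟨h.val.trans hKL, fun k => (h.grad k).trans hKL⟩

theorem abs_sum_le_card_mul {ι : Type*} [Fintype ι] {f : ι → ℝ} {K : ℝ} (h : ∀ i, |f i| ≤ K) :
    |∑ i, f i| ≤ Fintype.card ι * K :=
  (Finset.abs_sum_le_sum_abs _ _).trans (by
    simpa using Finset.sum_le_card_nsmul Finset.univ _ K fun i _ => h i)

/-- The jet of a linear combination. -/
theorem jetBound_comb {ι : Type*} [Fintype ι] {Ω : Set V3} (hΩ : IsOpen Ω) {F : V3 → ℝ}
    {c f : ι → V3 → ℝ} {K E : ℝ} {x : V3} (hx : x ∈ Ω)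
    (hF : ∀ y ∈ Ω, F y = ∑ j, c j y * f j y) (hc : ∀ j, DifferentiableAt ℝ (c j) x)
    (hf : ∀ j, DifferentiableAt ℝ (f j) x) (hcb : ∀ j, JetBound (c j) K x)
    (hfb : ∀ j, JetBound (f j) E x) : JetBound F (Fintype.card ι * (2 * (K * E))) x := by
  have hev : F =ᶠ[nhds x] fun y => ∑ j, c j y * f j y := by
    filter_upwards [hΩ.mem_nhds hx] with y hy using hF y hy
  constructor
  · rw [hF x hx]
    refine abs_sum_le_card_mul fun j => ?_
    have := abs_mul_le_mul (hcb j).val (hfb j).val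
    have := abs_nonneg (c j x * f j x)
    linarith
  · intro k
    rw [pdx_congr k hev, pdx_sum (f := fun j y => c j y * f j y) k fun j _ => (hc j).mul (hf j)]
    refine abs_sum_le_card_mul fun j => ?_
    rw [pdx_mul (f := c j) (g := f j) k (hc j) (hf j)]
    have h1 := abs_mul_le_mul ((hcb j).grad k) (hfb j).val
    have h2 := abs_mul_le_mul (hcb j).val ((hfb j).grad k)
    exact (abs_add_le _ _).trans (by linarith)

theorem pdx_along {Φ : V3 → V3} {p : V3 → ℝ} (hΦ : ContDiff ℝ 1 Φ) (hp : ContDiff ℝ 2 p)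
    (k : Fin 3) (x : V3) : pdx (along Φ p) k x =
      (∑ i, pdx (fun x => Φ x i) k x * pdx p i x) + along Φ (pdx p k) x := by
  have hd : ∀ i, DifferentiableAt ℝ (fun x => Φ x i) x := fun i =>
    (contDiff_pi.1 hΦ i).differentiable one_ne_zero x
  have hp' : ∀ i, DifferentiableAt ℝ (pdx p i) x := fun i =>
    (hp.pdx i (m := 1) (by norm_num)).differentiable one_ne_zero x
  have e : along Φ p = fun x => ∑ i, Φ x i * pdx p i x := rfl
  rw [e, pdx_sum (f := fun i x => Φ x i * pdx p i x) k fun i _ => (hd i).mul (hp' i)]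
  unfold along
  rw [← Finset.sum_add_distrib]
  refine Finset.sum_congr rfl fun i _ => ?_
  rw [pdx_mul (f := fun x => Φ x i) (g := pdx p i) k (hd i) (hp' i), pdx_comm hp i k]

theorem along_pdx_le {Φ : V3 → V3} {p : V3 → ℝ} {K E B : ℝ} {x : V3} (hΦ : ContDiff ℝ 1 Φ)
    (hp : ContDiff ℝ 2 p) (hΦb : ∀ i, JetBound (fun x => Φ x i) K x) (hpb : JetBound p E x)
    (hb : JetBound (along Φ p) B x) (k : Fin 3) : |along Φ (pdx p k) x| ≤ B + 3 * (K * E) := by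
  have h := pdx_along hΦ hp k x
  have e : along Φ (pdx p k) x =
      pdx (along Φ p) k x - ∑ i, pdx (fun x => Φ x i) k x * pdx p i x := by linarith
  have h1 := abs_sum_le_card_mul (K := K * E)
    (f := fun i => pdx (fun x => Φ x i) k x * pdx p i x) fun i =>
      abs_mul_le_mul ((hΦb i).grad k) (hpb.grad i)
  simp only [Fintype.card_fin, Nat.cast_ofNat] at h1
  rw [e]
  refine (abs_sub _ _).trans ?_
  linarith [hb.grad k]

/-- Divergence of the algebraic relation satisfied at the initial time. -/
theorem along_eq_of_relation {Ω : Set V3} (hΩ : IsOpen Ω) {α α' p : V3 → ℝ} {a b Φ : V3 → V3}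
    (hα : ContDiff ℝ 1 α) (hα' : ContDiff ℝ 1 α') (hp : ContDiff ℝ 1 p) (ha : ContDiff ℝ 1 a)
    (hb : ContDiff ℝ 1 b) (hΦ : ContDiff ℝ 1 Φ)
    (h : ∀ x ∈ Ω, ∀ i, α x * a x i + α' x * b x i = p x * Φ x i) {x : V3} (hx : x ∈ Ω) :
    along Φ p x = α x * sdivX a x + α' x * sdivX b x
      + (∑ i, pdx α i x * a x i) + (∑ i, pdx α' i x * b x i) - sdivX Φ x * p x := by
  have da : ∀ i, DifferentiableAt ℝ (fun x => a x i) x := fun i =>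
    (contDiff_pi.1 ha i).differentiable one_ne_zero x
  have db : ∀ i, DifferentiableAt ℝ (fun x => b x i) x := fun i =>
    (contDiff_pi.1 hb i).differentiable one_ne_zero x
  have dΦ : ∀ i, DifferentiableAt ℝ (fun x => Φ x i) x := fun i =>
    (contDiff_pi.1 hΦ i).differentiable one_ne_zero x
  have dα := hα.differentiable one_ne_zero x
  have dα' := hα'.differentiable one_ne_zero x
  have dp := hp.differentiable one_ne_zero x
  have key : ∀ i, pdx α i x * a x i + α x * pdx (fun x => a x i) i x
      + (pdx α' i x * b x i + α' x * pdx (fun x => b x i) i x)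
      = pdx p i x * Φ x i + p x * pdx (fun x => Φ x i) i x := fun i => by
    rw [← pdx_mul (f := p) (g := fun x => Φ x i) i dp (dΦ i),
      ← pdx_mul (f := α) (g := fun x => a x i) i dα (da i),
      ← pdx_mul (f := α') (g := fun x => b x i) i dα' (db i),
      ← pdx_add (f := fun x => α x * a x i) (g := fun x => α' x * b x i) i (dα.mul (da i))
        (dα'.mul (db i))]
    refine pdx_congr i ?_
    filter_upwards [hΩ.mem_nhds hx] with y hy using h y hy i
  have k0 := key 0
  have k1 := key 1
  have k2 := key 2
  have ea : sdivX a x = ∑ i, pdx (fun y => a y i) i x := rfl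
  have eb : sdivX b x = ∑ i, pdx (fun y => b y i) i x := rfl
  have eΦ : sdivX Φ x = ∑ i, pdx (fun y => Φ y i) i x := rfl
  rw [ea, eb, eΦ]
  simp only [along, Fin.sum_univ_three]
  linear_combination -k0 - k1 - k2

theorem contDiff_sdivX {n : WithTop ℕ∞} {a : V3 → V3} (ha : ContDiff ℝ (n + 1) a) :
    ContDiff ℝ n (sdivX a) :=
  ContDiff.sum fun i _ => (contDiff_pi.1 ha i).pdx i le_rfl

/-- The transport terms of the sources, controlled by the divergences of the solution. -/
theorem exists_along_bound {Ω : Set V3} (hΩo : IsOpen Ω) (hΩ : Bornology.IsBounded Ω)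
    {α α' : V3 → ℝ} {Φ A11 A12 A21 A22 : V3 → V3} (hα : ContDiff ℝ 2 α) (hα' : ContDiff ℝ 2 α')
    (hΦ : ContDiff ℝ 2 Φ) (h11 : ContDiff ℝ 1 A11) (h12 : ContDiff ℝ 1 A12)
    (h21 : ContDiff ℝ 1 A21) (h22 : ContDiff ℝ 1 A22) :
    ∃ K, 1 ≤ K ∧ ∀ (p p1 p2 : V3 → ℝ) (a b : V3 → V3), ContDiff ℝ 2 p → ContDiff ℝ 2 p1 →
      ContDiff ℝ 2 p2 → ContDiff ℝ 2 a → ContDiff ℝ 2 b →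
      (∀ x ∈ Ω, ∀ i, α x * a x i + α' x * b x i = p x * Φ x i) →
      (∀ x ∈ Ω, ∀ i, a x i = A11 x i * p1 x + A12 x i * p2 x) →
      (∀ x ∈ Ω, ∀ i, b x i = A21 x i * p1 x + A22 x i * p2 x) →
      ∀ x ∈ Ω, ∀ E, JetBound (sdivX a) E x → JetBound (sdivX b) E x → JetBound p E x →
        JetBound p1 E x → JetBound p2 E x →
        |along Φ p x| ≤ K * E ∧ ∀ k, |along Φ (pdx p k) x| ≤ K * E := by
  have hdα : ∀ i, ContDiff ℝ 1 (pdx α i) := fun i => hα.pdx i (by norm_num)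
  have hdα' : ∀ i, ContDiff ℝ 1 (pdx α' i) := fun i => hα'.pdx i (by norm_num)
  obtain ⟨c, hc⟩ : ∃ c : Fin 5 → V3 → ℝ, c = ![α, α',
      fun x => ∑ i, (pdx α i x * A11 x i + pdx α' i x * A21 x i),
      fun x => ∑ i, (pdx α i x * A12 x i + pdx α' i x * A22 x i),
      fun x => -sdivX Φ x] := ⟨_, rfl⟩
  have hcC : ∀ j, ContDiff ℝ 1 (c j) := by
    have hs : ∀ {P Q : V3 → V3}, ContDiff ℝ 1 P → ContDiff ℝ 1 Q →
        ContDiff ℝ 1 fun x => ∑ i, (pdx α i x * P x i + pdx α' i x * Q x i) := fun hP hQ =>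
      ContDiff.sum fun i _ =>
        ((hdα i).mul (contDiff_pi.1 hP i)).add ((hdα' i).mul (contDiff_pi.1 hQ i))
    intro j
    rw [hc]
    fin_cases j
    · exact hα.of_le (by norm_num)
    · exact hα'.of_le (by norm_num)
    · exact hs h11 h21
    · exact hs h12 h22
    · exact (contDiff_sdivX (n := 1) (hΦ.of_le (by norm_num))).neg
  obtain ⟨K, hK1, hK⟩ := exists_c1Bound hcC hΩ.isCompact_closure
  obtain ⟨L, hL1, hL⟩ := exists_c1Bound (h := fun i x => Φ x i)
    (fun i => (contDiff_pi.1 hΦ i).of_le (by norm_num)) hΩ.isCompact_closure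
  refine ⟨10 * K + 3 * L, by linarith, fun p p1 p2 a b hp hp1 hp2 ha hb hrel hA hB x hx E hW hW'
    hpE hp1E hp2E => ?_⟩
  have hE : 0 ≤ E := (abs_nonneg _).trans hpE.val
  have hxc := subset_closure hx
  have hF : ∀ y ∈ Ω, along Φ p y = ∑ j, c j y * (![sdivX a, sdivX b, p1, p2, p] : Fin 5 → _) j y := by
    intro y hy
    rw [along_eq_of_relation hΩo (hα.of_le (by norm_num)) (hα'.of_le (by norm_num))
      (hp.of_le (by norm_num)) (ha.of_le (by norm_num)) (hb.of_le (by norm_num))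
      (hΦ.of_le (by norm_num)) hrel hy, hc, Fin.sum_univ_five]
    simp only [hA y hy, hB y hy, Fin.sum_univ_three]
    simp only [Matrix.cons_val]
    ring
  have hfd : ∀ j, DifferentiableAt ℝ ((![sdivX a, sdivX b, p1, p2, p] : Fin 5 → _) j) x := by
    have h1 : ∀ {f : V3 → ℝ}, ContDiff ℝ 1 f → DifferentiableAt ℝ f x := fun h =>
      h.differentiable one_ne_zero x
    intro j
    fin_cases j
    · exact h1 (contDiff_sdivX (ha.of_le (by norm_num)))
    · exact h1 (contDiff_sdivX (hb.of_le (by norm_num)))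
    · exact h1 (hp1.of_le (by norm_num))
    · exact h1 (hp2.of_le (by norm_num))
    · exact h1 (hp.of_le (by norm_num))
  have hfb : ∀ j, JetBound ((![sdivX a, sdivX b, p1, p2, p] : Fin 5 → _) j) E x := by
    intro j
    fin_cases j
    exacts [hW, hW', hp1E, hp2E, hpE]
  have hB := jetBound_comb hΩo hx hF (fun j => (hK j x hxc).1) hfd
    (fun j => ⟨(hK j x hxc).2.1, (hK j x hxc).2.2⟩) hfb
  have e : (Fintype.card (Fin 5) : ℝ) * (2 * (K * E)) = 10 * K * E := by
    simp only [Fintype.card_fin]; norm_num; ring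
  rw [e] at hB
  refine ⟨hB.val.trans (by nlinarith), fun k => ?_⟩
  refine (along_pdx_le (hΦ.of_le (by norm_num)) hp
    (fun i => ⟨(hL i x hxc).2.1, (hL i x hxc).2.2⟩) hpE hB k).trans (le_of_eq ?_)
  ring

/-- Recovering a source from the solution at the initial time. -/
theorem exists_source_bound {Ω : Set V3} (hΩo : IsOpen Ω) (hΩ : Bornology.IsBounded Ω)
    {α α' : V3 → ℝ} {Φ : V3 → V3} {x0 : V3} (hα : ContDiff ℝ 1 α) (hα' : ContDiff ℝ 1 α')
    (hΦ : ContDiff ℝ 1 Φ) (hne : ∀ x ∈ closure Ω, ∑ i, Φ x i * (x i - x0 i) ≠ 0) :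
    ∃ K, 1 ≤ K ∧ ∀ (p : V3 → ℝ) (a b : V3 → V3), ContDiff ℝ 1 a → ContDiff ℝ 1 b →
      (∀ x ∈ Ω, ∀ i, α x * a x i + α' x * b x i = p x * Φ x i) →
      ∀ x ∈ Ω, ∀ E, (∀ i, JetBound (fun y => a y i) E x) → (∀ i, JetBound (fun y => b y i) E x) →
        JetBound p (K * E) x := by
  have hΦi : ∀ i, ContDiff ℝ 1 fun x => Φ x i := fun i => contDiff_pi.1 hΦ i
  have hxi : ∀ i, ContDiff ℝ 1 fun x : V3 => x i - x0 i := fun i =>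
    (contDiff_apply ℝ ℝ i).sub contDiff_const
  obtain ⟨g, hg, hg1⟩ := exists_contDiff_mul_eq_one (n := 1) isClosed_closure
    (f := fun x => ∑ i, Φ x i * (x i - x0 i)) (ContDiff.sum fun i _ => (hΦi i).mul (hxi i)) hne
  obtain ⟨c, hc⟩ : ∃ c : Fin 3 ⊕ Fin 3 → V3 → ℝ, c = Sum.elim
      (fun i x => g x * (x i - x0 i) * α x) (fun i x => g x * (x i - x0 i) * α' x) := ⟨_, rfl⟩
  have hcC : ∀ j, ContDiff ℝ 1 (c j) := by
    rw [hc]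
    rintro (i | i)
    exacts [(hg.mul (hxi i)).mul hα, (hg.mul (hxi i)).mul hα']
  obtain ⟨K, hK1, hK⟩ := exists_c1Bound hcC hΩ.isCompact_closure
  refine ⟨12 * K, by linarith, fun p a b ha hb hrel x hx E haE hbE => ?_⟩
  have hxc := subset_closure hx
  have hF : ∀ y ∈ Ω, p y = ∑ j, c j y *
      (Sum.elim (fun i y => a y i) (fun i y => b y i) : Fin 3 ⊕ Fin 3 → V3 → ℝ) j y := by
    intro y hy
    have h1 := (hg1.self_of_nhdsSet) y (subset_closure hy)
    have r0 := hrel y hy 0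
    have r1 := hrel y hy 1
    have r2 := hrel y hy 2
    rw [hc, Fintype.sum_sum_type]
    simp only [Sum.elim_inl, Sum.elim_inr, Fin.sum_univ_three] at h1 ⊢
    linear_combination -p y * h1 - g y * (y 0 - x0 0) * r0 - g y * (y 1 - x0 1) * r1
      - g y * (y 2 - x0 2) * r2
  have hB := jetBound_comb (E := E) hΩo hx hF (fun j => (hK j x hxc).1)
    (by rintro (i | i)
        exacts [(contDiff_pi.1 ha i).differentiable one_ne_zero x,
          (contDiff_pi.1 hb i).differentiable one_ne_zero x])
    (fun j => ⟨(hK j x hxc).2.1, (hK j x hxc).2.2⟩)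
    (by rintro (i | i); exacts [haE i, hbE i])
  refine hB.mono (le_of_eq ?_)
  simp only [Fintype.card_sum, Fintype.card_fin]
  push_cast
  ring

theorem pd_ex_slice {f : P4 → ℝ} {t : ℝ} {x : V3} (hf : DifferentiableAt ℝ f (t, x)) (i : Fin 3) :
    pd f (ex i) (t, x) = pdx (fun y => f (t, y)) i x := by
  have h := hf.hasFDerivAt.comp x (hasFDerivAt_prodMk_right t x)
  have e : HasFDerivAt (fun y => f (t, y))
      ((fderiv ℝ f (t, x)).comp (ContinuousLinearMap.inr ℝ ℝ V3)) x := h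
  simp only [pd, pdx]
  rw [e.fderiv]
  rfl

theorem pd_ex_eq_zero_of_slice {Ω : Set V3} (hΩ : IsOpen Ω) {f : P4 → ℝ} {t : ℝ}
    (hf : Differentiable ℝ f) (h : ∀ x ∈ Ω, f (t, x) = 0) (i : Fin 3) {x : V3} (hx : x ∈ Ω) :
    pd f (ex i) (t, x) = 0 := by
  rw [pd_ex_slice (hf _) i]
  have e : (fun y => f (t, y)) =ᶠ[nhds x] fun _ => (0 : ℝ) := by
    filter_upwards [hΩ.mem_nhds hx] with y hy using h y hy
  rw [pdx_congr i e, pdx_const]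

section InitialTime

variable {Ω : Set V3} {u : P4 → V3} {t : ℝ}

theorem sdiv_eq_zero_of_slice (hΩ : IsOpen Ω) (hu : ContDiff ℝ 2 u)
    (h : ∀ x ∈ Ω, u (t, x) = 0) {x : V3} (hx : x ∈ Ω) : sdiv u (t, x) = 0 :=
  Finset.sum_eq_zero fun i _ => pd_ex_eq_zero_of_slice hΩ
    ((contDiff_pi.1 hu i).differentiable (by norm_num)) (fun y hy => by rw [h y hy]; rfl) i hx

theorem pd_coef_sdiv_eq_zero_of_slice (hΩ : IsOpen Ω) (hu : ContDiff ℝ 2 u)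
    (h : ∀ x ∈ Ω, u (t, x) = 0) {c : V3 → ℝ} (hc : ContDiff ℝ 2 c) (i : Fin 3) {x : V3}
    (hx : x ∈ Ω) : pd (fun y => c y.2 * sdiv u y) (ex i) (t, x) = 0 := by
  have hs : ContDiff ℝ 1 (sdiv u) := contDiff_sdiv (by exact_mod_cast hu)
  refine pd_ex_eq_zero_of_slice hΩ (((hc.differentiable (by norm_num)).comp differentiable_snd).mul
    (hs.differentiable one_ne_zero)) (fun y hy => ?_) i hx
  show c y * sdiv u (t, y) = 0
  rw [sdiv_eq_zero_of_slice hΩ hu h hy, mul_zero]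

theorem lameOp_eq_zero_of_slice (hΩ : IsOpen Ω) (hu : ContDiff ℝ 2 u)
    (h : ∀ x ∈ Ω, u (t, x) = 0) (μ lam : V3 → ℝ) (i : Fin 3) {x : V3} (hx : x ∈ Ω) :
    lameOp μ lam u (t, x) i = 0 := by
  have hs : ContDiff ℝ 1 (sdiv u) := contDiff_sdiv (by exact_mod_cast hu)
  have h1 : ∀ i j, ∀ y ∈ Ω, pd (fun y => u y i) (ex j) (t, y) = 0 := fun i j y hy =>
    pd_ex_eq_zero_of_slice hΩ ((contDiff_pi.1 hu i).differentiable (by norm_num))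
      (fun y hy => by rw [h y hy]; rfl) j hy
  have h2 : slap (fun y => u y i) (t, x) = 0 := Finset.sum_eq_zero fun j _ =>
    pd_ex_eq_zero_of_slice hΩ
      (((contDiff_pi.1 hu i).pd (ex j) (m := 1) (by norm_num)).differentiable one_ne_zero)
      (h1 i j) j hx
  have h3 : pd (sdiv u) (ex i) (t, x) = 0 := pd_ex_eq_zero_of_slice hΩ
    (hs.differentiable one_ne_zero) (fun y hy => sdiv_eq_zero_of_slice hΩ hu h hy) i hx
  unfold lameOp
  simp only [h2, h3, h1 _ _ x hx, sdiv_eq_zero_of_slice hΩ hu h hx]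
  simp

end InitialTime

/-- With vanishing initial displacement, Biot's system is algebraic at the initial time. -/
theorem BiotSystem.initial_relations {Ω : Set V3} {ρ11 ρ12 ρ22 μ lam q r : V3 → ℝ}
    {us uf F1 F2 : P4 → V3} {T : ℝ} (hΩ : IsOpen Ω)
    (h : BiotSystem ρ11 ρ12 ρ22 μ lam q r us uf F1 F2 (Ioo (-T) T ×ˢ Ω)) (hT : 0 < T)
    (hq : ContDiff ℝ 2 q) (hr : ContDiff ℝ 2 r) (hus : ContDiff ℝ 2 us) (huf : ContDiff ℝ 2 uf)
    (hs0 : ∀ x ∈ Ω, us (0, x) = 0) (hf0 : ∀ x ∈ Ω, uf (0, x) = 0) {x : V3} (hx : x ∈ Ω)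
    (i : Fin 3) :
    ρ11 x * Dt (Dt us) (0, x) i + ρ12 x * Dt (Dt uf) (0, x) i = F1 (0, x) i ∧
      ρ12 x * Dt (Dt us) (0, x) i + ρ22 x * Dt (Dt uf) (0, x) i = F2 (0, x) i := by
  have hz : ((0 : ℝ), x) ∈ Ioo (-T) T ×ˢ Ω := ⟨⟨by simpa using hT, hT⟩, hx⟩
  obtain ⟨e1, e2⟩ := h _ hz i
  rw [lameOp_eq_zero_of_slice hΩ hus hs0 _ _ i hx,
    pd_coef_sdiv_eq_zero_of_slice hΩ huf hf0 hq i hx, sub_zero, sub_zero] at e1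
  rw [pd_coef_sdiv_eq_zero_of_slice hΩ hus hs0 hq i hx,
    pd_coef_sdiv_eq_zero_of_slice hΩ huf hf0 hr i hx, sub_zero, sub_zero] at e2
  exact ⟨e1, e2⟩

theorem Dt_coef_mul {p : V3 → ℝ} {R : P4 → V3} (hp : ContDiff ℝ 1 p) (hR : ContDiff ℝ 1 R) :
    Dt (fun z i => p z.2 * R z i) = fun z i => p z.2 * Dt R z i := by
  funext z i
  have e := pd_mul (f := fun z : P4 => p z.2) (g := fun z => R z i) (z := z) et
    ((hp.comp contDiff_snd).differentiable one_ne_zero z)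
    ((contDiff_pi.1 hR i).differentiable one_ne_zero z)
  rw [pd_comp_snd_et (hp.differentiable one_ne_zero _), zero_mul, zero_add] at e
  exact e

/-- The squared first-order jet of a function on `ℝ³`. -/
def psq (p : V3 → ℝ) (x : V3) : ℝ := p x ^ 2 + ∑ i, pdx p i x ^ 2

theorem psq_nonneg (p : V3 → ℝ) (x : V3) : 0 ≤ psq p x := by unfold psq; positivity

theorem continuous_psq {p : V3 → ℝ} (hp : ContDiff ℝ 1 p) : Continuous (psq p) :=
  (hp.continuous.pow 2).add (continuous_finsetSum _ fun i _ =>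
    (hp.pdx i (m := 0) (by simp)).continuous.pow 2)

theorem sq_le_psq (p : V3 → ℝ) (x : V3) : p x ^ 2 ≤ psq p x :=
  le_add_of_nonneg_right (Finset.sum_nonneg fun _ _ => sq_nonneg _)

theorem sq_pdx_le_psq (p : V3 → ℝ) (i : Fin 3) (x : V3) : pdx p i x ^ 2 ≤ psq p x :=
  (Finset.single_le_sum (f := fun i => pdx p i x ^ 2) (fun _ _ => sq_nonneg _)
    (Finset.mem_univ i)).trans (le_add_of_nonneg_left (sq_nonneg _))

theorem exists_source_sq_le {R : P4 → V3} (hR : ContDiff ℝ 1 R) {S : Set P4} (hS : IsCompact S) :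
    ∃ L, 0 ≤ L ∧ ∀ p : V3 → ℝ, ContDiff ℝ 1 p → ∀ z ∈ S,
      n2 (fun i => p z.2 * R z i) + vGradX2 (fun z i => p z.2 * R z i) z ≤ L * psq p z.2 := by
  obtain ⟨K, hK1, hK⟩ := exists_abs_le_of_isCompact
    (fun i => (contDiff_pi.1 hR i).continuous) hS
  obtain ⟨N, hN1, hN⟩ := exists_abs_le_of_isCompact
    (fun i : Fin 3 × Fin 3 => ((contDiff_pi.1 hR i.1).pd (ex i.2) (m := 0) (by simp)).continuous) hS
  refine ⟨3 * K ^ 2 + 9 * (2 * K ^ 2 + 2 * N ^ 2), by positivity, fun p hp z hz => ?_⟩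
  have h1 : ∀ i, (p z.2 * R z i) ^ 2 ≤ K ^ 2 * psq p z.2 := fun i => by
    have a := sq_le_sq' (abs_le.1 (hK i z hz)).1 (abs_le.1 (hK i z hz)).2
    rw [mul_pow, mul_comm]
    exact mul_le_mul a (sq_le_psq p _) (sq_nonneg _) (sq_nonneg _)
  have h2 : ∀ i j, pd (fun z : P4 => p z.2 * R z i) (ex j) z ^ 2 ≤
      (2 * K ^ 2 + 2 * N ^ 2) * psq p z.2 := fun i j => by
    rw [pd_mul (f := fun z : P4 => p z.2) (g := fun z => R z i) (ex j)
      ((hp.comp contDiff_snd).differentiable one_ne_zero z)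
      ((contDiff_pi.1 hR i).differentiable one_ne_zero z),
      pd_comp_snd_ex j (hp.differentiable one_ne_zero _)]
    have a := sq_le_sq' (abs_le.1 (hK i z hz)).1 (abs_le.1 (hK i z hz)).2
    have b := sq_le_sq' (abs_le.1 (hN (i, j) z hz)).1 (abs_le.1 (hN (i, j) z hz)).2
    have a' := mul_le_mul (sq_pdx_le_psq p j z.2) a (sq_nonneg _) (psq_nonneg _ _)
    have b' := mul_le_mul (sq_le_psq p z.2) b (sq_nonneg _) (psq_nonneg _ _)
    refine (add_sq_le (a := pdx p j z.2 * R z i)).trans ?_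
    rw [mul_pow, mul_pow]
    linarith
  have s1 : n2 (fun i => p z.2 * R z i) ≤ 3 * (K ^ 2 * psq p z.2) := by
    refine (Finset.sum_le_sum fun i _ => h1 i).trans (le_of_eq ?_)
    simp
  have s2 : vGradX2 (fun z i => p z.2 * R z i) z ≤
      9 * ((2 * K ^ 2 + 2 * N ^ 2) * psq p z.2) := by
    refine (Finset.sum_le_sum fun i _ => Finset.sum_le_sum fun j _ => h2 i j).trans (le_of_eq ?_)
    simp
    ring
  linarith

theorem exists_srcSq_le {R1 R2 : P4 → V3} (hR1 : ContDiff ℝ 1 R1) (hR2 : ContDiff ℝ 1 R2)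
    {S : Set P4} (hS : IsCompact S) :
    ∃ L, 0 ≤ L ∧ ∀ p1 p2 : V3 → ℝ, ContDiff ℝ 1 p1 → ContDiff ℝ 1 p2 → ∀ z ∈ S,
      srcSq (fun z i => p1 z.2 * R1 z i) (fun z i => p2 z.2 * R2 z i) z ≤
        L * (psq p1 z.2 + psq p2 z.2) := by
  obtain ⟨L1, h1, H1⟩ := exists_source_sq_le hR1 hS
  obtain ⟨L2, h2, H2⟩ := exists_source_sq_le hR2 hS
  refine ⟨L1 + L2, by positivity, fun p1 p2 hp1 hp2 z hz => ?_⟩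
  have a := H1 p1 hp1 z hz
  have b := H2 p2 hp2 z hz
  have := mul_nonneg h1 (psq_nonneg p2 z.2)
  have := mul_nonneg h2 (psq_nonneg p1 z.2)
  unfold srcSq
  linarith

theorem along_mul {Φ : V3 → V3} {f g : V3 → ℝ} {x : V3} (hf : DifferentiableAt ℝ f x)
    (hg : DifferentiableAt ℝ g x) :
    along Φ (fun y => f y * g y) x = f x * along Φ g x + g x * along Φ f x := by
  unfold along
  rw [Finset.mul_sum, Finset.mul_sum, ← Finset.sum_add_distrib]
  refine Finset.sum_congr rfl fun i _ => ?_
  rw [pdx_mul (f := f) (g := g) i hf hg]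
  ring

theorem along_cutoff_eq_zero {Ω V : Set V3} {Φ : V3 → V3} {χ : V3 → ℝ} (hχΩ : tsupport χ ⊆ Ω)
    (hχ1 : ∀ x ∈ Ω, x ∉ V → ∀ᶠ y in nhds x, χ y = 1) {x : V3} (hx : x ∉ Ω ∩ V) :
    along Φ χ x = 0 := by
  refine Finset.sum_eq_zero fun i _ => ?_
  have key : ∀ c : ℝ, χ =ᶠ[nhds x] (fun _ => c) → pdx χ i x = 0 := fun c h => by
    rw [pdx_congr i h, pdx_const]
  by_cases hxs : x ∈ tsupport χ
  · rw [key 1 (hχ1 x (hχΩ hxs) fun hV => hx ⟨hχΩ hxs, hV⟩), mul_zero]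
  · rw [key 0 (notMem_tsupport_iff_eventuallyEq.1 hxs), mul_zero]

theorem exists_transport_cutoff {Ω V : Set V3} {x0 : V3} {β K : ℝ} {Φ : V3 → V3} {χ : V3 → ℝ}
    (hΩo : IsOpen Ω) (hΩ : Bornology.IsBounded Ω) (hV : IsOpen V) (hK : 0 ≤ K)
    (hΦ : ContDiff ℝ 1 Φ) (hne : ∀ x ∈ closure Ω, ∑ i, Φ x i * (x i - x0 i) ≠ 0)
    (hχ : ContDiff ℝ 1 χ) (hχΩ : tsupport χ ⊆ Ω)
    (hχ1 : ∀ x ∈ Ω, x ∉ V → ∀ᶠ y in nhds x, χ y = 1) :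
    ∃ C, 1 ≤ C ∧ ∀ τ, C ≤ τ → ∀ h A : V3 → ℝ, ContDiff ℝ 1 h → Continuous A →
      (∀ x, 0 ≤ A x) → (∀ x ∈ Ω, along Φ h x ^ 2 ≤ K * A x) →
      τ ^ 2 * ∫ x, χ x ^ 2 * h x ^ 2 * wt x0 β τ (0, x) ≤
        C * ((∫ x, χ x ^ 2 * A x * wt x0 β τ (0, x))
          + ∫ x in Ω ∩ V, h x ^ 2 * wt x0 β τ (0, x)) := by
  obtain ⟨C, hC1, hC⟩ := exists_transport_carleman (β := β) hΩ hΦ hne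
  obtain ⟨N, hN1, hN⟩ := (continuous_along hΦ.continuous hχ).exists_abs_le_of_isCompact
    hΩ.isCompact_closure
  have hcχ : HasCompactSupport χ :=
    Metric.isCompact_of_isClosed_isBounded (isClosed_tsupport χ) (hΩ.subset hχΩ)
  have hC0 : 0 ≤ C := by linarith
  refine ⟨C * (1 + 2 * K + 2 * N ^ 2), ?_, fun τ hτ h A hh hA hA0 hb => ?_⟩
  · have : 0 ≤ 2 * K + 2 * N ^ 2 := by positivity
    nlinarith
  have hτC : C ≤ τ := by
    have : 0 ≤ C * (2 * K + 2 * N ^ 2) := by positivity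
    linarith
  obtain ⟨W, hW⟩ : ∃ W : V3 → ℝ, W = fun x => wt x0 β τ (0, x) := ⟨_, rfl⟩
  have hWc : Continuous W := hW ▸ (contDiff_wt_zero x0 β τ (n := 0)).continuous
  have hW0 : ∀ x, 0 < W x := fun x => by rw [hW]; exact wt_pos _ _ _ _
  have hcc : ∀ {f : V3 → ℝ}, Continuous f → Integrable fun x => χ x ^ 2 * f x * W x := fun hf =>
    (((hχ.continuous.pow 2).mul hf).mul hWc).integrable_of_hasCompactSupport
      (HasCompactSupport.intro hcχ fun x hx => by simp [image_eq_zero_of_notMem_tsupport hx])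
  have hΩV : IsOpen (Ω ∩ V) := hΩo.inter hV
  have hint : IntegrableOn (fun x => h x ^ 2 * W x) (Ω ∩ V) :=
    ((hh.continuous.pow 2).mul hWc).integrableOn_of_isBounded (hΩ.subset inter_subset_left)
  have h1 := hC τ hτC (fun x => χ x * h x) (hχ.mul hh)
    ((tsupport_mul_subset_left.trans hχΩ).trans subset_closure)
  have hpt : ∀ x, along Φ (fun x => χ x * h x) x ^ 2 * W x ≤
      2 * K * (χ x ^ 2 * A x * W x)
        + 2 * N ^ 2 * (Ω ∩ V).indicator (fun x => h x ^ 2 * W x) x := fun x => by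
    rw [along_mul (hχ.differentiable one_ne_zero x) (hh.differentiable one_ne_zero x)]
    have e1 : χ x ^ 2 * along Φ h x ^ 2 ≤ K * (χ x ^ 2 * A x) := by
      by_cases hx : x ∈ tsupport χ
      · have := mul_le_mul_of_nonneg_left (hb x (hχΩ hx)) (sq_nonneg (χ x))
        linarith
      · simp [image_eq_zero_of_notMem_tsupport hx]
    have e2 : h x ^ 2 * along Φ χ x ^ 2 * W x ≤
        N ^ 2 * (Ω ∩ V).indicator (fun x => h x ^ 2 * W x) x := by
      by_cases hx : x ∈ Ω ∩ V
      · rw [indicator_of_mem hx]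
        have hn := hN x (subset_closure hx.1)
        have := sq_le_sq' (abs_le.1 hn).1 (abs_le.1 hn).2
        have := mul_le_mul_of_nonneg_left this (mul_nonneg (sq_nonneg (h x)) (hW0 x).le)
        linarith
      · rw [indicator_of_notMem hx, along_cutoff_eq_zero hχΩ hχ1 hx]
        simp
    have e3 := mul_le_mul_of_nonneg_right
      (add_sq_le (a := χ x * along Φ h x) (b := h x * along Φ χ x)) (hW0 x).le
    have e1' := mul_le_mul_of_nonneg_right e1 (hW0 x).le
    simp only [mul_pow] at e3
    linarith
  have hi1 : Integrable fun x => 2 * K * (χ x ^ 2 * A x * W x) := (hcc hA).const_mul _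
  have hi2 : Integrable fun x =>
      2 * N ^ 2 * (Ω ∩ V).indicator (fun x => h x ^ 2 * W x) x :=
    (hint.integrable_indicator hΩV.measurableSet).const_mul _
  have h2 : ∫ x, along Φ (fun x => χ x * h x) x ^ 2 * W x ≤
      2 * K * (∫ x, χ x ^ 2 * A x * W x) + 2 * N ^ 2 * ∫ x in Ω ∩ V, h x ^ 2 * W x := by
    refine (integral_mono_of_nonneg (Filter.Eventually.of_forall fun x => ?_) (hi1.add hi2)
      (Filter.Eventually.of_forall hpt)).trans (le_of_eq ?_)
    · exact mul_nonneg (sq_nonneg _) (hW0 x).le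
    · rw [integral_add' hi1 hi2, integral_const_mul, integral_const_mul,
        integral_indicator hΩV.measurableSet]
  have hb0 : 0 ≤ ∫ x in Ω ∩ V, h x ^ 2 * W x :=
    integral_nonneg fun x => mul_nonneg (sq_nonneg _) (hW0 x).le
  have ha0 : 0 ≤ ∫ x, χ x ^ 2 * A x * W x :=
    integral_nonneg fun x => mul_nonneg (mul_nonneg (sq_nonneg _) (hA0 x)) (hW0 x).le
  have h1' : τ ^ 2 * ∫ x, χ x ^ 2 * h x ^ 2 * W x ≤
      C * ∫ x, along Φ (fun x => χ x * h x) x ^ 2 * W x := by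
    simpa only [hW, mul_pow] using h1
  have goal : τ ^ 2 * ∫ x, χ x ^ 2 * h x ^ 2 * W x ≤ C * (1 + 2 * K + 2 * N ^ 2) *
      ((∫ x, χ x ^ 2 * A x * W x) + ∫ x in Ω ∩ V, h x ^ 2 * W x) := by
    refine h1'.trans ((mul_le_mul_of_nonneg_left h2 hC0).trans ?_)
    rw [mul_assoc C (1 + 2 * K + 2 * N ^ 2)]
    refine mul_le_mul_of_nonneg_left ?_ hC0
    nlinarith [mul_nonneg hK hb0, mul_nonneg (sq_nonneg N) ha0]
  simpa only [hW] using goal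

theorem exists_transport_psq {Ω V : Set V3} {x0 : V3} {β K : ℝ} {Φ : V3 → V3} {χ : V3 → ℝ}
    (hΩo : IsOpen Ω) (hΩ : Bornology.IsBounded Ω) (hV : IsOpen V) (hK : 0 ≤ K)
    (hΦ : ContDiff ℝ 1 Φ) (hne : ∀ x ∈ closure Ω, ∑ i, Φ x i * (x i - x0 i) ≠ 0)
    (hχ : ContDiff ℝ 1 χ) (hχΩ : tsupport χ ⊆ Ω)
    (hχ1 : ∀ x ∈ Ω, x ∉ V → ∀ᶠ y in nhds x, χ y = 1) :
    ∃ C, 1 ≤ C ∧ ∀ τ, C ≤ τ → ∀ p A : V3 → ℝ, ContDiff ℝ 2 p → Continuous A → (∀ x, 0 ≤ A x) →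
      (∀ x ∈ Ω, along Φ p x ^ 2 ≤ K * A x ∧ ∀ k, along Φ (pdx p k) x ^ 2 ≤ K * A x) →
      τ ^ 2 * ∫ x, χ x ^ 2 * psq p x * wt x0 β τ (0, x) ≤
        C * ((∫ x, χ x ^ 2 * A x * wt x0 β τ (0, x))
          + ∫ x in Ω ∩ V, psq p x * wt x0 β τ (0, x)) := by
  obtain ⟨C, hC1, hC⟩ := exists_transport_cutoff (x0 := x0) (β := β) hΩo hΩ hV hK hΦ hne hχ hχΩ hχ1
  have hcχ : HasCompactSupport χ :=
    Metric.isCompact_of_isClosed_isBounded (isClosed_tsupport χ) (hΩ.subset hχΩ)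
  refine ⟨4 * C, by linarith, fun τ hτ p A hp hA hA0 hb => ?_⟩
  have hC0 : 0 ≤ C := by linarith
  have hp1 : ContDiff ℝ 1 p := hp.of_le (by norm_num)
  have hpi : ∀ i, ContDiff ℝ 1 (pdx p i) := fun i => hp.pdx i (by norm_num)
  have h0 := hC τ (by linarith) p A hp1 hA hA0 fun x hx => (hb x hx).1
  have hi := fun k => hC τ (by linarith) (pdx p k) A (hpi k) hA hA0 fun x hx => (hb x hx).2 k
  obtain ⟨W, hW⟩ : ∃ W : V3 → ℝ, W = fun x => wt x0 β τ (0, x) := ⟨_, rfl⟩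
  have hWc : Continuous W := hW ▸ (contDiff_wt_zero x0 β τ (n := 0)).continuous
  have hWx : ∀ x, wt x0 β τ (0, x) = W x := fun x => by rw [hW]
  simp only [hWx] at h0 hi ⊢
  have hcc : ∀ {f : V3 → ℝ}, Continuous f → Integrable fun x => χ x ^ 2 * f x * W x := fun hf =>
    (((hχ.continuous.pow 2).mul hf).mul hWc).integrable_of_hasCompactSupport
      (HasCompactSupport.intro hcχ fun x hx => by simp [image_eq_zero_of_notMem_tsupport hx])
  have hcc' : ∀ {f : V3 → ℝ}, Continuous f → IntegrableOn (fun x => f x * W x) (Ω ∩ V) :=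
    fun hf => (hf.mul hWc).integrableOn_of_isBounded (hΩ.subset inter_subset_left)
  have c0 : Continuous fun x => p x ^ 2 := hp1.continuous.pow 2
  have ci : ∀ i, Continuous fun x => pdx p i x ^ 2 := fun i => (hpi i).continuous.pow 2
  have e1 : ∫ x, χ x ^ 2 * psq p x * W x = (∫ x, χ x ^ 2 * p x ^ 2 * W x)
      + ∑ i, ∫ x, χ x ^ 2 * pdx p i x ^ 2 * W x := by
    rw [← integral_finsetSum Finset.univ fun i _ => hcc (ci i),
      ← integral_add (hcc c0) (integrable_finsetSum Finset.univ fun i _ => hcc (ci i))]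
    refine integral_congr_ae (Filter.Eventually.of_forall fun x => ?_)
    simp only [psq, Fin.sum_univ_three]
    ring
  have e2 : ∫ x in Ω ∩ V, psq p x * W x = (∫ x in Ω ∩ V, p x ^ 2 * W x)
      + ∑ i, ∫ x in Ω ∩ V, pdx p i x ^ 2 * W x := by
    rw [← integral_finsetSum Finset.univ fun i _ => hcc' (ci i),
      ← integral_add (hcc' c0) (integrable_finsetSum Finset.univ fun i _ => hcc' (ci i))]
    refine integral_congr_ae (Filter.Eventually.of_forall fun x => ?_)
    simp only [psq, Fin.sum_univ_three]
    ring
  have hb0 : 0 ≤ ∫ x in Ω ∩ V, psq p x * W x :=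
    integral_nonneg fun x => mul_nonneg (psq_nonneg _ _) (hWx x ▸ (wt_pos _ _ _ _).le)
  rw [e1]
  have i0 := hi 0
  have i1 := hi 1
  have i2 := hi 2
  have hb0' := mul_nonneg hC0 hb0
  rw [e2] at hb0' ⊢
  simp only [Fin.sum_univ_three] at hb0' ⊢
  linarith

theorem jetBound_sqrt {f : V3 → ℝ} {x : V3} {A : ℝ} (h : psq f x ≤ A) : JetBound f (√A) x :=
  ⟨abs_le_sqrt ((sq_le_psq f x).trans h), fun k => abs_le_sqrt ((sq_pdx_le_psq f k x).trans h)⟩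

/-- Carleman estimate for the sources in terms of the solution at the initial time. -/
theorem exists_sources_carleman {Ω V : Set V3} {x0 : V3} {β : ℝ} {ρ11 ρ12 ρ22 : V3 → ℝ}
    {Φ1 Φ2 : V3 → V3} {χ : V3 → ℝ} (hΩo : IsOpen Ω) (hΩ : Bornology.IsBounded Ω) (hV : IsOpen V)
    (h11 : ContDiff ℝ 2 ρ11) (h12 : ContDiff ℝ 2 ρ12) (h22 : ContDiff ℝ 2 ρ22)
    (hdet : ∀ x ∈ closure Ω, 0 < ρ11 x * ρ22 x - ρ12 x ^ 2)
    (hΦ1 : ContDiff ℝ 2 Φ1) (hne1 : ∀ x ∈ closure Ω, ∑ i, Φ1 x i * (x i - x0 i) ≠ 0)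
    (hΦ2 : ContDiff ℝ 2 Φ2) (hne2 : ∀ x ∈ closure Ω, ∑ i, Φ2 x i * (x i - x0 i) ≠ 0)
    (hχ : ContDiff ℝ 1 χ) (hχΩ : tsupport χ ⊆ Ω)
    (hχ1 : ∀ x ∈ Ω, x ∉ V → ∀ᶠ y in nhds x, χ y = 1) :
    ∃ C, 1 ≤ C ∧ ∀ τ, C ≤ τ → ∀ (p1 p2 : V3 → ℝ) (a b : V3 → V3), ContDiff ℝ 2 p1 →
      ContDiff ℝ 2 p2 → ContDiff ℝ 2 a → ContDiff ℝ 2 b →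
      (∀ x ∈ Ω, ∀ i, ρ11 x * a x i + ρ12 x * b x i = p1 x * Φ1 x i ∧
        ρ12 x * a x i + ρ22 x * b x i = p2 x * Φ2 x i) →
      τ ^ 2 * ∫ x, χ x ^ 2 * (psq p1 x + psq p2 x) * wt x0 β τ (0, x) ≤
        C * ((∫ x, χ x ^ 2 * (psq (sdivX a) x + psq (sdivX b) x + psq p1 x + psq p2 x)
            * wt x0 β τ (0, x))
          + ∫ x in Ω ∩ V, (psq p1 x + psq p2 x) * wt x0 β τ (0, x)) := by
  obtain ⟨g, hg, hg1⟩ := exists_contDiff_mul_eq_one (n := 2) isClosed_closure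
    (f := fun x => ρ11 x * ρ22 x - ρ12 x ^ 2) ((h11.mul h22).sub (h12.pow 2))
    fun x hx => (hdet x hx).ne'
  have h1 : ∀ {f : V3 → ℝ}, ContDiff ℝ 2 f → ContDiff ℝ 1 f := fun h => h.of_le (by norm_num)
  have hv : ∀ {s : V3 → ℝ} {Φ : V3 → V3}, ContDiff ℝ 2 s → ContDiff ℝ 2 Φ →
      ContDiff ℝ 1 fun x i => g x * s x * Φ x i := fun hs hΦ =>
    contDiff_pi.2 fun i => h1 (((show ContDiff ℝ 2 g from hg).mul hs).mul (contDiff_pi.1 hΦ i))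
  have hA11 := hv h22 hΦ1
  have hA12 := hv h12.neg hΦ2
  have hA21 := hv h12.neg hΦ1
  have hA22 := hv h11 hΦ2
  obtain ⟨K1, hK1, B1⟩ := exists_along_bound hΩo hΩ h11 h12 hΦ1 hA11 hA12 hA21 hA22
  obtain ⟨K2, hK2, B2⟩ := exists_along_bound hΩo hΩ h12 h22 hΦ2 hA11 hA12 hA21 hA22
  obtain ⟨C1, hC1, D1⟩ := exists_transport_psq (x0 := x0) (β := β) hΩo hΩ hV (sq_nonneg K1)
    (hΦ1.of_le (by norm_num)) hne1 hχ hχΩ hχ1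
  obtain ⟨C2, hC2, D2⟩ := exists_transport_psq (x0 := x0) (β := β) hΩo hΩ hV (sq_nonneg K2)
    (hΦ2.of_le (by norm_num)) hne2 hχ hχΩ hχ1
  refine ⟨C1 + C2, by linarith, fun τ hτ p1 p2 a b hp1 hp2 ha hb hrel => ?_⟩
  obtain ⟨A, hA⟩ : ∃ A : V3 → ℝ, A = fun x =>
    psq (sdivX a) x + psq (sdivX b) x + psq p1 x + psq p2 x := ⟨_, rfl⟩
  have sa : ContDiff ℝ 1 (sdivX a) := contDiff_sdivX (by exact_mod_cast ha)
  have sb : ContDiff ℝ 1 (sdivX b) := contDiff_sdivX (by exact_mod_cast hb)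
  have hAc : Continuous A := by
    rw [hA]
    exact (((continuous_psq sa).add (continuous_psq sb)).add (continuous_psq (h1 hp1))).add
      (continuous_psq (h1 hp2))
  have n0 := psq_nonneg
  have hA0 : ∀ x, 0 ≤ A x := fun x => by
    rw [hA]; dsimp only; linarith [n0 (sdivX a) x, n0 (sdivX b) x, n0 p1 x, n0 p2 x]
  have hae : ∀ x ∈ Ω, ∀ i, a x i = (g x * ρ22 x * Φ1 x i) * p1 x
      + (g x * -ρ12 x * Φ2 x i) * p2 x := fun x hx i => by
    have hd := hg1.self_of_nhdsSet x (subset_closure hx)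
    obtain ⟨r1, r2⟩ := hrel x hx i
    linear_combination -a x i * hd + g x * ρ22 x * r1 - g x * ρ12 x * r2
  have hbe : ∀ x ∈ Ω, ∀ i, b x i = (g x * -ρ12 x * Φ1 x i) * p1 x
      + (g x * ρ11 x * Φ2 x i) * p2 x := fun x hx i => by
    have hd := hg1.self_of_nhdsSet x (subset_closure hx)
    obtain ⟨r1, r2⟩ := hrel x hx i
    linear_combination -b x i * hd - g x * ρ12 x * r1 + g x * ρ11 x * r2
  have jb : ∀ x, JetBound (sdivX a) (√(A x)) x ∧ JetBound (sdivX b) (√(A x)) x ∧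
      JetBound p1 (√(A x)) x ∧ JetBound p2 (√(A x)) x := fun x => by
    have a1 := n0 (sdivX a) x
    have a2 := n0 (sdivX b) x
    have a3 := n0 p1 x
    have a4 := n0 p2 x
    rw [hA]
    refine ⟨jetBound_sqrt ?_, jetBound_sqrt ?_, jetBound_sqrt ?_, jetBound_sqrt ?_⟩ <;> linarith
  have sqb : ∀ {K y x}, |y| ≤ K * √(A x) → y ^ 2 ≤ K ^ 2 * A x := fun {K y x} h => by
    have := sq_le_sq' (abs_le.1 h).1 (abs_le.1 h).2
    rwa [mul_pow, sq_sqrt (hA0 x)] at this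
  have d1 := D1 τ (by linarith) p1 A hp1 hAc hA0 fun x hx => by
    obtain ⟨j1, j2, j3, j4⟩ := jb x
    obtain ⟨u, v⟩ := B1 p1 p1 p2 a b hp1 hp1 hp2 ha hb (fun x hx i => (hrel x hx i).1) hae hbe
      x hx _ j1 j2 j3 j3 j4
    exact ⟨sqb u, fun k => sqb (v k)⟩
  have d2 := D2 τ (by linarith) p2 A hp2 hAc hA0 fun x hx => by
    obtain ⟨j1, j2, j3, j4⟩ := jb x
    obtain ⟨u, v⟩ := B2 p2 p1 p2 a b hp2 hp1 hp2 ha hb (fun x hx i => (hrel x hx i).2) hae hbe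
      x hx _ j1 j2 j4 j3 j4
    exact ⟨sqb u, fun k => sqb (v k)⟩
  have hcχ : HasCompactSupport χ :=
    Metric.isCompact_of_isClosed_isBounded (isClosed_tsupport χ) (hΩ.subset hχΩ)
  obtain ⟨W, hW⟩ : ∃ W : V3 → ℝ, W = fun x => wt x0 β τ (0, x) := ⟨_, rfl⟩
  have hWc : Continuous W := hW ▸ (contDiff_wt_zero x0 β τ (n := 0)).continuous
  have hWx : ∀ x, wt x0 β τ (0, x) = W x := fun x => by rw [hW]
  have hW0 : ∀ x, 0 ≤ W x := fun x => hWx x ▸ (wt_pos _ _ _ _).le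
  have hAx : ∀ x, psq (sdivX a) x + psq (sdivX b) x + psq p1 x + psq p2 x = A x := fun x => by
    rw [hA]
  simp only [hWx, hAx] at d1 d2 ⊢
  have hcc : ∀ {f : V3 → ℝ}, Continuous f → Integrable fun x => χ x ^ 2 * f x * W x := fun hf =>
    (((hχ.continuous.pow 2).mul hf).mul hWc).integrable_of_hasCompactSupport
      (HasCompactSupport.intro hcχ fun x hx => by simp [image_eq_zero_of_notMem_tsupport hx])
  have hcc' : ∀ {f : V3 → ℝ}, Continuous f → IntegrableOn (fun x => f x * W x) (Ω ∩ V) :=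
    fun hf => (hf.mul hWc).integrableOn_of_isBounded (hΩ.subset inter_subset_left)
  have q1 := continuous_psq (h1 hp1)
  have q2 := continuous_psq (h1 hp2)
  have e1 : ∫ x, χ x ^ 2 * (psq p1 x + psq p2 x) * W x =
      (∫ x, χ x ^ 2 * psq p1 x * W x) + ∫ x, χ x ^ 2 * psq p2 x * W x := by
    rw [← integral_add (hcc q1) (hcc q2)]
    simp only [mul_add, add_mul]
  have e2 : ∫ x in Ω ∩ V, (psq p1 x + psq p2 x) * W x =
      (∫ x in Ω ∩ V, psq p1 x * W x) + ∫ x in Ω ∩ V, psq p2 x * W x := by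
    rw [← integral_add (hcc' q1) (hcc' q2)]
    simp only [add_mul]
  have m0 : 0 ≤ ∫ x, χ x ^ 2 * A x * W x :=
    integral_nonneg fun x => mul_nonneg (mul_nonneg (sq_nonneg _) (hA0 x)) (hW0 x)
  have m1 : 0 ≤ ∫ x in Ω ∩ V, psq p1 x * W x :=
    integral_nonneg fun x => mul_nonneg (n0 _ _) (hW0 x)
  have m2 : 0 ≤ ∫ x in Ω ∩ V, psq p2 x * W x :=
    integral_nonneg fun x => mul_nonneg (n0 _ _) (hW0 x)
  rw [e1, e2]
  nlinarith [mul_nonneg (show 0 ≤ C1 by linarith) m2, mul_nonneg (show 0 ≤ C2 by linarith) m1]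

theorem contDiff_jet2 {f : P4 → ℝ} (hf : ContDiff ℝ 2 f) : ContDiff ℝ 1 (jet2 f) :=
  ((hf.of_le (by norm_num)).pow 2).add (((hf.pd et (by norm_num)).pow 2).add
    (ContDiff.sum fun j _ => (hf.pd (ex j) (by norm_num)).pow 2))

theorem pd_jet2_et_le {f : P4 → ℝ} (hf : ContDiff ℝ 2 f) (z : P4) :
    pd (jet2 f) et z ≤ jet2 f z + jet2 (pd f et) z := by
  have h0 : DifferentiableAt ℝ f z := hf.differentiable (by norm_num) z
  have hd : ∀ d, DifferentiableAt ℝ (pd f d) z := fun d => hf.pd_differentiable d z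
  have e : jet2 f = fun z => (f z * f z + pd f et z * pd f et z)
      + ∑ j, pd f (ex j) z * pd f (ex j) z := by
    funext y; simp only [jet2, gradT2, sq, add_assoc]
  have ed : pd (jet2 f) et z = pd f et z * f z + f z * pd f et z
      + (pd (pd f et) et z * pd f et z + pd f et z * pd (pd f et) et z)
      + ∑ j, (pd (pd f et) (ex j) z * pd f (ex j) z + pd f (ex j) z * pd (pd f et) (ex j) z) := by
    rw [e, pd_add (f := fun z => f z * f z + pd f et z * pd f et z)
      (g := fun z => ∑ j, pd f (ex j) z * pd f (ex j) z) et
      ((h0.mul h0).add ((hd et).mul (hd et)))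
      (DifferentiableAt.fun_sum fun j _ => (hd (ex j)).mul (hd (ex j))),
      pd_add (f := fun z => f z * f z) (g := fun z => pd f et z * pd f et z) et (h0.mul h0)
        ((hd et).mul (hd et)), pd_mul (f := f) (g := f) et h0 h0,
      pd_mul (f := pd f et) (g := pd f et) et (hd et) (hd et),
      pd_sum (f := fun j z => pd f (ex j) z * pd f (ex j) z) et
        fun j _ => (hd (ex j)).mul (hd (ex j))]
    refine congrArg _ (Finset.sum_congr rfl fun j _ => ?_)
    rw [pd_mul (f := pd f (ex j)) (g := pd f (ex j)) et (hd _) (hd _), pd_comm hf (ex j) et]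
  rw [ed]
  simp only [jet2, gradT2, Fin.sum_univ_three]
  nlinarith [sq_nonneg (f z - pd f et z), sq_nonneg (pd (pd f et) et z - pd f et z),
    sq_nonneg (pd (pd f et) (ex 0) z - pd f (ex 0) z),
    sq_nonneg (pd (pd f et) (ex 1) z - pd f (ex 1) z),
    sq_nonneg (pd (pd f et) (ex 2) z - pd f (ex 2) z)]

theorem vjet_le_secSq {v : P4 → V3} (hv : ContDiff ℝ 2 v) (z : P4) :
    vjet v z ≤ 12 * secSq v z := by
  refine (Finset.sum_le_sum fun i _ => jet2_apply_le hv i z).trans (le_of_eq ?_)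
  simp
  ring

/-- Trace estimate in time: the first-order jet at the initial time is controlled by the
second-order norms of the field and of its time derivative. -/
theorem exists_initial_vjet_le {T : ℝ} (hT : 0 < T) {B : Set V3} (hB : IsOpen B)
    (hBb : Bornology.IsBounded B) :
    ∃ C, 1 ≤ C ∧ ∀ v : P4 → V3, ContDiff ℝ 3 v →
      ∫ x in B, vjet v (0, x) ≤
        C * (H2sq v (Ioo (-T) T ×ˢ B) + H2sq (Dt v) (Ioo (-T) T ×ˢ B)) := by
  obtain ⟨η, hη⟩ : ∃ η : ℝ → ℝ, η = fun t => smoothTransition (2 * t / T + 1) := ⟨_, rfl⟩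
  have hηC : ContDiff ℝ 2 η := by
    rw [hη]
    exact Real.smoothTransition.contDiff.comp (by fun_prop)
  have hη0 : ∀ t, t ≤ -T / 2 → η t = 0 := fun t ht => by
    rw [hη]
    refine Real.smoothTransition.zero_of_nonpos ?_
    have : 2 * t / T ≤ -1 := by rw [div_le_iff₀ hT]; linarith
    linarith
  have hη1 : η 0 = 1 := by rw [hη]; simp
  have hη01 : ∀ t, 0 ≤ η t ∧ η t ≤ 1 := fun t => by
    rw [hη]; exact ⟨Real.smoothTransition.nonneg _, Real.smoothTransition.le_one _⟩
  have hdη : Continuous (deriv η) := hηC.continuous_deriv (by norm_num)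
  obtain ⟨N, hN1, hN⟩ := hdη.exists_abs_le_of_isCompact (isCompact_Icc (a := -T) (b := T))
  refine ⟨12 * (N + 1), by linarith, fun v hv => ?_⟩
  have hv2 : ContDiff ℝ 2 v := hv.of_le (by norm_num)
  have hDv : ContDiff ℝ 2 (Dt v) := contDiff_Dt (by exact_mod_cast hv)
  have hvi : ∀ i, ContDiff ℝ 2 fun z => v z i := fun i => contDiff_pi.1 hv2 i
  have hvj : ContDiff ℝ 1 (vjet v) := ContDiff.sum fun i _ => contDiff_jet2 (hvi i)
  obtain ⟨G, hG⟩ : ∃ G : P4 → ℝ, G = fun z => η z.1 * vjet v z := ⟨_, rfl⟩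
  have hηz : ContDiff ℝ 1 fun z : P4 => η z.1 := (hηC.of_le (by norm_num)).comp contDiff_fst
  have hGC : ContDiff ℝ 1 G := by rw [hG]; exact hηz.mul hvj
  have hG0 : ∀ z : P4, z.1 ≤ -T / 2 → G z = 0 := fun z hz => by rw [hG]; simp [hη0 _ hz]
  have hpG : ∀ z, pd G et z = deriv η z.1 * vjet v z + η z.1 * pd (vjet v) et z := fun z => by
    rw [hG, pd_mul (f := fun z : P4 => η z.1) (g := vjet v) et
      (hηz.differentiable one_ne_zero z) (hvj.differentiable one_ne_zero z),
      pd_comp_fst et (hηC.differentiable (by norm_num) _)]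
    simp [et]
  have hpv : ∀ z, pd (vjet v) et z ≤ vjet v z + vjet (Dt v) z := fun z => by
    have e : vjet v = fun z => ∑ i, jet2 (fun y => v y i) z := rfl
    rw [e, pd_sum (f := fun i => jet2 (fun y => v y i)) et fun i _ =>
      (contDiff_jet2 (hvi i)).differentiable one_ne_zero z]
    unfold vjet
    rw [← Finset.sum_add_distrib]
    exact Finset.sum_le_sum fun i _ => pd_jet2_et_le (hvi i) z
  have hpG0 : ∀ z : P4, z.1 < -T / 2 → pd G et z = 0 := fun z hz => by
    refine (pd_eq_zero_of_eventuallyEq_const (c := 0) ?_ et).self_of_nhds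
    filter_upwards [(isOpen_Iio.preimage continuous_fst).mem_nhds hz] with y hy
    exact hG0 y (le_of_lt hy)
  have hIoo : IsOpen (Ioo (-T) T ×ˢ B) := isOpen_Ioo.prod hB
  have hbd : Bornology.IsBounded (Ioo (-T) T ×ˢ B) := (Metric.isBounded_Ioo _ _).prod hBb
  have hIic : MeasurableSet (Iic (0 : ℝ) ×ˢ B) := measurableSet_Iic.prod hB.measurableSet
  have hpGc : Continuous (pd G et) := (hGC.pd et (m := 0) (by simp)).continuous
  have hi : IntegrableOn (pd G et) (Iic (0 : ℝ) ×ˢ B) := by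
    refine (hpGc.integrableOn_of_isBounded hbd).of_forall_sdiff_eq_zero hIic fun z hz => ?_
    refine hpG0 z (lt_of_le_of_lt (not_lt.1 fun h => hz.2 ⟨⟨h, ?_⟩, hz.1.2⟩) (by linarith))
    exact lt_of_le_of_lt hz.1.1 hT
  have hsc : Continuous fun z => 12 * (N + 1) * (secSq v z + secSq (Dt v) z) :=
    ((continuous_secSq hv2).add (continuous_secSq hDv)).const_mul _
  have e0 : ∫ x in B, vjet v (0, x) = ∫ z in Iic (0 : ℝ) ×ˢ B, pd G et z := by
    rw [← integral_slice_eq_integral_half hGC _ hG0 hi, hG]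
    simp [hη1]
  have hpt : ∀ z, (Iic (0 : ℝ) ×ˢ B).indicator (pd G et) z ≤ (Ioo (-T) T ×ˢ B).indicator
      (fun z => 12 * (N + 1) * (secSq v z + secSq (Dt v) z)) z := fun z => by
    have s1 := secSq_nonneg v z
    have s2 := secSq_nonneg (Dt v) z
    have hr0 : 0 ≤ (Ioo (-T) T ×ˢ B).indicator
        (fun z => 12 * (N + 1) * (secSq v z + secSq (Dt v) z)) z :=
      indicator_nonneg (fun z _ => by
        have := secSq_nonneg v z
        have := secSq_nonneg (Dt v) z
        positivity) z
    by_cases hz : z ∈ Iic (0 : ℝ) ×ˢ B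
    · rw [indicator_of_mem hz]
      by_cases ht : -T < z.1
      · have hzm : z ∈ Ioo (-T) T ×ˢ B := ⟨⟨ht, lt_of_le_of_lt hz.1 hT⟩, hz.2⟩
        rw [indicator_of_mem hzm, hpG]
        have n1 := vjet_nonneg v z
        have n2 := vjet_nonneg (Dt v) z
        have l1 := vjet_le_secSq hv2 z
        have l2 := vjet_le_secSq hDv z
        have a1 : deriv η z.1 * vjet v z ≤ N * vjet v z := mul_le_mul_of_nonneg_right
          ((le_abs_self _).trans (hN _ ⟨ht.le, (lt_of_le_of_lt hz.1 hT).le⟩)) n1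
        have a2 : η z.1 * pd (vjet v) et z ≤ vjet v z + vjet (Dt v) z :=
          (mul_le_mul_of_nonneg_left (hpv z) (hη01 _).1).trans
            (mul_le_of_le_one_left (by linarith) (hη01 _).2)
        nlinarith
      · rw [hpG0 z (by linarith)]
        exact hr0
    · rw [indicator_of_notMem hz]
      exact hr0
  rw [e0, H2sq_eq, H2sq_eq, ← integral_add
    ((continuous_secSq hv2).integrableOn_of_isBounded hbd)
    ((continuous_secSq hDv).integrableOn_of_isBounded hbd), ← integral_const_mul,
    ← integral_indicator hIic, ← integral_indicator hIoo.measurableSet]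
  exact integral_mono (hi.integrable_indicator hIic)
    ((hsc.integrableOn_of_isBounded hbd).integrable_indicator hIoo.measurableSet) hpt

/-- Optimizing the Carleman parameter turns an exponentially weighted estimate into a Hölder
estimate. -/
theorem exists_rpow_bound {C C' B b τ1 : ℝ} (hC : 0 < C) (hC' : 0 < C') (hB : 0 < B) (hb : 0 < b) :
    ∃ K, 0 < K ∧ ∃ κ : ℝ, 0 < κ ∧ κ < 1 ∧ ∀ X e : ℝ, 0 ≤ e → X ≤ C' →
      (∀ τ, τ1 ≤ τ → X ≤ C * (e * exp (B * τ) + exp (-(b * τ)))) → X ≤ K * e ^ κ := by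
  have hBb : 0 < B + b := by linarith
  obtain ⟨e1, he1⟩ : ∃ e1, e1 = exp (-((B + b) * τ1)) := ⟨_, rfl⟩
  have he1p : 0 < e1 := by rw [he1]; exact exp_pos _
  obtain ⟨κ, hκ⟩ : ∃ κ, κ = b / (B + b) := ⟨_, rfl⟩
  have hκ0 : 0 < κ := by rw [hκ]; positivity
  have hκ1 : κ < 1 := by rw [hκ, div_lt_one hBb]; linarith
  have h1p : 0 < e1 ^ κ := rpow_pos_of_pos he1p κ
  refine ⟨2 * C + C' / e1 ^ κ, by positivity, κ, hκ0, hκ1, fun X e he hX h => ?_⟩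
  rcases he.eq_or_lt with rfl | hepos
  · rw [zero_rpow hκ0.ne', mul_zero]
    have ht : Filter.Tendsto (fun τ => C * ((0 : ℝ) * exp (B * τ) + exp (-(b * τ)))) Filter.atTop
        (nhds (C * 0)) := by
      simp only [zero_mul, zero_add]
      exact (tendsto_exp_neg_atTop_nhds_zero.comp
        (Filter.tendsto_id.const_mul_atTop hb)).const_mul C
    rw [mul_zero] at ht
    exact ge_of_tendsto ht (Filter.eventually_atTop.2 ⟨τ1, h⟩)
  have hp : 0 < e ^ κ := rpow_pos_of_pos hepos κ
  rw [add_mul]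
  rcases le_or_gt e e1 with hle | hgt
  · have hlog : log e ≤ -((B + b) * τ1) := by
      rw [← log_exp (-((B + b) * τ1)), ← he1]
      exact log_le_log hepos hle
    have hτ : τ1 ≤ -log e / (B + b) := by
      rw [le_div_iff₀ hBb]; linarith
    have h2 := h _ hτ
    have i1 : e * exp (B * (-log e / (B + b))) = e ^ κ := by
      nth_rewrite 1 [← exp_log hepos]
      rw [← exp_add, rpow_def_of_pos hepos, hκ]
      congr 1
      field_simp
      ring
    have i2 : exp (-(b * (-log e / (B + b)))) = e ^ κ := by
      rw [rpow_def_of_pos hepos, hκ]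
      congr 1
      field_simp
    rw [i1, i2] at h2
    have : 0 ≤ C' / e1 ^ κ * e ^ κ := by positivity
    linarith
  · have h2 : e1 ^ κ ≤ e ^ κ := rpow_le_rpow he1p.le hgt.le hκ0.le
    have h3 : C' ≤ C' / e1 ^ κ * e ^ κ := by
      rw [div_mul_eq_mul_div, le_div_iff₀ h1p]
      exact mul_le_mul_of_nonneg_left h2 hC'.le
    have : 0 ≤ 2 * C * e ^ κ := by positivity
    linarith

theorem psq_le_of_jetBound {p : V3 → ℝ} {x : V3} {E : ℝ} (h : JetBound p E x) :
    psq p x ≤ 4 * E ^ 2 := by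
  have h0 := sq_le_sq' (abs_le.1 h.val).1 (abs_le.1 h.val).2
  have hi := fun i => sq_le_sq' (abs_le.1 (h.grad i)).1 (abs_le.1 (h.grad i)).2
  have := hi 0
  have := hi 1
  have := hi 2
  simp only [psq, Fin.sum_univ_three]
  linarith

/-- The sources are pointwise controlled by the solution at the initial time. -/
theorem exists_psq_le_vjet {Ω : Set V3} (hΩo : IsOpen Ω) (hΩ : Bornology.IsBounded Ω)
    {α α' : V3 → ℝ} {Φ : V3 → V3} {x0 : V3} (hα : ContDiff ℝ 1 α) (hα' : ContDiff ℝ 1 α')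
    (hΦ : ContDiff ℝ 1 Φ) (hne : ∀ x ∈ closure Ω, ∑ i, Φ x i * (x i - x0 i) ≠ 0) :
    ∃ K, 1 ≤ K ∧ ∀ (p : V3 → ℝ) (vs vf : P4 → V3), ContDiff ℝ 1 vs → ContDiff ℝ 1 vf →
      (∀ x ∈ Ω, ∀ i, α x * vs (0, x) i + α' x * vf (0, x) i = p x * Φ x i) →
      ∀ x ∈ Ω, psq p x ≤ K * (vjet vs (0, x) + vjet vf (0, x)) := by
  obtain ⟨K, hK1, hK⟩ := exists_source_bound hΩo hΩ hα hα' hΦ hne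
  refine ⟨4 * K ^ 2, by nlinarith, fun p vs vf hvs hvf hrel x hx => ?_⟩
  have s1 := vjet_nonneg vs (0, x)
  have s2 := vjet_nonneg vf (0, x)
  have hj : ∀ {v : P4 → V3}, ContDiff ℝ 1 v →
      vjet v (0, x) ≤ vjet vs (0, x) + vjet vf (0, x) →
      ∀ i, JetBound (fun y => v (0, y) i) (√(vjet vs (0, x) + vjet vf (0, x))) x :=
    fun {v} hv h i => by
      refine ⟨abs_le_sqrt ((sq_le_vjet v i (0, x)).trans h), fun k => abs_le_sqrt ?_⟩
      rw [← pd_ex_slice (f := fun z => v z i)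
        ((contDiff_pi.1 hv i).differentiable one_ne_zero _) k]
      exact (sq_pd_ex_le_vjet v i k (0, x)).trans h
  have hsl : ∀ {v : P4 → V3}, ContDiff ℝ 1 v → ContDiff ℝ 1 fun x => v (0, x) := fun hv =>
    hv.comp (contDiff_const.prodMk contDiff_id)
  have := psq_le_of_jetBound (hK p (fun x => vs (0, x)) (fun x => vf (0, x)) (hsl hvs) (hsl hvf)
    hrel x hx _ (hj hvs (by linarith)) (hj hvf (by linarith)))
  rw [mul_pow, sq_sqrt (by linarith)] at this
  linarith

theorem psq_sdivX_slice_le {v : P4 → V3} (hv : ContDiff ℝ 2 v) (x : V3) :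
    psq (sdivX fun x => v (0, x)) x ≤ jet2 (sdiv v) (0, x) := by
  have e : (sdivX fun x => v (0, x)) = fun x => sdiv v (0, x) := by
    funext x
    exact Finset.sum_congr rfl fun i _ => (pd_ex_slice (f := fun z => v z i)
      ((contDiff_pi.1 hv i).differentiable (by norm_num) _) i).symm
  have hs : ContDiff ℝ 1 (sdiv v) := contDiff_sdiv (by exact_mod_cast hv)
  rw [e]
  unfold psq jet2 gradT2
  simp only [← pd_ex_slice (f := sdiv v) (hs.differentiable one_ne_zero _)]
  linarith [sq_nonneg (pd (sdiv v) et (0, x))]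

theorem psq_le_fderiv (p : V3 → ℝ) (x : V3) : psq p x ≤ p x ^ 2 + 3 * ‖fderiv ℝ p x‖ ^ 2 := by
  have h : ∀ i, pdx p i x ^ 2 ≤ ‖fderiv ℝ p x‖ ^ 2 := fun i => by
    rw [← sq_abs]
    refine pow_le_pow_left₀ (abs_nonneg _) ?_ 2
    simpa [pdx, Pi.norm_single] using (fderiv ℝ p x).le_opNorm (Pi.single i (1 : ℝ))
  have := h 0
  have := h 1
  have := h 2
  simp only [psq, Fin.sum_univ_three]
  linarith

theorem H01sq_le {Ω : Set V3} (hΩ : Bornology.IsBounded Ω) {p : V3 → ℝ} (hp : ContDiff ℝ 2 p)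
    {M : ℝ} (h : ∫ x in Ω, (p x ^ 2 + ‖fderiv ℝ p x‖ ^ 2 + ‖iteratedFDeriv ℝ 2 p x‖ ^ 2) ≤ M ^ 2) :
    H01sq Ω p ≤ 3 * M ^ 2 := by
  have hc : Continuous fun x => p x ^ 2 + ‖fderiv ℝ p x‖ ^ 2 + ‖iteratedFDeriv ℝ 2 p x‖ ^ 2 :=
    ((hp.continuous.pow 2).add ((hp.continuous_fderiv (by norm_num)).norm.pow 2)).add
      ((hp.continuous_iteratedFDeriv le_rfl).norm.pow 2)
  have h1 : H01sq Ω p ≤ ∫ x in Ω,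
      3 * (p x ^ 2 + ‖fderiv ℝ p x‖ ^ 2 + ‖iteratedFDeriv ℝ 2 p x‖ ^ 2) := by
    refine integral_mono ((continuous_psq (hp.of_le (by norm_num))).integrableOn_of_isBounded hΩ)
      ((hc.const_mul 3).integrableOn_of_isBounded hΩ) fun x => ?_
    have := psq_le_fderiv p x
    have e : (p x ^ 2 + ∑ i, pdx p i x ^ 2) = psq p x := rfl
    simp only [e]
    linarith [sq_nonneg (p x), sq_nonneg ‖iteratedFDeriv ℝ 2 p x‖]
  rw [integral_const_mul] at h1
  linarith

theorem integrable_cutoff_mul {χ f : V3 → ℝ} (hχ : Continuous χ) (hcχ : HasCompactSupport χ)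
    (hf : Continuous f) (x0 : V3) (β τ : ℝ) :
    Integrable fun x => χ x ^ 2 * f x * wt x0 β τ (0, x) :=
  Continuous.integrable_of_hasCompactSupport
    (((hχ.pow 2).mul hf).mul (contDiff_wt_zero x0 β τ (n := 0)).continuous)
    (HasCompactSupport.intro hcχ fun x hx => by simp [image_eq_zero_of_notMem_tsupport hx])

/-- The unweighted sources are controlled by the localized weighted ones and by the sources on
the observation set. -/
theorem setIntegral_le_exp_mul_cutoff {Ω V : Set V3} {x0 : V3} {β τ d : ℝ} {χ f : V3 → ℝ}
    (hΩo : IsOpen Ω) (hΩ : Bornology.IsBounded Ω) (hV : IsOpen V) (hτ : 0 ≤ τ)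
    (hd : ∀ x ∈ Ω, d ≤ sqd x0 x) (hχ : Continuous χ) (hχΩ : tsupport χ ⊆ Ω)
    (hχ1 : ∀ x ∈ Ω, x ∉ V → χ x = 1) (hf : Continuous f) (hf0 : ∀ x, 0 ≤ f x) :
    ∫ x in Ω, f x ≤ exp (-(2 * τ * d)) * (∫ x, χ x ^ 2 * f x * wt x0 β τ (0, x))
      + ∫ x in Ω ∩ V, f x := by
  have hcχ : HasCompactSupport χ :=
    Metric.isCompact_of_isClosed_isBounded (isClosed_tsupport χ) (hΩ.subset hχΩ)
  have hi := integrable_cutoff_mul hχ hcχ hf x0 β τ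
  have hiΩ := hf.integrableOn_of_isBounded (μ := volume) hΩ
  have hn : ∀ x, 0 ≤ χ x ^ 2 * f x * wt x0 β τ (0, x) := fun x =>
    mul_nonneg (mul_nonneg (sq_nonneg _) (hf0 x)) (wt_pos _ _ _ _).le
  have h1 : ∫ x in Ω, f x = (∫ x in Ω ∩ V, f x) + ∫ x in Ω \ V, f x :=
    (integral_inter_add_sdiff hV.measurableSet hiΩ).symm
  have h2 : ∫ x in Ω \ V, f x ≤
      ∫ x in Ω \ V, exp (-(2 * τ * d)) * (χ x ^ 2 * f x * wt x0 β τ (0, x)) := by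
    refine setIntegral_mono_on (hiΩ.mono_set sdiff_subset) (hi.const_mul _).integrableOn
      (hΩo.measurableSet.diff hV.measurableSet) fun x hx => ?_
    rw [hχ1 x hx.1 hx.2, one_pow, one_mul, mul_left_comm]
    refine le_mul_of_one_le_right (hf0 x) ?_
    rw [wt, ← exp_add]
    refine one_le_exp ?_
    have := mul_le_mul_of_nonneg_left (hd x hx.1) hτ
    simp only [ne_eq, OfNat.ofNat_ne_zero, not_false_eq_true, zero_pow, mul_zero, sub_zero]
    linarith
  have h3 : ∫ x in Ω \ V, exp (-(2 * τ * d)) * (χ x ^ 2 * f x * wt x0 β τ (0, x)) ≤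
      exp (-(2 * τ * d)) * ∫ x, χ x ^ 2 * f x * wt x0 β τ (0, x) := by
    rw [integral_const_mul]
    exact mul_le_mul_of_nonneg_left
      (setIntegral_le_integral hi (Filter.Eventually.of_forall hn)) (exp_pos _).le
  linarith

theorem H2sq_nonneg (v : P4 → V3) (S : Set P4) : 0 ≤ H2sq v S :=
  integral_nonneg fun z => secSq_nonneg v z

theorem integral_lowJet_le {us uf : P4 → V3} {S : Set P4} (hS : Bornology.IsBounded S)
    (hus : ContDiff ℝ 2 us) (huf : ContDiff ℝ 2 uf) :
    ∫ z in S, lowJet us uf z ≤ 200 * (H2sq us S + H2sq uf S) := by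
  have is := (continuous_secSq hus).integrableOn_of_isBounded (μ := volume) hS
  have jf := (continuous_secSq huf).integrableOn_of_isBounded (μ := volume) hS
  rw [H2sq_eq, H2sq_eq, ← integral_add is jf, ← integral_const_mul]
  exact integral_mono ((continuous_lowJet hus huf).integrableOn_of_isBounded hS)
    ((is.add jf).const_mul 200) fun z => lowJet_le_secSq hus huf z

theorem H2sq_Dt_Dt_add_le {us uf : P4 → V3} {S : Set P4} (hS : Bornology.IsBounded S)
    (hus : ContDiff ℝ 5 us) (huf : ContDiff ℝ 5 uf) :
    H2sq (Dt (Dt us)) S + H2sq (Dt (Dt uf)) S ≤ ∫ z in S, ∑ k ∈ Finset.range 6,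
      (‖iteratedFDeriv ℝ k us z‖ ^ 2 + ‖iteratedFDeriv ℝ k uf z‖ ^ 2) := by
  have h2 : ∀ {u : P4 → V3}, ContDiff ℝ 5 u → ContDiff ℝ 2 (Dt (Dt u)) := fun {u} hu => by
    have h4 : ContDiff ℝ (3 + 1) u := hu.of_le (by norm_num)
    have h3 : ContDiff ℝ (2 + 1) (Dt u) := (contDiff_Dt h4).of_le (by norm_num)
    exact contDiff_Dt h3
  have hk : ∀ {u : P4 → V3}, ContDiff ℝ 5 u → ∀ k ∈ Finset.range 6,
      Continuous fun z => ‖iteratedFDeriv ℝ k u z‖ ^ 2 := fun hu k hk =>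
    (hu.continuous_iteratedFDeriv (by
      have := Finset.mem_range.1 hk
      exact_mod_cast (by omega : k ≤ 5))).norm.pow 2
  have is := (continuous_secSq (h2 hus)).integrableOn_of_isBounded (μ := volume) hS
  have jf := (continuous_secSq (h2 huf)).integrableOn_of_isBounded (μ := volume) hS
  rw [H2sq_eq, H2sq_eq, ← integral_add is jf]
  refine integral_mono (is.add jf) ((continuous_finsetSum _ fun k h =>
    (hk hus k h).add (hk huf k h)).integrableOn_of_isBounded hS) fun z => ?_
  rw [Finset.sum_add_distrib]
  exact add_le_add (secSq_Dt_Dt_le (hus.of_le (by norm_num)) z)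
    (secSq_Dt_Dt_le (huf.of_le (by norm_num)) z)

/-- Absorbing the low-order terms in the coupled Carleman estimates for large parameter. -/
theorem absorb_carleman {C1 C2 K Cg N a b l e0 e X τ D d δ : ℝ} (hC1 : 1 ≤ C1) (hC2 : 1 ≤ C2)
    (hK : 0 ≤ K) (hCg : 1 ≤ Cg) (hN : 0 ≤ N) (ha : 0 ≤ a) (he : 0 ≤ e)
    (hd : 0 ≤ d) (hτ : 1 + C1 * (1 + C2) ≤ τ)
    (h1 : τ ^ 2 * a ≤ C1 * (b + a + exp (2 * τ * D) * (K * e0)))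
    (h2 : b ≤ C2 * (a + exp (2 * τ * D) * (l + e0) + exp (2 * τ * (D - δ)) * N))
    (hl : l ≤ 200 * e) (he0 : e0 ≤ Cg * e)
    (hX : X ≤ exp (-(2 * τ * d)) * a + K * e0) (hD : 0 ≤ D) :
    X ≤ (C1 * C2 * (200 + Cg) + C1 * (K * Cg) + K * Cg + C1 * C2 * N) *
      (e * exp ((2 * D + 1) * τ) + exp (-(2 * (δ + d - D) * τ))) := by
  have hC12 : 0 < C1 * C2 := by positivity
  have hτ1 : 1 ≤ τ := by nlinarith
  obtain ⟨E, hE⟩ : ∃ E, E = exp (2 * τ * D) := ⟨_, rfl⟩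
  obtain ⟨G, hG⟩ : ∃ G, G = exp (2 * τ * (D - δ)) := ⟨_, rfl⟩
  obtain ⟨w, hw⟩ : ∃ w, w = exp (-(2 * τ * d)) := ⟨_, rfl⟩
  rw [← hE] at h1 h2
  rw [← hG] at h2
  rw [← hw] at hX
  have hEp : 0 < E := hE ▸ exp_pos _
  have hwp : 0 < w := hw ▸ exp_pos _
  have hw1 : w ≤ 1 := by
    rw [hw, exp_le_one_iff]
    have : 0 ≤ τ * d := by positivity
    linarith
  have hE1 : 1 ≤ E := by rw [hE]; exact one_le_exp (by positivity)
  have hEF : E ≤ exp ((2 * D + 1) * τ) := by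
    rw [hE, exp_le_exp]; nlinarith
  have hwG : w * G = exp (-(2 * (δ + d - D) * τ)) := by
    rw [hw, hG, ← exp_add]; congr 1; ring
  rw [← hwG]
  have hle : l + e0 ≤ (200 + Cg) * e := by linarith
  have hKe : K * e0 ≤ K * (Cg * e) := mul_le_mul_of_nonneg_left he0 hK
  have h2' : b ≤ C2 * (a + E * ((200 + Cg) * e) + G * N) := h2.trans
    (mul_le_mul_of_nonneg_left (by have := mul_le_mul_of_nonneg_left hle hEp.le; linarith)
      (by linarith))
  have h1' : τ ^ 2 * a ≤ C1 * (b + a + E * (K * (Cg * e))) := h1.trans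
    (mul_le_mul_of_nonneg_left (by have := mul_le_mul_of_nonneg_left hKe hEp.le; linarith)
      (by linarith))
  have h3 : C1 * b ≤ C1 * (C2 * (a + E * ((200 + Cg) * e) + G * N)) :=
    mul_le_mul_of_nonneg_left h2' (by linarith)
  have h4 : (1 + C1 * (1 + C2)) * a ≤ τ ^ 2 * a :=
    mul_le_mul_of_nonneg_right (hτ.trans (by nlinarith)) ha
  have h5 : a ≤ (C1 * C2 * (200 + Cg) + C1 * (K * Cg)) * (E * e) + C1 * C2 * N * G := by
    linarith
  have h6 := mul_le_mul_of_nonneg_left h5 hwp.le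
  have hA : 0 ≤ C1 * C2 * (200 + Cg) + C1 * (K * Cg) := by positivity
  have hEe : 0 ≤ E * e := by positivity
  have h7 : w * ((C1 * C2 * (200 + Cg) + C1 * (K * Cg)) * (E * e)) ≤
      (C1 * C2 * (200 + Cg) + C1 * (K * Cg)) * (E * e) :=
    mul_le_of_le_one_left (by positivity) hw1
  have h8 : K * (Cg * e) ≤ K * Cg * (E * e) := by
    rw [← mul_assoc]
    exact mul_le_mul_of_nonneg_left (le_mul_of_one_le_left he hE1) (by positivity)
  have h9 : E * e ≤ e * exp ((2 * D + 1) * τ) := by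
    rw [mul_comm]; exact mul_le_mul_of_nonneg_left hEF he
  have hwGp : 0 ≤ w * G := by rw [hwG]; exact (exp_pos _).le
  have h10 : (C1 * C2 * (200 + Cg) + C1 * (K * Cg) + K * Cg) * (E * e) ≤
      (C1 * C2 * (200 + Cg) + C1 * (K * Cg) + K * Cg + C1 * C2 * N) *
        (e * exp ((2 * D + 1) * τ)) :=
    mul_le_mul (by have : 0 ≤ C1 * C2 * N := by positivity
                   linarith) h9 hEe (by positivity)
  have h11 : C1 * C2 * N * (w * G) ≤
      (C1 * C2 * (200 + Cg) + C1 * (K * Cg) + K * Cg + C1 * C2 * N) * (w * G) :=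
    mul_le_mul_of_nonneg_right (by have : 0 ≤ K * Cg := by positivity
                                   linarith) hwGp
  linarith

/-- Hölder stability for the inverse source problem for Biot's system:
under Assumptions A.1–A.3 and the non-degeneracy condition on Φⱼ = Rⱼ(·,0), there are
C > 0 and κ ∈ (0,1) with ‖p₁‖²_{H₀¹} + ‖p₂‖²_{H₀¹} ≤ C·E_ω(u)^κ for all sources
p_ℓ ∈ H²(Ω) bounded by M and vanishing with their gradients on ∂Ω. -/
theorem biot_inverse_holder_stability (Ω ω : Set V3) (x0 : V3) (ν : V3 → V3)
    (ρ11 ρ12 ρ22 μ lam q r μ2 μ3 : V3 → ℝ) (R1 R2 : P4 → V3)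
    (m θ c1 c2 c3 c0 d D β γ T M0 CR M : ℝ)
    (hΩopen : IsOpen Ω) (hΩbd : Bornology.IsBounded Ω) (hΩne : Ω.Nonempty)
    (hx0 : x0 ∉ closure Ω) (hm : 0 < m) (hθ : θ ∈ Set.Ioo (0 : ℝ) 1)
    (hγ : 0 < γ)
    (hω : ∃ V : Set V3, IsOpen V ∧ frontier Ω ⊆ V ∧ ω = Ω ∩ V)
    (hA1 : AssumpA1 Ω ρ11 ρ12 ρ22 μ lam q r)
    (hA2 : AssumpA2 Ω x0 ρ11 ρ12 ρ22 μ lam q r μ2 μ3 m θ c1 c2 c3)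
    (hgeom : dGeom Ω x0 d D) (hc0 : 0 < c0)
    (hc0min : c0 ≤ c1 ∧ c0 ≤ c2 ∧ c0 ≤ c3)
    (hβ : BetaCond m θ c0 d D β)
    (hT : Real.sqrt (D ^ 2 - d ^ 2) / Real.sqrt β < T)
    (hν : ∀ x ∈ frontier Ω, n2 (ν x) = 1)
    (hRreg : ContDiff ℝ 4 (fun z : P4 => R1 z) ∧ ContDiff ℝ 4 (fun z : P4 => R2 z))
    (hCR : 0 < CR)
    (hRbd : ∀ z ∈ Set.Ioo (-T) T ×ˢ Ω,
      n2 (Dt (Dt R1) z) + vGradX2 (Dt (Dt R1)) z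
        + n2 (Dt (Dt (Dt R1)) z) + vGradX2 (Dt (Dt (Dt R1))) z
        + n2 (Dt (Dt R2) z) + vGradX2 (Dt (Dt R2)) z
        + n2 (Dt (Dt (Dt R2)) z) + vGradX2 (Dt (Dt (Dt R2))) z ≤ CR)
    (hΦ1 : ∀ x ∈ closure Ω, (∑ i, R1 ((0 : ℝ), x) i * (x i - x0 i)) ≠ 0)
    (hΦ2 : ∀ x ∈ closure Ω, (∑ i, R2 ((0 : ℝ), x) i * (x i - x0 i)) ≠ 0)
    (hM0 : 0 < M0)
    (hM : 0 < M) :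
    ∃ C : ℝ, 0 < C ∧ ∃ κ : ℝ, 0 < κ ∧ κ < 1 ∧
      ∀ p1 p2 : V3 → ℝ, ∀ us uf : P4 → V3,
        ContDiff ℝ 2 p1 → ContDiff ℝ 2 p2 →
        (∫ x in Ω, ((p1 x) ^ 2 + ‖fderiv ℝ p1 x‖ ^ 2 + ‖iteratedFDeriv ℝ 2 p1 x‖ ^ 2)
          ≤ M ^ 2) →
        (∫ x in Ω, ((p2 x) ^ 2 + ‖fderiv ℝ p2 x‖ ^ 2 + ‖iteratedFDeriv ℝ 2 p2 x‖ ^ 2)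
          ≤ M ^ 2) →
        (∀ x ∈ frontier Ω, p1 x = 0 ∧ ∀ i, pdx p1 i x = 0) →
        (∀ x ∈ frontier Ω, p2 x = 0 ∧ ∀ i, pdx p2 i x = 0) →
        ContDiff ℝ 5 (fun z : P4 => us z) → ContDiff ℝ 5 (fun z : P4 => uf z) →
        (∫ z in Set.Ioo (-T) T ×ˢ Ω, ∑ k ∈ Finset.range 6,
            (‖iteratedFDeriv ℝ k us z‖ ^ 2 + ‖iteratedFDeriv ℝ k uf z‖ ^ 2) ≤ M0 ^ 2) →
        BiotSystem ρ11 ρ12 ρ22 μ lam q r us uf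
          (fun z i => p1 z.2 * R1 z i) (fun z i => p2 z.2 * R2 z i)
          (Set.Ioo (-T) T ×ˢ Ω) →
        (∀ t ∈ Set.Icc (-T) T, ∀ x ∈ frontier Ω,
          us (t, x) = 0 ∧ (∑ i, uf (t, x) i * ν x i) = 0) →
        (∀ x ∈ Ω, us ((0 : ℝ), x) = 0 ∧ uf ((0 : ℝ), x) = 0 ∧
          Dt us ((0 : ℝ), x) = 0 ∧ Dt uf ((0 : ℝ), x) = 0) →
        H01sq Ω p1 + H01sq Ω p2 ≤
          C * (Eobs us uf (Set.Ioo (-T) T ×ˢ ω)) ^ κ := by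
  obtain ⟨V, hV, hfV, rfl⟩ := hω
  have hdD : d ^ 2 ≤ D ^ 2 := hgeom.2.2.1.2 hgeom.2.2.2.1
  obtain ⟨T1, T2, hT1, hT12, hT2, ht1, ht2, ht3⟩ := exists_times hβ hdD hT
  have hTp : 0 < T := by linarith
  have hc21 : ∀ {f : V3 → ℝ}, ContDiff ℝ 2 f → ContDiff ℝ 1 f := fun h => h.of_le (by norm_num)
  have hQo : IsOpen (Ioo (-T) T ×ˢ Ω) := isOpen_Ioo.prod hΩopen
  have hQb : Bornology.IsBounded (Ioo (-T) T ×ˢ Ω) := (Metric.isBounded_Ioo _ _).prod hΩbd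
  have hΩVb : Bornology.IsBounded (Ω ∩ V) := hΩbd.subset inter_subset_left
  have hQVb : Bornology.IsBounded (Ioo (-T) T ×ˢ (Ω ∩ V)) :=
    (Metric.isBounded_Ioo _ _).prod hΩVb
  have hΩVo : IsOpen (Ω ∩ V) := hΩopen.inter hV
  obtain ⟨χ, hχ, hχΩ, hχ1⟩ := exists_contDiff_cutoff (t := closure Ω \ V)
    (isClosed_closure.sdiff hV) hΩopen (fun x hx => by
      by_contra h
      exact hx.2 (hfV ⟨hx.1, by rwa [hΩopen.interior_eq]⟩)) 2
  have hχ2 : ContDiff ℝ 2 χ := by exact_mod_cast hχ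
  have hχ1' : ∀ x ∈ Ω, x ∉ V → ∀ᶠ y in nhds x, χ y = 1 := fun x hx hxV =>
    hχ1.filter_mono (nhds_le_nhdsSet (show x ∈ closure Ω \ V from ⟨subset_closure hx, hxV⟩))
  have hcχ : HasCompactSupport χ :=
    Metric.isCompact_of_isClosed_isBounded (isClosed_tsupport χ) (hΩbd.subset hχΩ)
  obtain ⟨hR1, hR2⟩ := hRreg
  have hRt : ∀ {R : P4 → V3}, ContDiff ℝ 4 R →
      ContDiff ℝ 1 R ∧ ContDiff ℝ 1 (Dt R) ∧ ContDiff ℝ 1 (Dt (Dt R)) := fun {R} hR => by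
    have a : ContDiff ℝ (2 + 1) R := hR.of_le (by norm_num)
    have b : ContDiff ℝ (1 + 1) (Dt R) := (contDiff_Dt a).of_le (by norm_num)
    exact ⟨hR.of_le (by norm_num), b.of_le (by norm_num), contDiff_Dt b⟩
  have hslice : ∀ {n : WithTop ℕ∞} {v : P4 → V3}, ContDiff ℝ n v →
      ContDiff ℝ n fun x => v ((0 : ℝ), x) := fun hv =>
    hv.comp (contDiff_const.prodMk contDiff_id)
  obtain ⟨L, hL, hLsrc⟩ := exists_srcSq_le (hRt hR1).2.2 (hRt hR2).2.2
    (isCompact_Icc.prod hcχ : IsCompact (Icc (-T2) T2 ×ˢ tsupport χ))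
  obtain ⟨C2, hC2, hcar⟩ := exists_biot_carleman hΩopen hΩbd hV hm hθ.2 hA1 hA2 hgeom hc0 hc0min
    hβ.1 hT1 hT12 hT2 ht1 ht2 hχ2 hχΩ hχ1' hL
  obtain ⟨h11, h12, h22, hμ, hlam, hq, hr, -, hdet, -⟩ := hA1
  have hΦC1 : ContDiff ℝ 2 fun x => R1 ((0 : ℝ), x) := hslice (hR1.of_le (by norm_num))
  have hΦC2 : ContDiff ℝ 2 fun x => R2 ((0 : ℝ), x) := hslice (hR2.of_le (by norm_num))
  obtain ⟨C1, hC1, hsrc⟩ := exists_sources_carleman (β := β) hΩopen hΩbd hV h11 h12 h22 hdet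
    hΦC1 hΦ1 hΦC2 hΦ2 (hc21 hχ2) hχΩ hχ1'
  obtain ⟨K1, hK1, hp1le⟩ := exists_psq_le_vjet hΩopen hΩbd (hc21 h11) (hc21 h12)
    (hΦC1.of_le (by norm_num)) hΦ1
  obtain ⟨K2, hK2, hp2le⟩ := exists_psq_le_vjet hΩopen hΩbd (hc21 h12) (hc21 h22)
    (hΦC2.of_le (by norm_num)) hΦ2
  obtain ⟨Cg, hCg, htr⟩ := exists_initial_vjet_le hTp hΩVo hΩVb
  obtain ⟨K, hK, κ, hκ0, hκ1, hfin⟩ := exists_rpow_bound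
    (C := C1 * (2 * C2) * (200 + Cg) + C1 * ((K1 + K2) * Cg) + (K1 + K2) * Cg
      + C1 * (2 * C2) * (200 * M0 ^ 2)) (C' := 6 * M ^ 2) (B := 2 * D ^ 2 + 1)
    (b := 2 * (β * T1 ^ 2 + d ^ 2 - D ^ 2)) (τ1 := C1 + C2 + (1 + C1 * (1 + 2 * C2)))
    (by positivity) (by positivity) (by positivity) (by linarith)
  refine ⟨K, hK, κ, hκ0, hκ1, fun p1 p2 us uf hp1 hp2 hb1 hb2 _ _ hus huf hM0b hB _ hinit => ?_⟩
  have hP : Continuous fun x => psq p1 x + psq p2 x :=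
    (continuous_psq (hc21 hp1)).add (continuous_psq (hc21 hp2))
  have hP0 : ∀ x, 0 ≤ psq p1 x + psq p2 x := fun x =>
    add_nonneg (psq_nonneg _ _) (psq_nonneg _ _)
  have hX : H01sq Ω p1 + H01sq Ω p2 = ∫ x in Ω, (psq p1 x + psq p2 x) :=
    (integral_add ((continuous_psq (hc21 hp1)).integrableOn_of_isBounded hΩbd)
      ((continuous_psq (hc21 hp2)).integrableOn_of_isBounded hΩbd)).symm
  have hD3 : ∀ {u : P4 → V3}, ContDiff ℝ 5 u → ContDiff ℝ 3 (Dt (Dt u)) := fun {u} hu => by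
    have h4 : ContDiff ℝ (4 + 1) u := hu.of_le (by norm_num)
    have h3 : ContDiff ℝ (3 + 1) (Dt u) := (contDiff_Dt h4).of_le (by norm_num)
    exact contDiff_Dt h3
  have hDt3 : ∀ {u : P4 → V3}, ContDiff ℝ 5 u → ContDiff ℝ 3 (Dt u) := fun {u} hu => by
    have h4 : ContDiff ℝ (3 + 1) u := hu.of_le (by norm_num)
    exact contDiff_Dt h4
  have hBt : BiotSystem ρ11 ρ12 ρ22 μ lam q r (Dt (Dt us)) (Dt (Dt uf))
      (fun z i => p1 z.2 * Dt (Dt R1) z i) (fun z i => p2 z.2 * Dt (Dt R2) z i)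
      (Ioo (-T) T ×ˢ Ω) := by
    have h := (hB.dt hQo h11 h12 h22 hμ hlam hq hr (hus.of_le (by norm_num))
      (huf.of_le (by norm_num))).dt hQo h11 h12 h22 hμ hlam hq hr (hDt3 hus) (hDt3 huf)
    rwa [Dt_coef_mul (hc21 hp1) (hRt hR1).1, Dt_coef_mul (hc21 hp2) (hRt hR2).1,
      Dt_coef_mul (hc21 hp1) (hRt hR1).2.1, Dt_coef_mul (hc21 hp2) (hRt hR2).2.1] at h
  have hrel : ∀ x ∈ Ω, ∀ i,
      ρ11 x * Dt (Dt us) (0, x) i + ρ12 x * Dt (Dt uf) (0, x) i = p1 x * R1 (0, x) i ∧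
      ρ12 x * Dt (Dt us) (0, x) i + ρ22 x * Dt (Dt uf) (0, x) i = p2 x * R2 (0, x) i :=
    fun x hx i => hB.initial_relations hΩopen hTp hq hr (hus.of_le (by norm_num))
      (huf.of_le (by norm_num)) (fun x hx => (hinit x hx).1) (fun x hx => (hinit x hx).2.1) hx i
  have hvs := hD3 hus
  have hvf := hD3 huf
  obtain ⟨vs, hvseq⟩ : ∃ vs, vs = Dt (Dt us) := ⟨_, rfl⟩
  obtain ⟨vf, hvfeq⟩ : ∃ vf, vf = Dt (Dt uf) := ⟨_, rfl⟩
  have hN := H2sq_Dt_Dt_add_le hQb hus huf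
  have hE : Eobs us uf (Ioo (-T) T ×ˢ (Ω ∩ V)) =
    H2sq vs (Ioo (-T) T ×ˢ (Ω ∩ V)) + H2sq vf (Ioo (-T) T ×ˢ (Ω ∩ V))
      + H2sq (Dt vs) (Ioo (-T) T ×ˢ (Ω ∩ V)) + H2sq (Dt vf) (Ioo (-T) T ×ˢ (Ω ∩ V)) := by
    rw [hvseq, hvfeq]; rfl
  rw [← hvseq] at hvs hN hBt hrel
  rw [← hvfeq] at hvf hN hBt
  simp only [← hvfeq] at hrel
  have e1 := H2sq_nonneg vs (Ioo (-T) T ×ˢ (Ω ∩ V))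
  have e2 := H2sq_nonneg vf (Ioo (-T) T ×ˢ (Ω ∩ V))
  have e3 := H2sq_nonneg (Dt vs) (Ioo (-T) T ×ˢ (Ω ∩ V))
  have e4 := H2sq_nonneg (Dt vf) (Ioo (-T) T ×ˢ (Ω ∩ V))
  have hvs2 : ContDiff ℝ 2 vs := hvs.of_le (by norm_num)
  have hvf2 : ContDiff ℝ 2 vf := hvf.of_le (by norm_num)
  have hvs1 : ContDiff ℝ 1 vs := hvs.of_le (by norm_num)
  have hvf1 : ContDiff ℝ 1 vf := hvf.of_le (by norm_num)
  have hl := integral_lowJet_le hQVb hvs2 hvf2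
  have hNl := integral_lowJet_le hQb hvs2 hvf2
  have hJc : ∀ {v : P4 → V3}, ContDiff ℝ 1 v → Continuous fun x : V3 => vjet v (0, x) := fun hv =>
    (continuous_vjet hv).comp (continuous_const.prodMk continuous_id)
  have hJi := ((hJc hvs1).add (hJc hvf1)).integrableOn_of_isBounded (μ := volume) hΩVb
  have he0 : ∫ x in Ω ∩ V, (vjet vs (0, x) + vjet vf (0, x)) ≤
      Cg * Eobs us uf (Ioo (-T) T ×ˢ (Ω ∩ V)) := by
    rw [integral_add ((hJc hvs1).integrableOn_of_isBounded hΩVb)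
      ((hJc hvf1).integrableOn_of_isBounded hΩVb), hE]
    have := htr vs hvs
    have := htr vf hvf
    linarith
  have hPJ : ∀ x ∈ Ω, psq p1 x + psq p2 x ≤ (K1 + K2) * (vjet vs (0, x) + vjet vf (0, x)) :=
    fun x hx => by
      have := hp1le p1 vs vf hvs1 hvf1 (fun x hx i => (hrel x hx i).1) x hx
      have := hp2le p2 vs vf hvs1 hvf1 (fun x hx i => (hrel x hx i).2) x hx
      linarith
  refine hfin _ _ (by rw [hE]; positivity) ?_ fun τ hτ => ?_
  · have := H01sq_le hΩbd hp1 hb1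
    have := H01sq_le hΩbd hp2 hb2
    linarith
  have hCC : 0 ≤ C1 * (1 + 2 * C2) := by positivity
  have hτ0 : 0 ≤ τ := by linarith
  have hw : ∀ x ∈ Ω, wt x0 β τ (0, x) ≤ exp (2 * τ * D ^ 2) := fun x hx => by
    have := wt_le_exp (x0 := x0) (β := β) hτ0 (z := ((0 : ℝ), x))
      (hgeom.2.2.2.2 ⟨x, subset_closure hx, rfl⟩) (a := 0) (by simp)
    simpa using this
  have s1 := hsrc τ (by linarith) p1 p2 (fun x => vs (0, x)) (fun x => vf (0, x)) hp1 hp2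
    (hslice hvs2) (hslice hvf2) hrel
  have s2 := hcar τ (by linarith) vs vf _ _ hvs hvf
    (contDiff_pi.2 fun i => ((hc21 hp1).comp contDiff_snd).mul (contDiff_pi.1 (hRt hR1).2.2 i))
    (contDiff_pi.2 fun i => ((hc21 hp2).comp contDiff_snd).mul (contDiff_pi.1 (hRt hR2).2.2 i))
    hBt (fun x => psq p1 x + psq p2 x) hP hP0 (hLsrc p1 p2 (hc21 hp1) (hc21 hp2))
  have s3 := setIntegral_le_exp_mul_cutoff (x0 := x0) (β := β) hΩopen hΩbd hV hτ0
    (fun x hx => hgeom.2.2.1.2 ⟨x, subset_closure hx, rfl⟩) hχ2.continuous hχΩ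
    (fun x hx hxV => (hχ1' x hx hxV).self_of_nhds) hP hP0
  have hiP := integrable_cutoff_mul hχ2.continuous hcχ hP x0 β τ
  have hiJ : Integrable fun x => χ x ^ 2 * lowJet vs vf (0, x) * wt x0 β τ (0, x) :=
    integrable_cutoff_mul hχ2.continuous hcχ
      ((continuous_lowJet hvs2 hvf2).comp (Continuous.prodMk_right (0 : ℝ))) x0 β τ
  have s4 : ∫ x, χ x ^ 2 * (psq (sdivX fun x => vs (0, x)) x + psq (sdivX fun x => vf (0, x)) x
        + psq p1 x + psq p2 x) * wt x0 β τ (0, x) ≤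
      2 * (∫ x, χ x ^ 2 * lowJet vs vf (0, x) * wt x0 β τ (0, x))
        + ∫ x, χ x ^ 2 * (psq p1 x + psq p2 x) * wt x0 β τ (0, x) := by
    rw [← integral_const_mul, ← integral_add (hiJ.const_mul 2) hiP]
    have hn : ∀ x, 0 ≤ χ x ^ 2 * wt x0 β τ (0, x) := fun x =>
      mul_nonneg (sq_nonneg _) (wt_pos _ _ _ _).le
    refine integral_mono_of_nonneg (Filter.Eventually.of_forall fun x => ?_)
      ((hiJ.const_mul 2).add hiP) (Filter.Eventually.of_forall fun x => ?_)
    · have := psq_nonneg (sdivX fun x => vs (0, x)) x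
      have := psq_nonneg (sdivX fun x => vf (0, x)) x
      have := hP0 x
      exact mul_nonneg (mul_nonneg (sq_nonneg _) (by linarith)) (wt_pos _ _ _ _).le
    · have k1 := psq_sdivX_slice_le hvs2 x
      have k2 := psq_sdivX_slice_le hvf2 x
      have k3 := lowJet_terms_le vs vf (0, x)
      have := mul_le_mul_of_nonneg_left (a := χ x ^ 2 * wt x0 β τ (0, x))
        (show psq (sdivX fun x => vs (0, x)) x + psq (sdivX fun x => vf (0, x)) x ≤
          2 * lowJet vs vf (0, x) by linarith [k3.2.2.1, k3.2.2.2]) (hn x)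
      linarith
  have s5 : ∫ x in Ω ∩ V, (psq p1 x + psq p2 x) * wt x0 β τ (0, x) ≤
      exp (2 * τ * D ^ 2) *
        ((K1 + K2) * ∫ x in Ω ∩ V, (vjet vs (0, x) + vjet vf (0, x))) := by
    rw [← integral_const_mul, ← integral_const_mul]
    refine setIntegral_mono_on ((hP.mul (contDiff_wt_zero x0 β τ
      (n := 0)).continuous).integrableOn_of_isBounded hΩVb) ((hJi.const_mul _).const_mul _)
      hΩVo.measurableSet fun x hx => ?_
    rw [mul_comm]
    exact mul_le_mul (hw x hx.1) (hPJ x hx.1) (hP0 x) (exp_pos _).le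
  have s6 : ∫ x in Ω ∩ V, (psq p1 x + psq p2 x) ≤
      (K1 + K2) * ∫ x in Ω ∩ V, (vjet vs (0, x) + vjet vf (0, x)) := by
    rw [← integral_const_mul]
    exact setIntegral_mono_on (hP.integrableOn_of_isBounded hΩVb) (hJi.const_mul _)
      hΩVo.measurableSet fun x hx => hPJ x hx.1
  have hs : C1 * ((∫ x, χ x ^ 2 * (psq (sdivX fun x => vs (0, x)) x
      + psq (sdivX fun x => vf (0, x)) x + psq p1 x + psq p2 x) * wt x0 β τ (0, x))
        + ∫ x in Ω ∩ V, (psq p1 x + psq p2 x) * wt x0 β τ (0, x)) ≤ _ :=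
    mul_le_mul_of_nonneg_left (add_le_add s4 s5) (by linarith)
  rw [hX]
  exact absorb_carleman (C2 := 2 * C2) (N := 200 * M0 ^ 2) (D := D ^ 2) (d := d ^ 2)
    (δ := β * T1 ^ 2) (K := K1 + K2)
    (b := 2 * ∫ x, χ x ^ 2 * lowJet vs vf (0, x) * wt x0 β τ (0, x)) hC1 (by linarith)
    (by positivity) hCg (by positivity)
    (integral_nonneg fun x => mul_nonneg (mul_nonneg (sq_nonneg _) (hP0 x)) (wt_pos _ _ _ _).le)
    (by rw [hE]; positivity) (sq_nonneg d) (by linarith) (s1.trans hs)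
    (show _ ≤ _ by
      rw [mul_assoc]
      refine mul_le_mul_of_nonneg_left (s2.trans (mul_le_mul_of_nonneg_left (add_le_add_right
        (mul_le_mul_of_nonneg_left ?_ (exp_pos _).le) _) (by linarith))) two_pos.le
      linarith)
    (show _ ≤ 200 * Eobs us uf (Ioo (-T) T ×ˢ (Ω ∩ V)) by rw [hE]; linarith) he0
    (s3.trans (add_le_add_right s6 _)) (sq_nonneg D)

end
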